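/- One has, unconditionally, Σ_{0<γ≤T} |ζ(1/2+iγ)|² = (T/2π) log²T + O(T log T) + ∫₁^T |ζ(1/2+it)|² dS(t), and consequently for every ε > 0, Σ_{0<γ≤T} |ζ(1/2+iγ)|² ≪_ε T log²T (log log T)^{3/2+ε}, where γ runs over the positive ordinates of nontrivial zeros of ζ(s). -/

import Mathlib

open Complex Real MeasureTheory Set Filter

noncomputable section

/-- The multiplicity of `ρ` as a zero of the Riemann zeta function
(the order of vanishing, i.e. the least `n` with `ζ⁽ⁿ⁾(ρ) ≠ 0`). -/
def zetaMult (ρ : ℂ) : ℕ := sInf {n : ℕ | iteratedDeriv n riemannZeta ρ ≠ 0}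

/-- `ρ` is a nontrivial zero of the Riemann zeta function. -/
def IsNontrivialZero (ρ : ℂ) : Prop := riemannZeta ρ = 0 ∧ 0 < ρ.re ∧ ρ.re < 1

/-- `S` is the function `S(T) = (1/π) arg ζ(1/2 + iT)`, where the argument is obtained by
continuous variation along the straight segments joining `2`, `2 + iT`, `1/2 + iT`, starting
with the value `0` at `2`; if `T` is an ordinate of a zero then `S(T) = S(T+0)`
(right-continuity). -/
def IsS (S : ℝ → ℝ) : Prop :=
  (∀ T : ℝ, 0 < T →
    (∀ σ : ℝ, 1/2 ≤ σ → σ ≤ 2 → riemannZeta (σ + T * I) ≠ 0) →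
    ∃ θ : ℝ → ℂ, ContinuousOn θ (Icc 0 2) ∧
      θ 0 = Complex.log (riemannZeta 2) ∧
      (∀ u ∈ Icc (0:ℝ) 1, Complex.exp (θ u) = riemannZeta (2 + u * T * I)) ∧
      (∀ u ∈ Icc (1:ℝ) 2, Complex.exp (θ u) = riemannZeta (2 - 3/2 * (u - 1) + T * I)) ∧
      S T = (θ 2).im / π) ∧
  (∀ T : ℝ, 0 < T → Tendsto S (nhdsWithin T (Ioi T)) (nhds (S T)))

/-- The factor `χ(s) = 2^s π^(s-1) sin(πs/2) Γ(1-s)` from the functional equation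
`ζ(s) = χ(s) ζ(1-s)`. -/
def chi (s : ℂ) : ℂ :=
  2 ^ s * (π : ℂ) ^ (s - 1) * Complex.sin (π * s / 2) * Complex.Gamma (1 - s)

open scoped ComplexConjugate

/-- The Phragmén–Lindelöf principle in a narrow vertical strip for functions of exponential type. -/
lemma norm_le_of_strip_of_exp_growth {f : ℂ → ℂ} {a b A C : ℝ} (hab : a < b) (hab' : b - a < π)
    (hd : ∀ z : ℂ, a ≤ z.re → z.re ≤ b → DifferentiableAt ℂ f z)
    (hA : ∀ z : ℂ, a ≤ z.re → z.re ≤ b → ‖f z‖ ≤ A * Real.exp (A * |z.im|))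
    (ha : ∀ z : ℂ, z.re = a → ‖f z‖ ≤ C) (hb : ∀ z : ℂ, z.re = b → ‖f z‖ ≤ C)
    {z : ℂ} (hza : a ≤ z.re) (hzb : z.re ≤ b) : ‖f z‖ ≤ C := by
  have hA0 : 0 ≤ A := by
    have h := (norm_nonneg _).trans (hA z hza hzb)
    by_contra h'
    push Not at h'
    nlinarith [Real.exp_pos (A * |z.im|)]
  refine PhragmenLindelof.vertical_strip (a := a) (b := b) ?_ ?_ ha hb hza hzb
  · refine DifferentiableOn.diffContOnCl fun z hz => ?_
    have hcl : closure (re ⁻¹' Ioo a b) ⊆ re ⁻¹' Icc a b :=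
      closure_minimal (preimage_mono Ioo_subset_Icc_self)
        (isClosed_Icc.preimage Complex.continuous_re)
    have := hcl hz
    exact (hd z this.1 this.2).differentiableWithinAt
  · refine ⟨1, ?_, A, ?_⟩
    · rw [lt_div_iff₀ (by linarith)]; linarith
    · refine Asymptotics.IsBigO.of_bound A ?_
      have : ∀ᶠ z in 𝓟 (re ⁻¹' Ioo a b), ‖f z‖ ≤ A * ‖Real.exp (A * Real.exp (1 * |z.im|))‖ := by
        rw [eventually_principal]
        intro z hz
        refine (hA z hz.1.le hz.2.le).trans ?_
        rw [Real.norm_of_nonneg (Real.exp_pos _).le, one_mul]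
        gcongr
        linarith [Real.add_one_le_exp |z.im|]
      exact this.filter_mono inf_le_right

lemma norm_Gamma_le_Gamma_re {s : ℂ} (hs : 0 < s.re) : ‖Complex.Gamma s‖ ≤ Real.Gamma s.re := by
  rw [Complex.Gamma_eq_integral hs, Real.Gamma_eq_integral hs, Complex.GammaIntegral]
  refine (norm_integral_le_integral_norm _).trans (le_of_eq ?_)
  refine setIntegral_congr_fun measurableSet_Ioi fun x hx => ?_
  rw [mem_Ioi] at hx
  simp only [norm_mul, Complex.norm_real, Real.norm_of_nonneg (Real.exp_pos _).le]
  rw [Complex.norm_cpow_eq_rpow_re_of_pos hx]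
  simp

lemma norm_sin_le_exp_abs_im (z : ℂ) : ‖Complex.sin z‖ ≤ Real.exp |z.im| := by
  rw [Complex.sin]
  have h1 : ‖Complex.exp (-z * I)‖ ≤ Real.exp |z.im| := by
    rw [Complex.norm_exp]; apply Real.exp_le_exp.2; simpa using le_abs_self z.im
  have h2 : ‖Complex.exp (z * I)‖ ≤ Real.exp |z.im| := by
    rw [Complex.norm_exp]; apply Real.exp_le_exp.2; simpa using neg_le_abs z.im
  rw [norm_div, norm_mul, Complex.norm_I, mul_one]
  have := norm_sub_le (Complex.exp (-z * I)) (Complex.exp (z * I))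
  have h3 : ‖(2:ℂ)‖ = 2 := by simp
  rw [h3]; linarith

/-- The entire-in-`re < 2` version `(1 - s) χ(s)` of the factor of the functional equation. -/
def chiReg (s : ℂ) : ℂ :=
  2 ^ s * (π : ℂ) ^ (s - 1) * Complex.sin (π * s / 2) * Complex.Gamma (2 - s)

lemma pi_ne_zero_complex : (π : ℂ) ≠ 0 := by exact_mod_cast Real.pi_ne_zero

lemma chiReg_eq {s : ℂ} (hs : s ≠ 1) : chiReg s = (1 - s) * chi s := by
  have h : Complex.Gamma (2 - s) = (1 - s) * Complex.Gamma (1 - s) := by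
    rw [← Complex.Gamma_add_one _ (sub_ne_zero.2 hs.symm)]; congr 1; ring
  rw [chiReg, chi, h]; ring

lemma differentiableAt_chiReg {s : ℂ} (hs : s.re < 2) : DifferentiableAt ℂ chiReg s := by
  have hG : DifferentiableAt ℂ (fun s : ℂ => Complex.Gamma (2 - s)) s := by
    refine DifferentiableAt.comp s (Complex.differentiableAt_Gamma _ fun m h => ?_) (by fun_prop)
    have := congrArg Complex.re h
    simp at this
    have h0 : (0:ℝ) ≤ m := m.cast_nonneg
    linarith
  unfold chiReg
  refine DifferentiableAt.mul (DifferentiableAt.mul (DifferentiableAt.mul ?_ ?_) ?_) hG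
  · exact (differentiableAt_id).const_cpow (Or.inl two_ne_zero)
  · exact (differentiableAt_id.sub_const 1).const_cpow (Or.inl pi_ne_zero_complex)
  · fun_prop

lemma differentiableAt_chi {s : ℂ} (hs : s.re < 1) : DifferentiableAt ℂ chi s := by
  have hG : DifferentiableAt ℂ (fun s : ℂ => Complex.Gamma (1 - s)) s := by
    refine DifferentiableAt.comp s (Complex.differentiableAt_Gamma _ fun m h => ?_) (by fun_prop)
    have := congrArg Complex.re h
    simp at this
    have h0 : (0:ℝ) ≤ m := m.cast_nonneg
    linarith
  unfold chi
  refine DifferentiableAt.mul (DifferentiableAt.mul (DifferentiableAt.mul ?_ ?_) ?_) hG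
  · exact (differentiableAt_id).const_cpow (Or.inl two_ne_zero)
  · exact (differentiableAt_id.sub_const 1).const_cpow (Or.inl pi_ne_zero_complex)
  · fun_prop

lemma chi_mul_chi_one_sub {s : ℂ} (hs : Complex.sin (π * s) ≠ 0) : chi s * chi (1 - s) = 1 := by
  have h1 : Complex.sin (π * (1 - s) / 2) = Complex.cos (π * s / 2) := by
    rw [← Complex.sin_pi_div_two_sub]; congr 1; ring
  have h2 : Complex.sin (π * s) = 2 * Complex.sin (π * s / 2) * Complex.cos (π * s / 2) := by
    rw [← Complex.sin_two_mul]; congr 1; ring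
  have h3 := Complex.Gamma_mul_Gamma_one_sub s
  have h4 : (2:ℂ) ^ s * 2 ^ (1 - s) = 2 := by
    rw [← Complex.cpow_add _ _ two_ne_zero]; simp
  have h5 : (π:ℂ) ^ (s - 1) * (π:ℂ) ^ (1 - s - 1) = (π:ℂ)⁻¹ := by
    rw [← Complex.cpow_add _ _ pi_ne_zero_complex, ← Complex.cpow_neg_one]; congr 1; ring
  have h6 : Complex.Gamma (1 - (1 - s)) = Complex.Gamma s := by congr 1; ring
  rw [chi, chi, h1, h6]
  calc _ = ((2:ℂ) ^ s * 2 ^ (1 - s)) * ((π:ℂ) ^ (s - 1) * (π:ℂ) ^ (1 - s - 1)) *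
        (Complex.sin (π * s / 2) * Complex.cos (π * s / 2)) *
        (Complex.Gamma s * Complex.Gamma (1 - s)) := by ring
    _ = 1 := by
        rw [h4, h5, h3]
        have hpi := pi_ne_zero_complex
        have : Complex.sin (π * s / 2) * Complex.cos (π * s / 2) = Complex.sin (π * s) / 2 := by
          rw [h2]; ring
        rw [this]; field_simp

lemma chi_sub_one {s : ℂ} (hs : s ≠ 1) :
    chi (s - 1) * Complex.sin (π * s / 2) =
      -Complex.cos (π * s / 2) * ((1 - s) / (2 * π)) * chi s := by
  have h1 : Complex.sin (π * (s - 1) / 2) = -Complex.cos (π * s / 2) := by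
    rw [← Complex.sin_pi_div_two_sub, ← Complex.sin_neg]; congr 1; ring
  have h : Complex.Gamma (1 - (s - 1)) = (1 - s) * Complex.Gamma (1 - s) := by
    rw [← Complex.Gamma_add_one _ (sub_ne_zero.2 hs.symm)]; congr 1; ring
  have hpi := pi_ne_zero_complex
  rw [chi, chi, h1, h, Complex.cpow_sub _ _ two_ne_zero, Complex.cpow_sub (s - 1) 1 hpi]
  simp only [Complex.cpow_one]
  field_simp

lemma chi_conj (s : ℂ) : chi ((starRingEnd ℂ) s) = (starRingEnd ℂ) (chi s) := by
  have h2 : (2:ℂ) ^ (starRingEnd ℂ) s = (starRingEnd ℂ) ((2:ℂ) ^ s) := by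
    rw [Complex.cpow_conj _ _ (by
      rw [show (2:ℂ) = ((2:ℝ):ℂ) by norm_num, Complex.arg_ofReal_of_nonneg (by norm_num)]
      exact Real.pi_pos.ne), map_ofNat]
  have h3 : (π:ℂ) ^ ((starRingEnd ℂ) s - 1) = (starRingEnd ℂ) ((π:ℂ) ^ (s - 1)) := by
    rw [show (starRingEnd ℂ) s - 1 = (starRingEnd ℂ) (s - 1) by simp, Complex.cpow_conj _ _ (by
      rw [Complex.arg_ofReal_of_nonneg Real.pi_pos.le]
      exact Real.pi_pos.ne)]
    simp
  rw [chi, chi, h2, h3, map_mul, map_mul, map_mul, ← Complex.sin_conj, ← Complex.Gamma_conj]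
  simp [map_ofNat]

lemma norm_chi_half (t : ℝ) : ‖chi (1/2 + t * I)‖ = 1 := by
  have h1 : (1 : ℂ) - (1/2 + t * I) = (starRingEnd ℂ) (1/2 + t * I) := by
    apply Complex.ext <;> simp; norm_num
  have hs : Complex.sin (π * (1/2 + t * I)) ≠ 0 := by
    rw [show (π:ℂ) * (1/2 + t * I) = (π * t * I) + π / 2 by ring, Complex.sin_add_pi_div_two,
      Complex.cos_mul_I, ← Complex.ofReal_mul, ← Complex.ofReal_cosh]
    exact_mod_cast (Real.cosh_pos _).ne'
  have := chi_mul_chi_one_sub hs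
  rw [h1, chi_conj, Complex.mul_conj, Complex.normSq_eq_norm_sq] at this
  have h2 : ‖chi (1/2 + t * I)‖ ^ 2 = 1 := by exact_mod_cast this
  nlinarith [norm_nonneg (chi (1/2 + t * I))]

lemma norm_chi_neg_half (t : ℝ) : ‖chi (-1/2 + t * I)‖ = ‖(1/2 - t * I : ℂ)‖ / (2 * π) := by
  have h := chi_sub_one (s := 1/2 + t * I) (by
    intro h; have := congrArg Complex.re h; norm_num at this)
  have h1 : Complex.cos (π * (1/2 + t * I) / 2) =
      (starRingEnd ℂ) (Complex.sin (π * (1/2 + t * I) / 2)) := by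
    rw [← Complex.sin_conj, ← Complex.sin_pi_div_two_sub]
    congr 1
    simp only [map_div₀, map_mul, map_add, Complex.conj_ofReal, map_one, map_ofNat, Complex.conj_I]
    ring
  have hs : Complex.sin (π * (1/2 + t * I) / 2) ≠ 0 := by
    intro h0
    have h2 : Complex.sin (π * (1/2 + t * I) / 2) ^ 2 + Complex.cos (π * (1/2 + t * I) / 2) ^ 2 = 1 :=
      Complex.sin_sq_add_cos_sq _
    rw [h1, h0] at h2
    simp at h2
  have h3 := congrArg norm h
  rw [norm_mul, norm_mul, norm_mul, norm_neg, h1, RCLike.norm_conj, norm_chi_half] at h3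
  have h4 : ‖Complex.sin (π * (1/2 + t * I) / 2)‖ ≠ 0 := norm_ne_zero_iff.2 hs
  have h5 : (1/2 + t * I - 1 : ℂ) = -1/2 + t * I := by ring
  have h6 : ((1 - (1/2 + t * I)) / (2 * π) : ℂ) = (1/2 - t * I) / (2 * π) := by ring
  rw [h5, h6, mul_one, mul_comm] at h3
  rw [mul_left_cancel₀ h4 h3, norm_div]
  simp [abs_of_pos Real.pi_pos]

lemma zeta_eq_chi_mul {s : ℂ} (h0 : s ≠ 0) (h1 : s.re < 1) :
    riemannZeta s = chi s * riemannZeta (1 - s) := by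
  have h := riemannZeta_one_sub (s := 1 - s) (fun n h => by
    have := congrArg Complex.re h
    simp at this
    have h0 : (0:ℝ) ≤ n := n.cast_nonneg
    linarith) (fun h => h0 (by simpa using h))
  rw [sub_sub_cancel] at h
  rw [h, chi]
  have h2 : Complex.cos (π * (1 - s) / 2) = Complex.sin (π * s / 2) := by
    rw [← Complex.cos_pi_div_two_sub]; congr 1; ring
  have h3 : 2 * (2 * (π:ℂ)) ^ (-(1 - s)) = 2 ^ s * (π:ℂ) ^ (s - 1) := by
    rw [show -(1 - s) = s - 1 by ring,
      show (2 * (π:ℂ)) = ((2:ℝ):ℂ) * (π:ℝ) by norm_num,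
      Complex.mul_cpow_ofReal_nonneg (by norm_num) Real.pi_pos.le]
    push_cast
    rw [Complex.cpow_sub s 1 two_ne_zero, Complex.cpow_one]
    ring
  rw [h2, h3]; ring

/-- On a vertical line the chi factor is dominated by its size on the boundary of `[-1/2, 3/2]`. -/
lemma exists_norm_chiReg_le : ∃ C : ℝ, 0 < C ∧ ∀ s : ℂ, -1/2 ≤ s.re → s.re ≤ 3/2 →
    ‖chiReg s‖ ≤ C * (2 + |s.im|) ^ (3/2 - s.re) := by
  -- growth bound in the strip
  obtain ⟨B, hB0, hB⟩ : ∃ B : ℝ, 0 < B ∧ ∀ s : ℂ, -1/2 ≤ s.re → s.re ≤ 3/2 →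
      ‖chiReg s‖ ≤ B * Real.exp (2 * |s.im|) := by
    obtain ⟨G, hG⟩ := (isCompact_Icc (a := (1/2:ℝ)) (b := 5/2)).exists_bound_of_continuousOn
      (f := Real.Gamma) (fun x hx => (Real.differentiableAt_Gamma (fun m => by
        have h0 : (0:ℝ) ≤ m := m.cast_nonneg
        have := hx.1
        intro h; linarith)).continuousAt.continuousWithinAt)
    refine ⟨2 ^ (3/2:ℝ) * π ^ (1/2:ℝ) * max G 1, by positivity, fun s h1 h2 => ?_⟩
    rw [chiReg, norm_mul, norm_mul, norm_mul]
    have e1 : ‖(2:ℂ) ^ s‖ ≤ 2 ^ (3/2:ℝ) := by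
      have := Complex.norm_cpow_eq_rpow_re_of_pos (x := 2) (by norm_num) s
      norm_num at this
      rw [this]
      exact Real.rpow_le_rpow_of_exponent_le (by norm_num) h2
    have e2 : ‖(π:ℂ) ^ (s - 1)‖ ≤ π ^ (1/2:ℝ) := by
      rw [Complex.norm_cpow_eq_rpow_re_of_pos Real.pi_pos]
      exact Real.rpow_le_rpow_of_exponent_le (by linarith [Real.pi_gt_three]) (by simp; linarith)
    have e3 : ‖Complex.sin (π * s / 2)‖ ≤ Real.exp (2 * |s.im|) := by
      refine (norm_sin_le_exp_abs_im _).trans (Real.exp_le_exp.2 ?_)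
      have : ((π:ℂ) * s / 2).im = π / 2 * s.im := by
        rw [show (π:ℂ) * s / 2 = ((π / 2 : ℝ) : ℂ) * s by push_cast; ring, Complex.im_ofReal_mul]
      rw [this, abs_mul, abs_of_pos (by positivity)]
      gcongr
      linarith [Real.pi_lt_four]
    have e4 : ‖Complex.Gamma (2 - s)‖ ≤ max G 1 := by
      have hre : (2 - s).re = 2 - s.re := by simp
      refine (norm_Gamma_le_Gamma_re (by rw [hre]; linarith)).trans ?_
      rw [hre]
      exact (le_abs_self _).trans ((hG _ ⟨by linarith, by linarith⟩).trans (le_max_left _ _))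
    calc _ ≤ 2 ^ (3/2:ℝ) * π ^ (1/2:ℝ) * Real.exp (2 * |s.im|) * max G 1 := by gcongr
      _ = _ := by ring
  refine ⟨Real.exp 4 * 20, by positivity, fun s₀ h1 h2 => ?_⟩
  set T : ℝ := 2 + |s₀.im| with hT
  have hT2 : 2 ≤ T := by rw [hT]; linarith [abs_nonneg s₀.im]
  have hT0 : 0 < T := by linarith
  let f : ℂ → ℂ := fun p => chiReg p * (T:ℂ) ^ (p - 3/2) * Complex.exp ((p - s₀) ^ 2)
  have hfn : ∀ p : ℂ, ‖f p‖ = ‖chiReg p‖ * T ^ (p.re - 3/2) *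
      Real.exp ((p.re - s₀.re) ^ 2 - (p.im - s₀.im) ^ 2) := fun p => by
    simp only [f, norm_mul, Complex.norm_cpow_eq_rpow_re_of_pos hT0, Complex.norm_exp]
    congr 2
    · norm_num
    · rw [sq]; simp [sq]
  have hx : ∀ p : ℂ, -1/2 ≤ p.re → p.re ≤ 3/2 → (p.re - s₀.re) ^ 2 ≤ 4 := fun p hp1 hp2 => by
    nlinarith
  have key : ‖f s₀‖ ≤ Real.exp 4 * 20 := by
    refine norm_le_of_strip_of_exp_growth (a := -1/2) (b := 3/2)
      (A := max (B * Real.exp 4) 2) (by norm_num) (by linarith [Real.pi_gt_three])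
      (fun z hz1 hz2 => ?_) (fun z hz1 hz2 => ?_) (fun z hz => ?_) (fun z hz => ?_) h1 h2
    · refine ((differentiableAt_chiReg (by linarith)).mul ?_).mul (by fun_prop)
      exact (differentiableAt_id.sub_const _).const_cpow (Or.inl (by exact_mod_cast hT0.ne'))
    · rw [hfn]
      have e1 : T ^ (z.re - 3/2) ≤ 1 :=
        Real.rpow_le_one_of_one_le_of_nonpos (by linarith) (by linarith)
      have e2 : Real.exp ((z.re - s₀.re) ^ 2 - (z.im - s₀.im) ^ 2) ≤ Real.exp 4 :=
        Real.exp_le_exp.2 (by nlinarith [hx z hz1 hz2, sq_nonneg (z.im - s₀.im)])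
      have e3 : Real.exp (2 * |z.im|) ≤ Real.exp (max (B * Real.exp 4) 2 * |z.im|) := by
        gcongr; exact le_max_right _ _
      calc _ ≤ B * Real.exp (2 * |z.im|) * 1 * Real.exp 4 := by
            gcongr
            exact hB z hz1 hz2
        _ = B * Real.exp 4 * Real.exp (2 * |z.im|) := by ring
        _ ≤ _ := by gcongr; exact le_max_left _ _
    · have hz' : z = -1/2 + z.im * I := by
        apply Complex.ext <;> simp [hz]
      have hne : z ≠ 1 := fun h => by rw [h] at hz; norm_num at hz
      have e0 : ‖chiReg z‖ ≤ (2 + |z.im|) ^ 2 := by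
        rw [chiReg_eq hne, norm_mul]
        have a1 : ‖1 - z‖ ≤ 2 + |z.im| := by
          refine (Complex.norm_le_abs_re_add_abs_im _).trans ?_
          simp [hz]; norm_num
        have a2 : ‖chi z‖ ≤ 2 + |z.im| := by
          rw [hz', norm_chi_neg_half, div_le_iff₀ (by positivity)]
          have a3 : ‖(1/2 - z.im * I : ℂ)‖ ≤ 1/2 + |z.im| := by
            refine (Complex.norm_le_abs_re_add_abs_im _).trans ?_
            simp
          simp at a3 ⊢
          nlinarith [abs_nonneg z.im, Real.pi_gt_three]
        nlinarith [norm_nonneg (1 - z), norm_nonneg (chi z)]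
      rw [hfn]
      have e1 : T ^ (z.re - 3/2) = 1 / T ^ 2 := by
        rw [hz, show (-1/2 - 3/2 : ℝ) = -(2:ℕ) by norm_num, Real.rpow_neg hT0.le, Real.rpow_natCast,
          one_div]
      have e2 : Real.exp ((z.re - s₀.re) ^ 2 - (z.im - s₀.im) ^ 2) ≤
          Real.exp 4 * (1 / (1 + (z.im - s₀.im) ^ 2)) := by
        rw [sub_eq_add_neg, Real.exp_add, Real.exp_neg, ← one_div]
        gcongr
        · exact hx z hz.ge (by linarith)
        · linarith [Real.add_one_le_exp ((z.im - s₀.im) ^ 2)]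
      rw [e1]
      set y := z.im - s₀.im
      have e3 : 2 + |z.im| ≤ T + |y| := by
        have := abs_add_le y s₀.im
        rw [show y + s₀.im = z.im by ring] at this
        linarith
      have e4 : (2 + |z.im|) ^ 2 ≤ 20 * (T ^ 2 * (1 + y ^ 2)) := by
        have : (2 + |z.im|) ^ 2 ≤ (T + |y|) ^ 2 := by
          gcongr
        have h5 : |y| ^ 2 = y ^ 2 := sq_abs y
        nlinarith [sq_nonneg (T - |y|), mul_nonneg (sq_nonneg y) (show 0 ≤ T ^ 2 - 4 by nlinarith)]
      calc _ ≤ (2 + |z.im|) ^ 2 * (1 / T ^ 2) * (Real.exp 4 * (1 / (1 + y ^ 2))) := by gcongr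
        _ = Real.exp 4 * ((2 + |z.im|) ^ 2 / (T ^ 2 * (1 + y ^ 2))) := by
            field_simp
        _ ≤ _ := by
            gcongr
            rw [div_le_iff₀ (by positivity)]
            exact e4
    · have hz' : z = 1 - (-1/2 + (-z.im : ℝ) * I) := by
        apply Complex.ext <;> simp [hz]; norm_num
      have hsin : Complex.sin (π * (-1/2 + (-z.im : ℝ) * I)) ≠ 0 := by
        rw [show (π:ℂ) * (-1/2 + (-z.im : ℝ) * I) = (π * (-z.im : ℝ) * I) - π / 2 by ring,
          Complex.sin_sub_pi_div_two, Complex.cos_mul_I, ← Complex.ofReal_mul, ← Complex.ofReal_cosh]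
        exact_mod_cast neg_ne_zero.2 (Real.cosh_pos _).ne'
      have hmul := congrArg norm (chi_mul_chi_one_sub hsin)
      rw [← hz', norm_mul, norm_chi_neg_half, norm_one] at hmul
      rw [hfn, hz]
      by_cases hne : z = 1
      · rw [hne] at hz; norm_num at hz
      have e0 : ‖chiReg z‖ = 2 * π := by
        rw [chiReg_eq hne, norm_mul]
        have : ‖1 - z‖ = ‖(1/2 - (-z.im : ℝ) * I : ℂ)‖ := by
          rw [← norm_neg]; congr 1; rw [hz']; push_cast
          apply Complex.ext <;> simp; norm_num
        rw [this]
        rwa [div_mul_eq_mul_div, div_eq_iff (by positivity), one_mul] at hmul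
      rw [e0]
      have e2 : Real.exp ((3/2 - s₀.re) ^ 2 - (z.im - s₀.im) ^ 2) ≤ Real.exp 4 := by
        have := hx z (by linarith) (by linarith)
        rw [hz] at this
        exact Real.exp_le_exp.2 (by nlinarith [sq_nonneg (z.im - s₀.im)])
      norm_num
      nlinarith [Real.pi_lt_four, Real.pi_pos, Real.exp_pos 4,
        Real.exp_pos ((3/2 - s₀.re) ^ 2 - (z.im - s₀.im) ^ 2)]
  rw [hfn] at key
  simp only [sub_self, ne_eq, OfNat.ofNat_ne_zero, not_false_eq_true, zero_pow, Real.exp_zero,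
    mul_one] at key
  have e5 : T ^ (s₀.re - 3/2) * T ^ (3/2 - s₀.re) = 1 := by
    rw [← Real.rpow_add hT0]; simp
  calc ‖chiReg s₀‖ = ‖chiReg s₀‖ * T ^ (s₀.re - 3/2) * T ^ (3/2 - s₀.re) := by
        rw [mul_assoc, e5, mul_one]
    _ ≤ _ := by gcongr

lemma exists_norm_chi_le : ∃ C : ℝ, 0 < C ∧ ∀ s : ℂ, -1/2 ≤ s.re → s.re ≤ 3/4 →
    ‖chi s‖ ≤ C * (2 + |s.im|) ^ (1/2 - s.re) := by
  obtain ⟨C, hC, h⟩ := exists_norm_chiReg_le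
  refine ⟨9 * C, by positivity, fun s h1 h2 => ?_⟩
  have hne : s ≠ 1 := fun h => by rw [h] at h2; norm_num at h2
  have h3 := h s h1 (by linarith)
  rw [chiReg_eq hne, norm_mul] at h3
  have a1 : |s.im| ≤ ‖1 - s‖ := by simpa using Complex.abs_im_le_norm (1 - s)
  have a2 : 1/4 ≤ ‖1 - s‖ := by
    have := (le_abs_self _).trans (Complex.abs_re_le_norm (1 - s))
    simp at this
    linarith
  have hT : 0 < 2 + |s.im| := by positivity
  have a3 : (2 + |s.im|) / 9 ≤ ‖1 - s‖ := by linarith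
  have a4 : (2 + |s.im|) ^ (3/2 - s.re) = (2 + |s.im|) ^ (1/2 - s.re) * (2 + |s.im|) := by
    rw [show 3/2 - s.re = (1/2 - s.re) + 1 by ring, Real.rpow_add hT, Real.rpow_one]
  rw [a4] at h3
  have a5 : (2 + |s.im|) / 9 * ‖chi s‖ ≤ C * ((2 + |s.im|) ^ (1/2 - s.re) * (2 + |s.im|)) :=
    (by gcongr : (2 + |s.im|) / 9 * ‖chi s‖ ≤ ‖1 - s‖ * ‖chi s‖).trans h3
  have a6 : (2 + |s.im|) * ‖chi s‖ ≤ (2 + |s.im|) * (9 * C * (2 + |s.im|) ^ (1/2 - s.re)) := by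
    linarith
  exact le_of_mul_le_mul_left a6 hT

/-- The logarithmic derivative of `χ` on the critical line is `-log t + O(1)`. -/
lemma exists_norm_logDeriv_chi_add_log_le : ∃ C : ℝ, 0 < C ∧ ∀ t : ℝ, 1 ≤ t →
    ‖deriv chi (1/2 + t * I) / chi (1/2 + t * I) + Real.log t‖ ≤ C := by
  obtain ⟨C, hC, h⟩ := exists_norm_chi_le
  refine ⟨C * 4 / (1/4), by positivity, fun t ht => ?_⟩
  have ht0 : 0 < t := by linarith
  set s : ℂ := 1/2 + t * I with hs
  have hsre : s.re = 1/2 := by simp [hs]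
  have hsim : s.im = t := by simp [hs]
  let U : ℂ → ℂ := fun p => chi p * (t:ℂ) ^ (p - 1/2)
  have htc : (t:ℂ) ≠ 0 := by exact_mod_cast ht0.ne'
  have hU : ∀ p : ℂ, p.re < 1 → DifferentiableAt ℂ U p := fun p hp =>
    (differentiableAt_chi hp).mul
      ((differentiableAt_id.sub_const _).const_cpow (Or.inl htc))
  have hre : ∀ z ∈ Metric.closedBall s (1/4), 1/4 ≤ z.re ∧ z.re ≤ 3/4 ∧ |z.im - t| ≤ 1/4 := by
    intro z hz
    rw [Metric.mem_closedBall, dist_eq_norm] at hz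
    have h1 := (Complex.abs_re_le_norm (z - s)).trans hz
    have h2 := (Complex.abs_im_le_norm (z - s)).trans hz
    rw [Complex.sub_re, hsre, abs_le] at h1
    rw [Complex.sub_im, hsim] at h2
    exact ⟨by linarith [h1.1], by linarith [h1.2], h2⟩
  have hb : ‖deriv U s‖ ≤ C * 4 / (1/4) := by
    refine Complex.norm_deriv_le_of_forall_mem_sphere_norm_le (by norm_num) ?_ fun z hz => ?_
    · refine DifferentiableOn.diffContOnCl fun z hz => (hU z ?_).differentiableWithinAt
      have := hre z (Metric.closure_ball_subset_closedBall hz)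
      linarith [this.2.1]
    · obtain ⟨h1, h2, h3⟩ := hre z (Metric.sphere_subset_closedBall hz)
      rw [norm_mul, Complex.norm_cpow_eq_rpow_re_of_pos ht0]
      have h4 := h z (by linarith) h2
      rw [abs_le] at h3
      have him : |z.im| = z.im := abs_of_pos (by linarith)
      rw [him] at h4
      have e : (z - 1/2).re = -(1/2 - z.re) := by simp
      rw [e, Real.rpow_neg ht0.le]
      have key : (2 + z.im) ^ (1/2 - z.re) * (t ^ (1/2 - z.re))⁻¹ ≤ 4 := by
        rw [← div_eq_mul_inv, ← Real.div_rpow (by linarith) ht0.le]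
        rcases le_total 0 (1/2 - z.re) with h0 | h0
        · calc ((2 + z.im) / t) ^ (1/2 - z.re) ≤ (4:ℝ) ^ (1/2 - z.re) := by
                apply Real.rpow_le_rpow (div_nonneg (by linarith) ht0.le) _ h0
                rw [div_le_iff₀ ht0]; linarith
            _ ≤ (4:ℝ) ^ (1:ℝ) := Real.rpow_le_rpow_of_exponent_le (by norm_num) (by linarith)
            _ = 4 := Real.rpow_one _
        · refine (Real.rpow_le_one_of_one_le_of_nonpos ?_ h0).trans (by norm_num)
          rw [le_div_iff₀ ht0]; linarith
      calc _ ≤ C * (2 + z.im) ^ (1/2 - z.re) * (t ^ (1/2 - z.re))⁻¹ := by gcongr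
        _ = C * ((2 + z.im) ^ (1/2 - z.re) * (t ^ (1/2 - z.re))⁻¹) := by ring
        _ ≤ C * 4 := by gcongr
  have hd : HasDerivAt U (deriv chi s * (t:ℂ) ^ (s - 1/2) +
      chi s * ((t:ℂ) ^ (s - 1/2) * Complex.log t)) s := by
    refine (differentiableAt_chi (by rw [hsre]; norm_num)).hasDerivAt.mul ?_
    have := ((hasDerivAt_id s).sub_const (1/2)).const_cpow (c := (t:ℂ)) (Or.inl htc)
    simpa using this
  rw [hd.deriv] at hb
  have hchi : ‖chi s‖ = 1 := norm_chi_half t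
  have hchi0 : chi s ≠ 0 := fun h => by rw [h] at hchi; simp at hchi
  have hpow : ‖(t:ℂ) ^ (s - 1/2)‖ = 1 := by
    rw [Complex.norm_cpow_eq_rpow_re_of_pos ht0]; simp [hsre]
  have : deriv chi s * (t:ℂ) ^ (s - 1/2) + chi s * ((t:ℂ) ^ (s - 1/2) * Complex.log t) =
      (deriv chi s / chi s + Real.log t) * (chi s * (t:ℂ) ^ (s - 1/2)) := by
    rw [Complex.ofReal_log ht0.le]
    field_simp
  rwa [this, norm_mul, norm_mul, hchi, hpow, mul_one, mul_one] at hb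

lemma norm_ofReal_cpow_sub_le {s : ℂ} (hs : -1 < s.re) {a x b : ℝ} (ha : 0 < a) (hax : a ≤ x)
    (hxb : x ≤ b) : ‖(b:ℂ) ^ (-s) - (x:ℂ) ^ (-s)‖ ≤ ‖s‖ * a ^ (-s.re - 1) * (b - x) := by
  have hd : ∀ y ∈ Icc a b, HasDerivWithinAt (fun y : ℝ => (y:ℂ) ^ (-s))
      (-s * (y:ℂ) ^ (-s - 1)) (Icc a b) y := fun y hy => by
    have hy0 : y ≠ 0 := (ha.trans_le hy.1).ne'
    by_cases hs0 : s = 0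
    · subst hs0; simpa using hasDerivWithinAt_const y (Icc a b) (1:ℂ)
    · exact (hasDerivAt_ofReal_cpow_const hy0 (neg_ne_zero.2 hs0)).hasDerivWithinAt |>.congr_deriv rfl
  have hb : ∀ y ∈ Icc a b, ‖-s * (y:ℂ) ^ (-s - 1)‖ ≤ ‖s‖ * a ^ (-s.re - 1) := fun y hy => by
    rw [norm_mul, norm_neg, Complex.norm_cpow_eq_rpow_re_of_pos (ha.trans_le hy.1)]
    gcongr
    simp only [sub_re, neg_re, one_re]
    exact Real.rpow_le_rpow_of_nonpos ha hy.1 (by linarith)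
  have := Convex.norm_image_sub_le_of_norm_hasDerivWithin_le hd hb (convex_Icc a b)
    ⟨hax, hxb⟩ ⟨hax.trans hxb, le_rfl⟩
  rwa [Real.norm_of_nonneg (by linarith)] at this

/-- The terms of the Euler–Maclaurin series `(s - 1) ζ(s) = s + ∑ zetaTerm n s`. -/
def zetaTerm (n : ℕ) (s : ℂ) : ℂ :=
  (s - 1) * ((n + 2 : ℕ) : ℂ) ^ (-s) + ((n + 2 : ℕ) : ℂ) ^ (1 - s) - ((n + 1 : ℕ) : ℂ) ^ (1 - s)

lemma norm_zetaTerm_le (n : ℕ) {s : ℂ} (hs : -1 < s.re) :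
    ‖zetaTerm n s‖ ≤ ‖s - 1‖ * ‖s‖ * ((n + 1 : ℕ) : ℝ) ^ (-s.re - 1) := by
  set a : ℝ := ((n + 1 : ℕ) : ℝ) with ha
  have ha0 : 0 < a := by rw [ha]; positivity
  have hb : ((n + 2 : ℕ) : ℝ) = a + 1 := by rw [ha]; push_cast; ring
  let F : ℝ → ℂ := fun x => (s - 1) * ((a + 1 : ℝ) : ℂ) ^ (-s) * (x - a) + (x:ℂ) ^ (1 - s)
  have hd : ∀ y ∈ Icc a (a + 1), HasDerivWithinAt F
      ((s - 1) * (((a + 1 : ℝ) : ℂ) ^ (-s) - (y:ℂ) ^ (-s))) (Icc a (a + 1)) y := fun y hy => by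
    have hy0 : y ≠ 0 := (ha0.trans_le hy.1).ne'
    have h1 : HasDerivAt (fun x : ℝ => (x:ℂ) ^ (1 - s)) ((1 - s) * (y:ℂ) ^ (-s)) y := by
      by_cases hs1 : 1 - s = 0
      · simpa [hs1] using hasDerivAt_const y (1:ℂ)
      · simpa [show (1 - s - 1 : ℂ) = -s by ring] using hasDerivAt_ofReal_cpow_const hy0 hs1
    have h2 : HasDerivAt (fun x : ℝ => (s - 1) * ((a + 1 : ℝ) : ℂ) ^ (-s) * ((x:ℂ) - a))
        ((s - 1) * ((a + 1 : ℝ) : ℂ) ^ (-s) * 1) y :=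
      ((Complex.ofRealCLM.hasDerivAt (x := y)).sub_const _).const_mul _
    exact ((h2.add h1).congr_deriv (by ring)).hasDerivWithinAt
  have hbd : ∀ y ∈ Icc a (a + 1), ‖(s - 1) * (((a + 1 : ℝ) : ℂ) ^ (-s) - (y:ℂ) ^ (-s))‖ ≤
      ‖s - 1‖ * ‖s‖ * a ^ (-s.re - 1) := fun y hy => by
    rw [norm_mul, mul_assoc]
    gcongr
    refine (norm_ofReal_cpow_sub_le hs ha0 hy.1 hy.2).trans ?_
    refine mul_le_of_le_one_right (by positivity) (by linarith [hy.1])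
  have := Convex.norm_image_sub_le_of_norm_hasDerivWithin_le hd hbd (convex_Icc a (a + 1))
    ⟨le_rfl, by linarith⟩ ⟨by linarith, le_rfl⟩
  have e : F (a + 1) - F a = zetaTerm n s := by
    have h1 : ((n + 2 : ℕ) : ℂ) = ((a + 1 : ℝ) : ℂ) := by rw [← hb]; simp
    have h2 : ((n + 1 : ℕ) : ℂ) = (a : ℂ) := by simp [ha]
    rw [zetaTerm, h1, h2]
    simp only [F]
    push_cast
    ring
  rw [e] at this
  simpa using this

lemma sum_zetaTerm (s : ℂ) (M : ℕ) : s + ∑ n ∈ Finset.range M, zetaTerm n s =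
    (s - 1) * ∑ n ∈ Finset.Icc 1 (M + 1), (n : ℂ) ^ (-s) + ((M + 1 : ℕ) : ℂ) ^ (1 - s) := by
  induction M with
  | zero => simp
  | succ M ih =>
    rw [Finset.sum_range_succ, ← add_assoc, ih, Finset.sum_Icc_succ_top (by omega : 1 ≤ M + 1 + 1),
      zetaTerm]
    ring

lemma summable_zetaTerm {s : ℂ} (hs : 0 < s.re) : Summable fun n => zetaTerm n s := by
  refine Summable.of_norm_bounded (g := fun n : ℕ => ‖s - 1‖ * ‖s‖ * ((n + 1 : ℕ) : ℝ) ^ (-s.re - 1))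
    (Summable.mul_left _ ?_) fun n => norm_zetaTerm_le n (by linarith)
  exact (summable_nat_add_iff 1 (f := fun n : ℕ => (n:ℝ) ^ (-s.re - 1))).2
    (Real.summable_nat_rpow.2 (by linarith))

lemma riemannZeta₁_eq {s : ℂ} (hs : s ≠ 1) : riemannZeta₁ s = (s - 1) * riemannZeta s := by
  rw [riemannZeta_eq_inv_sub_mul hs, mul_inv_cancel_left₀ (sub_ne_zero.2 hs)]

lemma riemannZeta₁_eq_tsum_of_one_lt {s : ℂ} (hs : 1 < s.re) :
    riemannZeta₁ s = s + ∑' n, zetaTerm n s := by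
  have hne : s ≠ 1 := fun h => by rw [h] at hs; simp at hs
  rw [riemannZeta₁_eq hne]
  have h1 := ((summable_zetaTerm (s := s) (by linarith)).hasSum.tendsto_sum_nat).const_add s
  simp_rw [sum_zetaTerm] at h1
  have h2 : Tendsto (fun M : ℕ => ∑ n ∈ Finset.Icc 1 (M + 1), (n : ℂ) ^ (-s)) atTop
      (nhds (riemannZeta s)) := by
    rw [zeta_eq_tsum_one_div_nat_add_one_cpow hs]
    have hsum : Summable fun n : ℕ => 1 / ((n:ℂ) + 1) ^ s := by
      have := (summable_nat_add_iff 1).2 (Complex.summable_one_div_nat_cpow.2 hs)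
      simpa using this
    have := (hsum.hasSum.tendsto_sum_nat).comp (tendsto_add_atTop_nat 1)
    refine this.congr fun M => ?_
    simp only [Function.comp]
    clear * -
    induction M with
    | zero => simp
    | succ M ih =>
      rw [Finset.sum_range_succ, ih, Finset.sum_Icc_succ_top (by omega : 1 ≤ M + 1 + 1),
        Complex.cpow_neg, one_div]
      push_cast
      rfl
  have h3 : Tendsto (fun M : ℕ => ((M + 1 : ℕ) : ℂ) ^ (1 - s)) atTop (nhds 0) := by
    rw [tendsto_zero_iff_norm_tendsto_zero]
    have : ∀ M : ℕ, ‖((M + 1 : ℕ) : ℂ) ^ (1 - s)‖ = ((M + 1 : ℕ) : ℝ) ^ (-(s.re - 1)) := fun M => by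
      rw [Complex.norm_natCast_cpow_of_pos (by omega)]; simp
    simp_rw [this]
    exact (tendsto_rpow_neg_atTop (by linarith : 0 < s.re - 1)).comp
      (tendsto_natCast_atTop_atTop.comp (tendsto_add_atTop_nat 1))
  have h4 := (h2.const_mul (s - 1)).add h3
  rw [add_zero] at h4
  exact tendsto_nhds_unique h4 h1

lemma riemannZeta₁_eq_tsum {s : ℂ} (hs : 0 < s.re) :
    riemannZeta₁ s = s + ∑' n, zetaTerm n s := by
  have hopen : ∀ c : ℝ, IsOpen {z : ℂ | c < z.re} := fun c =>
    isOpen_lt continuous_const Complex.continuous_re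
  have hdiff : DifferentiableOn ℂ (fun s => s + ∑' n, zetaTerm n s) {z : ℂ | 0 < z.re} := by
    intro z hz
    have hz : 0 < z.re := hz
    let U : Set ℂ := {w : ℂ | z.re / 2 < w.re} ∩ Metric.ball z 1
    have hU : IsOpen U := (hopen _).inter Metric.isOpen_ball
    have hzU : z ∈ U := ⟨by simp only [mem_ofPred_eq]; linarith, by simp⟩
    have : DifferentiableOn ℂ (fun s => ∑' n, zetaTerm n s) U := by
      refine Complex.differentiableOn_tsum_of_summable_norm
        (u := fun n : ℕ => (‖z‖ + 2) * (‖z‖ + 2) * ((n + 1 : ℕ) : ℝ) ^ (-(z.re / 2) - 1)) ?_ ?_ hU ?_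
      · refine Summable.mul_left _ ?_
        exact (summable_nat_add_iff 1 (f := fun n : ℕ => (n:ℝ) ^ (-(z.re / 2) - 1))).2
          (Real.summable_nat_rpow.2 (by linarith))
      · intro n
        unfold zetaTerm
        have h1 : ((n + 2 : ℕ) : ℂ) ≠ 0 := by exact_mod_cast (by omega : n + 2 ≠ 0)
        have h2 : ((n + 1 : ℕ) : ℂ) ≠ 0 := by exact_mod_cast (by omega : n + 1 ≠ 0)
        intro w _
        refine DifferentiableAt.differentiableWithinAt ?_
        refine ((DifferentiableAt.mul (by fun_prop) ?_).add ?_).sub ?_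
        · exact (differentiableAt_id.neg).const_cpow (Or.inl h1)
        · exact (differentiableAt_id.const_sub 1).const_cpow (Or.inl h1)
        · exact (differentiableAt_id.const_sub 1).const_cpow (Or.inl h2)
      · intro n w hw
        have h1 : z.re / 2 < w.re := hw.1
        have h2 : ‖w - z‖ < 1 := by simpa [dist_eq_norm] using hw.2
        have h3 : ‖w‖ ≤ ‖z‖ + 1 := by
          have := norm_add_le (w - z) z; rw [sub_add_cancel] at this; linarith
        have h4 : ‖w - 1‖ ≤ ‖z‖ + 2 := by
          have := norm_sub_le w 1; rw [norm_one] at this; linarith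
        refine (norm_zetaTerm_le n (by linarith)).trans ?_
        gcongr
        · linarith
        · push_cast; linarith [(n.cast_nonneg : (0:ℝ) ≤ n)]
    exact (differentiableAt_id.add (this.differentiableAt (hU.mem_nhds hzU))).differentiableWithinAt
  have hpre : IsPreconnected {z : ℂ | 0 < z.re} :=
    (convex_halfSpace_re_gt 0).isPreconnected
  have h2 : (2:ℂ) ∈ {z : ℂ | 0 < z.re} := by simp
  have := (differentiable_riemannZeta₁.differentiableOn.analyticOnNhd (hopen 0)).eqOn_of_preconnected_of_eventuallyEq
    (hdiff.analyticOnNhd (hopen 0)) hpre h2 (by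
      filter_upwards [(hopen 1).mem_nhds (show (2:ℂ) ∈ {z : ℂ | 1 < z.re} by simp)] with w hw
      exact riemannZeta₁_eq_tsum_of_one_lt hw)
  exact this hs

lemma riemannZeta₁_eq_sum_add_tsum {s : ℂ} (hs : 0 < s.re) (M : ℕ) :
    riemannZeta₁ s = (s - 1) * ∑ n ∈ Finset.Icc 1 (M + 1), (n : ℂ) ^ (-s) +
      ((M + 1 : ℕ) : ℂ) ^ (1 - s) + ∑' n, zetaTerm (n + M) s := by
  rw [riemannZeta₁_eq_tsum hs, ← sum_zetaTerm, add_assoc,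
    (summable_zetaTerm hs).sum_add_tsum_nat_add M]

lemma exists_norm_riemannZeta₁_le_of_re_ge : ∃ C : ℝ, 0 < C ∧ ∀ s : ℂ, 1/8 ≤ s.re →
    ‖riemannZeta₁ s‖ ≤ C * (1 + ‖s‖) ^ 2 := by
  have hsum : Summable fun n : ℕ => ((n + 1 : ℕ) : ℝ) ^ (-(1/8:ℝ) - 1) :=
    (summable_nat_add_iff 1 (f := fun n : ℕ => (n:ℝ) ^ (-(1/8:ℝ) - 1))).2
      (Real.summable_nat_rpow.2 (by norm_num))
  set A := ∑' n : ℕ, ((n + 1 : ℕ) : ℝ) ^ (-(1/8:ℝ) - 1)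
  have hA : 0 ≤ A := tsum_nonneg fun n => by positivity
  refine ⟨1 + A, by positivity, fun s hs => ?_⟩
  rw [riemannZeta₁_eq_tsum (by linarith)]
  have h1 : ‖∑' n, zetaTerm n s‖ ≤ ‖s - 1‖ * ‖s‖ * A := by
    refine tsum_of_norm_bounded (hsum.hasSum.mul_left _) fun n => ?_
    refine (norm_zetaTerm_le n (by linarith)).trans ?_
    gcongr
    push_cast; linarith [(n.cast_nonneg : (0:ℝ) ≤ n)]
  have h2 : ‖s - 1‖ ≤ 1 + ‖s‖ := by
    have := norm_sub_le s 1; rw [norm_one] at this; linarith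
  have h3 : ‖s - 1‖ * ‖s‖ * A ≤ (1 + ‖s‖) * (1 + ‖s‖) * A := by gcongr; linarith
  have := norm_add_le s (∑' n, zetaTerm n s)
  nlinarith [norm_nonneg s]

lemma riemannZeta₁_eq_chiReg_mul {s : ℂ} (h0 : s ≠ 0) (h1 : s.re < 1) :
    riemannZeta₁ s = -chiReg s * riemannZeta (1 - s) := by
  have hne : s ≠ 1 := fun h => by rw [h] at h1; simp at h1
  rw [riemannZeta₁_eq hne, zeta_eq_chi_mul h0 h1, chiReg_eq hne]
  ring

lemma exists_norm_riemannZeta₁_le : ∃ C : ℝ, 0 < C ∧ ∀ s : ℂ, -1/2 ≤ s.re →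
    ‖riemannZeta₁ s‖ ≤ C * (1 + ‖s‖) ^ 4 := by
  obtain ⟨C₁, hC₁, h₁⟩ := exists_norm_riemannZeta₁_le_of_re_ge
  obtain ⟨C₂, hC₂, h₂⟩ := exists_norm_chiReg_le
  obtain ⟨C₃, h₃⟩ := (isCompact_closedBall (0:ℂ) 2).exists_bound_of_continuousOn
    (differentiable_riemannZeta₁.continuous.continuousOn)
  refine ⟨C₁ + C₂ * C₁ * 16 + |C₃|, by positivity, fun s hs => ?_⟩
  have hn := norm_nonneg s
  have hp : (1:ℝ) ≤ (1 + ‖s‖) ^ 4 := one_le_pow₀ (by linarith)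
  rcases le_total (1/8) s.re with h | h
  · have := h₁ s h
    have h4 : (1 + ‖s‖) ^ 2 ≤ (1 + ‖s‖) ^ 4 := pow_le_pow_right₀ (by linarith) (by norm_num)
    have : C₁ * (1 + ‖s‖) ^ 2 ≤ C₁ * (1 + ‖s‖) ^ 4 := by gcongr
    have : 0 ≤ (C₂ * C₁ * 16 + |C₃|) * (1 + ‖s‖) ^ 4 := by positivity
    linarith
  rcases le_total ‖s‖ 2 with h' | h'
  · have := h₃ s (by simpa using h')
    have h5 : |C₃| * 1 ≤ |C₃| * (1 + ‖s‖) ^ 4 := by gcongr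
    have h6 := le_abs_self C₃
    have : 0 ≤ (C₁ + C₂ * C₁ * 16) * (1 + ‖s‖) ^ 4 := by positivity
    linarith
  · have hs0 : s ≠ 0 := fun h => by rw [h] at h'; simp at h'; linarith
    have hne : (1 - s) ≠ 1 := fun h => hs0 (by simpa using h)
    have e1 := h₁ (1 - s) (by simp; linarith)
    rw [riemannZeta₁_eq hne, norm_mul, show 1 - s - 1 = -s by ring, norm_neg] at e1
    have e2 : ‖1 - s‖ ≤ 1 + ‖s‖ := by
      have := norm_sub_le 1 s; rwa [norm_one] at this
    have e3 : ‖riemannZeta (1 - s)‖ ≤ C₁ * 4 * (1 + ‖s‖) ^ 2 := by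
      have h7 : C₁ * (1 + ‖1 - s‖) ^ 2 ≤ C₁ * (2 * (1 + ‖s‖)) ^ 2 := by gcongr; linarith
      have h8 : 1 * ‖riemannZeta (1 - s)‖ ≤ ‖s‖ * ‖riemannZeta (1 - s)‖ := by
        gcongr; linarith
      nlinarith
    have e4 : ‖chiReg s‖ ≤ C₂ * (2 + ‖s‖) ^ 2 := by
      refine (h₂ s hs (by linarith)).trans ?_
      gcongr
      calc (2 + |s.im|) ^ (3/2 - s.re) ≤ (2 + |s.im|) ^ (2:ℝ) :=
            Real.rpow_le_rpow_of_exponent_le (by linarith [abs_nonneg s.im]) (by linarith)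
        _ = (2 + |s.im|) ^ 2 := by norm_cast
        _ ≤ _ := by gcongr; exact Complex.abs_im_le_norm s
    rw [riemannZeta₁_eq_chiReg_mul hs0 (by linarith), norm_mul, norm_neg]
    have e5 : C₂ * (2 + ‖s‖) ^ 2 ≤ C₂ * 4 * (1 + ‖s‖) ^ 2 := by
      have : C₂ * (2 + ‖s‖) ^ 2 ≤ C₂ * (2 * (1 + ‖s‖)) ^ 2 := by gcongr; linarith
      linarith
    calc _ ≤ (C₂ * 4 * (1 + ‖s‖) ^ 2) * (C₁ * 4 * (1 + ‖s‖) ^ 2) := by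
          gcongr; exact e4.trans e5
      _ = C₂ * C₁ * 16 * (1 + ‖s‖) ^ 4 := by ring
      _ ≤ _ := by
          gcongr
          linarith [abs_nonneg C₃]

lemma exists_mul_norm_le_norm_one_sub_exp : ∃ c : ℝ, 0 < c ∧ ∀ z : ℂ, 0 ≤ z.re → z.re ≤ 2 →
    |z.im| ≤ 2 → c * ‖z‖ ≤ ‖1 - Complex.exp z‖ := by
  have hK : IsCompact (Icc (0:ℝ) 2 ×ℂ Icc (-2:ℝ) 2) := isCompact_Icc.reProdIm isCompact_Icc
  have hne : (Icc (0:ℝ) 2 ×ℂ Icc (-2:ℝ) 2).Nonempty := ⟨0, by simp [Complex.mem_reProdIm]⟩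
  have hcont : Continuous fun z => ‖dslope Complex.exp 0 z‖ :=
    (continuousOn_univ.1 ((continuousOn_dslope univ_mem).2
      ⟨Complex.continuous_exp.continuousOn, Complex.differentiable_exp 0⟩)).norm
  obtain ⟨z₀, hz₀, hmin⟩ := hK.exists_isMinOn hne hcont.continuousOn
  refine ⟨‖dslope Complex.exp 0 z₀‖, ?_, fun z h1 h2 h3 => ?_⟩
  · rw [norm_pos_iff]
    by_cases h : z₀ = 0
    · rw [h, dslope_same]; simp
    · rw [dslope_of_ne _ h, slope_def_field, Complex.exp_zero, sub_zero]
      refine div_ne_zero (fun h0 => h ?_) h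
      obtain ⟨n, hn⟩ := Complex.exp_eq_one_iff.1 (sub_eq_zero.1 h0)
      rw [Complex.mem_reProdIm] at hz₀
      have him := congrArg Complex.im hn
      simp at him
      have hn0 : n = 0 := by
        by_contra hn0
        have h4 : (1:ℝ) ≤ |(n:ℝ)| := by exact_mod_cast Int.one_le_abs hn0
        have h5 : |z₀.im| = |(n:ℝ)| * (2 * π) := by
          rw [him, abs_mul, abs_of_pos (by positivity : 0 < 2 * π)]
        have h6 : |z₀.im| ≤ 2 := abs_le.2 hz₀.2
        nlinarith [Real.pi_gt_three]
      rw [hn, hn0]; simp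
  · have hmem : z ∈ Icc (0:ℝ) 2 ×ℂ Icc (-2:ℝ) 2 := by
      rw [Complex.mem_reProdIm]; exact ⟨⟨h1, h2⟩, abs_le.1 h3⟩
    have h4 : ‖dslope Complex.exp 0 z₀‖ ≤ ‖dslope Complex.exp 0 z‖ := hmin hmem
    by_cases h : z = 0
    · simp [h]
    · rw [dslope_of_ne _ h, slope_def_field, Complex.exp_zero, sub_zero, norm_div,
        le_div_iff₀ (norm_pos_iff.2 h)] at h4
      rwa [norm_sub_rev]

lemma norm_exp_sub_one_sub_le (z : ℂ) :
    ‖Complex.exp z - 1 - z‖ ≤ ‖z‖ ^ 2 * Real.exp ‖z‖ := by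
  have := Complex.norm_exp_sub_sum_le_norm_mul_exp z 2
  simpa [Finset.sum_range_succ, sub_sub] using this

lemma norm_one_sub_exp_sq_sub_le {z : ℂ} (hz : ‖z‖ ≤ 4) :
    ‖(1 - Complex.exp z) ^ 2 - z ^ 2 * Complex.exp z‖ ≤ 10 ^ 8 * ‖z‖ ^ 4 := by
  have h2 : Real.exp 2 ≤ 9 := by
    have := Real.exp_one_lt_d9
    rw [show (2:ℝ) = 1 + 1 by norm_num, Real.exp_add]
    nlinarith [Real.exp_pos 1]
  have hr : ∀ w : ℂ, ‖w‖ ≤ 2 → ‖Complex.exp w - (1 + w + w ^ 2 / 2)‖ ≤ ‖w‖ ^ 3 * 9 := fun w hw => by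
    have := Complex.norm_exp_sub_sum_le_norm_mul_exp w 3
    simp only [Finset.sum_range_succ, Finset.sum_range_zero] at this
    norm_num at this
    refine this.trans ?_
    gcongr
    exact (Real.exp_le_exp.2 hw).trans h2
  have hz2 : ‖z / 2‖ = ‖z‖ / 2 := by simp
  have hz3 : ‖-(z / 2)‖ = ‖z‖ / 2 := by rw [norm_neg, hz2]
  set D := Complex.exp (z / 2) - Complex.exp (-(z / 2)) with hD
  have e1 : ‖D - z‖ ≤ ‖z‖ ^ 3 * 9 := by
    have a1 := hr (z / 2) (by rw [hz2]; linarith)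
    have a2 := hr (-(z / 2)) (by rw [hz3]; linarith)
    have : D - z = (Complex.exp (z / 2) - (1 + z / 2 + (z / 2) ^ 2 / 2)) -
        (Complex.exp (-(z / 2)) - (1 + -(z / 2) + (-(z / 2)) ^ 2 / 2)) := by rw [hD]; ring
    rw [this]
    refine (norm_sub_le _ _).trans ?_
    rw [hz2] at a1; rw [hz3] at a2
    nlinarith [norm_nonneg z, pow_nonneg (norm_nonneg z) 3]
  have e2 : ‖D + z‖ ≤ 146 * ‖z‖ := by
    have : D + z = (D - z) + 2 * z := by ring
    rw [this]
    refine (norm_add_le _ _).trans ?_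
    rw [norm_mul]
    have h3 : ‖z‖ ^ 3 ≤ 16 * ‖z‖ := by nlinarith [norm_nonneg z, mul_nonneg (norm_nonneg z) (norm_nonneg z)]
    norm_num
    linarith
  have e3 : (1 - Complex.exp z) ^ 2 - z ^ 2 * Complex.exp z = Complex.exp z * ((D - z) * (D + z)) := by
    have h4 : Complex.exp z = Complex.exp (z / 2) * Complex.exp (z / 2) := by
      rw [← Complex.exp_add]; congr 1; ring
    have h5 : Complex.exp (z / 2) * Complex.exp (-(z / 2)) = 1 := by
      rw [← Complex.exp_add]; simp
    rw [hD]
    have h6 : (1 - Complex.exp z) ^ 2 = Complex.exp z * (Complex.exp (z / 2) - Complex.exp (-(z / 2))) ^ 2 := by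
      rw [h4]
      linear_combination (-1 - Complex.exp (z/2) * Complex.exp (-(z/2)) + 2 * Complex.exp (z/2) ^ 2) * h5
    linear_combination h6
  have e4 : ‖Complex.exp z‖ ≤ 81 := by
    refine (Complex.norm_exp_le_exp_norm z).trans ((Real.exp_le_exp.2 hz).trans ?_)
    rw [show (4:ℝ) = 2 + 2 by norm_num, Real.exp_add]
    nlinarith [Real.exp_pos 2]
  rw [e3, norm_mul, norm_mul]
  calc _ ≤ 81 * ((‖z‖ ^ 3 * 9) * (146 * ‖z‖)) := by gcongr
    _ ≤ _ := by nlinarith [pow_nonneg (norm_nonneg z) 4]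

/-- The correction factor that turns the Euler–Maclaurin terms into a telescoping sum. -/
def teleFactor (s : ℂ) (x : ℝ) : ℂ :=
  (s / (1 - Complex.exp (s * (Real.log (1 + 1 / x) : ℝ))) + x) / (s - 1)

lemma log_one_add_inv_bounds {x : ℝ} (hx : 0 < x) :
    1 / (x + 1) ≤ Real.log (1 + 1 / x) ∧ Real.log (1 + 1 / x) ≤ 1 / x := by
  have hp : 0 < 1 + 1 / x := by positivity
  constructor
  · have := Real.one_sub_inv_le_log_of_pos hp
    refine le_trans (le_of_eq ?_) this
    field_simp; ring
  · have := Real.log_le_sub_one_of_pos hp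
    linarith

lemma exists_teleFactor_bounds : ∃ C : ℝ, 0 < C ∧ ∀ (s : ℂ) (x : ℝ), 1/4 ≤ s.re → s.re ≤ 2 →
    1 ≤ s.im → 1 ≤ x → s.im ≤ 2 * x →
    1 - Complex.exp (s * (Real.log (1 + 1 / x) : ℝ)) ≠ 0 ∧ ‖teleFactor s x‖ ≤ C ∧
    ∃ d : ℂ, HasDerivAt (teleFactor s) d x ∧ ‖d‖ ≤ C / x := by
  obtain ⟨c, hc, hexp⟩ := exists_mul_norm_le_norm_one_sub_exp
  refine ⟨4 * (1 + Real.exp 4) / c + 64 * (10 ^ 9 + Real.exp 4) / c ^ 2, by positivity,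
    fun s x h1 h2 h3 h4 h5 => ?_⟩
  have hx0 : 0 < x := by linarith
  obtain ⟨hL1, hL2⟩ := log_one_add_inv_bounds hx0
  set L := Real.log (1 + 1 / x) with hL
  have hL0 : 0 < L := lt_of_lt_of_le (by positivity) hL1
  have hLle : L ≤ 1 := hL2.trans (by rw [div_le_one hx0]; exact h4)
  have hL2x : 1 / (2 * x) ≤ L := le_trans (by gcongr; linarith) hL1
  set z : ℂ := s * (L : ℝ) with hz
  have hzre : z.re = s.re * L := by simp [hz]
  have hzim : z.im = s.im * L := by simp [hz]
  have hzn : ‖z‖ = ‖s‖ * L := by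
    rw [hz, norm_mul, Complex.norm_real, Real.norm_of_nonneg hL0.le]
  have hs1 : 1 ≤ ‖s‖ := h3.trans ((le_abs_self _).trans (Complex.abs_im_le_norm s))
  have hsx : ‖s‖ ≤ 4 * x := by
    refine (Complex.norm_le_abs_re_add_abs_im s).trans ?_
    rw [abs_of_nonneg (by linarith), abs_of_nonneg (by linarith)]
    linarith
  have hzim' : |z.im| ≤ 2 := by
    rw [hzim, abs_of_nonneg (by positivity)]
    calc s.im * L ≤ (2 * x) * (1 / x) := by gcongr
      _ = 2 := by field_simp
  have hE := hexp z (by rw [hzre]; positivity) (by rw [hzre]; nlinarith) hzim'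
  have hz4 : ‖z‖ ≤ 4 := by
    rw [hzn]
    calc ‖s‖ * L ≤ (4 * x) * (1 / x) := by gcongr
      _ = 4 := by field_simp
  have hz0 : 0 < ‖z‖ := by rw [hzn]; positivity
  have hne : 1 - Complex.exp z ≠ 0 := norm_pos_iff.1 (lt_of_lt_of_le (by positivity) hE)
  have hsm : ‖s‖ / 2 ≤ ‖s - 1‖ := by
    have a1 : 1 ≤ ‖s - 1‖ := h3.trans ((le_abs_self _).trans (by
      simpa using Complex.abs_im_le_norm (s - 1)))
    have a2 := norm_add_le (s - 1) 1
    rw [sub_add_cancel, norm_one] at a2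
    linarith
  have hsm0 : s - 1 ≠ 0 := norm_pos_iff.1 (lt_of_lt_of_le (by positivity) hsm)
  have hden : c * (‖s‖ / (2 * x)) ≤ ‖1 - Complex.exp z‖ := by
    refine le_trans ?_ hE
    rw [hzn, div_eq_mul_one_div]
    gcongr
  refine ⟨hne, ?_, ?_⟩
  · have hnum : ‖s + x * (1 - Complex.exp z)‖ ≤ (1 + Real.exp 4) * (‖s‖ ^ 2 / x) := by
      have e : s + x * (1 - Complex.exp z) = s * ((1 - x * L : ℝ) : ℂ) -
          x * (Complex.exp z - 1 - z) := by
        rw [hz]; push_cast; ring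
      rw [e]
      refine (norm_sub_le _ _).trans ?_
      rw [norm_mul, norm_mul, Complex.norm_real, Complex.norm_real, Real.norm_of_nonneg hx0.le]
      have a1 : ‖1 - x * L‖ ≤ 1 / x := by
        have b1 : x * L ≤ 1 := by
          calc x * L ≤ x * (1 / x) := by gcongr
            _ = 1 := by field_simp
        rw [Real.norm_of_nonneg (by linarith)]
        have b2 : x * (1 / (x + 1)) ≤ x * L := by gcongr
        have b3 : 1 - x * (1 / (x + 1)) ≤ 1 / x := by
          rw [show 1 - x * (1 / (x + 1)) = 1 / (x + 1) by field_simp; ring]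
          gcongr; linarith
        linarith
      have a2 : ‖Complex.exp z - 1 - z‖ ≤ (‖s‖ * (1 / x)) ^ 2 * Real.exp 4 := by
        refine (norm_exp_sub_one_sub_le z).trans ?_
        have : ‖z‖ ≤ ‖s‖ * (1 / x) := by rw [hzn]; gcongr
        gcongr
      calc _ ≤ ‖s‖ * (1 / x) + x * ((‖s‖ * (1 / x)) ^ 2 * Real.exp 4) := by gcongr
        _ ≤ ‖s‖ ^ 2 * (1 / x) + x * ((‖s‖ * (1 / x)) ^ 2 * Real.exp 4) := by
            gcongr
            nlinarith
        _ = _ := by field_simp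
    have e : teleFactor s x = (s + x * (1 - Complex.exp z)) / ((s - 1) * (1 - Complex.exp z)) := by
      rw [teleFactor, ← hL, ← hz]; field_simp
    rw [e, norm_div, norm_mul]
    calc _ ≤ (1 + Real.exp 4) * (‖s‖ ^ 2 / x) / (‖s‖ / 2 * (c * (‖s‖ / (2 * x)))) := by gcongr
      _ = 4 * (1 + Real.exp 4) / c := by field_simp; ring
      _ ≤ _ := le_add_of_nonneg_right (by positivity)
  · have hlog : HasDerivAt (fun x : ℝ => Real.log (1 + 1 / x)) (-1 / (x * (x + 1))) x := by
      have a1 : HasDerivAt (fun x : ℝ => 1 + 1 / x) (-1 / x ^ 2) x := by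
        have := (hasDerivAt_inv hx0.ne').const_add 1
        simp only [one_div]
        exact this.congr_deriv (by field_simp)
      refine (a1.log (by positivity)).congr_deriv ?_
      field_simp
    have hexpd : HasDerivAt (fun x : ℝ => Complex.exp (s * (Real.log (1 + 1 / x) : ℝ)))
        (Complex.exp z * (s * ((-1 / (x * (x + 1)) : ℝ) : ℂ))) x :=
      ((hlog.ofReal_comp).const_mul s).cexp
    have hd := (((hexpd.const_sub 1).inv hne).const_mul s).add
      (Complex.ofRealCLM.hasDerivAt (x := x)) |>.div_const (s - 1)
    refine ⟨_, (hd.congr_of_eventuallyEq (Eventually.of_forall fun y => ?_)), ?_⟩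
    · simp [teleFactor, div_eq_mul_inv]
    · simp only [← hL, ← hz]
      have e : (s * (-(-(Complex.exp z * (s * ((-1 / (x * (x + 1)) : ℝ) : ℂ)))) /
          (1 - Complex.exp z) ^ 2) + Complex.ofRealCLM 1) / (s - 1) =
          (((1 - Complex.exp z) ^ 2 - z ^ 2 * Complex.exp z) +
            Complex.exp z * s ^ 2 * ((L ^ 2 - 1 / (x * (x + 1)) : ℝ) : ℂ)) /
          ((s - 1) * (1 - Complex.exp z) ^ 2) := by
        have hzL : z ^ 2 = s ^ 2 * (L:ℂ) ^ 2 := by rw [hz]; ring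
        have hxx : ((x:ℂ) * (x + 1)) ≠ 0 := by
          exact_mod_cast (by positivity : (x * (x + 1)) ≠ 0)
        have hx1 : (x:ℂ) ≠ 0 := left_ne_zero_of_mul hxx
        have hx2 : (x:ℂ) + 1 ≠ 0 := right_ne_zero_of_mul hxx
        rw [hzL]
        generalize Complex.exp z = w at hne
        simp only [Complex.ofRealCLM_apply, Complex.ofReal_one]
        push_cast
        field_simp
        ring
      rw [e, norm_div, norm_mul, norm_pow]
      have a1 := norm_one_sub_exp_sq_sub_le hz4
      have a2 : |L ^ 2 - 1 / (x * (x + 1))| ≤ 2 / x ^ 3 := by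
        have b1 : L ^ 2 ≤ (1 / x) ^ 2 := by gcongr
        have b2 : (1 / (x + 1)) ^ 2 ≤ L ^ 2 := by gcongr
        have b3 : (1 / x) ^ 2 - 1 / (x * (x + 1)) ≤ 2 / x ^ 3 := by
          rw [show (1 / x) ^ 2 - 1 / (x * (x + 1)) = 1 / (x ^ 2 * (x + 1)) by field_simp; ring]
          rw [div_le_div_iff₀ (by positivity) (by positivity)]
          nlinarith [pow_pos hx0 3, pow_pos hx0 2]
        have b4 : 1 / (x * (x + 1)) - (1 / (x + 1)) ^ 2 ≤ 2 / x ^ 3 := by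
          rw [show 1 / (x * (x + 1)) - (1 / (x + 1)) ^ 2 = 1 / (x * (x + 1) ^ 2) by field_simp; ring]
          rw [div_le_div_iff₀ (by positivity) (by positivity)]
          nlinarith [pow_pos hx0 3, pow_pos hx0 2]
        rw [abs_le]; constructor <;> linarith
      have a3 : ‖Complex.exp z‖ ≤ Real.exp 4 :=
        (Complex.norm_exp_le_exp_norm z).trans (Real.exp_le_exp.2 hz4)
      have a4 : ‖z‖ ≤ ‖s‖ * (1 / x) := by rw [hzn]; gcongr
      have a5 : ‖((1 - Complex.exp z) ^ 2 - z ^ 2 * Complex.exp z) +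
            Complex.exp z * s ^ 2 * ((L ^ 2 - 1 / (x * (x + 1)) : ℝ) : ℂ)‖ ≤
          (10 ^ 8 * 4 + 2 * Real.exp 4) * (‖s‖ ^ 3 / x ^ 3) := by
        refine (norm_add_le _ _).trans ?_
        rw [norm_mul, norm_mul, norm_pow, Complex.norm_real, Real.norm_eq_abs]
        calc _ ≤ 10 ^ 8 * (‖s‖ * (1 / x)) ^ 4 + Real.exp 4 * ‖s‖ ^ 2 * (2 / x ^ 3) := by
              gcongr
              exact a1.trans (by gcongr)
          _ ≤ 10 ^ 8 * (‖s‖ * (1 / x)) ^ 3 * 4 + Real.exp 4 * ‖s‖ ^ 3 * (2 / x ^ 3) := by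
              have b1 : (‖s‖ * (1 / x)) ^ 4 ≤ (‖s‖ * (1 / x)) ^ 3 * 4 := by
                rw [pow_succ]
                gcongr
                calc ‖s‖ * (1 / x) ≤ (4 * x) * (1 / x) := by gcongr
                  _ = 4 := by field_simp
              have b2 : ‖s‖ ^ 2 ≤ ‖s‖ ^ 3 := pow_le_pow_right₀ hs1 (by norm_num)
              have b3 : (10:ℝ) ^ 8 * (‖s‖ * (1 / x)) ^ 4 ≤ 10 ^ 8 * ((‖s‖ * (1 / x)) ^ 3 * 4) := by
                gcongr
              have b4 : Real.exp 4 * ‖s‖ ^ 2 * (2 / x ^ 3) ≤ Real.exp 4 * ‖s‖ ^ 3 * (2 / x ^ 3) := by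
                gcongr
              linarith
          _ = _ := by field_simp
      calc _ ≤ (10 ^ 8 * 4 + 2 * Real.exp 4) * (‖s‖ ^ 3 / x ^ 3) /
            (‖s‖ / 2 * (c * (‖s‖ / (2 * x))) ^ 2) := by gcongr
        _ = (8 * (10 ^ 8 * 4 + 2 * Real.exp 4) / c ^ 2) / x := by field_simp; ring
        _ ≤ _ := by
          gcongr
          refine le_add_of_nonneg_of_le (by positivity) ?_
          gcongr ?_ / _
          linarith [Real.exp_pos 4]

lemma rpow_neg_succ_add_le {k σ : ℝ} (hk : 0 < k) (hσ : 0 < σ) :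
    (k + 1) ^ (-σ) + σ * ((k + 1) ^ (-σ) / (k + 1)) ≤ k ^ (-σ) := by
  have h1 := (log_one_add_inv_bounds hk).1
  have e : k ^ (-σ) = (k + 1) ^ (-σ) * Real.exp (σ * Real.log (1 + 1 / k)) := by
    have : (1 + 1 / k) = (k + 1) / k := by field_simp
    rw [this, Real.log_div (by positivity) (by positivity), Real.rpow_def_of_pos hk,
      Real.rpow_def_of_pos (by positivity), ← Real.exp_add]
    congr 1; ring
  have h2 : 1 + σ * (1 / (k + 1)) ≤ Real.exp (σ * Real.log (1 + 1 / k)) := by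
    refine le_trans ?_ (Real.add_one_le_exp _)
    rw [add_comm]; gcongr
  calc _ = (k + 1) ^ (-σ) * (1 + σ * (1 / (k + 1))) := by ring
    _ ≤ _ := by rw [e]; gcongr

lemma natCast_cpow_neg_eq_succ_mul (s : ℂ) {k : ℕ} (hk : 0 < k) :
    (k : ℂ) ^ (-s) = ((k + 1 : ℕ) : ℂ) ^ (-s) *
      Complex.exp (s * (Real.log (1 + 1 / (k:ℝ)) : ℝ)) := by
  have hk' : (0:ℝ) < k := by exact_mod_cast hk
  have : (1 + 1 / (k:ℝ)) = ((k + 1 : ℕ) : ℝ) / k := by push_cast; field_simp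
  rw [this, Real.log_div (by positivity) (by positivity), Complex.cpow_def_of_ne_zero
    (by exact_mod_cast hk.ne'), Complex.cpow_def_of_ne_zero (by exact_mod_cast k.succ_ne_zero),
    ← Complex.exp_add]
  congr 1
  rw [← Complex.ofReal_natCast, ← Complex.ofReal_natCast, ← Complex.ofReal_log (by positivity),
    ← Complex.ofReal_log (by positivity)]
  push_cast; ring

lemma zetaTerm_div_eq {s : ℂ} (hs : s ≠ 1) {k : ℕ} (hk : 0 < k)
    (hne : 1 - Complex.exp (s * (Real.log (1 + 1 / (k:ℝ)) : ℝ)) ≠ 0) :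
    zetaTerm (k - 1) s / (s - 1) = ((k + 1 : ℕ) : ℂ) ^ (-s) * teleFactor s k
      - (k : ℂ) ^ (-s) * teleFactor s k := by
  have hs' : s - 1 ≠ 0 := sub_ne_zero.2 hs
  obtain ⟨j, rfl⟩ : ∃ j, k = j + 1 := ⟨k - 1, by omega⟩
  rw [natCast_cpow_neg_eq_succ_mul s hk]
  have e1 : ((j + 1 : ℕ) : ℂ) ^ (1 - s) = (j + 1 : ℕ) * ((j + 1 : ℕ) : ℂ) ^ (-s) := by
    rw [sub_eq_add_neg, Complex.cpow_add _ _ (by exact_mod_cast j.succ_ne_zero), Complex.cpow_one]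
  have e2 : ((j + 2 : ℕ) : ℂ) ^ (1 - s) = (j + 2 : ℕ) * ((j + 2 : ℕ) : ℂ) ^ (-s) := by
    rw [sub_eq_add_neg, Complex.cpow_add _ _ (by exact_mod_cast (j+1).succ_ne_zero),
      Complex.cpow_one]
  simp only [zetaTerm, teleFactor, Nat.add_sub_cancel]
  rw [e1, e2, natCast_cpow_neg_eq_succ_mul s hk]
  have e3 : (((j + 1 : ℕ) : ℝ) : ℂ) = (j + 1 : ℕ) := by push_cast; rfl
  rw [e3]
  generalize Complex.exp _ = w at hne
  rw [show j + 1 + 1 = j + 2 from rfl]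
  generalize ((j + 2 : ℕ) : ℂ) ^ (-s) = v
  push_cast
  field_simp
  ring

/-- Approximation of `ζ` by its partial sums, uniformly for `1 ≤ Im s ≤ 2 N`. -/
theorem exists_norm_zeta_sub_sum_le : ∃ C : ℝ, 0 < C ∧ ∀ (s : ℂ) (N : ℕ), 1/4 ≤ s.re → s.re ≤ 2 →
    1 ≤ s.im → 1 ≤ N → s.im ≤ 2 * N →
    ‖riemannZeta s - ∑ n ∈ Finset.Icc 1 N, (n : ℂ) ^ (-s) - (N : ℂ) ^ (1 - s) / (s - 1)‖ ≤
      C * (N : ℝ) ^ (-s.re) := by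
  obtain ⟨C, hC, hT⟩ := exists_teleFactor_bounds
  refine ⟨C + 8 * C + C, by positivity, fun s N h1 h2 h3 hN h4 => ?_⟩
  have hs1 : s ≠ 1 := by rintro rfl; norm_num at h3
  have hs1' : s - 1 ≠ 0 := sub_ne_zero.2 hs1
  have hN' : (1:ℝ) ≤ N := by exact_mod_cast hN
  have hnorm : ∀ k : ℕ, 0 < k → ‖(k:ℂ) ^ (-s)‖ = (k:ℝ) ^ (-s.re) := fun k hk => by
    rw [Complex.norm_natCast_cpow_of_pos hk, Complex.neg_re]
  have hT' : ∀ k : ℕ, N ≤ k → _ := fun k hk => hT s k h1 h2 h3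
    (hN'.trans (by exact_mod_cast hk)) (h4.trans (by gcongr))
  have hdiff : ∀ k : ℕ, N ≤ k → ‖teleFactor s (k + 1 : ℕ) - teleFactor s k‖ ≤ C / k := by
    intro k hk
    have hkk : (N:ℝ) ≤ k := by exact_mod_cast hk
    have hb : ∀ x ∈ Icc (k:ℝ) (k + 1), DifferentiableAt ℝ (teleFactor s) x ∧
        ‖deriv (teleFactor s) x‖ ≤ C / k := by
      intro x hx
      obtain ⟨-, -, d, hd, hdb⟩ := hT s x h1 h2 h3 (by linarith [hx.1]) (by linarith [hx.1])
      refine ⟨hd.differentiableAt, ?_⟩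
      rw [hd.deriv]
      refine hdb.trans ?_
      have : (0:ℝ) < k := by linarith
      gcongr; exact hx.1
    have := (convex_Icc (k:ℝ) (k + 1)).norm_image_sub_le_of_norm_deriv_le
      (fun x hx => (hb x hx).1) (fun x hx => (hb x hx).2)
      (left_mem_Icc.2 (by linarith)) (right_mem_Icc.2 (by linarith))
    simpa using this
  have hind : ∀ J : ℕ, ‖∑ j ∈ Finset.range J, zetaTerm (j + (N - 1)) s / (s - 1) -
      ((N + J : ℕ) : ℂ) ^ (-s) * teleFactor s (N + J : ℕ) + (N : ℂ) ^ (-s) * teleFactor s N‖ ≤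
      8 * C * ((N:ℝ) ^ (-s.re) - ((N + J : ℕ) : ℝ) ^ (-s.re)) := by
    intro J
    induction J with
    | zero => simp
    | succ J ih =>
      set k := N + J with hk
      have hk0 : 0 < k := by omega
      have hkN : N ≤ k := by omega
      have hkp : (0:ℝ) < k := by exact_mod_cast hk0
      rw [Finset.sum_range_succ, show J + (N - 1) = k - 1 by omega,
        zetaTerm_div_eq hs1 hk0 (hT' k hkN).1, show N + (J + 1) = k + 1 by omega]
      have e : ∀ A B : ℂ, A + (((k + 1 : ℕ) : ℂ) ^ (-s) * teleFactor s k
          - (k : ℂ) ^ (-s) * teleFactor s k) - ((k + 1 : ℕ) : ℂ) ^ (-s) * teleFactor s (k + 1 : ℕ)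
          + B = (A - (k : ℂ) ^ (-s) * teleFactor s k + B) -
          ((k + 1 : ℕ) : ℂ) ^ (-s) * (teleFactor s (k + 1 : ℕ) - teleFactor s k) := by
        intro A B; ring
      rw [e]
      refine (norm_sub_le _ _).trans ?_
      have a1 : ‖((k + 1 : ℕ) : ℂ) ^ (-s) * (teleFactor s (k + 1 : ℕ) - teleFactor s k)‖ ≤
          8 * C * ((k:ℝ) ^ (-s.re) - ((k + 1 : ℕ) : ℝ) ^ (-s.re)) := by
        rw [norm_mul, hnorm _ k.succ_pos]
        have b1 := rpow_neg_succ_add_le hkp (show 0 < s.re by linarith)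
        have b2 : C / k ≤ 2 * (C / (k + 1)) := by
          have : (1:ℝ) ≤ k := by exact_mod_cast hk0
          rw [← mul_div_assoc, div_le_div_iff₀ hkp (by positivity)]; nlinarith
        rw [Nat.cast_succ (R := ℝ)]
        set v := ((k:ℝ) + 1) ^ (-s.re)
        have hv : 0 ≤ v := by positivity
        have b3 : 1 / 4 * (v / (k + 1)) ≤ s.re * (v / (k + 1)) := by gcongr
        have b4 := (hdiff k hkN).trans b2
        rw [Nat.cast_succ (R := ℝ)] at b4
        calc v * ‖teleFactor s (k + 1) - teleFactor s k‖ ≤ v * (2 * (C / (k + 1))) := by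
              gcongr
          _ = 8 * C * (1 / 4 * (v / (k + 1))) := by ring
          _ ≤ 8 * C * ((k:ℝ) ^ (-s.re) - v) :=
              mul_le_mul_of_nonneg_left (by linarith) (by positivity)
      linarith
  have hsum := summable_zetaTerm (s := s) (by linarith)
  have hsum' : Summable fun j => zetaTerm (j + (N - 1)) s / (s - 1) :=
    ((summable_nat_add_iff (N - 1)).2 hsum).div_const _
  have hz : riemannZeta s - ∑ n ∈ Finset.Icc 1 N, (n : ℂ) ^ (-s) - (N : ℂ) ^ (1 - s) / (s - 1)
      = ∑' j, zetaTerm (j + (N - 1)) s / (s - 1) := by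
    have e1 := riemannZeta₁_eq_sum_add_tsum (s := s) (by linarith) (N - 1)
    rw [riemannZeta₁_eq hs1, Nat.sub_add_cancel hN] at e1
    rw [tsum_div_const, eq_div_iff hs1']
    linear_combination e1 - (N : ℂ) ^ (1 - s) * (div_mul_cancel₀ 1 hs1' : 1 / (s-1) * (s - 1) = 1)
  rw [hz]
  refine le_of_tendsto hsum'.hasSum.tendsto_sum_nat.norm (Eventually.of_forall fun J => ?_)
  have b1 := hind J
  have hmono : ((N + J : ℕ) : ℝ) ^ (-s.re) ≤ (N:ℝ) ^ (-s.re) :=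
    Real.rpow_le_rpow_of_nonpos (by linarith) (by exact_mod_cast Nat.le_add_right N J) (by linarith)
  have b2 : ‖((N + J : ℕ) : ℂ) ^ (-s) * teleFactor s (N + J : ℕ)‖ ≤ (N:ℝ) ^ (-s.re) * C := by
    rw [norm_mul, hnorm _ (by omega)]
    gcongr
    exact (hT' _ (by omega)).2.1
  have b3 : ‖(N : ℂ) ^ (-s) * teleFactor s N‖ ≤ (N:ℝ) ^ (-s.re) * C := by
    rw [norm_mul, hnorm _ (by omega)]
    gcongr
    exact (hT' _ le_rfl).2.1
  have b4 : (0:ℝ) ≤ ((N + J : ℕ) : ℝ) ^ (-s.re) := by positivity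
  set A := ∑ j ∈ Finset.range J, zetaTerm (j + (N - 1)) s / (s - 1)
  set P := ((N + J : ℕ) : ℂ) ^ (-s) * teleFactor s (N + J : ℕ)
  set Q := (N : ℂ) ^ (-s) * teleFactor s N
  have e : A = (A - P + Q) + P - Q := by ring
  rw [e]
  refine (norm_sub_le _ _).trans ((add_le_add_left (norm_add_le _ _) _).trans ?_)
  nlinarith

lemma normSq_sum_mul_exp (s : Finset ℕ) (x : ℕ → ℂ) (l : ℕ → ℝ) (t : ℝ) :
    ((‖∑ m ∈ s, x m * Complex.exp (l m * t * I)‖ ^ 2 : ℝ) : ℂ) =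
      ∑ m ∈ s, ∑ n ∈ s, x m * conj (x n) * Complex.exp ((l m - l n) * I * t) := by
  rw [Complex.ofReal_pow, ← Complex.mul_conj', map_sum, Finset.sum_mul_sum]
  refine Finset.sum_congr rfl fun m _ => Finset.sum_congr rfl fun n _ => ?_
  rw [map_mul, ← Complex.exp_conj]
  have e : Complex.exp ((l m - l n) * I * t) = Complex.exp (l m * t * I) *
      Complex.exp (conj (l n * t * I)) := by
    rw [← Complex.exp_add]; congr 1; simp; ring
  rw [e]; ring

lemma integral_exp_int_mul (k : ℤ) :
    ∫ t in (0:ℝ)..2 * π, Complex.exp (k * I * t) = if k = 0 then 2 * π else 0 := by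
  split_ifs with h
  · simp [h]
  · rw [integral_exp_mul_complex (by simp [h])]
    have : Complex.exp (k * I * ((2 * π : ℝ) : ℂ)) = 1 :=
      Complex.exp_eq_one_iff.2 ⟨k, by push_cast; ring⟩
    rw [this]; simp

lemma integral_sub_mul_exp_int (k : ℤ) :
    ∫ t in (0:ℝ)..2 * π, ((π - t : ℝ) : ℂ) * Complex.exp (k * I * t) = 2 * π * I / k := by
  by_cases h : k = 0
  · subst h
    simp only [Int.cast_zero, zero_mul, Complex.exp_zero, mul_one, div_zero]
    rw [intervalIntegral.integral_ofReal, intervalIntegral.integral_sub (by simp) (by simp)]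
    simp; ring
  · have hk : (k : ℂ) ≠ 0 := by exact_mod_cast h
    have hkI : (k : ℂ) * I ≠ 0 := mul_ne_zero hk I_ne_zero
    have hd : ∀ t : ℝ, HasDerivAt (fun t : ℝ => (((π - t : ℝ) : ℂ) / (k * I) + 1 / (k * I) ^ 2) *
        Complex.exp (k * I * t)) (((π - t : ℝ) : ℂ) * Complex.exp (k * I * t)) t := by
      intro t
      have h1 : HasDerivAt (fun t : ℝ => Complex.exp (k * I * t))
          (Complex.exp (k * I * t) * (k * I * 1)) t :=
        ((Complex.ofRealCLM.hasDerivAt (x := t)).const_mul (k * I : ℂ)).cexp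
      have h2 : HasDerivAt (fun t : ℝ => ((π - t : ℝ) : ℂ) / (k * I) + 1 / (k * I) ^ 2)
          (((-1 : ℝ) : ℂ) / (k * I)) t :=
        ((((hasDerivAt_id t).const_sub π).ofReal_comp).div_const _).add_const _
      refine (h2.mul h1).congr_deriv ?_
      push_cast
      field_simp
      ring
    rw [intervalIntegral.integral_eq_sub_of_hasDerivAt (fun t _ => hd t)
      (Continuous.intervalIntegrable (by fun_prop) _ _)]
    have : Complex.exp (k * I * ((2 * π : ℝ) : ℂ)) = 1 :=
      Complex.exp_eq_one_iff.2 ⟨k, by push_cast; ring⟩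
    rw [this]
    simp
    field_simp
    ring_nf
    simp

/-- Hilbert's inequality. The diagonal terms vanish by the convention `z / 0 = 0`. -/
theorem norm_sum_sum_div_sub_le (s : Finset ℕ) (x : ℕ → ℂ) :
    ‖∑ m ∈ s, ∑ n ∈ s, x m * conj (x n) / ((m : ℂ) - n)‖ ≤ π * ∑ m ∈ s, ‖x m‖ ^ 2 := by
  set F : ℝ → ℂ := fun t => ∑ m ∈ s, x m * Complex.exp ((m : ℝ) * t * I) with hF
  have hFc : Continuous F := by fun_prop
  have hsq : ∀ t, ((‖F t‖ ^ 2 : ℝ) : ℂ) = ∑ m ∈ s, ∑ n ∈ s, x m * conj (x n) *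
      Complex.exp (((m - n : ℤ) : ℂ) * I * t) := by
    intro t
    rw [hF, normSq_sum_mul_exp s x (fun m => m)]
    simp
  have h1 : ∫ t in (0:ℝ)..2 * π, ((‖F t‖ ^ 2 : ℝ) : ℂ) = ((2 * π * ∑ m ∈ s, ‖x m‖ ^ 2 : ℝ) : ℂ) := by
    simp_rw [hsq]
    rw [intervalIntegral.integral_finsetSum
      (fun i _ => Continuous.intervalIntegrable (by fun_prop) _ _)]
    rw [Complex.ofReal_mul, Complex.ofReal_sum, Finset.mul_sum]
    refine Finset.sum_congr rfl fun m hm => ?_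
    rw [intervalIntegral.integral_finsetSum
      (fun i _ => Continuous.intervalIntegrable (by fun_prop) _ _)]
    simp_rw [intervalIntegral.integral_const_mul, integral_exp_int_mul]
    rw [Finset.sum_eq_single_of_mem m hm]
    · simp only [sub_self, if_true]
      rw [Complex.mul_conj']; push_cast; ring
    · intro n _ hn
      rw [if_neg (by omega), Complex.ofReal_zero, mul_zero]
  have h2 : ∫ t in (0:ℝ)..2 * π, (((π - t) * ‖F t‖ ^ 2 : ℝ) : ℂ) =
      2 * π * I * ∑ m ∈ s, ∑ n ∈ s, x m * conj (x n) / ((m : ℂ) - n) := by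
    have : ∀ t : ℝ, (((π - t) * ‖F t‖ ^ 2 : ℝ) : ℂ) = ∑ m ∈ s, ∑ n ∈ s, x m * conj (x n) *
      (((π - t : ℝ) : ℂ) * Complex.exp (((m - n : ℤ) : ℂ) * I * t)) := by
      intro t
      rw [Complex.ofReal_mul, hsq, Finset.mul_sum]
      refine Finset.sum_congr rfl fun m _ => ?_
      rw [Finset.mul_sum]
      refine Finset.sum_congr rfl fun n _ => ?_
      ring
    simp_rw [this]
    rw [intervalIntegral.integral_finsetSum
      (fun i _ => Continuous.intervalIntegrable (by fun_prop) _ _), Finset.mul_sum]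
    refine Finset.sum_congr rfl fun m hm => ?_
    rw [intervalIntegral.integral_finsetSum
      (fun i _ => Continuous.intervalIntegrable (by fun_prop) _ _), Finset.mul_sum]
    refine Finset.sum_congr rfl fun n hn => ?_
    rw [intervalIntegral.integral_const_mul, integral_sub_mul_exp_int]
    push_cast
    ring
  have h1' : ∫ t in (0:ℝ)..2 * π, ‖F t‖ ^ 2 = 2 * π * ∑ m ∈ s, ‖x m‖ ^ 2 := by
    rw [intervalIntegral.integral_ofReal] at h1
    exact_mod_cast h1
  have h3 : ‖∫ t in (0:ℝ)..2 * π, (((π - t) * ‖F t‖ ^ 2 : ℝ) : ℂ)‖ ≤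
      ∫ t in (0:ℝ)..2 * π, π * ‖F t‖ ^ 2 := by
    refine intervalIntegral.norm_integral_le_of_norm_le (by positivity)
      (ae_of_all _ fun t ht => ?_) (Continuous.intervalIntegrable (by fun_prop) _ _)
    rw [Complex.norm_real, norm_mul, norm_pow, norm_norm]
    gcongr
    rw [Real.norm_eq_abs, abs_le]
    constructor <;> linarith [ht.1, ht.2]
  rw [h2, intervalIntegral.integral_const_mul, h1', norm_mul, norm_mul, norm_mul] at h3
  simp only [Complex.norm_I, Complex.norm_real, mul_one, Complex.norm_ofNat,
    Real.norm_of_nonneg Real.pi_pos.le] at h3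
  have h4 : 2 * π * ‖∑ m ∈ s, ∑ n ∈ s, x m * conj (x n) / ((m : ℂ) - n)‖ ≤
      2 * π * (π * ∑ m ∈ s, ‖x m‖ ^ 2) := by linarith
  exact le_of_mul_le_mul_left h4 (by positivity)

lemma abs_inv_sub_inv_sinh_le_of_pos {u : ℝ} (hu : 0 < u) : |1 / u - 1 / Real.sinh u| ≤ 1 := by
  have h0 : 0 < Real.sinh u := Real.sinh_pos_iff.2 hu
  have h1 : u ≤ Real.sinh u := Real.self_le_sinh_iff.2 hu.le
  have h2 : Real.sinh u ≤ u + u * Real.sinh u := by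
    rcases le_or_gt 1 u with h | h
    · nlinarith
    · have a1 : Real.sinh u * (1 - u) ≤ Real.sinh u * Real.exp (-u) := by
        gcongr; linarith [Real.add_one_le_exp (-u)]
      have a2 : Real.sinh u * Real.exp (-u) = (1 - Real.exp (-(2 * u))) / 2 := by
        rw [Real.sinh_eq, show -(2 * u) = -u + -u by ring, Real.exp_add]
        have : Real.exp u * Real.exp (-u) = 1 := by rw [← Real.exp_add]; simp
        linear_combination this / 2
      linarith [Real.add_one_le_exp (-(2 * u))]
  have e : 1 / u - 1 / Real.sinh u = (Real.sinh u - u) / (u * Real.sinh u) := by field_simp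
  rw [e, abs_of_nonneg (div_nonneg (by linarith) (by positivity)), div_le_one (by positivity)]
  linarith

lemma abs_inv_sub_inv_sinh_le (u : ℝ) : |1 / u - 1 / Real.sinh u| ≤ 1 := by
  rcases lt_trichotomy u 0 with h | h | h
  · have := abs_inv_sub_inv_sinh_le_of_pos (neg_pos.2 h)
    rw [Real.sinh_neg] at this
    rw [← abs_neg]
    convert this using 2
    rw [div_neg, div_neg]; ring
  · simp [h]
  · exact abs_inv_sub_inv_sinh_le_of_pos h

lemma abs_inv_log_sub_log_sub_le {m n : ℕ} (hm : 0 < m) (hn : 0 < n) :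
    |1 / (Real.log m - Real.log n) - √m * √n / ((m:ℝ) - n)| ≤ 1 / 2 := by
  have hm' : (0:ℝ) < m := by exact_mod_cast hm
  have hn' : (0:ℝ) < n := by exact_mod_cast hn
  have h := abs_inv_sub_inv_sinh_le ((Real.log m - Real.log n) / 2)
  have e1 : ∀ k : ℝ, 0 < k → Real.exp (Real.log k / 2) = √k := fun k hk => by
    rw [Real.sqrt_eq_rpow, Real.rpow_def_of_pos hk]; congr 1; ring
  have e : Real.sinh ((Real.log m - Real.log n) / 2) = ((m:ℝ) - n) / (2 * (√m * √n)) := by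
    have h1 : 0 < √(m:ℝ) := Real.sqrt_pos.2 hm'
    have h2 : 0 < √(n:ℝ) := Real.sqrt_pos.2 hn'
    rw [Real.sinh_eq, sub_div (Real.log m), neg_sub, Real.exp_sub, Real.exp_sub, e1 _ hm', e1 _ hn']
    field_simp
    rw [Real.sq_sqrt hm'.le, Real.sq_sqrt hn'.le]
  rw [e] at h
  have e2 : 1 / (Real.log m - Real.log n) - √m * √n / ((m:ℝ) - n) =
      (1 / ((Real.log m - Real.log n) / 2) - 1 / (((m:ℝ) - n) / (2 * (√m * √n)))) / 2 := by
    rw [one_div_div, one_div_div]; ring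
  rw [e2, abs_div, abs_two]
  linarith

lemma norm_sum_sum_div_log_sub_le (s : Finset ℕ) (hs : ∀ n ∈ s, 0 < n) (x : ℕ → ℂ) :
    ‖∑ m ∈ s, ∑ n ∈ s, x m * conj (x n) / ((Real.log m - Real.log n : ℝ) : ℂ)‖ ≤
      π * ∑ m ∈ s, m * ‖x m‖ ^ 2 + (∑ m ∈ s, ‖x m‖) ^ 2 / 2 := by
  have h1 := norm_sum_sum_div_sub_le s (fun m => (√m : ℝ) * x m)
  have e1 : ∀ m : ℕ, ‖((√m : ℝ) : ℂ) * x m‖ ^ 2 = m * ‖x m‖ ^ 2 := fun m => by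
    rw [norm_mul, mul_pow, Complex.norm_real, Real.norm_of_nonneg (Real.sqrt_nonneg _),
      Real.sq_sqrt (Nat.cast_nonneg m)]
  simp_rw [e1] at h1
  have h2 : ‖∑ m ∈ s, ∑ n ∈ s, x m * conj (x n) / ((Real.log m - Real.log n : ℝ) : ℂ) -
      ∑ m ∈ s, ∑ n ∈ s, ((√m : ℝ) : ℂ) * x m * conj (((√n : ℝ) : ℂ) * x n) / ((m : ℂ) - n)‖ ≤
      (∑ m ∈ s, ‖x m‖) ^ 2 / 2 := by
    rw [← Finset.sum_sub_distrib, sq, Finset.sum_mul_sum, Finset.sum_div]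
    refine norm_sum_le_of_le _ fun m hm => ?_
    rw [← Finset.sum_sub_distrib, Finset.sum_div]
    refine norm_sum_le_of_le _ fun n hn => ?_
    have e : x m * conj (x n) / ((Real.log m - Real.log n : ℝ) : ℂ) -
        ((√m : ℝ) : ℂ) * x m * conj (((√n : ℝ) : ℂ) * x n) / ((m : ℂ) - n) =
        x m * conj (x n) * ((1 / (Real.log m - Real.log n) - √m * √n / ((m:ℝ) - n) : ℝ) : ℂ) := by
      push_cast [map_mul, Complex.conj_ofReal]; ring
    rw [e, norm_mul, norm_mul, RCLike.norm_conj, Complex.norm_real, div_eq_mul_one_div (‖x m‖ * ‖x n‖)]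
    refine mul_le_mul_of_nonneg_left ?_ (by positivity)
    exact abs_inv_log_sub_log_sub_le (hs m hm) (hs n hn)
  have h3 := norm_sub_norm_le (∑ m ∈ s, ∑ n ∈ s, x m * conj (x n) /
    ((Real.log m - Real.log n : ℝ) : ℂ))
    (∑ m ∈ s, ∑ n ∈ s, ((√m : ℝ) : ℂ) * x m * conj (((√n : ℝ) : ℂ) * x n) / ((m : ℂ) - n))
  linarith

/-- Mean value theorem for Dirichlet polynomials. -/
theorem abs_integral_normSq_sub_le (s : Finset ℕ) (hs : ∀ n ∈ s, 0 < n) (a : ℕ → ℂ) (x y : ℝ) :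
    |(∫ t in x..y, ‖∑ n ∈ s, a n * (n : ℂ) ^ (-(t * I))‖ ^ 2) - (y - x) * ∑ n ∈ s, ‖a n‖ ^ 2| ≤
      2 * π * ∑ n ∈ s, n * ‖a n‖ ^ 2 + (∑ n ∈ s, ‖a n‖) ^ 2 := by
  have hexp : ∀ n ∈ s, ∀ t : ℝ, (n : ℂ) ^ (-(t * I)) =
      Complex.exp ((-Real.log n : ℝ) * t * I) := fun n hn t => by
    have hn0 := hs n hn
    rw [Complex.cpow_def_of_ne_zero (by exact_mod_cast hn0.ne'), ← Complex.natCast_log]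
    congr 1; push_cast; ring
  have hA : ∀ t : ℝ, ∑ n ∈ s, a n * (n : ℂ) ^ (-(t * I)) =
      ∑ n ∈ s, a n * Complex.exp ((-Real.log n : ℝ) * t * I) := fun t =>
    Finset.sum_congr rfl fun n hn => by rw [hexp n hn]
  simp_rw [hA]
  set B : ℝ → ℂ := fun v => ∑ m ∈ s, ∑ n ∈ s,
    (a m * Complex.exp ((-Real.log m : ℝ) * v * I)) *
    conj (a n * Complex.exp ((-Real.log n : ℝ) * v * I)) / ((Real.log m - Real.log n : ℝ) : ℂ) with hB
  have hBb : ∀ v, ‖B v‖ ≤ π * ∑ m ∈ s, m * ‖a m‖ ^ 2 + (∑ m ∈ s, ‖a m‖) ^ 2 / 2 := by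
    intro v
    have := norm_sum_sum_div_log_sub_le s hs
      (fun m => a m * Complex.exp ((-Real.log m : ℝ) * v * I))
    have e : ∀ m : ℕ, ‖a m * Complex.exp ((-Real.log m : ℝ) * v * I)‖ = ‖a m‖ := fun m => by
      rw [norm_mul, ← Complex.ofReal_mul, Complex.norm_exp_ofReal_mul_I, mul_one]
    simp_rw [e] at this
    exact this
  have hintegral : ∀ m ∈ s, ∀ n ∈ s, ∫ t in x..y, Complex.exp (((-Real.log m : ℝ) - (-Real.log n : ℝ)) * I * t) =
      (if m = n then ((y - x : ℝ) : ℂ) else 0) + I *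
      (Complex.exp ((-Real.log m : ℝ) * y * I) * conj (Complex.exp ((-Real.log n : ℝ) * y * I)) -
       Complex.exp ((-Real.log m : ℝ) * x * I) * conj (Complex.exp ((-Real.log n : ℝ) * x * I))) /
      ((Real.log m - Real.log n : ℝ) : ℂ) := by
    intro m hm n hn
    split_ifs with h
    · subst h; simp
    · have hl : Real.log m - Real.log n ≠ 0 := by
        rw [sub_ne_zero]
        intro h'
        exact h (by exact_mod_cast Real.log_injOn_pos (by simpa using hs m hm) (by simpa using hs n hn) h')
      have hl' : ((Real.log m - Real.log n : ℝ) : ℂ) ≠ 0 := by exact_mod_cast hl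
      have e0 : ((-Real.log m : ℝ) : ℂ) - (-Real.log n : ℝ) = -((Real.log m - Real.log n : ℝ) : ℂ) := by
        push_cast; ring
      have e1 : ∀ v : ℝ, Complex.exp ((-Real.log m : ℝ) * v * I) *
          conj (Complex.exp ((-Real.log n : ℝ) * v * I)) =
          Complex.exp (-((Real.log m - Real.log n : ℝ) : ℂ) * I * v) := fun v => by
        rw [← Complex.exp_conj, ← Complex.exp_add]; congr 1
        simp only [map_mul, Complex.conj_ofReal, Complex.conj_I]; push_cast; ring
      rw [e0, integral_exp_mul_complex (mul_ne_zero (neg_ne_zero.2 hl') I_ne_zero), e1, e1]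
      generalize Complex.exp (-((Real.log m - Real.log n : ℝ) : ℂ) * I * y) = p
      generalize Complex.exp (-((Real.log m - Real.log n : ℝ) : ℂ) * I * x) = q
      rw [zero_add, div_eq_div_iff (mul_ne_zero (neg_ne_zero.2 hl') I_ne_zero) hl']
      linear_combination ((p - q) * ((Real.log m - Real.log n : ℝ) : ℂ)) * I_sq
  have hmain : ((∫ t in x..y, ‖∑ n ∈ s, a n * Complex.exp ((-Real.log n : ℝ) * t * I)‖ ^ 2 : ℝ) : ℂ)
      - ((y - x) * ∑ n ∈ s, ‖a n‖ ^ 2 : ℝ) = I * (B y - B x) := by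
    rw [← intervalIntegral.integral_ofReal]
    simp_rw [normSq_sum_mul_exp s a (fun m => -Real.log m)]
    rw [intervalIntegral.integral_finsetSum
      (fun i _ => Continuous.intervalIntegrable (by fun_prop) _ _), Complex.ofReal_mul,
      Complex.ofReal_sum, Finset.mul_sum, hB, ← Finset.sum_sub_distrib, ← Finset.sum_sub_distrib,
      Finset.mul_sum]
    refine Finset.sum_congr rfl fun m hm => ?_
    rw [intervalIntegral.integral_finsetSum
      (fun i _ => Continuous.intervalIntegrable (by fun_prop) _ _)]
    simp_rw [intervalIntegral.integral_const_mul]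
    rw [Finset.sum_congr rfl fun n hn => by rw [hintegral m hm n hn], ← Finset.sum_sub_distrib,
      Finset.mul_sum]
    have e2 : ((y - x : ℝ) : ℂ) * ((‖a m‖ ^ 2 : ℝ) : ℂ) =
        ∑ n ∈ s, a m * conj (a n) * (if m = n then ((y - x : ℝ) : ℂ) else 0) := by
      rw [Finset.sum_eq_single_of_mem m hm]
      · rw [if_pos rfl, Complex.mul_conj']; push_cast; ring
      · intro n _ hn; rw [if_neg (Ne.symm hn), mul_zero]
    rw [e2, ← Finset.sum_sub_distrib]
    refine Finset.sum_congr rfl fun n hn => ?_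
    rw [map_mul, map_mul]
    ring
  rw [← Complex.ofReal_sub] at hmain
  rw [← Real.norm_eq_abs, ← Complex.norm_real, hmain, norm_mul, Complex.norm_I, one_mul]
  refine (norm_sub_le _ _).trans ?_
  linarith [hBb x, hBb y]

lemma card_divisors_eq (n : ℕ) : n.divisors.card = n.divisorsAntidiagonal.card := by
  rw [← Nat.map_div_right_divisors, Finset.card_map]

lemma card_divisors_mul_le (m n : ℕ) :
    (m * n).divisors.card ≤ m.divisors.card * n.divisors.card := by
  rw [Nat.divisors_mul]; exact Finset.card_mul_le

/-- Fourth power mean value of a Dirichlet polynomial. -/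
theorem integral_norm_pow_four_le (s : Finset ℕ) (hs : ∀ n ∈ s, 0 < n) (a : ℕ → ℂ) {x y : ℝ}
    (hxy : x ≤ y) :
    ∫ t in x..y, ‖∑ n ∈ s, a n * (n : ℂ) ^ (-(t * I))‖ ^ 4 ≤
      (y - x) * (∑ n ∈ s, n.divisors.card * ‖a n‖ ^ 2) ^ 2 +
      7 * (∑ n ∈ s, n.divisors.card * (n * ‖a n‖ ^ 2)) ^ 2 + (∑ n ∈ s, ‖a n‖) ^ 4 := by
  classical
  set r : Finset ℕ := (s ×ˢ s).image fun p => p.1 * p.2 with hr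
  have hmaps : ∀ p ∈ s ×ˢ s, p.1 * p.2 ∈ r := fun p hp => Finset.mem_image_of_mem _ hp
  set c : ℕ → ℂ := fun k => ∑ p ∈ s ×ˢ s with p.1 * p.2 = k, a p.1 * a p.2 with hc
  have hrpos : ∀ k ∈ r, 0 < k := by
    intro k hk
    obtain ⟨p, hp, rfl⟩ := Finset.mem_image.1 hk
    rw [Finset.mem_product] at hp
    exact Nat.mul_pos (hs _ hp.1) (hs _ hp.2)
  have hsq : ∀ t : ℝ, (∑ n ∈ s, a n * (n : ℂ) ^ (-(t * I))) ^ 2 =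
      ∑ k ∈ r, c k * (k : ℂ) ^ (-(t * I)) := by
    intro t
    rw [sq, Finset.sum_mul_sum, ← Finset.sum_product', ← Finset.sum_fiberwise_of_maps_to hmaps]
    refine Finset.sum_congr rfl fun k _ => ?_
    rw [hc, Finset.sum_mul]
    refine Finset.sum_congr rfl fun p hp => ?_
    rw [Finset.mem_filter] at hp
    rw [← hp.2, Nat.cast_mul, Complex.natCast_mul_natCast_cpow]
    ring
  have hcsq : ∀ k ∈ r, ‖c k‖ ^ 2 ≤ ∑ p ∈ s ×ˢ s with p.1 * p.2 = k,
      (k.divisors.card : ℝ) * (‖a p.1‖ ^ 2 * ‖a p.2‖ ^ 2) := by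
    intro k hk
    have h1 : ‖c k‖ ≤ ∑ p ∈ s ×ˢ s with p.1 * p.2 = k, ‖a p.1 * a p.2‖ := norm_sum_le _ _
    have h2 := sq_sum_le_card_mul_sum_sq (s := (s ×ˢ s).filter fun p => p.1 * p.2 = k)
      (f := fun p => ‖a p.1 * a p.2‖)
    have h3 : ((s ×ˢ s).filter fun p => p.1 * p.2 = k).card ≤ k.divisors.card := by
      rw [card_divisors_eq]
      refine Finset.card_le_card fun p hp => ?_
      rw [Finset.mem_filter] at hp
      rw [Nat.mem_divisorsAntidiagonal]
      exact ⟨hp.2, (hrpos k hk).ne'⟩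
    rw [← Finset.mul_sum]
    calc ‖c k‖ ^ 2 ≤ (∑ p ∈ s ×ˢ s with p.1 * p.2 = k, ‖a p.1 * a p.2‖) ^ 2 := by gcongr
      _ ≤ _ := h2
      _ ≤ (k.divisors.card : ℝ) * ∑ p ∈ s ×ˢ s with p.1 * p.2 = k, ‖a p.1 * a p.2‖ ^ 2 := by
          gcongr
      _ = _ := by simp_rw [norm_mul, mul_pow]
  have hw : ∀ w : ℕ → ℝ, (∀ n, 0 ≤ w n) → (∀ m n, w (m * n) = w m * w n) →
      ∑ k ∈ r, w k * ‖c k‖ ^ 2 ≤ (∑ n ∈ s, n.divisors.card * (w n * ‖a n‖ ^ 2)) ^ 2 := by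
    intro w hw0 hwm
    rw [sq, Finset.sum_mul_sum, ← Finset.sum_product', ← Finset.sum_fiberwise_of_maps_to hmaps]
    refine Finset.sum_le_sum fun k hk => ?_
    refine (mul_le_mul_of_nonneg_left (hcsq k hk) (hw0 k)).trans ?_
    rw [Finset.mul_sum]
    refine Finset.sum_le_sum fun p hp => ?_
    rw [Finset.mem_filter] at hp
    rw [← hp.2, hwm]
    have hd : ((p.1 * p.2).divisors.card : ℝ) ≤ p.1.divisors.card * p.2.divisors.card := by
      exact_mod_cast card_divisors_mul_le _ _
    calc w p.1 * w p.2 * (((p.1 * p.2).divisors.card : ℝ) * (‖a p.1‖ ^ 2 * ‖a p.2‖ ^ 2))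
        ≤ w p.1 * w p.2 * ((p.1.divisors.card * p.2.divisors.card) * (‖a p.1‖ ^ 2 * ‖a p.2‖ ^ 2)) := by
          have := hw0 p.1; have := hw0 p.2
          gcongr
      _ = _ := by ring
  have hc1 : ∑ k ∈ r, ‖c k‖ ≤ (∑ n ∈ s, ‖a n‖) ^ 2 := by
    rw [sq, Finset.sum_mul_sum, ← Finset.sum_product', ← Finset.sum_fiberwise_of_maps_to hmaps]
    refine Finset.sum_le_sum fun k hk => (norm_sum_le _ _).trans (le_of_eq ?_)
    simp_rw [norm_mul]
  have e : ∀ t : ℝ, ‖∑ n ∈ s, a n * (n : ℂ) ^ (-(t * I))‖ ^ 4 =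
      ‖∑ k ∈ r, c k * (k : ℂ) ^ (-(t * I))‖ ^ 2 := fun t => by
    rw [← hsq, norm_pow, ← pow_mul]
  simp_rw [e]
  have hmv := (abs_le.1 (abs_integral_normSq_sub_le r hrpos c x y)).2
  have h1 := hw (fun _ => 1) (by simp) (by simp)
  have h2 := hw (fun n => n) (by simp) (by simp)
  simp only [one_mul] at h1
  have h3 : (∑ k ∈ r, ‖c k‖) ^ 2 ≤ (∑ n ∈ s, ‖a n‖) ^ 4 := by
    calc _ ≤ ((∑ n ∈ s, ‖a n‖) ^ 2) ^ 2 := by gcongr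
      _ = _ := by ring
  have h4 := mul_le_mul_of_nonneg_left h1 (sub_nonneg.2 hxy)
  have h5 : 2 * π * ∑ k ∈ r, k * ‖c k‖ ^ 2 ≤ 7 * ∑ k ∈ r, k * ‖c k‖ ^ 2 := by
    gcongr
    linarith [Real.pi_lt_d2]
  linarith

/-- Fourth power mean value for absolutely convergent Dirichlet series. -/
theorem integral_norm_tsum_pow_four_le {a : ℕ → ℂ} (h0 : a 0 = 0) (ha : Summable fun n => ‖a n‖)
    {x y P Q R : ℝ} (hxy : x ≤ y)
    (hP : ∀ N, ∑ n ∈ Finset.range N, (n.divisors.card : ℝ) * ‖a n‖ ^ 2 ≤ P)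
    (hQ : ∀ N, ∑ n ∈ Finset.range N, (n.divisors.card : ℝ) * (n * ‖a n‖ ^ 2) ≤ Q)
    (hR : ∀ N, ∑ n ∈ Finset.range N, ‖a n‖ ≤ R) :
    ∫ t in x..y, ‖∑' n, a n * (n : ℂ) ^ (-(t * I))‖ ^ 4 ≤ (y - x) * P ^ 2 + 7 * Q ^ 2 + R ^ 4 := by
  have hnorm : ∀ (t : ℝ) n, ‖a n * (n : ℂ) ^ (-(t * I))‖ ≤ ‖a n‖ := by
    intro t n
    rcases Nat.eq_zero_or_pos n with rfl | hn
    · simp [h0]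
    · rw [norm_mul, Complex.norm_natCast_cpow_of_pos hn]; simp
  have hsum : ∀ t : ℝ, Summable fun n => a n * (n : ℂ) ^ (-(t * I)) := fun t =>
    Summable.of_norm_bounded ha (hnorm t)
  have hrange : ∀ N (f : ℕ → ℂ) , f 0 = 0 → ∑ n ∈ Finset.range N, f n =
      ∑ n ∈ (Finset.range N).filter (0 < ·), f n := by
    intro N f hf
    refine (Finset.sum_filter_of_ne fun n _ hn => ?_).symm
    rcases Nat.eq_zero_or_pos n with rfl | hn'
    · exact absurd hf hn
    · exact hn'
  have hlim : Tendsto (fun N : ℕ => ∫ t in x..y,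
      ‖∑ n ∈ Finset.range N, a n * (n : ℂ) ^ (-(t * I))‖ ^ 4) atTop
      (nhds (∫ t in x..y, ‖∑' n, a n * (n : ℂ) ^ (-(t * I))‖ ^ 4)) := by
    refine intervalIntegral.tendsto_integral_filter_of_dominated_convergence (fun _ => R ^ 4) ?_ ?_
      (by simp) ?_
    · refine Eventually.of_forall fun N => Continuous.aestronglyMeasurable ?_
      refine Continuous.pow (Continuous.norm (continuous_finsetSum _ fun n _ => ?_)) 4
      rcases Nat.eq_zero_or_pos n with rfl | hn
      · simp only [h0, zero_mul]; exact continuous_const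
      · exact continuous_const.mul (Continuous.const_cpow (by fun_prop) (Or.inl (by exact_mod_cast hn.ne')))
    · refine Eventually.of_forall fun N => ae_of_all _ fun t _ => ?_
      rw [norm_pow, norm_norm]
      have : ‖∑ n ∈ Finset.range N, a n * (n : ℂ) ^ (-(t * I))‖ ≤ R :=
        (norm_sum_le_of_le _ fun n _ => hnorm t n).trans (hR N)
      gcongr
    · exact ae_of_all _ fun t _ => (((hsum t).hasSum.tendsto_sum_nat).norm).pow 4
  refine le_of_tendsto hlim (Eventually.of_forall fun N => ?_)
  have hsub : (Finset.range N).filter (0 < ·) ⊆ Finset.range N := Finset.filter_subset _ _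
  have e : ∀ t : ℝ, ∑ n ∈ Finset.range N, a n * (n : ℂ) ^ (-(t * I)) =
      ∑ n ∈ (Finset.range N).filter (0 < ·), a n * (n : ℂ) ^ (-(t * I)) := fun t =>
    hrange N _ (by simp [h0])
  simp_rw [e]
  refine (integral_norm_pow_four_le _ (fun n hn => (Finset.mem_filter.1 hn).2) a hxy).trans ?_
  have := sub_nonneg.2 hxy
  gcongr
  · exact (Finset.sum_le_sum_of_subset_of_nonneg hsub fun _ _ _ => by positivity).trans (hP N)
  · exact (Finset.sum_le_sum_of_subset_of_nonneg hsub fun _ _ _ => by positivity).trans (hQ N)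
  · exact (Finset.sum_le_sum_of_subset_of_nonneg hsub fun _ _ _ => by positivity).trans (hR N)

lemma sum_rpow_neg_le {ε : ℝ} (hε : 0 < ε) (N : ℕ) :
    ∑ n ∈ Finset.Icc 1 N, (n : ℝ) ^ (-(1 + ε)) ≤ 1 + 1 / ε := by
  have h : ∀ M : ℕ, ∑ n ∈ Finset.Icc 1 (M + 1), (n : ℝ) ^ (-(1 + ε)) ≤
      1 + (1 - ((M + 1 : ℕ) : ℝ) ^ (-ε)) / ε := by
    intro M
    induction M with
    | zero => simp
    | succ M ih =>
      rw [Finset.sum_Icc_succ_top (by omega)]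
      have h1 := rpow_neg_succ_add_le (k := ((M + 1 : ℕ) : ℝ)) (by positivity) hε
      have e : ((M + 1 + 1 : ℕ) : ℝ) = ((M + 1 : ℕ) : ℝ) + 1 := by push_cast; ring
      rw [e]
      set k := ((M + 1 : ℕ) : ℝ)
      have hk : 0 < k := by positivity
      have e2 : (k + 1) ^ (-(1 + ε)) = (k + 1) ^ (-ε) / (k + 1) := by
        rw [neg_add, add_comm (-1) (-ε), Real.rpow_add (by positivity), Real.rpow_neg_one, div_eq_mul_inv]
      rw [e2]
      have h2 : (k + 1) ^ (-ε) / (k + 1) ≤ (k ^ (-ε) - (k + 1) ^ (-ε)) / ε := by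
        rw [le_div_iff₀ hε]; linarith
      have e3 : (1 - (k + 1) ^ (-ε)) / ε = (1 - k ^ (-ε)) / ε + (k ^ (-ε) - (k + 1) ^ (-ε)) / ε := by
        ring
      linarith
  rcases N with _ | M
  · simp; positivity
  · refine (h M).trans ?_
    gcongr
    linarith [show (0:ℝ) ≤ ((M + 1 : ℕ) : ℝ) ^ (-ε) by positivity]

lemma sum_card_divisors_mul_rpow_neg_le {ε : ℝ} (hε : 0 < ε) (N : ℕ) :
    ∑ n ∈ Finset.Icc 1 N, (n.divisors.card : ℝ) * (n : ℝ) ^ (-(1 + ε)) ≤ (1 + 1 / ε) ^ 2 := by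
  have h1 : (∑ n ∈ Finset.Icc 1 N, (n : ℝ) ^ (-(1 + ε))) ^ 2 ≤ (1 + 1 / ε) ^ 2 := by
    have := sum_rpow_neg_le hε N
    have : 0 ≤ ∑ n ∈ Finset.Icc 1 N, (n : ℝ) ^ (-(1 + ε)) := by positivity
    gcongr
  refine le_trans ?_ h1
  rw [sq, Finset.sum_mul_sum, ← Finset.sum_product']
  refine le_trans (Finset.sum_le_sum fun n hn => ?_)
    (Finset.sum_fiberwise_le_sum_of_sum_fiber_nonneg (t := Finset.Icc 1 N)
      (g := fun p : ℕ × ℕ => p.1 * p.2) (fun _ _ => Finset.sum_nonneg fun _ _ => by positivity))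
  rw [Finset.mem_Icc] at hn
  rw [card_divisors_eq, ← nsmul_eq_mul, ← Finset.sum_const]
  have hsub : n.divisorsAntidiagonal ⊆ (Finset.Icc 1 N ×ˢ Finset.Icc 1 N).filter
      fun p => p.1 * p.2 = n := by
    intro p hp
    rw [Nat.mem_divisorsAntidiagonal] at hp
    have hp1 : 0 < p.1 := Nat.pos_of_ne_zero fun h => hp.2 (by rw [← hp.1, h, zero_mul])
    have hp2 : 0 < p.2 := Nat.pos_of_ne_zero fun h => hp.2 (by rw [← hp.1, h, mul_zero])
    simp only [Finset.mem_filter, Finset.mem_product, Finset.mem_Icc]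
    refine ⟨⟨⟨hp1, ?_⟩, hp2, ?_⟩, hp.1⟩
    · exact (Nat.le_mul_of_pos_right _ hp2).trans (hp.1.le.trans hn.2)
    · exact (Nat.le_mul_of_pos_left _ hp1).trans (hp.1.le.trans hn.2)
  refine le_trans (le_of_eq (Finset.sum_congr rfl fun p hp => ?_))
    (Finset.sum_le_sum_of_subset_of_nonneg hsub fun _ _ _ => by positivity)
  rw [Nat.mem_divisorsAntidiagonal] at hp
  rw [← hp.1, Nat.cast_mul, Real.mul_rpow (by positivity) (by positivity)]

lemma continuous_zeta_vertical {σ : ℝ} (hσ : σ ≠ 1) :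
    Continuous fun t : ℝ => riemannZeta (σ + t * I) := by
  refine continuous_iff_continuousAt.2 fun t => ?_
  refine ContinuousAt.comp (f := fun t : ℝ => (σ + t * I : ℂ)) (g := riemannZeta) ?_ (by fun_prop)
  refine (differentiableAt_riemannZeta fun h => hσ ?_).continuousAt
  simpa using congrArg Complex.re h

lemma exists_norm_zeta_sub_sum_le_dyadic : ∃ C : ℝ, 0 < C ∧ ∀ T σ t : ℝ, 4 ≤ T → 1/4 ≤ σ → σ ≤ 2 →
    T / 2 ≤ t → t ≤ 4 * T →
    ‖riemannZeta (σ + t * I) - ∑ n ∈ Finset.Icc 1 ⌈2 * T⌉₊,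
      (n : ℂ) ^ (-(σ:ℂ)) * (n : ℂ) ^ (-(t * I))‖ ≤ C * T ^ (-σ) := by
  obtain ⟨C, hC, h⟩ := exists_norm_zeta_sub_sum_le
  refine ⟨C + 8, by positivity, fun T σ t hT h1 h2 h3 h4 => ?_⟩
  set N := ⌈2 * T⌉₊ with hN
  have hN1 : 2 * T ≤ N := Nat.le_ceil _
  have hN2 : (N:ℝ) ≤ 4 * T := by
    have := Nat.ceil_lt_add_one (show 0 ≤ 2 * T by linarith)
    linarith
  have hNpos : 0 < N := by
    have : (0:ℝ) < N := by linarith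
    exact_mod_cast this
  have hre : ((σ : ℂ) + t * I).re = σ := by simp
  have him : ((σ : ℂ) + t * I).im = t := by simp
  have a1 := h (σ + t * I) N (by rwa [hre]) (by rwa [hre]) (by rw [him]; linarith) hNpos
    (by rw [him]; linarith)
  rw [hre] at a1
  have e : ∑ n ∈ Finset.Icc 1 N, (n : ℂ) ^ (-((σ:ℂ) + t * I)) =
      ∑ n ∈ Finset.Icc 1 N, (n : ℂ) ^ (-(σ:ℂ)) * (n : ℂ) ^ (-(t * I)) := by
    refine Finset.sum_congr rfl fun n hn => ?_
    rw [neg_add, Complex.cpow_add _ _ (by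
      have := (Finset.mem_Icc.1 hn).1; exact_mod_cast (by omega : n ≠ 0))]
  rw [e] at a1
  have a2 : (N:ℝ) ^ (-σ) ≤ T ^ (-σ) :=
    Real.rpow_le_rpow_of_nonpos (by linarith) (by linarith) (by linarith)
  have a3 : ‖(N : ℂ) ^ (1 - ((σ:ℂ) + t * I)) / (σ + t * I - 1)‖ ≤ 8 * T ^ (-σ) := by
    rw [norm_div, Complex.norm_natCast_cpow_of_pos hNpos]
    have e1 : (1 - ((σ:ℂ) + t * I)).re = 1 + -σ := by simp; ring
    rw [e1, Real.rpow_add (by positivity), Real.rpow_one]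
    have b1 : T / 2 ≤ ‖(σ:ℂ) + t * I - 1‖ := by
      refine h3.trans ((le_abs_self _).trans ?_)
      simpa using Complex.abs_im_le_norm ((σ:ℂ) + t * I - 1)
    calc _ ≤ (4 * T) * T ^ (-σ) / (T / 2) := by gcongr
      _ = _ := by field_simp; ring
  have e2 : ∀ z A B : ℂ, z - A = (z - A - B) + B := fun z A B => by ring
  rw [e2 _ _ ((N : ℂ) ^ (1 - ((σ:ℂ) + t * I)) / (σ + t * I - 1))]
  refine (norm_add_le _ _).trans ?_
  nlinarith

lemma sum_rpow_neg_half_le (N : ℕ) :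
    ∑ n ∈ Finset.Icc 1 N, (n : ℝ) ^ (-(1/2) : ℝ) ≤ 2 * √N := by
  induction N with
  | zero => simp
  | succ N ih =>
    rw [Finset.sum_Icc_succ_top (by omega)]
    have e : ((N + 1 : ℕ) : ℝ) ^ (-(1/2) : ℝ) = 1 / √((N + 1 : ℕ) : ℝ) := by
      rw [Real.rpow_neg (by positivity), ← Real.sqrt_eq_rpow, one_div]
    rw [e]
    push_cast
    have h1 : 0 < √((N:ℝ) + 1) := Real.sqrt_pos.2 (by positivity)
    have h2 : 0 ≤ √(N:ℝ) := Real.sqrt_nonneg _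
    have h3 := Real.sq_sqrt (show 0 ≤ (N:ℝ) + 1 by positivity)
    have h4 := Real.sq_sqrt (show 0 ≤ (N:ℝ) by positivity)
    have h5 : 1 / √((N:ℝ) + 1) ≤ 2 * √((N:ℝ) + 1) - 2 * √N := by
      rw [div_le_iff₀ h1]
      nlinarith [sq_nonneg (√((N:ℝ) + 1) - √N)]
    linarith

lemma abs_sum_inv_sub_log_le {N : ℕ} (hN : 0 < N) :
    |∑ n ∈ Finset.Icc 1 N, (n : ℝ)⁻¹ - Real.log N| ≤ 1 := by
  have h1 := log_add_one_le_harmonic N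
  have h2 := harmonic_le_one_add_log N
  have e : (harmonic N : ℝ) = ∑ n ∈ Finset.Icc 1 N, (n : ℝ)⁻¹ := by
    rw [harmonic_eq_sum_Icc]; push_cast; rfl
  rw [e] at h1 h2
  have h3 : Real.log N ≤ Real.log (N + 1 : ℕ) := by
    have : (0:ℝ) < N := by exact_mod_cast hN
    refine Real.log_le_log this ?_
    push_cast; linarith
  rw [abs_le]; constructor <;> linarith

/-- The Dirichlet polynomial approximating `ζ` near height `T`. -/
def zetaPoly (T σ t : ℝ) : ℂ :=
  ∑ n ∈ Finset.Icc 1 ⌈2 * T⌉₊, (n : ℂ) ^ (-(σ:ℂ)) * (n : ℂ) ^ (-(t * I))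

lemma continuous_zetaPoly (T σ : ℝ) : Continuous (zetaPoly T σ) := by
  refine continuous_finsetSum _ fun n hn => ?_
  have := (Finset.mem_Icc.1 hn).1
  exact continuous_const.mul (Continuous.const_cpow (by fun_prop)
    (Or.inl (by exact_mod_cast (by omega : n ≠ 0))))

lemma abs_integral_zetaPoly_sub_le (T σ x y : ℝ) :
    |(∫ t in x..y, ‖zetaPoly T σ t‖ ^ 2) - (y - x) * ∑ n ∈ Finset.Icc 1 ⌈2 * T⌉₊, (n:ℝ) ^ (-2 * σ)| ≤
      2 * π * ∑ n ∈ Finset.Icc 1 ⌈2 * T⌉₊, (n:ℝ) ^ (1 - 2 * σ) +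
      (∑ n ∈ Finset.Icc 1 ⌈2 * T⌉₊, (n:ℝ) ^ (-σ)) ^ 2 := by
  have hpos : ∀ n ∈ Finset.Icc 1 ⌈2 * T⌉₊, 0 < n := fun n hn => (Finset.mem_Icc.1 hn).1
  have h := abs_integral_normSq_sub_le (Finset.Icc 1 ⌈2 * T⌉₊) hpos
    (fun n => (n : ℂ) ^ (-(σ:ℂ))) x y
  have e1 : ∀ n ∈ Finset.Icc 1 ⌈2 * T⌉₊, ‖(n : ℂ) ^ (-(σ:ℂ))‖ = (n:ℝ) ^ (-σ) := fun n hn => by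
    rw [Complex.norm_natCast_cpow_of_pos (hpos n hn)]; simp
  have e2 : ∀ n ∈ Finset.Icc 1 ⌈2 * T⌉₊, ‖(n : ℂ) ^ (-(σ:ℂ))‖ ^ 2 = (n:ℝ) ^ (-2 * σ) := fun n hn => by
    rw [e1 n hn, ← Real.rpow_natCast, ← Real.rpow_mul (by positivity)]; congr 1; push_cast; ring
  have e3 : ∀ n ∈ Finset.Icc 1 ⌈2 * T⌉₊, (n:ℝ) * ‖(n : ℂ) ^ (-(σ:ℂ))‖ ^ 2 = (n:ℝ) ^ (1 - 2 * σ) :=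
    fun n hn => by
    have := hpos n hn
    rw [e2 n hn, show 1 - 2 * σ = 1 + -2 * σ by ring, Real.rpow_add (by positivity), Real.rpow_one]
  rw [Finset.sum_congr rfl e1, Finset.sum_congr rfl e2, Finset.sum_congr rfl e3] at h
  exact h

lemma exists_integral_zetaPoly_half_le : ∃ C : ℝ, 0 < C ∧ ∀ T : ℝ, 4 ≤ T →
    |(∫ t in T..2 * T, ‖zetaPoly T (1/2) t‖ ^ 2) - T * Real.log T| ≤ C * T := by
  refine ⟨100, by positivity, fun T hT => ?_⟩
  have h := abs_integral_zetaPoly_sub_le T (1/2) T (2 * T)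
  set N := ⌈2 * T⌉₊ with hN
  have hN1 : 2 * T ≤ N := Nat.le_ceil _
  have hN2 : (N:ℝ) ≤ 4 * T := by
    have := Nat.ceil_lt_add_one (show 0 ≤ 2 * T by linarith)
    linarith
  have hNpos : 0 < N := by
    have : (0:ℝ) < N := by linarith
    exact_mod_cast this
  have e1 : ∑ n ∈ Finset.Icc 1 N, (n:ℝ) ^ (-2 * (1/2) : ℝ) = ∑ n ∈ Finset.Icc 1 N, (n:ℝ)⁻¹ :=
    Finset.sum_congr rfl fun n _ => by
      rw [show (-2 * (1/2) : ℝ) = -1 by norm_num, Real.rpow_neg_one]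
  have e2 : ∑ n ∈ Finset.Icc 1 N, (n:ℝ) ^ (1 - 2 * (1/2) : ℝ) = N := by simp
  rw [e1, e2] at h
  have h1 := sum_rpow_neg_half_le N
  have h2 : (∑ n ∈ Finset.Icc 1 N, (n:ℝ) ^ (-(1/2) : ℝ)) ^ 2 ≤ (2 * √N) ^ 2 := by gcongr
  rw [mul_pow, Real.sq_sqrt (Nat.cast_nonneg N)] at h2
  have h3 := abs_sum_inv_sub_log_le hNpos
  have h4 : |Real.log N - Real.log T| ≤ 2 := by
    have hT0 : (0:ℝ) < T := by linarith
    have a1 : Real.log T ≤ Real.log N := Real.log_le_log hT0 (by linarith)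
    have a2 : Real.log N ≤ Real.log (4 * T) := Real.log_le_log (by linarith) hN2
    rw [Real.log_mul (by norm_num) hT0.ne', show (4:ℝ) = 2 * 2 by norm_num,
      Real.log_mul (by norm_num) (by norm_num)] at a2
    have := Real.log_two_lt_d9
    rw [abs_le]; constructor <;> linarith
  have h5 : 2 * π * N ≤ 8 * (4 * T) := by nlinarith [Real.pi_lt_d2, Real.pi_pos]
  set J := ∫ t in T..2 * T, ‖zetaPoly T (1/2) t‖ ^ 2
  set H := ∑ n ∈ Finset.Icc 1 N, (n:ℝ)⁻¹
  rw [abs_le] at h h3 h4 ⊢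
  constructor <;> nlinarith

lemma exists_integral_normSq_zeta_dyadic : ∃ C : ℝ, 0 < C ∧ ∀ T : ℝ, 4 ≤ T →
    |(∫ t in T..2 * T, ‖riemannZeta (1/2 + t * I)‖ ^ 2) - T * Real.log T| ≤ C * T := by
  obtain ⟨C₁, hC₁, h₁⟩ := exists_norm_zeta_sub_sum_le_dyadic
  obtain ⟨C₂, hC₂, h₂⟩ := exists_integral_zetaPoly_half_le
  refine ⟨C₂ + (1 + C₂) + 2 * C₁ ^ 2, by positivity, fun T hT => ?_⟩
  have hT0 : 0 < T := by linarith
  have hL : 1 ≤ Real.log T := by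
    rw [Real.le_log_iff_exp_le hT0]; linarith [Real.exp_one_lt_d9]
  have hLT : Real.log T ≤ T := (Real.log_le_sub_one_of_pos hT0).trans (by linarith)
  set L := Real.log T with hLdef
  have hc1 : Continuous fun t : ℝ => ‖riemannZeta (1/2 + t * I)‖ ^ 2 := by
    have := continuous_zeta_vertical (σ := 1/2) (by norm_num)
    push_cast at this
    exact this.norm.pow 2
  have hc2 : Continuous fun t : ℝ => ‖zetaPoly T (1/2) t‖ ^ 2 := (continuous_zetaPoly T _).norm.pow 2
  have hpt : ∀ t ∈ Icc T (2 * T), |‖riemannZeta (1/2 + t * I)‖ ^ 2 - ‖zetaPoly T (1/2) t‖ ^ 2| ≤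
      ‖zetaPoly T (1/2) t‖ ^ 2 / L + 2 * L * C₁ ^ 2 / T := by
    intro t ht
    have a := h₁ T (1/2) t hT (by norm_num) (by norm_num) (by linarith [ht.1]) (by linarith [ht.2])
    rw [← zetaPoly] at a
    push_cast at a
    set z := riemannZeta (1/2 + t * I)
    set A := zetaPoly T (1/2) t
    have hsq : (C₁ * T ^ (-(1/2) : ℝ)) ^ 2 = C₁ ^ 2 / T := by
      rw [mul_pow, ← Real.rpow_natCast (T ^ (-(1/2) : ℝ)), ← Real.rpow_mul hT0.le]
      norm_num [Real.rpow_neg_one, div_eq_mul_inv]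
    have b1 : ‖z - A‖ ^ 2 ≤ C₁ ^ 2 / T := by rw [← hsq]; gcongr
    have b2 := abs_norm_sub_norm_le z A
    set d := ‖z‖ - ‖A‖ with hd
    have b3 : d ^ 2 ≤ C₁ ^ 2 / T := by
      rw [← sq_abs]; exact (by gcongr : |d| ^ 2 ≤ ‖z - A‖ ^ 2).trans b1
    have e : ‖z‖ ^ 2 - ‖A‖ ^ 2 = 2 * ‖A‖ * d + d ^ 2 := by rw [hd]; ring
    have b4 : |2 * ‖A‖ * d| ≤ ‖A‖ ^ 2 / L + L * d ^ 2 := by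
      have hL0 : 0 < L := by linarith
      have e1 : ‖A‖ ^ 2 / L + L * d ^ 2 - 2 * ‖A‖ * |d| = (‖A‖ - L * |d|) ^ 2 / L := by
        rw [← sq_abs d]; field_simp; ring
      rw [abs_mul, abs_of_nonneg (by positivity)]
      have : 0 ≤ (‖A‖ - L * |d|) ^ 2 / L := by positivity
      linarith
    rw [e]
    refine (abs_add_le _ _).trans ?_
    rw [abs_of_nonneg (sq_nonneg d)]
    have b5 : L * d ^ 2 + d ^ 2 ≤ 2 * L * (C₁ ^ 2 / T) := by nlinarith [sq_nonneg d]
    have : 2 * L * (C₁ ^ 2 / T) = 2 * L * C₁ ^ 2 / T := by ring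
    linarith
  have hdiff : |(∫ t in T..2 * T, ‖riemannZeta (1/2 + t * I)‖ ^ 2) -
      ∫ t in T..2 * T, ‖zetaPoly T (1/2) t‖ ^ 2| ≤
      (∫ t in T..2 * T, ‖zetaPoly T (1/2) t‖ ^ 2) / L + 2 * L * C₁ ^ 2 := by
    rw [← intervalIntegral.integral_sub (hc1.intervalIntegrable _ _) (hc2.intervalIntegrable _ _)]
    have := intervalIntegral.norm_integral_le_of_norm_le (μ := volume) (a := T) (b := 2 * T)
      (f := fun t => ‖riemannZeta (1/2 + t * I)‖ ^ 2 - ‖zetaPoly T (1/2) t‖ ^ 2)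
      (g := fun t => ‖zetaPoly T (1/2) t‖ ^ 2 / L + 2 * L * C₁ ^ 2 / T) (by linarith)
      (ae_of_all _ fun t ht => hpt t (Ioc_subset_Icc_self ht))
      (((hc2.div_const L).add continuous_const).intervalIntegrable _ _)
    rw [Real.norm_eq_abs] at this
    refine this.trans (le_of_eq ?_)
    rw [intervalIntegral.integral_add ((hc2.div_const L).intervalIntegrable _ _)
      (continuous_const.intervalIntegrable _ _), intervalIntegral.integral_div,
      intervalIntegral.integral_const, smul_eq_mul]
    field_simp; ring
  have hA := h₂ T hT
  set J := ∫ t in T..2 * T, ‖zetaPoly T (1/2) t‖ ^ 2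
  set W := ∫ t in T..2 * T, ‖riemannZeta (1/2 + t * I)‖ ^ 2
  have hJ : J / L ≤ (1 + C₂) * T := by
    rw [div_le_iff₀ (by linarith)]
    nlinarith [(abs_le.1 hA).2, mul_pos hC₂ hT0]
  have e : W - T * L = (W - J) + (J - T * L) := by ring
  rw [e]
  refine (abs_add_le _ _).trans ?_
  nlinarith [sq_nonneg C₁]

/-- The second moment of `ζ` on the critical line. -/
theorem exists_integral_normSq_zeta_sub_le : ∃ C : ℝ, 0 < C ∧ ∀ T : ℝ, 1 ≤ T →
    |(∫ t in (1:ℝ)..T, ‖riemannZeta (1/2 + t * I)‖ ^ 2) - T * Real.log T| ≤ C * T := by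
  obtain ⟨C, hC, h⟩ := exists_integral_normSq_zeta_dyadic
  have hc1 : Continuous fun t : ℝ => ‖riemannZeta (1/2 + t * I)‖ ^ 2 := by
    have := continuous_zeta_vertical (σ := 1/2) (by norm_num)
    push_cast at this
    exact this.norm.pow 2
  set E : ℝ → ℝ := fun T => (∫ t in (1:ℝ)..T, ‖riemannZeta (1/2 + t * I)‖ ^ 2) - T * Real.log T with hE
  have hEc : Continuous E := by
    refine (intervalIntegral.continuous_primitive (fun a b => hc1.intervalIntegrable a b) 1).sub ?_
    exact Real.continuous_mul_log
  obtain ⟨B, hB⟩ := (isCompact_Icc (a := (1:ℝ)) (b := 8)).exists_bound_of_continuousOn hEc.continuousOn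
  have hB0 : 0 ≤ B := (norm_nonneg _).trans (hB 1 (by norm_num))
  have key : ∀ n : ℕ, ∀ T : ℝ, 1 ≤ T → T ≤ 8 * 2 ^ n → |E T| ≤ (B + C + 2) * T := by
    intro n
    induction n with
    | zero =>
      intro T h1 h2
      have := hB T ⟨h1, by simpa using h2⟩
      rw [Real.norm_eq_abs] at this
      nlinarith
    | succ n ih =>
      intro T h1 h2
      rcases le_or_gt T 8 with h8 | h8
      · have := hB T ⟨h1, h8⟩
        rw [Real.norm_eq_abs] at this
        nlinarith
      · have a1 := ih (T / 2) (by linarith) (by rw [pow_succ] at h2; linarith)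
        have a2 := h (T / 2) (by linarith)
        rw [mul_div_cancel₀ T (two_ne_zero)] at a2
        have e : E T = E (T / 2) + ((∫ t in (T / 2)..T, ‖riemannZeta (1/2 + t * I)‖ ^ 2)
            - T / 2 * Real.log (T / 2)) - T * Real.log 2 := by
          simp only [hE]
          rw [← intervalIntegral.integral_add_adjacent_intervals (hc1.intervalIntegrable 1 (T / 2))
            (hc1.intervalIntegrable (T / 2) T), Real.log_div (by linarith) (by norm_num)]
          ring
        rw [e]
        have h2' := Real.log_two_lt_d9
        have h2'' := Real.log_two_gt_d9
        rw [abs_le] at a1 a2 ⊢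
        constructor <;> nlinarith
  refine ⟨B + C + 2, by positivity, fun T hT => ?_⟩
  obtain ⟨n, hn⟩ := pow_unbounded_of_one_lt T (one_lt_two)
  exact key n T hT (by linarith [show (0:ℝ) < 2 ^ n by positivity])

/-- Upper bound for the second moment of `ζ` very close to the critical line. -/
theorem exists_integral_normSq_zeta_near_le : ∃ C : ℝ, 0 < C ∧ ∀ T σ : ℝ, 4 ≤ T → 1/4 ≤ σ → σ < 1 →
    1/2 - 2 / Real.log T ≤ σ →
    ∫ t in T / 2..4 * T, ‖riemannZeta (σ + t * I)‖ ^ 2 ≤ C * T * Real.log T := by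
  obtain ⟨C₁, hC₁, h₁⟩ := exists_norm_zeta_sub_sum_le_dyadic
  set E := Real.exp 8 with hE
  have hE0 : 0 < E := Real.exp_pos _
  refine ⟨2 * (14 * E + 32 * E + 16 * E) + 8 * C₁ ^ 2 * E, by positivity, fun T σ hT h1 h2 h3 => ?_⟩
  have hT0 : 0 < T := by linarith
  have hL : 1 ≤ Real.log T := by
    rw [Real.le_log_iff_exp_le hT0]; linarith [Real.exp_one_lt_d9]
  have h := abs_integral_zetaPoly_sub_le T σ (T / 2) (4 * T)
  set N := ⌈2 * T⌉₊ with hN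
  have hN1 : 2 * T ≤ N := Nat.le_ceil _
  have hN2 : (N:ℝ) ≤ 4 * T := by
    have := Nat.ceil_lt_add_one (show 0 ≤ 2 * T by linarith)
    linarith
  have hNpos : 0 < N := by
    have : (0:ℝ) < N := by linarith
    exact_mod_cast this
  have hx : ∀ x : ℝ, 1 ≤ x → x ≤ 4 * T → x ^ (1 - 2 * σ) ≤ E := by
    intro x hx1 hx2
    have a1 : x ^ (1 - 2 * σ) ≤ x ^ (4 / Real.log T) :=
      Real.rpow_le_rpow_of_exponent_le hx1 (by
        have : 4 / Real.log T = 2 * (2 / Real.log T) := by ring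
        linarith)
    have a2 : x ^ (4 / Real.log T) ≤ (T ^ (2:ℝ)) ^ (4 / Real.log T) := by
      refine Real.rpow_le_rpow (by linarith) ?_ (by positivity)
      rw [Real.rpow_two]; nlinarith
    refine a1.trans (a2.trans (le_of_eq ?_))
    rw [← Real.rpow_mul hT0.le, Real.rpow_def_of_pos hT0, hE]
    congr 1; field_simp; norm_num
  have hmem : ∀ n ∈ Finset.Icc 1 N, (1:ℝ) ≤ n ∧ (n:ℝ) ≤ 4 * T := fun n hn => by
    obtain ⟨a1, a2⟩ := Finset.mem_Icc.1 hn
    exact ⟨by exact_mod_cast a1, le_trans (by exact_mod_cast a2) hN2⟩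
  have s1 : ∑ n ∈ Finset.Icc 1 N, (n:ℝ) ^ (-2 * σ) ≤ E * (4 * Real.log T) := by
    have a1 : ∑ n ∈ Finset.Icc 1 N, (n:ℝ) ^ (-2 * σ) ≤ E * ∑ n ∈ Finset.Icc 1 N, (n:ℝ)⁻¹ := by
      rw [Finset.mul_sum]
      refine Finset.sum_le_sum fun n hn => ?_
      obtain ⟨b1, b2⟩ := hmem n hn
      rw [show -2 * σ = (1 - 2 * σ) + -1 by ring, Real.rpow_add (by linarith), Real.rpow_neg_one]
      gcongr
      exact hx _ b1 b2
    refine a1.trans ?_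
    gcongr
    have a2 := (abs_le.1 (abs_sum_inv_sub_log_le hNpos)).2
    have a3 : Real.log N ≤ Real.log (T ^ 2) := Real.log_le_log (by linarith) (by nlinarith)
    rw [Real.log_pow] at a3
    push_cast at a3
    linarith
  have s2 : ∑ n ∈ Finset.Icc 1 N, (n:ℝ) ^ (1 - 2 * σ) ≤ 4 * T * E := by
    refine (Finset.sum_le_sum fun (n : ℕ) hn => hx n (hmem n hn).1 (hmem n hn).2).trans ?_
    simp only [Finset.sum_const, Nat.card_Icc, Nat.add_sub_cancel, nsmul_eq_mul]
    gcongr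
  have s3 : (∑ n ∈ Finset.Icc 1 N, (n:ℝ) ^ (-σ)) ^ 2 ≤ 16 * T * E := by
    have hsq : ∀ n ∈ Finset.Icc 1 N, (n:ℝ) ^ (-σ) ≤ √E * (n:ℝ) ^ (-(1/2) : ℝ) := by
      intro n hn
      obtain ⟨b1, b2⟩ := hmem n hn
      rw [show -σ = (1 - 2 * σ) * (1/2) + -(1/2) by ring, Real.rpow_add (by linarith),
        Real.rpow_mul (by linarith), ← Real.sqrt_eq_rpow]
      gcongr
      exact hx _ b1 b2
    have a1 := Finset.sum_le_sum hsq
    rw [← Finset.mul_sum] at a1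
    have a2 : ∑ n ∈ Finset.Icc 1 N, (n:ℝ) ^ (-σ) ≤ √E * (2 * √N) :=
      a1.trans (by gcongr; exact sum_rpow_neg_half_le N)
    calc _ ≤ (√E * (2 * √N)) ^ 2 := by gcongr
      _ = E * (4 * N) := by
          rw [mul_pow, mul_pow, Real.sq_sqrt hE0.le, Real.sq_sqrt (Nat.cast_nonneg N)]; norm_num
      _ ≤ _ := by nlinarith
  have hJ : ∫ t in T / 2..4 * T, ‖zetaPoly T σ t‖ ^ 2 ≤ (14 * E + 32 * E + 16 * E) * T * Real.log T := by
    have a1 := (abs_le.1 h).2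
    have a2 : 2 * π * ∑ n ∈ Finset.Icc 1 N, (n:ℝ) ^ (1 - 2 * σ) ≤ 8 * (4 * T * E) := by
      gcongr; linarith [Real.pi_lt_d2]
    have a3 : (4 * T - T / 2) * ∑ n ∈ Finset.Icc 1 N, (n:ℝ) ^ (-2 * σ) ≤
        (4 * T - T / 2) * (E * (4 * Real.log T)) := by gcongr; linarith
    have a4 : T * E ≤ T * E * Real.log T := le_mul_of_one_le_right (by positivity) hL
    nlinarith
  have hc2 : Continuous fun t : ℝ => ‖zetaPoly T σ t‖ ^ 2 := (continuous_zetaPoly T _).norm.pow 2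
  have hc1 : Continuous fun t : ℝ => ‖riemannZeta (σ + t * I)‖ ^ 2 :=
    (continuous_zeta_vertical (σ := σ) h2.ne).norm.pow 2
  have hpt : ∀ t ∈ Icc (T / 2) (4 * T), ‖riemannZeta (σ + t * I)‖ ^ 2 ≤
      2 * ‖zetaPoly T σ t‖ ^ 2 + 2 * (C₁ ^ 2 * E) / T := by
    intro t ht
    have a := h₁ T σ t hT h1 (by linarith) ht.1 ht.2
    rw [← zetaPoly] at a
    have b1 : ‖riemannZeta (σ + t * I)‖ ≤ ‖zetaPoly T σ t‖ + C₁ * T ^ (-σ) := by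
      have := norm_le_norm_add_norm_sub' (riemannZeta (σ + t * I)) (zetaPoly T σ t)
      linarith
    have b2 : (C₁ * T ^ (-σ)) ^ 2 ≤ C₁ ^ 2 * E / T := by
      rw [mul_pow, ← Real.rpow_natCast (T ^ (-σ)), ← Real.rpow_mul hT0.le,
        show -σ * (2:ℕ) = (1 - 2 * σ) + -1 by push_cast; ring, Real.rpow_add hT0, Real.rpow_neg_one,
        mul_div_assoc, div_eq_mul_inv E]
      gcongr
      exact hx T (by linarith) (by linarith)
    calc _ ≤ (‖zetaPoly T σ t‖ + C₁ * T ^ (-σ)) ^ 2 := by gcongr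
      _ ≤ 2 * ‖zetaPoly T σ t‖ ^ 2 + 2 * (C₁ * T ^ (-σ)) ^ 2 := by
          nlinarith [sq_nonneg (‖zetaPoly T σ t‖ - C₁ * T ^ (-σ))]
      _ ≤ _ := by rw [mul_div_assoc]; gcongr
  calc _ ≤ ∫ t in T / 2..4 * T, (2 * ‖zetaPoly T σ t‖ ^ 2 + 2 * (C₁ ^ 2 * E) / T) :=
        intervalIntegral.integral_mono_on (by linarith) (hc1.intervalIntegrable _ _)
          (((hc2.const_mul 2).add continuous_const).intervalIntegrable _ _) hpt
    _ = 2 * (∫ t in T / 2..4 * T, ‖zetaPoly T σ t‖ ^ 2) + 7 * (C₁ ^ 2 * E) := by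
        rw [intervalIntegral.integral_add ((hc2.const_mul 2).intervalIntegrable _ _)
          (continuous_const.intervalIntegrable _ _), intervalIntegral.integral_const_mul,
          intervalIntegral.integral_const, smul_eq_mul]
        field_simp; ring
    _ ≤ _ := by
        have a1 : 1 ≤ T * Real.log T := by nlinarith
        have a2 : C₁ ^ 2 * E ≤ C₁ ^ 2 * E * (T * Real.log T) :=
          le_mul_of_one_le_right (by positivity) a1
        nlinarith

theorem integral_one_div_add_mul_I {a : ℝ} (ha : 0 < a) (R : ℝ) :
    ∫ y in (-R)..R, (1 : ℂ) / (a + y * I) = ((2 * Real.arctan (R / a) : ℝ) : ℂ) := by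
  have hne : ∀ y : ℝ, (a + y * I : ℂ) ≠ 0 := fun y h => by
    have := congrArg Complex.re h
    simp at this
    exact ha.ne' this
  have hne' : ∀ y : ℝ, (a - y * I : ℂ) ≠ 0 := fun y h => by
    have := congrArg Complex.re h
    simp at this
    exact ha.ne' this
  have hrefl : ∫ y in (-R)..R, (1 : ℂ) / (a + y * I) = ∫ y in (-R)..R, (1 : ℂ) / (a - y * I) := by
    have := intervalIntegral.integral_comp_neg (a := -R) (b := R) (fun y : ℝ => (1 : ℂ) / (a + y * I))
    simp only [neg_neg] at this
    rw [← this]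
    congr 1; ext y; push_cast; ring_nf
  have hreal : ∫ y in (-R)..R, (2 * a / (a ^ 2 + y ^ 2)) = 4 * Real.arctan (R / a) := by
    have := intervalIntegral.integral_eq_sub_of_hasDerivAt (a := -R) (b := R)
      (f := fun y : ℝ => 2 * Real.arctan (y / a)) (f' := fun y => 2 * a / (a ^ 2 + y ^ 2)) ?_ ?_
    · rw [this, neg_div, Real.arctan_neg]; ring
    · intro y _
      have h1 : HasDerivAt (fun y : ℝ => y / a) (1 / a) y := (hasDerivAt_id y).div_const a
      have := (h1.arctan).const_mul 2
      have e : 2 * a / (a ^ 2 + y ^ 2) = 2 * (1 / (1 + (y / a) ^ 2) * (1 / a)) := by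
        field_simp
      rw [e]; exact this
    · apply Continuous.intervalIntegrable
      refine continuous_const.div (by fun_prop) fun y => ?_
      positivity
  have hintegral : ∀ (g : ℝ → ℂ), Continuous g → (∀ y, g y ≠ 0) →
      IntervalIntegrable (fun y => 1 / g y) volume (-R) R := fun g hg h0 =>
    (continuous_const.div hg h0).intervalIntegrable _ _
  have hsum : (∫ y in (-R)..R, (1 : ℂ) / (a + y * I)) + ∫ y in (-R)..R, (1 : ℂ) / (a - y * I)
      = ((4 * Real.arctan (R / a) : ℝ) : ℂ) := by
    rw [← intervalIntegral.integral_add (hintegral _ (by fun_prop) hne) (hintegral _ (by fun_prop) hne'),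
      ← hreal, ← intervalIntegral.integral_ofReal]
    congr 1; ext y
    have h3 : ((a : ℂ) ^ 2 + (y : ℂ) ^ 2) ≠ 0 := by
      have : (a + y * I : ℂ) * (a - y * I) = (a : ℂ) ^ 2 + (y : ℂ) ^ 2 := by
        ring_nf; rw [I_sq]; ring
      rw [← this]; exact mul_ne_zero (hne y) (hne' y)
    push_cast
    rw [div_add_div _ _ (hne y) (hne' y), div_eq_div_iff (mul_ne_zero (hne y) (hne' y)) h3]
    ring_nf; rw [I_sq]; ring
  rw [← hrefl] at hsum
  have : (∫ y in (-R)..R, (1 : ℂ) / (a + y * I)) = ((4 * Real.arctan (R / a) : ℝ) : ℂ) / 2 := by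
    rw [← hsum]; ring
  rw [this]; push_cast; ring

/-- The contribution of a vertical side of the rectangle. -/
theorem enorm_intervalIntegral_div_le {G : ℝ → ℂ} {c R : ℝ} {d : ℝ → ℂ} (hc : 0 < c) (hR : 0 ≤ R)
    (hd : ∀ y, c ≤ ‖d y‖) :
    ‖∫ y in (-R)..R, G y / d y‖ₑ ≤ ENNReal.ofReal (1 / c) * ∫⁻ y, ‖G y‖ₑ := by
  rw [intervalIntegral.integral_of_le (by linarith)]
  refine (enorm_integral_le_lintegral_enorm _).trans ?_
  refine (setLIntegral_le_lintegral _ _).trans ?_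
  rw [← lintegral_const_mul' _ _ (by simp)]
  refine lintegral_mono fun y => ?_
  rw [← ofReal_norm, ← ofReal_norm, ← ENNReal.ofReal_mul (by positivity)]
  apply ENNReal.ofReal_le_ofReal
  rw [norm_div, div_eq_mul_inv, mul_comm, ← one_div]
  gcongr
  exact hd y

theorem norm_zero_mul_arctan_le {G : ℂ → ℂ} {a b K R : ℝ} (ha : 0 < a) (hb : 0 < b) (hR : 0 < R)
    (hG : ∀ z : ℂ, -b ≤ z.re → z.re ≤ a → DifferentiableAt ℂ G z)
    (hK : ∀ z : ℂ, -b ≤ z.re → z.re ≤ a → ‖G z‖ ≤ K) :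
    ENNReal.ofReal (‖G 0‖ * (2 * Real.arctan (R / a) + 2 * Real.arctan (R / b))) ≤
      ENNReal.ofReal (4 * K * (a + b) / R)
      + (ENNReal.ofReal (1 / a) * ∫⁻ y : ℝ, ‖G (a + y * I)‖ₑ)
      + (ENNReal.ofReal (1 / b) * ∫⁻ y : ℝ, ‖G (-b + y * I)‖ₑ) := by
  have hK0 : ‖G 0‖ ≤ K := hK 0 (by simp [hb.le]) (by simp [ha.le])
  have hD : ∀ z : ℂ, -b ≤ z.re → z.re ≤ a → DifferentiableAt ℂ (dslope G 0) z := by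
    intro z h1 h2
    rcases eq_or_ne z 0 with rfl | hz
    · have : {z : ℂ | -b < z.re ∧ z.re < a} ∈ nhds (0 : ℂ) := by
        apply IsOpen.mem_nhds
        · exact (isOpen_lt continuous_const continuous_re).inter (isOpen_lt continuous_re continuous_const)
        · simp [ha, hb]
      have h3 : DifferentiableOn ℂ G {z : ℂ | -b < z.re ∧ z.re < a} :=
        fun z hz => (hG z hz.1.le hz.2.le).differentiableWithinAt
      exact ((Complex.differentiableOn_dslope this).2 h3).differentiableAt this
    · exact (differentiableAt_dslope_of_ne hz).2 (hG z h1 h2)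
  have hrect := Complex.integral_boundary_rect_eq_zero_of_differentiableOn (dslope G 0)
    (⟨-b, -R⟩ : ℂ) (⟨a, R⟩ : ℂ) (fun z hz => by
      rw [mem_reProdIm] at hz
      have h1 := hz.1
      simp only [] at h1
      rw [uIcc_of_le (by linarith)] at h1
      exact (hD z h1.1 h1.2).differentiableWithinAt)
  simp only [smul_eq_mul] at hrect
  have hds : ∀ z : ℂ, z ≠ 0 → dslope G 0 z = (G z - G 0) / z := fun z hz => by
    rw [dslope_of_ne _ hz, slope_def_field, sub_zero]
  have hhor : ∀ r : ℝ, |r| = R → ‖∫ x in (-b)..a, dslope G 0 (x + r * I)‖ ≤ 2 * K / R * (a + b) := by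
    intro r hr
    have := intervalIntegral.norm_integral_le_of_norm_le_const (a := -b) (b := a)
      (f := fun x : ℝ => dslope G 0 (x + r * I)) (C := 2 * K / R) (fun x hx => by
        rw [uIoc_of_le (by linarith)] at hx
        have him : R ≤ ‖(x + r * I : ℂ)‖ := by
          have := abs_im_le_norm (x + r * I : ℂ)
          simpa [hr] using this
        have h0 : (x + r * I : ℂ) ≠ 0 := norm_pos_iff.1 (hR.trans_le him)
        rw [hds _ h0, norm_div]
        have h1 : ‖G (x + r * I)‖ ≤ K := hK _ (by simpa using hx.1.le) (by simpa using hx.2)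
        have : ‖G (x + r * I) - G 0‖ ≤ 2 * K := (norm_sub_le _ _).trans (by linarith)
        gcongr
        exact (norm_nonneg _).trans this)
    rwa [show |a - -b| = a + b by rw [sub_neg_eq_add, abs_of_pos (by linarith)]] at this
  have hvert : ∀ c : ℝ, c ≠ 0 → -b ≤ c → c ≤ a →
      ∫ y in (-R)..R, dslope G 0 (c + y * I) =
        (∫ y in (-R)..R, G (c + y * I) / (c + y * I)) - G 0 * ∫ y in (-R)..R, 1 / (c + y * I) := by
    intro c hc h1 h2
    have hne : ∀ y : ℝ, (c + y * I : ℂ) ≠ 0 := fun y h => hc (by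
      have := congrArg Complex.re h
      simpa using this)
    have hcG : Continuous fun y : ℝ => G (c + y * I) := continuous_iff_continuousAt.2 fun y => by
      have : ContinuousAt G (c + y * I) := (hG _ (by simpa using h1) (by simpa using h2)).continuousAt
      exact ContinuousAt.comp (f := fun y : ℝ => (c + y * I : ℂ)) this (by fun_prop)
    have hcd : Continuous fun y : ℝ => (c + y * I : ℂ) := by fun_prop
    rw [← intervalIntegral.integral_const_mul, ← intervalIntegral.integral_sub]
    · congr 1; ext y
      rw [hds _ (hne y)]; field_simp [hne y]
    · exact (hcG.div hcd hne).intervalIntegrable _ _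
    · exact (continuous_const.mul (continuous_const.div hcd hne)).intervalIntegrable _ _
  have hIb : ∫ y in (-R)..R, (1 : ℂ) / (((-b : ℝ) : ℂ) + y * I)
      = -((2 * Real.arctan (R / b) : ℝ) : ℂ) := by
    rw [← integral_one_div_add_mul_I hb R]
    have := intervalIntegral.integral_comp_neg (a := -R) (b := R) (fun y : ℝ => (1 : ℂ) / (b + y * I))
    simp only [neg_neg] at this
    rw [← this, ← intervalIntegral.integral_neg]
    congr 1; ext y
    push_cast
    rw [← div_neg]; congr 1; ring
  have e1 := hvert a ha.ne' (by linarith) le_rfl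
  have e2 := hvert (-b) (by linarith) le_rfl (by linarith)
  rw [integral_one_div_add_mul_I ha] at e1
  rw [hIb] at e2
  rw [e1, e2] at hrect
  have hmain : G 0 * ((2 * Real.arctan (R / a) + 2 * Real.arctan (R / b) : ℝ) : ℂ) =
      (∫ y in (-R)..R, G ((a : ℝ) + y * I) / ((a : ℝ) + y * I))
      - (∫ y in (-R)..R, G ((-b : ℝ) + y * I) / ((-b : ℝ) + y * I))
      - I * ((∫ x in (-b)..a, dslope G 0 (x + (-R : ℝ) * I)) - ∫ x in (-b)..a, dslope G 0 (x + R * I)) := by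
    simp only [ofReal_neg, ofReal_add, ofReal_mul, ofReal_ofNat] at hrect ⊢
    linear_combination I * hrect + (G 0 * (2 * Real.arctan (R / a) + 2 * Real.arctan (R / b))
      - (∫ y in (-R)..R, G (a + y * I) / (a + y * I)) + ∫ y in (-R)..R, G (-b + y * I) / (-b + y * I)) * I_sq
  have harc : 0 ≤ 2 * Real.arctan (R / a) + 2 * Real.arctan (R / b) := by
    have h1 : 0 ≤ Real.arctan (R / a) := Real.arctan_nonneg.2 (by positivity)
    have h2 : 0 ≤ Real.arctan (R / b) := Real.arctan_nonneg.2 (by positivity)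
    linarith
  have hl : ENNReal.ofReal (‖G 0‖ * (2 * Real.arctan (R / a) + 2 * Real.arctan (R / b)))
      = ‖G 0 * ((2 * Real.arctan (R / a) + 2 * Real.arctan (R / b) : ℝ) : ℂ)‖ₑ := by
    rw [← ofReal_norm, norm_mul, Complex.norm_real, Real.norm_of_nonneg harc]
  rw [hl, hmain]
  refine (enorm_sub_le).trans ?_
  have hA : ‖I * ((∫ x in (-b)..a, dslope G 0 (x + (-R : ℝ) * I)) - ∫ x in (-b)..a, dslope G 0 (x + R * I))‖ₑ
      ≤ ENNReal.ofReal (4 * K * (a + b) / R) := by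
    rw [← ofReal_norm]
    apply ENNReal.ofReal_le_ofReal
    rw [norm_mul, norm_I, one_mul]
    refine (norm_sub_le _ _).trans ?_
    have h1 := hhor (-R) (by rw [abs_neg, abs_of_pos hR])
    have h2 := hhor R (abs_of_pos hR)
    calc _ ≤ 2 * K / R * (a + b) + 2 * K / R * (a + b) := add_le_add h1 h2
      _ = _ := by ring
  have hB := enorm_intervalIntegral_div_le (G := fun y : ℝ => G ((a : ℝ) + y * I)) (R := R)
    (d := fun y : ℝ => ((a : ℝ) + y * I : ℂ)) ha hR.le (fun y => by
      have := abs_re_le_norm ((a : ℝ) + y * I : ℂ)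
      simpa [abs_of_pos ha] using this)
  have hC := enorm_intervalIntegral_div_le (G := fun y : ℝ => G ((-b : ℝ) + y * I)) (R := R)
    (d := fun y : ℝ => ((-b : ℝ) + y * I : ℂ)) hb hR.le (fun y => by
      have := abs_re_le_norm ((-b : ℝ) + y * I : ℂ)
      simpa [abs_of_pos hb] using this)
  refine (add_le_add ((enorm_sub_le).trans (add_le_add hB hC)) hA).trans ?_
  rw [add_comm, ← add_assoc]
  push_cast
  exact le_rfl

/-- A three-lines type inequality with Gaussian weights. -/
theorem enorm_zero_le_lintegral_strip {f : ℂ → ℂ} {a b K : ℝ} (ha : 0 < a) (hb : 0 < b)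
    (hf : ∀ z : ℂ, -b ≤ z.re → z.re ≤ a → DifferentiableAt ℂ f z)
    (hK : ∀ z : ℂ, -b ≤ z.re → z.re ≤ a → ‖f z‖ * Real.exp (-z.im ^ 2) ≤ K) :
    ‖f 0‖ₑ ≤
      ENNReal.ofReal (Real.exp (a ^ 2) / a) *
        (∫⁻ y : ℝ, ‖f (a + y * I)‖ₑ * ENNReal.ofReal (Real.exp (-y ^ 2 / 2))
          ∂(ProbabilityTheory.gaussianReal 0 1))
      + ENNReal.ofReal (Real.exp (b ^ 2) / b) *
        (∫⁻ y : ℝ, ‖f (-b + y * I)‖ₑ * ENNReal.ofReal (Real.exp (-y ^ 2 / 2))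
          ∂(ProbabilityTheory.gaussianReal 0 1)) := by
  set G : ℂ → ℂ := fun w => f w * Complex.exp (w ^ 2) with hGdef
  have hnexp : ∀ w : ℂ, ‖Complex.exp (w ^ 2)‖ = Real.exp (w.re ^ 2) * Real.exp (-w.im ^ 2) := by
    intro w
    rw [Complex.norm_exp, ← Real.exp_add]; congr 1
    rw [sq, mul_re]; ring
  have hG0 : G 0 = f 0 := by simp [hGdef]
  have hdG : ∀ z : ℂ, -b ≤ z.re → z.re ≤ a → DifferentiableAt ℂ G z := fun z h1 h2 =>
    (hf z h1 h2).mul (by fun_prop)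
  have hKG : ∀ z : ℂ, -b ≤ z.re → z.re ≤ a → ‖G z‖ ≤ K * Real.exp ((a + b) ^ 2) := by
    intro z h1 h2
    rw [norm_mul, hnexp]
    have h3 : z.re ^ 2 ≤ (a + b) ^ 2 := by
      apply sq_le_sq'  <;> linarith
    calc ‖f z‖ * (Real.exp (z.re ^ 2) * Real.exp (-z.im ^ 2))
        = (‖f z‖ * Real.exp (-z.im ^ 2)) * Real.exp (z.re ^ 2) := by ring
      _ ≤ K * Real.exp ((a + b) ^ 2) := by
        have := hK z h1 h2
        have h0 : 0 ≤ K := (by positivity : 0 ≤ ‖f z‖ * Real.exp (-z.im ^ 2)).trans this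
        gcongr
  set A := ENNReal.ofReal (1 / a) * ∫⁻ y : ℝ, ‖G (a + y * I)‖ₑ
  set B := ENNReal.ofReal (1 / b) * ∫⁻ y : ℝ, ‖G (-b + y * I)‖ₑ
  have hlim : ENNReal.ofReal (‖G 0‖ * (2 * π)) ≤ 0 + A + B := by
    have t1 : Tendsto (fun R : ℝ => ENNReal.ofReal (‖G 0‖ * (2 * Real.arctan (R / a) + 2 * Real.arctan (R / b))))
        atTop (nhds (ENNReal.ofReal (‖G 0‖ * (2 * π)))) := by
      apply ENNReal.tendsto_ofReal
      have h : ∀ c : ℝ, 0 < c → Tendsto (fun R : ℝ => Real.arctan (R / c)) atTop (nhds (π / 2)) :=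
        fun c hc => (Real.tendsto_arctan_atTop.mono_right nhdsWithin_le_nhds).comp
          (tendsto_id.atTop_div_const hc)
      have := (((h a ha).const_mul 2).add ((h b hb).const_mul 2)).const_mul ‖G 0‖
      convert this using 2; ring
    have t2 : Tendsto (fun R : ℝ => ENNReal.ofReal (4 * (K * Real.exp ((a + b) ^ 2)) * (a + b) / R) + A + B)
        atTop (nhds (0 + A + B)) := by
      have : Tendsto (fun R : ℝ => ENNReal.ofReal (4 * (K * Real.exp ((a + b) ^ 2)) * (a + b) / R))
          atTop (nhds 0) := by
        rw [← ENNReal.ofReal_zero]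
        exact ENNReal.tendsto_ofReal (tendsto_const_nhds.div_atTop tendsto_id)
      exact (this.add tendsto_const_nhds).add tendsto_const_nhds
    refine le_of_tendsto_of_tendsto t1 t2 ?_
    filter_upwards [eventually_gt_atTop 0] with R hR
    exact norm_zero_mul_arctan_le ha hb hR hdG hKG
  have hconv : ∀ c : ℝ, ∀ z : ℝ → ℂ, (∀ y, (z y).re ^ 2 = c ^ 2 ∧ (z y).im = y) →
      ∫⁻ y : ℝ, ‖G (z y)‖ₑ = ENNReal.ofReal (√(2 * π)) * (ENNReal.ofReal (Real.exp (c ^ 2)) *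
        ∫⁻ y : ℝ, ‖f (z y)‖ₑ * ENNReal.ofReal (Real.exp (-y ^ 2 / 2))
          ∂(ProbabilityTheory.gaussianReal 0 1)) := by
    intro c z hz
    rw [ProbabilityTheory.gaussianReal_of_var_ne_zero 0 (by simp),
      lintegral_withDensity_eq_lintegral_mul_non_measurable _
        (ProbabilityTheory.measurable_gaussianPDF 0 1)
        (ae_of_all _ fun y => ProbabilityTheory.gaussianPDF_lt_top),
      ← lintegral_const_mul' _ _ ENNReal.ofReal_ne_top,
      ← lintegral_const_mul' _ _ ENNReal.ofReal_ne_top]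
    refine lintegral_congr fun y => ?_
    rw [hGdef, Pi.mul_apply, ProbabilityTheory.gaussianPDF, ProbabilityTheory.gaussianPDFReal]
    simp only [enorm_mul]
    rw [← ofReal_norm (f (z y)), ← ofReal_norm (Complex.exp _), hnexp, (hz y).1, (hz y).2,
      ← ENNReal.ofReal_mul (by positivity), ← ENNReal.ofReal_mul (by positivity),
      ← ENNReal.ofReal_mul (by positivity), ← ENNReal.ofReal_mul (by positivity),
      ← ENNReal.ofReal_mul (by positivity)]
    congr 1
    have h1 : Real.exp (-y ^ 2) = Real.exp (-y ^ 2 / 2) * Real.exp (-y ^ 2 / 2) := by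
      rw [← Real.exp_add]; congr 1; ring
    simp only [NNReal.coe_one, mul_one, sub_zero]
    have h2 : √(2 * π) ≠ 0 := by positivity
    rw [h1]; field_simp
  have hA := hconv a (fun y => a + y * I) (fun y => by simp)
  have hB := hconv b (fun y => -b + y * I) (fun y => by simp)
  rw [zero_add, hG0, mul_comm, ENNReal.ofReal_mul (by positivity), ofReal_norm] at hlim
  have hs : ENNReal.ofReal (√(2 * π)) ≤ ENNReal.ofReal (2 * π) := by
    apply ENNReal.ofReal_le_ofReal
    rw [Real.sqrt_le_left (by positivity)]
    nlinarith [Real.pi_gt_three]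
  have h2pi : ENNReal.ofReal (2 * π) ≠ 0 := by
    simp [Real.pi_pos]
  rw [← ENNReal.mul_le_mul_iff_right h2pi ENNReal.ofReal_ne_top]
  refine hlim.trans ?_
  rw [mul_add]
  refine add_le_add ?_ ?_
  · simp only [A]
    rw [hA, div_eq_mul_one_div (Real.exp (a ^ 2)),
      ENNReal.ofReal_mul (p := Real.exp (a ^ 2)) (by positivity),
      ← mul_assoc (ENNReal.ofReal (1 / a)), mul_comm (ENNReal.ofReal (1 / a)), mul_assoc,
      ← mul_assoc (ENNReal.ofReal (1 / a)), mul_comm (ENNReal.ofReal (1 / a))]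
    exact mul_le_mul' hs le_rfl
  · simp only [B]
    rw [hB, div_eq_mul_one_div (Real.exp (b ^ 2)),
      ENNReal.ofReal_mul (p := Real.exp (b ^ 2)) (by positivity),
      ← mul_assoc (ENNReal.ofReal (1 / b)), mul_comm (ENNReal.ofReal (1 / b)), mul_assoc,
      ← mul_assoc (ENNReal.ofReal (1 / b)), mul_comm (ENNReal.ofReal (1 / b))]
    exact mul_le_mul' hs le_rfl

theorem lintegral_pow_le_lintegral_pow {α : Type*} [MeasurableSpace α] {ν : Measure α}
    [IsProbabilityMeasure ν] {g : α → ENNReal} (hg : Measurable g) {k : ℕ} (hk : 1 ≤ k) :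
    (∫⁻ y, g y ∂ν) ^ k ≤ ∫⁻ y, g y ^ k ∂ν := by
  have hk' : (1 : ℝ) ≤ k := by exact_mod_cast hk
  have := eLpNorm'_le_eLpNorm'_of_exponent_le (f := g) (μ := ν) zero_lt_one hk'
    hg.aestronglyMeasurable
  simp only [eLpNorm', enorm_eq_self, ENNReal.rpow_one, div_one] at this
  have h2 := ENNReal.rpow_le_rpow this (by positivity : (0 : ℝ) ≤ k)
  rw [← ENNReal.rpow_mul, one_div, inv_mul_cancel₀ (by positivity), ENNReal.rpow_one] at h2
  simpa only [ENNReal.rpow_natCast] using h2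

/-- Moments of a convolution with a probability measure. -/
theorem setLIntegral_lintegral_pow_le {ν : Measure ℝ} [IsProbabilityMeasure ν] {H : ℝ → ENNReal}
    (hH : Measurable H) {k : ℕ} (hk : 1 ≤ k) {x₁ x₂ : ℝ} {B : ENNReal}
    (hB : ∀ y, ∫⁻ t in Icc (x₁ + y) (x₂ + y), H t ^ k ≤ B) :
    ∫⁻ t in Icc x₁ x₂, (∫⁻ y, H (t + y) ∂ν) ^ k ≤ B := by
  have hB' : ∀ y, ∫⁻ t in Icc x₁ x₂, H (t + y) ^ k ≤ B := by
    intro y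
    refine le_trans (le_of_eq ?_) (hB y)
    rw [← lintegral_indicator measurableSet_Icc, ← lintegral_indicator measurableSet_Icc,
      ← lintegral_add_right_eq_self ((Icc (x₁ + y) (x₂ + y)).indicator _) y]
    refine lintegral_congr fun t => ?_
    by_cases ht : t ∈ Icc x₁ x₂
    · rw [indicator_of_mem ht, indicator_of_mem]
      exact ⟨by linarith [ht.1], by linarith [ht.2]⟩
    · rw [indicator_of_notMem ht, indicator_of_notMem]
      exact fun h => ht ⟨by linarith [h.1], by linarith [h.2]⟩
  calc ∫⁻ t in Icc x₁ x₂, (∫⁻ y, H (t + y) ∂ν) ^ k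
      ≤ ∫⁻ t in Icc x₁ x₂, ∫⁻ y, H (t + y) ^ k ∂ν :=
        lintegral_mono fun t => lintegral_pow_le_lintegral_pow (by fun_prop) hk
    _ = ∫⁻ y, (∫⁻ t in Icc x₁ x₂, H (t + y) ^ k) ∂ν := by
        rw [lintegral_lintegral_swap]
        exact ((hH.comp (measurable_fst.add measurable_snd)).pow_const k).aemeasurable
    _ ≤ ∫⁻ _, B ∂ν := lintegral_mono hB'
    _ = B := by simp

theorem one_add_abs_pow_mul_exp_le (m : ℕ) (y : ℝ) :
    (1 + |y|) ^ m * Real.exp (-y ^ 2 / 4) ≤ m.factorial * Real.exp 2 := by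
  have h1 : (1 + |y|) ^ m ≤ m.factorial * Real.exp (1 + |y|) := by
    have := Real.pow_div_factorial_le_exp (1 + |y|) (by positivity) m
    rwa [div_le_iff₀ (by positivity), mul_comm] at this
  calc (1 + |y|) ^ m * Real.exp (-y ^ 2 / 4)
      ≤ m.factorial * Real.exp (1 + |y|) * Real.exp (-y ^ 2 / 4) := by gcongr
    _ = m.factorial * Real.exp (1 + |y| + -y ^ 2 / 4) := by rw [mul_assoc, ← Real.exp_add]
    _ ≤ m.factorial * Real.exp 2 := by
      gcongr
      nlinarith [sq_nonneg (|y| - 2), sq_abs y]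

theorem ENNReal.add_pow_le_two_pow_mul (a b : ENNReal) (k : ℕ) :
    (a + b) ^ k ≤ 2 ^ k * (a ^ k + b ^ k) := by
  rcases le_total a b with h | h
  · calc (a + b) ^ k ≤ (2 * b) ^ k := by gcongr; rw [two_mul]; gcongr
      _ = 2 ^ k * b ^ k := mul_pow _ _ _
      _ ≤ _ := by gcongr; exact le_add_self
  · calc (a + b) ^ k ≤ (2 * a) ^ k := by gcongr; rw [two_mul]; gcongr
      _ = 2 ^ k * a ^ k := mul_pow _ _ _
      _ ≤ _ := by gcongr; exact le_self_add

theorem lintegral_add_pow_le {α : Type*} [MeasurableSpace α] {μ : Measure α} {f g : α → ENNReal}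
    (hf : Measurable f) (k : ℕ) {A B : ENNReal} (hA : ∫⁻ x, f x ^ k ∂μ ≤ A)
    (hB : ∫⁻ x, g x ^ k ∂μ ≤ B) :
    ∫⁻ x, (f x + g x) ^ k ∂μ ≤ 2 ^ k * (A + B) := by
  calc ∫⁻ x, (f x + g x) ^ k ∂μ ≤ ∫⁻ x, 2 ^ k * (f x ^ k + g x ^ k) ∂μ :=
        lintegral_mono fun x => ENNReal.add_pow_le_two_pow_mul _ _ _
    _ = 2 ^ k * ∫⁻ x, (f x ^ k + g x ^ k) ∂μ := lintegral_const_mul' _ _ (by finiteness)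
    _ = 2 ^ k * (∫⁻ x, f x ^ k ∂μ + ∫⁻ x, g x ^ k ∂μ) := by
        rw [lintegral_add_left (hf.pow_const k)]
    _ ≤ _ := by gcongr

/-- Fourth moment of a Dirichlet series with coefficients concentrated on `n ≤ Y`, `Y = √T`. -/
theorem exists_integral_norm_tsum_pow_four_le :
    ∃ C > 0, ∀ (T Y : ℝ) (a : ℕ → ℂ), 1 ≤ Y → Y ^ 2 = T → a 0 = 0 →
      (∀ n : ℕ, 0 < n → ‖a n‖ ≤ (n : ℝ) ^ (-(1 / 2) : ℝ)) →
      (∀ n : ℕ, 0 < n → ‖a n‖ ≤ Y ^ (5 / 8 : ℝ) * (n : ℝ) ^ (-(9 / 8) : ℝ)) →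
      Continuous (fun t : ℝ => ∑' n, a n * (n : ℂ) ^ (-(t * I))) ∧
      ∀ x y : ℝ, x ≤ y → y - x ≤ 4 * T →
        ∫ t in x..y, ‖∑' n, a n * (n : ℂ) ^ (-(t * I))‖ ^ 4 ≤ C * T * (9 + Real.log T) ^ 4 := by
  refine ⟨4 * Real.exp 1 ^ 2 + 7 * Real.exp 1 ^ 2 + Real.exp 1 ^ 4, by positivity, ?_⟩
  intro T Y a hY hYT h0 h1 h2
  have hY0 : 0 < Y := by linarith
  have hsum9 : Summable fun n : ℕ => Y ^ (5 / 8 : ℝ) * (n : ℝ) ^ (-(9 / 8) : ℝ) :=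
    (Real.summable_nat_rpow.2 (by norm_num)).mul_left _
  have hle : ∀ n, ‖a n‖ ≤ Y ^ (5 / 8 : ℝ) * (n : ℝ) ^ (-(9 / 8) : ℝ) := by
    intro n
    rcases Nat.eq_zero_or_pos n with rfl | hn
    · rw [h0, norm_zero]; positivity
    · exact h2 n hn
  have ha : Summable fun n => ‖a n‖ := Summable.of_nonneg_of_le (fun _ => norm_nonneg _) hle hsum9
  refine ⟨?_, ?_⟩
  · refine continuous_tsum (u := fun n => ‖a n‖) (fun n => ?_) ha (fun n t => ?_)
    · rcases Nat.eq_zero_or_pos n with rfl | hn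
      · simp only [h0, zero_mul]; exact continuous_const
      · exact continuous_const.mul (Continuous.const_cpow (by fun_prop) (Or.inl (by exact_mod_cast hn.ne')))
    · rcases Nat.eq_zero_or_pos n with rfl | hn
      · simp [h0]
      · rw [norm_mul, Complex.norm_natCast_cpow_of_pos hn]; simp
  intro x y hxy hlen
  have hT : 1 ≤ T := by rw [← hYT]; nlinarith
  have hlogT : 0 ≤ Real.log T := Real.log_nonneg hT
  set ε : ℝ := 1 / (8 + Real.log T) with hε
  have hε0 : 0 < ε := by positivity
  have hε8 : ε ≤ 1 / 8 := by
    rw [hε]; gcongr; linarith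
  have hL : 1 + 1 / ε = 9 + Real.log T := by rw [hε]; field_simp; ring
  have hYε : Y ^ ε ≤ Real.exp 1 := by
    rw [Real.rpow_def_of_pos hY0]
    gcongr
    have : Real.log T = 2 * Real.log Y := by rw [← hYT, Real.log_pow]; norm_num
    have hlY : 0 ≤ Real.log Y := Real.log_nonneg hY
    rw [hε, mul_one_div, div_le_one (by positivity)]
    linarith
  set L := 9 + Real.log T with hLd
  have hL0 : 0 ≤ L := by positivity
  -- comparison of the two bounds with a common power
  have key : ∀ n : ℕ, 0 < n → ∀ e c : ℝ, 0 ≤ e → e ≤ c → min 1 ((Y / n) ^ c) ≤ (Y / n) ^ e := by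
    intro n hn e c he hec
    have hn' : (0 : ℝ) < n := by exact_mod_cast hn
    rcases le_total (Y / n) 1 with h | h
    · exact (min_le_right _ _).trans (Real.rpow_le_rpow_of_exponent_ge (by positivity) h hec)
    · exact (min_le_left _ _).trans (Real.one_le_rpow h he)
  have hdiv : ∀ n : ℕ, 0 < n → ∀ e : ℝ, (Y / n) ^ e = Y ^ e * (n : ℝ) ^ (-e) := by
    intro n hn e
    have hn' : (0 : ℝ) < n := by exact_mod_cast hn
    rw [Real.div_rpow hY0.le hn'.le, div_eq_mul_inv, ← Real.rpow_neg hn'.le]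
  have hna : ∀ n : ℕ, 0 < n → (n : ℝ) ^ (1 / 2 : ℝ) * ‖a n‖ ≤ min 1 ((Y / n) ^ (5 / 8 : ℝ)) := by
    intro n hn
    have hn' : (0 : ℝ) < n := by exact_mod_cast hn
    apply le_min
    · calc _ ≤ (n : ℝ) ^ (1 / 2 : ℝ) * (n : ℝ) ^ (-(1 / 2) : ℝ) := by gcongr; exact h1 n hn
        _ = 1 := by rw [← Real.rpow_add hn']; norm_num
    · calc _ ≤ (n : ℝ) ^ (1 / 2 : ℝ) * (Y ^ (5 / 8 : ℝ) * (n : ℝ) ^ (-(9 / 8) : ℝ)) := by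
            gcongr; exact h2 n hn
        _ = Y ^ (5 / 8 : ℝ) * ((n : ℝ) ^ (1 / 2 : ℝ) * (n : ℝ) ^ (-(9 / 8) : ℝ)) := by ring
        _ = (Y / n) ^ (5 / 8 : ℝ) := by
          rw [← Real.rpow_add hn', hdiv n hn]; norm_num
  have hna2 : ∀ n : ℕ, 0 < n → (n : ℝ) * ‖a n‖ ^ 2 ≤ min 1 ((Y / n) ^ (5 / 4 : ℝ)) := by
    intro n hn
    have hn' : (0 : ℝ) < n := by exact_mod_cast hn
    have e1 : (n : ℝ) * ‖a n‖ ^ 2 = ((n : ℝ) ^ (1 / 2 : ℝ) * ‖a n‖) ^ 2 := by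
      rw [mul_pow, ← Real.sqrt_eq_rpow, Real.sq_sqrt hn'.le]
    have e2 : (Y / n : ℝ) ^ (5 / 4 : ℝ) = ((Y / n : ℝ) ^ (5 / 8 : ℝ)) ^ 2 := by
      rw [← Real.rpow_natCast, ← Real.rpow_mul (by positivity)]; norm_num
    have h := hna n hn
    rw [e1, e2]
    apply le_min
    · exact pow_le_one₀ (by positivity) (h.trans (min_le_left _ _))
    · gcongr; exact h.trans (min_le_right _ _)
  have hP1 : ∀ n : ℕ, 0 < n → ‖a n‖ ^ 2 ≤ Real.exp 1 * (n : ℝ) ^ (-(1 + ε)) := by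
    intro n hn
    have hn' : (0 : ℝ) < n := by exact_mod_cast hn
    have h := (hna2 n hn).trans (key n hn ε (5 / 4) hε0.le (by linarith))
    rw [hdiv n hn] at h
    have h3 : ‖a n‖ ^ 2 ≤ (Y ^ ε * (n : ℝ) ^ (-ε)) * (n : ℝ)⁻¹ := by
      rw [← div_eq_mul_inv, le_div_iff₀ hn']; linarith
    refine h3.trans ?_
    rw [neg_add, Real.rpow_add hn', Real.rpow_neg_one, mul_comm ((n : ℝ)⁻¹), ← mul_assoc]
    gcongr
  have hQ1 : ∀ n : ℕ, 0 < n → (n : ℝ) * ‖a n‖ ^ 2 ≤ Y * Real.exp 1 * (n : ℝ) ^ (-(1 + ε)) := by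
    intro n hn
    have h := (hna2 n hn).trans (key n hn (1 + ε) (5 / 4) (by positivity) (by linarith))
    rw [hdiv n hn] at h
    refine h.trans ?_
    rw [Real.rpow_add hY0, Real.rpow_one]
    gcongr
  have hR1 : ∀ n : ℕ, 0 < n → ‖a n‖ ≤ Y ^ (1 / 2 : ℝ) * Real.exp 1 * (n : ℝ) ^ (-(1 + ε)) := by
    intro n hn
    have hn' : (0 : ℝ) < n := by exact_mod_cast hn
    have h := (hna n hn).trans (key n hn (1 / 2 + ε) (5 / 8) (by positivity) (by linarith))
    rw [hdiv n hn] at h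
    have h3 : ‖a n‖ ≤ Y ^ (1 / 2 + ε) * (n : ℝ) ^ (-(1 / 2 + ε)) * (n : ℝ) ^ (-(1 / 2) : ℝ) := by
      rw [Real.rpow_neg hn'.le (1 / 2), ← div_eq_mul_inv, le_div_iff₀ (by positivity)]; linarith
    refine h3.trans ?_
    rw [mul_assoc, ← Real.rpow_add hn', Real.rpow_add hY0,
      show -(1 / 2 + ε) + -(1 / 2) = -(1 + ε) by ring]
    gcongr
  have hpass : ∀ (g h : ℕ → ℝ) (N : ℕ), g 0 = 0 → (∀ n, 0 < n → g n ≤ h n) → (∀ n, 0 ≤ h n) →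
      ∑ n ∈ Finset.range N, g n ≤ ∑ n ∈ Finset.Icc 1 N, h n := by
    intro g h N hg0 hgh hh
    calc ∑ n ∈ Finset.range N, g n ≤ ∑ n ∈ Finset.range N, (if 0 < n then h n else 0) := by
          refine Finset.sum_le_sum fun n _ => ?_
          split_ifs with hn
          · exact hgh n hn
          · rw [show n = 0 by omega, hg0]
      _ = ∑ n ∈ (Finset.range N).filter (fun n => 0 < n), h n := by rw [Finset.sum_filter]
      _ ≤ _ := by
          refine Finset.sum_le_sum_of_subset_of_nonneg (fun n hn => ?_) (fun n _ _ => hh n)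
          simp only [Finset.mem_filter, Finset.mem_range, Finset.mem_Icc] at hn ⊢
          omega
  have hP : ∀ N : ℕ, ∑ n ∈ Finset.range N, (n.divisors.card : ℝ) * ‖a n‖ ^ 2 ≤ Real.exp 1 * L ^ 2 := by
    intro N
    refine (hpass _ (fun n => Real.exp 1 * ((n.divisors.card : ℝ) * (n : ℝ) ^ (-(1 + ε)))) N (by simp)
      (fun n hn => ?_) (fun n => by positivity)).trans ?_
    · have := hP1 n hn
      calc _ ≤ (n.divisors.card : ℝ) * (Real.exp 1 * (n : ℝ) ^ (-(1 + ε))) := by gcongr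
        _ = _ := by ring
    · rw [← Finset.mul_sum, ← hL]
      gcongr
      exact sum_card_divisors_mul_rpow_neg_le hε0 N
  have hQ : ∀ N : ℕ, ∑ n ∈ Finset.range N, (n.divisors.card : ℝ) * (n * ‖a n‖ ^ 2)
      ≤ Y * Real.exp 1 * L ^ 2 := by
    intro N
    refine (hpass _ (fun n => Y * Real.exp 1 * ((n.divisors.card : ℝ) * (n : ℝ) ^ (-(1 + ε)))) N (by simp)
      (fun n hn => ?_) (fun n => by positivity)).trans ?_
    · have := hQ1 n hn
      calc _ ≤ (n.divisors.card : ℝ) * (Y * Real.exp 1 * (n : ℝ) ^ (-(1 + ε))) := by gcongr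
        _ = _ := by ring
    · rw [← Finset.mul_sum, ← hL]
      gcongr
      exact sum_card_divisors_mul_rpow_neg_le hε0 N
  have hR : ∀ N : ℕ, ∑ n ∈ Finset.range N, ‖a n‖ ≤ Y ^ (1 / 2 : ℝ) * Real.exp 1 * L := by
    intro N
    refine (hpass _ (fun n => Y ^ (1 / 2 : ℝ) * Real.exp 1 * ((n : ℝ) ^ (-(1 + ε)))) N (by simp [h0])
      (fun n hn => hR1 n hn) (fun n => by positivity)).trans ?_
    rw [← Finset.mul_sum, ← hL]
    gcongr
    exact sum_rpow_neg_le hε0 N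
  refine (integral_norm_tsum_pow_four_le h0 ha hxy hP hQ hR).trans ?_
  have hY4 : (Y ^ (1 / 2 : ℝ)) ^ 4 = T := by
    rw [← Real.rpow_natCast, ← Real.rpow_mul hY0.le, ← hYT, ← Real.rpow_natCast]; norm_num
  calc (y - x) * (Real.exp 1 * L ^ 2) ^ 2 + 7 * (Y * Real.exp 1 * L ^ 2) ^ 2
        + (Y ^ (1 / 2 : ℝ) * Real.exp 1 * L) ^ 4
      ≤ 4 * T * (Real.exp 1 * L ^ 2) ^ 2 + 7 * (Y * Real.exp 1 * L ^ 2) ^ 2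
        + (Y ^ (1 / 2 : ℝ) * Real.exp 1 * L) ^ 4 := by gcongr
    _ = _ := by
      rw [mul_pow _ L 4, mul_pow _ _ 4, hY4, ← hYT]; ring

/-- Partial sums of the Dirichlet series of `ζ`. -/
def dirPoly (N : ℕ) (s : ℂ) : ℂ := ∑ n ∈ Finset.Icc 1 N, (n : ℂ) ^ (-s)

theorem differentiable_dirPoly (N : ℕ) : Differentiable ℂ (dirPoly N) := by
  unfold dirPoly
  refine Differentiable.fun_sum fun n hn => ?_
  have hn : (n : ℂ) ≠ 0 := by
    rw [Finset.mem_Icc] at hn; exact_mod_cast (show n ≠ 0 by omega)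
  exact fun s => (differentiableAt_id.neg).const_cpow (Or.inl hn)

theorem natCast_cpow_conj (n : ℕ) (s : ℂ) : (n : ℂ) ^ (conj s) = conj ((n : ℂ) ^ s) := by
  rw [Complex.cpow_conj _ _ (by rw [Complex.natCast_arg]; exact Real.pi_pos.ne), Complex.conj_natCast]

theorem dirPoly_conj (N : ℕ) (s : ℂ) : dirPoly N (conj s) = conj (dirPoly N s) := by
  unfold dirPoly
  rw [map_sum]
  refine Finset.sum_congr rfl fun n _ => ?_
  rw [← map_neg, natCast_cpow_conj]

theorem norm_dirPoly_conj (N : ℕ) (s : ℂ) : ‖dirPoly N (conj s)‖ = ‖dirPoly N s‖ := by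
  rw [dirPoly_conj, Complex.norm_conj]

theorem norm_zeta_sub_dirPoly_conj (N : ℕ) (s : ℂ) :
    ‖riemannZeta (conj s) - dirPoly N (conj s)‖ = ‖riemannZeta s - dirPoly N s‖ := by
  rw [dirPoly_conj, riemannZeta_conj, ← map_sub, Complex.norm_conj]

theorem natCast_cpow_neg_add_mul_I {n : ℕ} (hn : 0 < n) (κ u : ℝ) :
    (n : ℂ) ^ (-(κ + u * I)) = (((n : ℝ) ^ (-κ) : ℝ) : ℂ) * (n : ℂ) ^ (-(u * I)) := by
  have hn0 : (n : ℂ) ≠ 0 := by exact_mod_cast hn.ne'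
  rw [neg_add, Complex.cpow_add _ _ hn0, Complex.ofReal_cpow (by positivity)]
  simp

theorem mul_dirPoly_eq_tsum (N : ℕ) (c κ u : ℝ) :
    c * dirPoly N (κ + u * I) =
      ∑' n : ℕ, (if n ∈ Finset.Icc 1 N then ((c * (n : ℝ) ^ (-κ) : ℝ) : ℂ) else 0) *
        (n : ℂ) ^ (-(u * I)) := by
  rw [tsum_eq_sum (s := Finset.Icc 1 N) (fun n hn => by rw [if_neg hn, zero_mul]), dirPoly,
    Finset.mul_sum]
  refine Finset.sum_congr rfl fun n hn => ?_
  rw [if_pos hn, natCast_cpow_neg_add_mul_I (by rw [Finset.mem_Icc] at hn; omega)]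
  push_cast; ring

theorem mul_zeta_sub_dirPoly_eq_tsum (N : ℕ) {κ : ℝ} (hκ : 1 < κ) (c u : ℝ) :
    c * (riemannZeta (κ + u * I) - dirPoly N (κ + u * I)) =
      ∑' n : ℕ, (if N < n then ((c * (n : ℝ) ^ (-κ) : ℝ) : ℂ) else 0) *
        (n : ℂ) ^ (-(u * I)) := by
  have hs : Summable fun n : ℕ => (n : ℂ) ^ (-(κ + u * I : ℂ)) := by
    have : Summable fun n : ℕ => 1 / (n : ℂ) ^ (κ + u * I : ℂ) :=
      Complex.summable_one_div_nat_cpow.2 (by simpa using hκ)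
    refine this.congr fun n => ?_
    rw [Complex.cpow_neg, one_div]
  have hz : riemannZeta (κ + u * I) = ∑' n : ℕ, (n : ℂ) ^ (-(κ + u * I : ℂ)) := by
    rw [zeta_eq_tsum_one_div_nat_cpow (by simpa using hκ)]
    refine tsum_congr fun n => ?_
    rw [Complex.cpow_neg, one_div]
  have hne : (-(κ + u * I : ℂ)) ≠ 0 := by
    intro h
    have := congrArg Complex.re h
    simp at this
    linarith
  have hp : dirPoly N (κ + u * I) = ∑' n : ℕ, if n ≤ N then (n : ℂ) ^ (-(κ + u * I : ℂ)) else 0 := by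
    rw [tsum_eq_sum (s := Finset.Icc 0 N) (fun n hn => by
      rw [if_neg]; simpa using hn), dirPoly]
    have : Finset.Icc 1 N ⊆ Finset.Icc 0 N := Finset.Icc_subset_Icc_left (by norm_num)
    rw [← Finset.sum_subset this (f := fun n : ℕ => if n ≤ N then (n : ℂ) ^ (-(κ + u * I : ℂ)) else 0)]
    · refine Finset.sum_congr rfl fun n hn => ?_
      rw [if_pos (Finset.mem_Icc.1 hn).2]
    · intro n hn hn'
      rw [Finset.mem_Icc] at hn hn'
      have : n = 0 := by omega
      rw [this, if_pos (Nat.zero_le _), Nat.cast_zero, Complex.zero_cpow hne]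
  have hs2 : Summable fun n : ℕ => if n ≤ N then (n : ℂ) ^ (-(κ + u * I : ℂ)) else 0 := by
    refine summable_of_ne_finset_zero (s := Finset.Icc 0 N) fun n hn => ?_
    rw [if_neg]; simpa using hn
  rw [hz, hp, ← hs.tsum_sub hs2, ← tsum_mul_left]
  refine tsum_congr fun n => ?_
  by_cases h : N < n
  · rw [if_neg (not_le.2 h), if_pos h, natCast_cpow_neg_add_mul_I (by omega)]
    push_cast; ring
  · rw [if_pos (not_lt.1 h), if_neg h]; ring

theorem rpow_neg_mul_rpow_le {Y n α β γ : ℝ} (hn : 0 < n) (hnY : n ≤ Y) (h : 0 ≤ β) (h2 : γ = α + β) :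
    Y ^ (-β) * n ^ γ ≤ n ^ α := by
  have hY : 0 < Y := hn.trans_le hnY
  rw [h2, Real.rpow_add hn, Real.rpow_neg hY.le]
  have h3 : n ^ β ≤ Y ^ β := Real.rpow_le_rpow hn.le hnY h
  have h4 : 0 < Y ^ β := by positivity
  calc (Y ^ β)⁻¹ * (n ^ α * n ^ β) ≤ (Y ^ β)⁻¹ * (n ^ α * Y ^ β) := by gcongr
    _ = n ^ α := by field_simp

/-- The fourth moments of all pieces of the approximate functional equation. -/
theorem exists_lintegral_pow_four_pieces_le :
    ∃ C > 0, ∀ (T Y : ℝ), 1 ≤ Y → Y ^ 2 = T → ∀ c κ : ℝ, 0 ≤ c →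
      ((∀ n : ℕ, 0 < n → (n : ℝ) ≤ Y → c * (n : ℝ) ^ (-κ) ≤ (n : ℝ) ^ (-(1 / 2) : ℝ)) →
        ∀ x y : ℝ, x ≤ y → y - x ≤ 4 * T →
          ∫⁻ u in Icc x y, ENNReal.ofReal (c * ‖dirPoly ⌊Y⌋₊ (κ + u * I)‖) ^ 4 ≤
            ENNReal.ofReal (C * T * (9 + Real.log T) ^ 4)) ∧
      (9 / 8 ≤ κ → c ≤ Y ^ (κ - 1 / 2) →
        ∀ x y : ℝ, x ≤ y → y - x ≤ 4 * T →
          ∫⁻ u in Icc x y, ENNReal.ofReal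
              (c * ‖riemannZeta (κ + u * I) - dirPoly ⌊Y⌋₊ (κ + u * I)‖) ^ 4 ≤
            ENNReal.ofReal (C * T * (9 + Real.log T) ^ 4)) := by
  obtain ⟨C, hC, h⟩ := exists_integral_norm_tsum_pow_four_le
  refine ⟨C, hC, fun T Y hY hYT c κ hc => ?_⟩
  have hY0 : 0 < Y := by linarith
  have conv : ∀ D : ℝ → ℂ, Continuous D → ∀ x y : ℝ, x ≤ y → ∀ B : ℝ,
      ∫ t in x..y, ‖D t‖ ^ 4 ≤ B → ∫⁻ t in Icc x y, ENNReal.ofReal ‖D t‖ ^ 4 ≤ ENNReal.ofReal B := by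
    intro D hD x y hxy B hB
    have hc4 : Continuous fun t => ‖D t‖ ^ 4 := by fun_prop
    rw [intervalIntegral.integral_of_le hxy, ← integral_Icc_eq_integral_Ioc] at hB
    refine le_trans (le_of_eq ?_) (ENNReal.ofReal_le_ofReal hB)
    rw [ofReal_integral_eq_lintegral_ofReal (hc4.continuousOn.integrableOn_Icc)
      (ae_of_all _ fun t => by positivity)]
    refine lintegral_congr fun t => ?_
    rw [ENNReal.ofReal_pow (norm_nonneg _)]
  have hcn : ∀ z : ℂ, c * ‖z‖ = ‖(c : ℂ) * z‖ := fun z => by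
    rw [norm_mul, Complex.norm_real, Real.norm_of_nonneg hc]
  have hnn : ∀ n : ℕ, ‖((c * (n : ℝ) ^ (-κ) : ℝ) : ℂ)‖ = c * (n : ℝ) ^ (-κ) := fun n => by
    rw [Complex.norm_real, Real.norm_of_nonneg (by positivity)]
  constructor
  · intro hcoef x y hxy hlen
    simp only [hcn, mul_dirPoly_eq_tsum]
    have h12 : ∀ n : ℕ, 0 < n → (n : ℝ) ≤ Y →
        (n : ℝ) ^ (-(1 / 2) : ℝ) ≤ Y ^ (5 / 8 : ℝ) * (n : ℝ) ^ (-(9 / 8) : ℝ) := by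
      intro n hn hnY
      have hn' : (0 : ℝ) < n := by exact_mod_cast hn
      calc (n : ℝ) ^ (-(1 / 2) : ℝ) = (n : ℝ) ^ (5 / 8 : ℝ) * (n : ℝ) ^ (-(9 / 8) : ℝ) := by
            rw [← Real.rpow_add hn']; norm_num
        _ ≤ _ := by gcongr
    have hmem : ∀ n : ℕ, n ∈ Finset.Icc 1 ⌊Y⌋₊ → 0 < n ∧ (n : ℝ) ≤ Y := fun n hn => by
      rw [Finset.mem_Icc] at hn
      exact ⟨hn.1, (Nat.le_floor_iff hY0.le).1 hn.2⟩
    have := h T Y (fun n => if n ∈ Finset.Icc 1 ⌊Y⌋₊ then ((c * (n : ℝ) ^ (-κ) : ℝ) : ℂ) else 0)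
      hY hYT (by simp) (fun n hn => by
        split_ifs with hh
        · rw [hnn]; exact hcoef n hn (hmem n hh).2
        · rw [norm_zero]; positivity) (fun n hn => by
        split_ifs with hh
        · rw [hnn]; exact (hcoef n hn (hmem n hh).2).trans (h12 n hn (hmem n hh).2)
        · rw [norm_zero]; positivity)
    exact conv _ this.1 x y hxy _ (this.2 x y hxy hlen)
  · intro hκ hcY x y hxy hlen
    simp only [hcn, mul_zeta_sub_dirPoly_eq_tsum _ (show 1 < κ by linarith)]
    have hb : ∀ n : ℕ, 0 < n → ⌊Y⌋₊ < n →
        c * (n : ℝ) ^ (-κ) ≤ Y ^ (5 / 8 : ℝ) * (n : ℝ) ^ (-(9 / 8) : ℝ) ∧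
        Y ^ (5 / 8 : ℝ) * (n : ℝ) ^ (-(9 / 8) : ℝ) ≤ (n : ℝ) ^ (-(1 / 2) : ℝ) := by
      intro n hn hh
      have hn' : (0 : ℝ) < n := by exact_mod_cast hn
      have hYn : Y ≤ n := (Nat.lt_of_floor_lt hh).le
      constructor
      · calc c * (n : ℝ) ^ (-κ) ≤ Y ^ (κ - 1 / 2) * (n : ℝ) ^ (-κ) := by gcongr
          _ = Y ^ (5 / 8 : ℝ) * (Y ^ (κ - 9 / 8) * (n : ℝ) ^ (-κ)) := by
            rw [← mul_assoc, ← Real.rpow_add hY0]; congr 2; ring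
          _ ≤ Y ^ (5 / 8 : ℝ) * ((n : ℝ) ^ (κ - 9 / 8) * (n : ℝ) ^ (-κ)) := by
            gcongr
          _ = _ := by rw [← Real.rpow_add hn']; congr 2; ring
      · calc _ ≤ (n : ℝ) ^ (5 / 8 : ℝ) * (n : ℝ) ^ (-(9 / 8) : ℝ) := by gcongr
          _ = _ := by rw [← Real.rpow_add hn']; norm_num
    have := h T Y (fun n => if ⌊Y⌋₊ < n then ((c * (n : ℝ) ^ (-κ) : ℝ) : ℂ) else 0)
      hY hYT (by simp) (fun n hn => by
        split_ifs with hh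
        · rw [hnn]; exact (hb n hn hh).1.trans (hb n hn hh).2
        · rw [norm_zero]; positivity) (fun n hn => by
        split_ifs with hh
        · rw [hnn]; exact (hb n hn hh).1
        · rw [norm_zero]; positivity)
    exact conv _ this.1 x y hxy _ (this.2 x y hxy hlen)

/-- `s - 1` times the error in the approximate functional equation. -/
def afeRem (N : ℕ) (p : ℂ) : ℂ :=
  riemannZeta₁ p - (p - 1) * dirPoly N p + chiReg p * dirPoly N (1 - p)

theorem differentiableAt_afeRem (N : ℕ) {p : ℂ} (hp : p.re < 2) :
    DifferentiableAt ℂ (afeRem N) p := by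
  have h1 := differentiable_dirPoly N
  have h2 : DifferentiableAt ℂ (fun p => dirPoly N (1 - p)) p :=
    (h1 (1 - p)).comp p (by fun_prop)
  have h3 : DifferentiableAt ℂ (fun p => (p - 1) * dirPoly N p) p :=
    (by fun_prop : DifferentiableAt ℂ (fun p : ℂ => p - 1) p).mul (h1 p)
  exact ((differentiable_riemannZeta₁ p).sub h3).add ((differentiableAt_chiReg hp).mul h2)

theorem afeRem_eq {N : ℕ} {p : ℂ} (hp : p ≠ 1) :
    afeRem N p = (p - 1) * (riemannZeta p - dirPoly N p - chi p * dirPoly N (1 - p)) := by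
  rw [afeRem, riemannZeta₁_eq hp, chiReg_eq hp]; ring

theorem afeRem_eq_right {N : ℕ} {p : ℂ} (hp : p ≠ 1) :
    afeRem N p = (p - 1) * (riemannZeta p - dirPoly N p) + chiReg p * dirPoly N (1 - p) := by
  rw [afeRem, riemannZeta₁_eq hp]; ring

theorem afeRem_eq_left {N : ℕ} {p : ℂ} (hp : p ≠ 0) (hp1 : p.re < 1) :
    afeRem N p = -((p - 1) * dirPoly N p + chiReg p * (riemannZeta (1 - p) - dirPoly N (1 - p))) := by
  rw [afeRem, riemannZeta₁_eq_chiReg_mul hp hp1]; ring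

theorem norm_dirPoly_le (N : ℕ) {p : ℂ} (hp : -2 ≤ p.re) : ‖dirPoly N p‖ ≤ N * (N : ℝ) ^ 2 := by
  refine (norm_sum_le _ _).trans ?_
  calc ∑ n ∈ Finset.Icc 1 N, ‖(n : ℂ) ^ (-p)‖ ≤ ∑ n ∈ Finset.Icc 1 N, (N : ℝ) ^ 2 := by
        refine Finset.sum_le_sum fun n hn => ?_
        rw [Finset.mem_Icc] at hn
        have hn1 : (1 : ℝ) ≤ n := by exact_mod_cast hn.1
        have hnN : (n : ℝ) ≤ N := by exact_mod_cast hn.2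
        rw [Complex.norm_natCast_cpow_of_pos (by omega), neg_re]
        calc (n : ℝ) ^ (-p.re) ≤ (n : ℝ) ^ (2 : ℝ) :=
              Real.rpow_le_rpow_of_exponent_le hn1 (by linarith)
          _ = (n : ℝ) ^ 2 := by norm_num
          _ ≤ _ := by gcongr
    _ = _ := by simp

theorem exists_norm_afeRem_le (N : ℕ) : ∃ K > 0, ∀ p : ℂ, -1 / 2 ≤ p.re → p.re ≤ 3 / 2 →
    ‖afeRem N p‖ ≤ K * (1 + |p.im|) ^ 4 := by
  obtain ⟨C₁, hC₁, h₁⟩ := exists_norm_riemannZeta₁_le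
  obtain ⟨C₂, hC₂, h₂⟩ := exists_norm_chiReg_le
  refine ⟨C₁ * 3 ^ 4 + 3 * (N * (N : ℝ) ^ 2) + C₂ * 2 ^ 2 * (N * (N : ℝ) ^ 2), by positivity, ?_⟩
  intro p hp1 hp2
  have hnp : ‖p‖ ≤ 3 / 2 + |p.im| := by
    refine (Complex.norm_le_abs_re_add_abs_im p).trans ?_
    gcongr
    exact abs_le.2 ⟨by linarith, hp2⟩
  set v := 1 + |p.im| with hv
  have hv1 : 1 ≤ v := by rw [hv]; linarith [abs_nonneg p.im]
  have e1 : ‖riemannZeta₁ p‖ ≤ C₁ * 3 ^ 4 * v ^ 4 := by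
    refine (h₁ p (by linarith)).trans ?_
    rw [mul_assoc, ← mul_pow]
    gcongr
    rw [hv]; linarith [abs_nonneg p.im]
  have e2 : ‖(p - 1) * dirPoly N p‖ ≤ 3 * (N * (N : ℝ) ^ 2) * v ^ 4 := by
    rw [norm_mul]
    have : ‖p - 1‖ ≤ 3 * v := by
      refine (norm_sub_le _ _).trans ?_
      rw [norm_one, hv]; linarith [abs_nonneg p.im]
    calc ‖p - 1‖ * ‖dirPoly N p‖ ≤ 3 * v * (N * (N : ℝ) ^ 2) := by
          gcongr; exact norm_dirPoly_le N (by linarith)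
      _ = 3 * (N * (N : ℝ) ^ 2) * v := by ring
      _ ≤ 3 * (N * (N : ℝ) ^ 2) * v ^ 4 := by
          gcongr
          exact le_self_pow₀ hv1 (by norm_num)
  have e3 : ‖chiReg p * dirPoly N (1 - p)‖ ≤ C₂ * 2 ^ 2 * (N * (N : ℝ) ^ 2) * v ^ 4 := by
    rw [norm_mul]
    have h2v : 2 + |p.im| ≤ 2 * v := by rw [hv]; linarith [abs_nonneg p.im]
    have : ‖chiReg p‖ ≤ C₂ * 2 ^ 2 * v ^ 4 := by
      refine (h₂ p (by linarith) hp2).trans ?_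
      calc C₂ * (2 + |p.im|) ^ (3 / 2 - p.re) ≤ C₂ * (2 + |p.im|) ^ (2 : ℝ) := by
            gcongr
            · linarith [abs_nonneg p.im]
            · linarith
        _ = C₂ * (2 + |p.im|) ^ 2 := by norm_num
        _ ≤ C₂ * (2 * v) ^ 2 := by gcongr
        _ = C₂ * 2 ^ 2 * v ^ 2 := by ring
        _ ≤ C₂ * 2 ^ 2 * v ^ 4 := by gcongr; norm_num
    calc ‖chiReg p‖ * ‖dirPoly N (1 - p)‖ ≤ C₂ * 2 ^ 2 * v ^ 4 * (N * (N : ℝ) ^ 2) := by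
          gcongr; exact norm_dirPoly_le N (by simp; linarith)
      _ = _ := by ring
  calc ‖afeRem N p‖ ≤ ‖riemannZeta₁ p‖ + ‖(p - 1) * dirPoly N p‖ + ‖chiReg p * dirPoly N (1 - p)‖ := by
        rw [afeRem]; exact (norm_add_le _ _).trans (by gcongr; exact norm_sub_le _ _)
    _ ≤ _ := by linarith

/-- Ratio bounds used on both vertical lines. -/
theorem exists_norm_chiReg_div_le : ∃ C > 0, ∀ (T σ t x y : ℝ), 2 ≤ T → T / 2 ≤ t → t ≤ 4 * T →
    1 / 2 ≤ σ → σ ≤ 5 / 8 → |x| ≤ 3 / 4 →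
    ‖((σ + x : ℝ) + (t + y : ℝ) * I : ℂ) - 1‖ / ‖(σ + t * I : ℂ) - 1‖ * Real.exp (-y ^ 2 / 2) ≤ C ∧
    ‖chiReg ((σ + x : ℝ) + (t + y : ℝ) * I)‖ / ‖(σ + t * I : ℂ) - 1‖ * Real.exp (-y ^ 2 / 2)
      ≤ C * T ^ (1 / 2 - σ - x) := by
  obtain ⟨C₂, hC₂, h₂⟩ := exists_norm_chiReg_le
  refine ⟨6 * Real.exp 2 + 100 * C₂ * Real.exp 2, by positivity, ?_⟩
  intro T σ t x y hT ht1 ht2 hσ1 hσ2 hx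
  have hx' := abs_le.1 hx
  have hd : T / 2 ≤ ‖(σ + t * I : ℂ) - 1‖ := by
    have := abs_im_le_norm ((σ + t * I : ℂ) - 1)
    simp at this
    exact ht1.trans ((le_abs_self _).trans this)
  have hd0 : 0 < ‖(σ + t * I : ℂ) - 1‖ := by linarith
  have hexp : Real.exp (-y ^ 2 / 2) ≤ Real.exp (-y ^ 2 / 4) := by
    rw [Real.exp_le_exp]
    nlinarith [sq_nonneg y]
  have hE0 : 0 ≤ Real.exp 2 := by positivity
  constructor
  · have h1 : ‖((σ + x : ℝ) + (t + y : ℝ) * I : ℂ) - 1‖ ≤ ‖(σ + t * I : ℂ) - 1‖ * (2 * (1 + |y|)) := by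
      have e : ((σ + x : ℝ) + (t + y : ℝ) * I : ℂ) - 1 = ((σ + t * I : ℂ) - 1) + ((x : ℂ) + y * I) := by
        push_cast; ring
      have h3 : ‖(x : ℂ) + y * I‖ ≤ 1 + |y| := by
        refine (norm_add_le _ _).trans ?_
        simp only [norm_mul, Complex.norm_real, norm_I, mul_one, Real.norm_eq_abs]
        linarith
      rw [e]
      refine (norm_add_le _ _).trans ?_
      nlinarith [abs_nonneg y]
    have h2 := one_add_abs_pow_mul_exp_le 1 y
    simp only [pow_one, Nat.factorial_one, Nat.cast_one, one_mul] at h2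
    calc _ ≤ (2 * (1 + |y|)) * Real.exp (-y ^ 2 / 4) := by
          gcongr
          rw [div_le_iff₀ hd0]; linarith
      _ ≤ 2 * Real.exp 2 := by linarith
      _ ≤ _ := by nlinarith
  · have h1 := h₂ ((σ + x : ℝ) + (t + y : ℝ) * I) (by simp; linarith) (by simp; linarith)
    have hre : ((σ + x : ℝ) + (t + y : ℝ) * I : ℂ).re = σ + x := by simp
    have him : ((σ + x : ℝ) + (t + y : ℝ) * I : ℂ).im = t + y := by simp
    rw [hre, him] at h1
    have hu : 2 + |t + y| ≤ (5 * (1 + |y|)) * T := by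
      have : |t + y| ≤ t + |y| := (abs_add_le _ _).trans (by rw [abs_of_nonneg (by linarith)])
      nlinarith [abs_nonneg y]
    have h5 : 1 ≤ 5 * (1 + |y|) := by linarith [abs_nonneg y]
    have he : 0 ≤ 3 / 2 - (σ + x) := by linarith
    have h3 : (2 + |t + y|) ^ (3 / 2 - (σ + x)) ≤ 25 * (1 + |y|) ^ 2 * T ^ (3 / 2 - (σ + x)) := by
      calc (2 + |t + y|) ^ (3 / 2 - (σ + x)) ≤ ((5 * (1 + |y|)) * T) ^ (3 / 2 - (σ + x)) := by
            gcongr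
        _ = (5 * (1 + |y|)) ^ (3 / 2 - (σ + x)) * T ^ (3 / 2 - (σ + x)) :=
            Real.mul_rpow (by positivity) (by linarith)
        _ ≤ (5 * (1 + |y|)) ^ (2 : ℝ) * T ^ (3 / 2 - (σ + x)) := by
            gcongr; linarith
        _ = _ := by rw [Real.rpow_two]; ring
    have hTT : T ^ (3 / 2 - (σ + x)) = T ^ (1 / 2 - σ - x) * T := by
      rw [← Real.rpow_add_one (by linarith)]; congr 1; ring
    have h2 := one_add_abs_pow_mul_exp_le 2 y
    simp only [Nat.factorial_two, Nat.cast_ofNat] at h2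
    have hT0 : 0 < T := by linarith
    have hTp : 0 < T ^ (1 / 2 - σ - x) := by positivity
    calc ‖chiReg ((σ + x : ℝ) + (t + y : ℝ) * I)‖ / ‖(σ + t * I : ℂ) - 1‖ * Real.exp (-y ^ 2 / 2)
        ≤ (C₂ * (25 * (1 + |y|) ^ 2 * (T ^ (1 / 2 - σ - x) * T))) / (T / 2) * Real.exp (-y ^ 2 / 4) := by
          rw [hTT] at h3
          gcongr
          exact h1.trans (by gcongr)
      _ = 50 * C₂ * T ^ (1 / 2 - σ - x) * ((1 + |y|) ^ 2 * Real.exp (-y ^ 2 / 4)) := by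
          field_simp; ring
      _ ≤ 50 * C₂ * T ^ (1 / 2 - σ - x) * (2 * Real.exp 2) := by gcongr
      _ ≤ _ := by nlinarith [mul_pos hTp (Real.exp_pos 2)]

theorem conj_one_sub_add_mul_I (a u : ℝ) : conj (1 - ((a : ℂ) + u * I)) = ((1 - a : ℝ) : ℂ) + u * I := by
  apply Complex.ext <;> simp

theorem exists_enorm_afe_le : ∃ K > 0, ∀ (T Y σ t : ℝ), 2 ≤ T → 0 < Y → Y ^ 2 = T → T / 2 ≤ t →
    t ≤ 4 * T → 1 / 2 ≤ σ → σ ≤ 5 / 8 →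
    ‖riemannZeta (σ + t * I) - dirPoly ⌊Y⌋₊ (σ + t * I)
        - chi (σ + t * I) * dirPoly ⌊Y⌋₊ (1 - (σ + t * I))‖ₑ ≤
      ENNReal.ofReal K * ((∫⁻ y, (ENNReal.ofReal (Y ^ (3 / 4 : ℝ) *
          ‖riemannZeta ((σ + 3 / 4 : ℝ) + (t + y : ℝ) * I) - dirPoly ⌊Y⌋₊ ((σ + 3 / 4 : ℝ) + (t + y : ℝ) * I)‖)
          + ENNReal.ofReal (Y ^ (1 / 4 - 2 * σ) * ‖dirPoly ⌊Y⌋₊ ((1 / 4 - σ : ℝ) + (t + y : ℝ) * I)‖))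
          ∂(ProbabilityTheory.gaussianReal 0 1))
        + ∫⁻ y, (ENNReal.ofReal (Y ^ (7 / 4 - 2 * σ) *
          ‖riemannZeta ((7 / 4 - σ : ℝ) + (t + y : ℝ) * I) - dirPoly ⌊Y⌋₊ ((7 / 4 - σ : ℝ) + (t + y : ℝ) * I)‖)
          + ENNReal.ofReal (Y ^ (-(3 / 4) : ℝ) * ‖dirPoly ⌊Y⌋₊ ((σ - 3 / 4 : ℝ) + (t + y : ℝ) * I)‖))
          ∂(ProbabilityTheory.gaussianReal 0 1)) := by
  obtain ⟨C, hC, hC'⟩ := exists_norm_chiReg_div_le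
  refine ⟨Real.exp ((3 / 4 : ℝ) ^ 2) / (3 / 4) * C, by positivity, ?_⟩
  intro T Y σ t hT hY hYT ht1 ht2 hσ1 hσ2
  set N := ⌊Y⌋₊ with hN
  set s : ℂ := σ + t * I with hs
  have hs1 : s - 1 ≠ 0 := fun h => by
    have := congrArg Complex.im h
    simp [hs] at this; linarith
  set f : ℂ → ℂ := fun w => afeRem N (s + w) * (Y : ℂ) ^ w / (s - 1) with hf
  have hYc : (Y : ℂ) ≠ 0 := by exact_mod_cast hY.ne'
  have hf0 : f 0 = riemannZeta s - dirPoly N s - chi s * dirPoly N (1 - s) := by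
    simp only [hf, add_zero, Complex.cpow_zero, mul_one]
    rw [afeRem_eq (sub_ne_zero.1 hs1)]
    field_simp
  have hsre : s.re = σ := by simp [hs]
  have hsim : s.im = t := by simp [hs]
  have hnY : ∀ w : ℂ, ‖(Y : ℂ) ^ w‖ = Y ^ w.re := fun w =>
    Complex.norm_cpow_eq_rpow_re_of_pos hY w
  have hdiff : ∀ z : ℂ, -(3 / 4 : ℝ) ≤ z.re → z.re ≤ 3 / 4 → DifferentiableAt ℂ f z := by
    intro z h1 h2
    have e1 : DifferentiableAt ℂ (fun w => afeRem N (s + w)) z :=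
      (differentiableAt_afeRem N (p := s + z) (by rw [add_re, hsre]; linarith)).comp z (by fun_prop)
    exact (e1.mul (differentiableAt_id.const_cpow (Or.inl hYc))).div_const _
  obtain ⟨K, hK0, hK⟩ := exists_norm_afeRem_le N
  have hbd : ∀ z : ℂ, -(3 / 4 : ℝ) ≤ z.re → z.re ≤ 3 / 4 → ‖f z‖ * Real.exp (-z.im ^ 2) ≤
      K * (1 + |t|) ^ 4 * (Y ^ (3 / 4 : ℝ) + Y ^ (-(3 / 4) : ℝ)) / ‖s - 1‖ * ((4).factorial * Real.exp 2) := by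
    intro z h1 h2
    have e1 := hK (s + z) (by rw [add_re, hsre]; linarith) (by rw [add_re, hsre]; linarith)
    rw [add_im, hsim] at e1
    have e2 : 1 + |t + z.im| ≤ (1 + |t|) * (1 + |z.im|) := by
      have := abs_add_le t z.im
      nlinarith [abs_nonneg t, abs_nonneg z.im]
    have e3 : Y ^ z.re ≤ Y ^ (3 / 4 : ℝ) + Y ^ (-(3 / 4) : ℝ) := by
      have p1 : 0 < Y ^ (3 / 4 : ℝ) := by positivity
      have p2 : 0 < Y ^ (-(3 / 4) : ℝ) := by positivity
      rcases le_total 1 Y with h | h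
      · have := Real.rpow_le_rpow_of_exponent_le h h2; linarith
      · have := Real.rpow_le_rpow_of_exponent_ge hY h h1; linarith
    have e4 : Real.exp (-z.im ^ 2) ≤ Real.exp (-z.im ^ 2 / 4) := by
      rw [Real.exp_le_exp]; nlinarith [sq_nonneg z.im]
    have e5 := one_add_abs_pow_mul_exp_le 4 z.im
    simp only [hf, norm_div, norm_mul, hnY]
    have hpos : 0 < ‖s - 1‖ := norm_pos_iff.2 hs1
    calc ‖afeRem N (s + z)‖ * Y ^ z.re / ‖s - 1‖ * Real.exp (-z.im ^ 2)
        ≤ (K * ((1 + |t|) * (1 + |z.im|)) ^ 4) * (Y ^ (3 / 4 : ℝ) + Y ^ (-(3 / 4) : ℝ)) / ‖s - 1‖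
          * Real.exp (-z.im ^ 2 / 4) := by
          gcongr
          exact e1.trans (by gcongr)
      _ = K * (1 + |t|) ^ 4 * (Y ^ (3 / 4 : ℝ) + Y ^ (-(3 / 4) : ℝ)) / ‖s - 1‖ *
          ((1 + |z.im|) ^ 4 * Real.exp (-z.im ^ 2 / 4)) := by ring
      _ ≤ _ := by gcongr
  have hsc := enorm_zero_le_lintegral_strip (a := 3 / 4) (b := 3 / 4) (by norm_num) (by norm_num) hdiff hbd
  rw [hf0] at hsc
  refine hsc.trans ?_
  rw [← mul_add, ENNReal.ofReal_mul (by positivity), mul_assoc]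
  refine mul_le_mul' le_rfl ?_
  rw [mul_add, ← lintegral_const_mul' _ _ ENNReal.ofReal_ne_top, ← lintegral_const_mul' _ _ ENNReal.ofReal_ne_top]
  have hTY : ∀ e : ℝ, T ^ e = Y ^ (2 * e) := fun e => by
    rw [← hYT, ← Real.rpow_natCast, ← Real.rpow_mul hY.le]; norm_num
  refine add_le_add (lintegral_mono fun y => ?_) (lintegral_mono fun y => ?_)
  · obtain ⟨b1, b2⟩ := hC' T σ t (3 / 4) y hT ht1 ht2 hσ1 hσ2 (by norm_num [abs_of_pos])
    rw [← ENNReal.ofReal_add (by positivity) (by positivity), ← ENNReal.ofReal_mul hC.le, ← ofReal_norm,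
      ← ENNReal.ofReal_mul (by positivity)]
    apply ENNReal.ofReal_le_ofReal
    set p : ℂ := (σ + 3 / 4 : ℝ) + (t + y : ℝ) * I with hp
    have hsp : s + ((3 / 4 : ℝ) + y * I) = p := by rw [hs, hp]; push_cast; ring
    have hp1 : p ≠ 1 := fun h => by
      have := congrArg Complex.re h
      simp [hp] at this; linarith
    have hconj : ‖dirPoly N (1 - p)‖ = ‖dirPoly N ((1 / 4 - σ : ℝ) + (t + y : ℝ) * I)‖ := by
      rw [← norm_dirPoly_conj, hp, conj_one_sub_add_mul_I, show 1 - (σ + 3 / 4) = 1 / 4 - σ by ring]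
    simp only [hf]
    rw [hsp, norm_div, norm_mul, hnY, afeRem_eq_right hp1]
    have hre : (((3 / 4 : ℝ) : ℂ) + y * I).re = 3 / 4 := by simp
    rw [hre, ← hconj]
    have hpos : 0 < ‖s - 1‖ := norm_pos_iff.2 hs1
    calc ‖(p - 1) * (riemannZeta p - dirPoly N p) + chiReg p * dirPoly N (1 - p)‖ * Y ^ (3 / 4 : ℝ) / ‖s - 1‖
          * Real.exp (-y ^ 2 / 2)
        ≤ (‖p - 1‖ * ‖riemannZeta p - dirPoly N p‖ + ‖chiReg p‖ * ‖dirPoly N (1 - p)‖) * Y ^ (3 / 4 : ℝ)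
          / ‖s - 1‖ * Real.exp (-y ^ 2 / 2) := by
          gcongr
          refine (norm_add_le _ _).trans ?_
          rw [norm_mul, norm_mul]
      _ = (‖p - 1‖ / ‖s - 1‖ * Real.exp (-y ^ 2 / 2)) * (Y ^ (3 / 4 : ℝ) * ‖riemannZeta p - dirPoly N p‖)
          + (‖chiReg p‖ / ‖s - 1‖ * Real.exp (-y ^ 2 / 2)) * (Y ^ (3 / 4 : ℝ) * ‖dirPoly N (1 - p)‖) := by ring
      _ ≤ C * (Y ^ (3 / 4 : ℝ) * ‖riemannZeta p - dirPoly N p‖)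
          + (C * T ^ (1 / 2 - σ - 3 / 4)) * (Y ^ (3 / 4 : ℝ) * ‖dirPoly N (1 - p)‖) := by gcongr
      _ = _ := by
          have : Y ^ (1 / 4 - 2 * σ) = T ^ (1 / 2 - σ - 3 / 4) * Y ^ (3 / 4 : ℝ) := by
            rw [hTY, ← Real.rpow_add hY]; congr 1; ring
          rw [this]; ring
  · obtain ⟨b1, b2⟩ := hC' T σ t (-(3 / 4)) y hT ht1 ht2 hσ1 hσ2 (by norm_num [abs_of_pos])
    rw [← ENNReal.ofReal_add (by positivity) (by positivity), ← ENNReal.ofReal_mul hC.le, ← ofReal_norm,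
      ← ENNReal.ofReal_mul (by positivity)]
    apply ENNReal.ofReal_le_ofReal
    set p : ℂ := (σ + -(3 / 4) : ℝ) + (t + y : ℝ) * I with hp
    have hsp : s + (-(3 / 4 : ℝ) + y * I) = p := by rw [hs, hp]; push_cast; ring
    have hp0 : p ≠ 0 := fun h => by
      have := congrArg Complex.re h
      simp [hp] at this; linarith
    have hpre : p.re < 1 := by simp [hp]; linarith
    have hconj : ‖riemannZeta (1 - p) - dirPoly N (1 - p)‖ =
        ‖riemannZeta ((7 / 4 - σ : ℝ) + (t + y : ℝ) * I) - dirPoly N ((7 / 4 - σ : ℝ) + (t + y : ℝ) * I)‖ := by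
      rw [← norm_zeta_sub_dirPoly_conj, hp, conj_one_sub_add_mul_I,
        show 1 - (σ + -(3 / 4)) = 7 / 4 - σ by ring]
    have hpe : ((σ - 3 / 4 : ℝ) + (t + y : ℝ) * I : ℂ) = p := by rw [hp, sub_eq_add_neg]
    simp only [hf]
    rw [hsp, norm_div, norm_mul, hnY, afeRem_eq_left hp0 hpre, norm_neg]
    have hre : (-((3 / 4 : ℝ) : ℂ) + y * I).re = -(3 / 4) := by simp
    rw [hre, ← hconj, hpe]
    have hpos : 0 < ‖s - 1‖ := norm_pos_iff.2 hs1
    calc ‖(p - 1) * dirPoly N p + chiReg p * (riemannZeta (1 - p) - dirPoly N (1 - p))‖ * Y ^ (-(3 / 4) : ℝ)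
          / ‖s - 1‖ * Real.exp (-y ^ 2 / 2)
        ≤ (‖p - 1‖ * ‖dirPoly N p‖ + ‖chiReg p‖ * ‖riemannZeta (1 - p) - dirPoly N (1 - p)‖) * Y ^ (-(3 / 4) : ℝ)
          / ‖s - 1‖ * Real.exp (-y ^ 2 / 2) := by
          gcongr
          refine (norm_add_le _ _).trans ?_
          rw [norm_mul, norm_mul]
      _ = (‖p - 1‖ / ‖s - 1‖ * Real.exp (-y ^ 2 / 2)) * (Y ^ (-(3 / 4) : ℝ) * ‖dirPoly N p‖)
          + (‖chiReg p‖ / ‖s - 1‖ * Real.exp (-y ^ 2 / 2)) *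
            (Y ^ (-(3 / 4) : ℝ) * ‖riemannZeta (1 - p) - dirPoly N (1 - p)‖) := by ring
      _ ≤ C * (Y ^ (-(3 / 4) : ℝ) * ‖dirPoly N p‖)
          + (C * T ^ (1 / 2 - σ - -(3 / 4))) *
            (Y ^ (-(3 / 4) : ℝ) * ‖riemannZeta (1 - p) - dirPoly N (1 - p)‖) := by gcongr
      _ = _ := by
          have : Y ^ (7 / 4 - 2 * σ) = T ^ (1 / 2 - σ - -(3 / 4)) * Y ^ (-(3 / 4) : ℝ) := by
            rw [hTY, ← Real.rpow_add hY]; congr 1; ring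
          rw [this]; ring

theorem lintegral_const_mul_pow_le {α : Type*} [MeasurableSpace α] {μ : Measure α} {f : α → ENNReal}
    {c B : ENNReal} (hc : c ≠ ⊤) (k : ℕ) (hB : ∫⁻ x, f x ^ k ∂μ ≤ B) :
    ∫⁻ x, (c * f x) ^ k ∂μ ≤ c ^ k * B := by
  simp only [mul_pow]
  rw [lintegral_const_mul' _ _ (by finiteness)]
  gcongr

theorem measurable_lintegral_shift {ν : Measure ℝ} [SFinite ν] {H : ℝ → ENNReal} (hH : Measurable H) :
    Measurable fun t => ∫⁻ y, H (t + y) ∂ν :=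
  Measurable.lintegral_prod_right' (f := fun z : ℝ × ℝ => H (z.1 + z.2))
    (hH.comp (measurable_fst.add measurable_snd))

theorem continuous_dirPoly_vertical (N : ℕ) (κ : ℝ) :
    Continuous fun u : ℝ => dirPoly N (κ + u * I) :=
  (differentiable_dirPoly N).continuous.comp (by fun_prop)

/-- Fourth moment of `ζ` on and slightly to the right of the critical line. -/
theorem exists_lintegral_zeta_pow_four_le : ∃ C > 0, ∀ T σ : ℝ, 2 ≤ T → 1 / 2 ≤ σ → σ ≤ 5 / 8 →
    ∫⁻ t in Icc (T / 2) (4 * T), ‖riemannZeta (σ + t * I)‖ₑ ^ 4 ≤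
      ENNReal.ofReal (C * (T * (9 + Real.log T) ^ 4)) := by
  obtain ⟨C₀, hC₀, hpieces⟩ := exists_lintegral_pow_four_pieces_le
  obtain ⟨K, hK, hafe⟩ := exists_enorm_afe_le
  obtain ⟨C₁, hC₁, hchi⟩ := exists_norm_chi_le
  have hval : ∃ Z : ℝ, 0 < Z ∧ ∀ M : ℝ, 0 ≤ M →
      2 ^ 4 * (2 ^ 4 * (ENNReal.ofReal (C₀ * M) + ENNReal.ofReal (2 * C₁) ^ 4 * ENNReal.ofReal (C₀ * M))
        + ENNReal.ofReal K ^ 4 * (2 ^ 4 * (2 ^ 4 * (ENNReal.ofReal (C₀ * M) + ENNReal.ofReal (C₀ * M))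
          + 2 ^ 4 * (ENNReal.ofReal (C₀ * M) + ENNReal.ofReal (C₀ * M)))))
      = ENNReal.ofReal (Z * M) := by
    refine ⟨2 ^ 4 * (2 ^ 4 * (C₀ + (2 * C₁) ^ 4 * C₀) +
      K ^ 4 * (2 ^ 4 * (2 ^ 4 * (C₀ + C₀) + 2 ^ 4 * (C₀ + C₀)))), by positivity, fun M hM => ?_⟩
    have h2 : (2 : ENNReal) = ENNReal.ofReal 2 := by simp
    rw [h2]
    simp only [← ENNReal.ofReal_pow (show (0 : ℝ) ≤ 2 by norm_num), ← ENNReal.ofReal_pow hK.le,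
      ← ENNReal.ofReal_pow (show 0 ≤ 2 * C₁ by positivity)]
    repeat
      first
      | rw [← ENNReal.ofReal_mul (by positivity)]
      | rw [← ENNReal.ofReal_add (by positivity) (by positivity)]
    congr 1; ring
  obtain ⟨Z, hZ, hZ'⟩ := hval
  refine ⟨Z, hZ, fun T σ hT hσ1 hσ2 => ?_⟩
  set Y := √T with hYd
  have hT0 : 0 < T := by linarith
  have hYT : Y ^ 2 = T := Real.sq_sqrt hT0.le
  have hY1 : 1 ≤ Y := Real.one_le_sqrt.2 (by linarith)
  have hY0 : 0 < Y := by linarith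
  have hlog : 0 ≤ Real.log T := Real.log_nonneg (by linarith)
  set N := ⌊Y⌋₊ with hN
  set M := T * (9 + Real.log T) ^ 4 with hM
  have hM0 : 0 ≤ M := by positivity
  rw [← hZ' M hM0]
  have hnσ : ∀ n : ℕ, 0 < n → (n : ℝ) ^ (-σ) ≤ (n : ℝ) ^ (-(1 / 2) : ℝ) := fun n hn =>
    Real.rpow_le_rpow_of_exponent_le (by exact_mod_cast hn) (by linarith)
  have hpoly : ∀ c β κ : ℝ, c = Y ^ (-β) → 0 ≤ β → -κ = -σ + β → ∀ x y : ℝ, x ≤ y → y - x ≤ 4 * T →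
      ∫⁻ u in Icc x y, ENNReal.ofReal (c * ‖dirPoly N (κ + u * I)‖) ^ 4 ≤ ENNReal.ofReal (C₀ * M) := by
    intro c β κ hc hβ hκ x y hxy hlen
    rw [hM, ← mul_assoc]
    refine (hpieces T Y hY1 hYT c κ (by rw [hc]; positivity)).1 (fun n hn hnY => ?_) x y hxy hlen
    rw [hc]
    exact (rpow_neg_mul_rpow_le (by exact_mod_cast hn) hnY hβ hκ).trans (hnσ n hn)
  have htail : ∀ c κ : ℝ, 0 ≤ c → 9 / 8 ≤ κ → c ≤ Y ^ (κ - 1 / 2) → ∀ x y : ℝ, x ≤ y → y - x ≤ 4 * T →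
      ∫⁻ u in Icc x y, ENNReal.ofReal (c * ‖riemannZeta (κ + u * I) - dirPoly N (κ + u * I)‖) ^ 4
        ≤ ENNReal.ofReal (C₀ * M) := by
    intro c κ hc hκ hcY x y hxy hlen
    rw [hM, ← mul_assoc]
    exact (hpieces T Y hY1 hYT c κ hc).2 hκ hcY x y hxy hlen
  have hmeas : ∀ c κ : ℝ, Measurable fun u : ℝ => ENNReal.ofReal (c * ‖dirPoly N (κ + u * I)‖) :=
    fun c κ => (((continuous_dirPoly_vertical N κ).norm.const_mul c).measurable).ennreal_ofReal
  have hmeas' : ∀ c κ : ℝ, κ ≠ 1 → Measurable fun u : ℝ =>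
      ENNReal.ofReal (c * ‖riemannZeta (κ + u * I) - dirPoly N (κ + u * I)‖) :=
    fun c κ hκ => ((((continuous_zeta_vertical hκ).sub
      (continuous_dirPoly_vertical N κ)).norm.const_mul c).measurable).ennreal_ofReal
  set H₁ : ℝ → ENNReal := fun u => ENNReal.ofReal (Y ^ (3 / 4 : ℝ) *
      ‖riemannZeta ((σ + 3 / 4 : ℝ) + u * I) - dirPoly N ((σ + 3 / 4 : ℝ) + u * I)‖)
      + ENNReal.ofReal (Y ^ (1 / 4 - 2 * σ) * ‖dirPoly N ((1 / 4 - σ : ℝ) + u * I)‖) with hH₁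
  set H₂ : ℝ → ENNReal := fun u => ENNReal.ofReal (Y ^ (7 / 4 - 2 * σ) *
      ‖riemannZeta ((7 / 4 - σ : ℝ) + u * I) - dirPoly N ((7 / 4 - σ : ℝ) + u * I)‖)
      + ENNReal.ofReal (Y ^ (-(3 / 4) : ℝ) * ‖dirPoly N ((σ - 3 / 4 : ℝ) + u * I)‖) with hH₂
  have hH₁m : Measurable H₁ := (hmeas' _ _ (by linarith)).add (hmeas _ _)
  have hH₂m : Measurable H₂ := (hmeas' _ _ (by linarith)).add (hmeas _ _)
  set B := ENNReal.ofReal (C₀ * M) with hB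
  have hlen : ∀ y : ℝ, 4 * T + y - (T / 2 + y) ≤ 4 * T := fun y => by linarith
  have hle : ∀ y : ℝ, T / 2 + y ≤ 4 * T + y := fun y => by linarith
  have hI₁ := setLIntegral_lintegral_pow_le (ν := ProbabilityTheory.gaussianReal 0 1) hH₁m
    (k := 4) (by norm_num) (x₁ := T / 2) (x₂ := 4 * T) (B := 2 ^ 4 * (B + B)) (fun y =>
      lintegral_add_pow_le (hmeas' _ _ (by linarith)) 4
        (htail _ _ (by positivity) (by linarith)
          (Real.rpow_le_rpow_of_exponent_le hY1 (by linarith)) _ _ (hle y) (hlen y))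
        (hpoly _ (2 * σ - 1 / 4) _ (by congr 1; ring) (by linarith) (by ring) _ _ (hle y) (hlen y)))
  have hI₂ := setLIntegral_lintegral_pow_le (ν := ProbabilityTheory.gaussianReal 0 1) hH₂m
    (k := 4) (by norm_num) (x₁ := T / 2) (x₂ := 4 * T) (B := 2 ^ 4 * (B + B)) (fun y =>
      lintegral_add_pow_le (hmeas' _ _ (by linarith)) 4
        (htail _ _ (by positivity) (by linarith)
          (Real.rpow_le_rpow_of_exponent_le hY1 (by linarith)) _ _ (hle y) (hlen y))
        (hpoly _ (3 / 4) _ rfl (by norm_num) (by ring) _ _ (hle y) (hlen y)))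
  have hA := hpoly 1 0 σ (by simp) le_rfl (by ring) (T / 2) (4 * T) (by linarith) (by linarith)
  have hA' := hpoly (Y ^ (1 - 2 * σ)) (2 * σ - 1) (1 - σ) (by congr 1; ring) (by linarith) (by ring)
    (T / 2) (4 * T) (by linarith) (by linarith)
  have hfin := lintegral_add_pow_le (((hmeas 1 σ).add ((hmeas (Y ^ (1 - 2 * σ)) (1 - σ)).const_mul
      (ENNReal.ofReal (2 * C₁))))) 4
    (lintegral_add_pow_le (hmeas 1 σ) 4 hA (lintegral_const_mul_pow_le
      (c := ENNReal.ofReal (2 * C₁)) ENNReal.ofReal_ne_top 4 hA'))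
    (lintegral_const_mul_pow_le (c := ENNReal.ofReal K) ENNReal.ofReal_ne_top 4
      (lintegral_add_pow_le (measurable_lintegral_shift hH₁m) 4 hI₁ hI₂))
  refine le_trans (setLIntegral_mono' measurableSet_Icc fun t ht => ?_) hfin
  gcongr
  have h1 : riemannZeta (σ + t * I) = (dirPoly N (σ + t * I) + chi (σ + t * I) * dirPoly N (1 - (σ + t * I)))
      + (riemannZeta (σ + t * I) - dirPoly N (σ + t * I)
        - chi (σ + t * I) * dirPoly N (1 - (σ + t * I))) := by ring
  rw [h1]
  refine (enorm_add_le _ _).trans (add_le_add ((enorm_add_le _ _).trans (add_le_add ?_ ?_)) ?_)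
  · beta_reduce
    rw [one_mul, ofReal_norm]
  · beta_reduce
    rw [← ENNReal.ofReal_mul (by positivity), ← ofReal_norm]
    apply ENNReal.ofReal_le_ofReal
    rw [norm_mul, ← norm_dirPoly_conj, conj_one_sub_add_mul_I, ← mul_assoc]
    gcongr
    have h2 := hchi (σ + t * I) (by simp; linarith) (by simp; linarith)
    have ht0 : 0 < t := by linarith [ht.1]
    simp only [add_re, ofReal_re, mul_re, I_re, mul_zero, ofReal_im, I_im, mul_one, sub_self, add_zero,
      add_im, mul_im, zero_add] at h2
    refine h2.trans ?_
    rw [mul_comm 2 C₁, mul_assoc]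
    gcongr
    calc (2 + |t|) ^ (1 / 2 - σ) ≤ (T / 2) ^ (1 / 2 - σ) := by
          apply Real.rpow_le_rpow_of_nonpos (by linarith) _ (by linarith)
          rw [abs_of_pos ht0]; linarith [ht.1]
      _ = 2 ^ (σ - 1 / 2) * T ^ (1 / 2 - σ) := by
          rw [Real.div_rpow hT0.le (by norm_num), div_eq_mul_inv, ← Real.rpow_neg (by norm_num), mul_comm]
          congr 2; ring
      _ ≤ 2 ^ (1 : ℝ) * T ^ (1 / 2 - σ) := by
          gcongr
          · norm_num
          · linarith
      _ = 2 * Y ^ (1 - 2 * σ) := by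
          rw [← hYT, ← Real.rpow_natCast, ← Real.rpow_mul hY0.le, Real.rpow_one]
          congr 2; push_cast; ring
  · exact hafe T Y σ t hT hY0 hYT ht.1 ht.2 hσ1 hσ2

theorem exists_lintegral_zeta_pow_four_near_le : ∃ C > 0, ∀ T σ e : ℝ, 2 ≤ T → 0 ≤ e → e ≤ 1 / 8 →
    1 / 2 - e ≤ σ → σ ≤ 5 / 8 →
    ∫⁻ t in Icc (T / 2) (4 * T), ‖riemannZeta (σ + t * I)‖ₑ ^ 4 ≤
      ENNReal.ofReal (C * (T * (9 + Real.log T) ^ 4 * T ^ (4 * e))) := by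
  obtain ⟨C, hC, h⟩ := exists_lintegral_zeta_pow_four_le
  obtain ⟨C₁, hC₁, hchi⟩ := exists_norm_chi_le
  refine ⟨C + (5 * C₁) ^ 4 * C, by positivity, fun T σ e hT he he' hσ hσ' => ?_⟩
  have hT0 : 0 < T := by linarith
  have hlog : 0 < Real.log T := Real.log_pos (by linarith)
  rcases le_total (1 / 2) σ with h1 | h1
  · refine (h T σ hT h1 hσ').trans (ENNReal.ofReal_le_ofReal ?_)
    have h2 : 1 ≤ T ^ (4 * e) := Real.one_le_rpow (by linarith) (by positivity)
    calc C * (T * (9 + Real.log T) ^ 4) = C * (T * (9 + Real.log T) ^ 4 * 1) := by ring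
      _ ≤ C * (T * (9 + Real.log T) ^ 4 * T ^ (4 * e)) := by gcongr
      _ ≤ _ := by gcongr; linarith [show 0 ≤ (5 * C₁) ^ 4 * C by positivity]
  · have key : ∀ t ∈ Icc (T / 2) (4 * T), ‖riemannZeta (σ + t * I)‖ₑ ≤
        ENNReal.ofReal (5 * C₁ * T ^ e) * ‖riemannZeta ((1 - σ : ℝ) + t * I)‖ₑ := by
      intro t ht
      have ht0 : 0 < t := by linarith [ht.1]
      have hz := zeta_eq_chi_mul (s := σ + t * I) (fun h0 => by
        have := congrArg Complex.im h0
        simp at this; linarith) (by simp; linarith)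
      have hc : (1 - (σ + t * I) : ℂ) = conj ((1 - σ : ℝ) + t * I : ℂ) := by
        simp; ring
      rw [hz, hc, riemannZeta_conj, enorm_mul, ← ofReal_norm (conj _), Complex.norm_conj, ofReal_norm,
        ← ofReal_norm (chi _)]
      gcongr
      have h2 := hchi (σ + t * I) (by simp; linarith) (by simp; linarith)
      simp only [add_re, ofReal_re, mul_re, I_re, mul_zero, ofReal_im, I_im, mul_one, sub_self,
        add_zero, add_im, mul_im, zero_add] at h2
      refine h2.trans ?_
      rw [mul_comm 5 C₁, mul_assoc]
      gcongr
      calc (2 + |t|) ^ (1 / 2 - σ) ≤ (5 * T) ^ (1 / 2 - σ) := by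
            rw [abs_of_pos ht0]
            gcongr
            · linarith [ht.2]
        _ = 5 ^ (1 / 2 - σ) * T ^ (1 / 2 - σ) := Real.mul_rpow (by norm_num) hT0.le
        _ ≤ 5 ^ (1 : ℝ) * T ^ e := by
            gcongr
            · norm_num
            · linarith
            · linarith
            · linarith
        _ = 5 * T ^ e := by rw [Real.rpow_one]
    have h3 := h T (1 - σ) hT (by linarith) (by linarith)
    calc _ ≤ ∫⁻ t in Icc (T / 2) (4 * T),
          (ENNReal.ofReal (5 * C₁ * T ^ e) * ‖riemannZeta ((1 - σ : ℝ) + t * I)‖ₑ) ^ 4 :=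
          setLIntegral_mono' measurableSet_Icc fun t ht => by gcongr; exact key t ht
      _ ≤ _ := lintegral_const_mul_pow_le ENNReal.ofReal_ne_top 4 h3
      _ = ENNReal.ofReal ((5 * C₁) ^ 4 * C * (T * (9 + Real.log T) ^ 4 * T ^ (4 * e))) := by
          rw [← ENNReal.ofReal_pow (by positivity), ← ENNReal.ofReal_mul (by positivity)]
          congr 1
          rw [mul_comm 4 e, Real.rpow_mul hT0.le]
          norm_cast
          ring
      _ ≤ _ := by
          apply ENNReal.ofReal_le_ofReal
          gcongr; linarith

/-- The mollifier: partial sums of the Dirichlet series of `1 / ζ`. -/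
def molPoly (N : ℕ) (s : ℂ) : ℂ :=
  ∑ n ∈ Finset.Icc 1 N, (ArithmeticFunction.moebius n : ℂ) * (n : ℂ) ^ (-s)

theorem norm_moebius_le_one (n : ℕ) : ‖(ArithmeticFunction.moebius n : ℂ)‖ ≤ 1 := by
  rw [Complex.norm_intCast]
  exact_mod_cast ArithmeticFunction.abs_moebius_le_one

theorem differentiable_molPoly (N : ℕ) : Differentiable ℂ (molPoly N) := by
  unfold molPoly
  refine Differentiable.fun_sum fun n hn => ?_
  have hn : (n : ℂ) ≠ 0 := by
    rw [Finset.mem_Icc] at hn; exact_mod_cast (show n ≠ 0 by omega)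
  exact fun s => ((differentiableAt_id.neg).const_cpow (Or.inl hn)).const_mul _

theorem norm_molPoly_le (N : ℕ) {s : ℂ} (hs : 0 ≤ s.re) : ‖molPoly N s‖ ≤ N := by
  unfold molPoly
  refine (norm_sum_le _ _).trans ?_
  calc _ ≤ ∑ n ∈ Finset.Icc 1 N, (1 : ℝ) := by
        refine Finset.sum_le_sum fun n hn => ?_
        rw [Finset.mem_Icc] at hn
        rw [norm_mul, Complex.norm_natCast_cpow_of_pos (by omega)]
        have h1 : ((n : ℝ)) ^ ((-s).re) ≤ 1 :=
          Real.rpow_le_one_of_one_le_of_nonpos (by exact_mod_cast hn.1) (by simpa using hs)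
        calc _ ≤ (1 : ℝ) * 1 := mul_le_mul (norm_moebius_le_one n) h1 (by positivity) (by norm_num)
          _ = 1 := one_mul 1
    _ = N := by simp

theorem norm_zeta_mul_molPoly_sub_one_le {N : ℕ} {s : ℂ} (hs : s.re = 2) :
    ‖riemannZeta s * molPoly N s - 1‖ ≤ 8 / (N + 1) := by
  have hs1 : 1 < s.re := by rw [hs]; norm_num
  have hsum := ArithmeticFunction.LSeriesSummable_moebius_iff.mpr hs1
  have hterm : ∀ n : ℕ, ‖LSeries.term (fun n => (ArithmeticFunction.moebius n : ℂ)) s n‖ ≤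
      ((n : ℝ) ^ 2)⁻¹ := by
    intro n
    rcases Nat.eq_zero_or_pos n with rfl | hn
    · simp
    · rw [LSeries.norm_term_eq, if_neg hn.ne', hs, div_eq_mul_inv]
      rw [show (2 : ℝ) = ((2 : ℕ) : ℝ) by norm_num, Real.rpow_natCast]
      exact mul_le_of_le_one_left (by positivity) (norm_moebius_le_one n)
  have hpart : ∑ n ∈ Finset.range (N + 1),
      LSeries.term (fun n => (ArithmeticFunction.moebius n : ℂ)) s n = molPoly N s := by
    rw [Finset.range_eq_Ico, Finset.sum_eq_sum_Ico_succ_bot (by omega), LSeries.term_zero, zero_add,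
      molPoly]
    refine Finset.sum_congr (by ext; simp) fun n hn => ?_
    have hn0 : n ≠ 0 := by simp at hn; omega
    rw [LSeries.term_of_ne_zero hn0, Complex.cpow_neg, div_eq_mul_inv]
  have hM : ‖LSeries (fun n => (ArithmeticFunction.moebius n : ℂ)) s - molPoly N s‖ ≤
      2 / (N + 1) := by
    have htend := hsum.LSeriesHasSum.tendsto_sum_nat
    refine le_of_tendsto ((htend.sub_const (molPoly N s)).norm) ?_
    filter_upwards [eventually_ge_atTop (N + 1)] with K hK
    rw [← hpart, ← Finset.sum_Ico_eq_sub _ hK]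
    refine (norm_sum_le _ _).trans ((Finset.sum_le_sum fun n _ => hterm n).trans ?_)
    exact sum_Ioo_inv_sq_le N K
  have hz : ‖riemannZeta s‖ ≤ 4 := by
    have h1 := ArithmeticFunction.LSeriesHasSum_zeta hs1
    refine le_of_tendsto h1.tendsto_sum_nat.norm ?_
    filter_upwards with K
    refine (norm_sum_le _ _).trans ?_
    have h2 : ∀ n : ℕ, ‖LSeries.term (fun n => (ArithmeticFunction.zeta n : ℂ)) s n‖ ≤
        ((n : ℝ) ^ 2)⁻¹ := by
      intro n
      rcases Nat.eq_zero_or_pos n with rfl | hn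
      · simp
      · rw [LSeries.norm_term_eq, if_neg hn.ne', hs]
        simp [hn.ne']
    refine (Finset.sum_le_sum fun n _ => h2 n).trans ?_
    rcases Nat.eq_zero_or_pos K with rfl | hK
    · simp
    · have := sum_Ioo_inv_sq_le (α := ℝ) 0 K
      rw [Finset.range_eq_Ico, Finset.sum_eq_sum_Ico_succ_bot hK]
      have h3 : Finset.Ico (0 + 1) K = Finset.Ioo 0 K := by ext; simp; omega
      rw [h3]
      norm_num at this ⊢
      linarith
  have h1 : riemannZeta s * LSeries (fun n => (ArithmeticFunction.moebius n : ℂ)) s = 1 := by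
    rw [← LSeries_one_eq_riemannZeta hs1]
    exact LSeries_one_mul_Lseries_moebius hs1
  rw [← h1, ← mul_sub, norm_mul, norm_sub_rev]
  calc _ ≤ (4 : ℝ) * (2 / (N + 1)) := by gcongr
    _ = _ := by ring

theorem exists_lintegral_molPoly_pow_four_le : ∃ C > 0, ∀ (T σ e : ℝ) (N : ℕ), 2 ≤ T → 0 ≤ e →
    (N : ℝ) ^ 2 ≤ T → 1 / 2 - e ≤ σ → ∀ x y : ℝ, x ≤ y → y - x ≤ 4 * T →
    ∫⁻ t in Icc x y, ‖molPoly N (σ + t * I)‖ₑ ^ 4 ≤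
      ENNReal.ofReal (C * (T * (9 + Real.log T) ^ 4 * T ^ (4 * e))) := by
  obtain ⟨C, hC, h⟩ := exists_integral_norm_tsum_pow_four_le
  refine ⟨C, hC, fun T σ e N hT he hN hσ x y hxy hlen => ?_⟩
  have hT0 : 0 < T := by linarith
  set Y := Real.sqrt T with hY
  have hYT : Y ^ 2 = T := Real.sq_sqrt hT0.le
  have hY1 : 1 ≤ Y := by rw [hY, Real.one_le_sqrt]; linarith
  have hY0 : 0 < Y := by linarith
  have hYleT : Y ≤ T := by nlinarith
  have hNY : (N : ℝ) ≤ Y := Real.le_sqrt_of_sq_le hN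
  set a : ℕ → ℂ := fun n => if n ∈ Finset.Icc 1 N then
    ((T ^ (-e) * (n : ℝ) ^ (-σ) : ℝ) : ℂ) * (ArithmeticFunction.moebius n : ℂ) else 0 with ha
  have hasum : ∀ t : ℝ, ∑' n, a n * (n : ℂ) ^ (-(t * I)) =
      ((T ^ (-e) : ℝ) : ℂ) * molPoly N (σ + t * I) := by
    intro t
    rw [tsum_eq_sum (s := Finset.Icc 1 N) (fun n hn => by simp only [ha]; rw [if_neg hn, zero_mul]),
      molPoly, Finset.mul_sum]
    refine Finset.sum_congr rfl fun n hn => ?_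
    simp only [ha]
    rw [if_pos hn, natCast_cpow_neg_add_mul_I (by rw [Finset.mem_Icc] at hn; omega)]
    push_cast; ring
  have hb : ∀ n : ℕ, 0 < n → ‖a n‖ ≤ (n : ℝ) ^ (-(1 / 2) : ℝ) ∧
      ‖a n‖ ≤ Y ^ (5 / 8 : ℝ) * (n : ℝ) ^ (-(9 / 8) : ℝ) := by
    intro n hn
    have hn' : (1 : ℝ) ≤ n := by exact_mod_cast hn
    have hn0 : (0 : ℝ) < n := by linarith
    simp only [ha]
    split_ifs with hmem
    · have hnY : (n : ℝ) ≤ Y := le_trans (by exact_mod_cast (Finset.mem_Icc.1 hmem).2) hNY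
      have h1 : ‖((T ^ (-e) * (n : ℝ) ^ (-σ) : ℝ) : ℂ) * (ArithmeticFunction.moebius n : ℂ)‖ ≤
          (n : ℝ) ^ (-(1 / 2) : ℝ) := by
        rw [norm_mul, Complex.norm_real, Real.norm_of_nonneg (by positivity)]
        calc _ ≤ T ^ (-e) * (n : ℝ) ^ (-σ) * 1 := by gcongr; exact norm_moebius_le_one n
          _ ≤ (n : ℝ) ^ (-e) * (n : ℝ) ^ (-(1 / 2 - e)) * 1 := by
              gcongr ?_ * ?_ * 1
              · exact Real.rpow_le_rpow_of_nonpos hn0 (hnY.trans hYleT) (by linarith)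
              · exact Real.rpow_le_rpow_of_exponent_le hn' (by linarith)
          _ = _ := by rw [mul_one, ← Real.rpow_add hn0]; congr 1; ring
      refine ⟨h1, h1.trans ?_⟩
      calc (n : ℝ) ^ (-(1 / 2) : ℝ) = (n : ℝ) ^ (5 / 8 : ℝ) * (n : ℝ) ^ (-(9 / 8) : ℝ) := by
            rw [← Real.rpow_add hn0]; norm_num
        _ ≤ _ := by gcongr
    · rw [norm_zero]; constructor <;> positivity
  have := (h T Y a hY1 hYT (by simp [ha]) (fun n hn => (hb n hn).1) (fun n hn => (hb n hn).2)).2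
    x y hxy hlen
  simp only [hasum] at this
  have hcont : Continuous fun t : ℝ => molPoly N (σ + t * I) :=
    (differentiable_molPoly N).continuous.comp (by fun_prop)
  rw [intervalIntegral.integral_of_le hxy, ← integral_Icc_eq_integral_Ioc] at this
  have hTe : T ^ (-e) * T ^ e = 1 := by rw [← Real.rpow_add hT0]; simp
  have h2 : ∫ t in Icc x y, ‖molPoly N (σ + t * I)‖ ^ 4 ≤
      C * (T * (9 + Real.log T) ^ 4 * T ^ (4 * e)) := by
    have h3 : ∀ t : ℝ, ‖molPoly N (σ + t * I)‖ ^ 4 =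
        T ^ (4 * e) * ‖((T ^ (-e) : ℝ) : ℂ) * molPoly N (σ + t * I)‖ ^ 4 := by
      intro t
      rw [norm_mul, Complex.norm_real, Real.norm_of_nonneg (by positivity), mul_comm 4 e,
        Real.rpow_mul hT0.le]
      norm_cast
      rw [← mul_pow, ← mul_assoc, mul_comm (T ^ e), hTe, one_mul]
    simp only [h3]
    rw [integral_const_mul]
    calc _ ≤ T ^ (4 * e) * (C * T * (9 + Real.log T) ^ 4) := by gcongr
      _ = _ := by ring
  refine le_trans (le_of_eq ?_) (ENNReal.ofReal_le_ofReal h2)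
  rw [ofReal_integral_eq_lintegral_ofReal
    (Continuous.continuousOn (by fun_prop) |>.integrableOn_Icc) (ae_of_all _ fun t => by positivity)]
  refine lintegral_congr fun t => ?_
  rw [ENNReal.ofReal_pow (norm_nonneg _), ofReal_norm]

theorem exists_lintegral_zeta_mul_molPoly_sq_le : ∃ C > 0, ∀ (T σ e : ℝ) (N : ℕ), 2 ≤ T → 0 ≤ e →
    e ≤ 1 / 8 → (N : ℝ) ^ 2 ≤ T → 1 / 2 - e ≤ σ → σ ≤ 5 / 8 →
    ∫⁻ t in Icc (T / 2) (4 * T), ‖riemannZeta (σ + t * I) * molPoly N (σ + t * I)‖ₑ ^ 2 ≤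
      ENNReal.ofReal (C * (T * (9 + Real.log T) ^ 4 * T ^ (4 * e))) := by
  obtain ⟨C₁, hC₁, h₁⟩ := exists_lintegral_zeta_pow_four_near_le
  obtain ⟨C₂, hC₂, h₂⟩ := exists_lintegral_molPoly_pow_four_le
  refine ⟨C₁ + C₂, by positivity, fun T σ e N hT he he' hN hσ hσ' => ?_⟩
  have hT0 : 0 < T := by linarith
  have hlog : 0 < Real.log T := Real.log_pos (by linarith)
  have hm : Measurable fun t : ℝ => ‖molPoly N (σ + t * I)‖ₑ ^ 4 :=
    ((differentiable_molPoly N).continuous.comp (by fun_prop)).enorm.measurable.pow_const 4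
  calc _ ≤ ∫⁻ t in Icc (T / 2) (4 * T), (‖riemannZeta (σ + t * I)‖ₑ ^ 4 +
          ‖molPoly N (σ + t * I)‖ₑ ^ 4) := by
        refine lintegral_mono fun t => ?_
        rw [enorm_mul, mul_pow]
        rcases le_total (‖riemannZeta (σ + t * I)‖ₑ) (‖molPoly N (σ + t * I)‖ₑ) with h | h
        · refine le_add_left ?_
          calc _ ≤ ‖molPoly N (σ + t * I)‖ₑ ^ 2 * ‖molPoly N (σ + t * I)‖ₑ ^ 2 := by gcongr
            _ = _ := by ring
        · refine le_add_right ?_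
          calc _ ≤ ‖riemannZeta (σ + t * I)‖ₑ ^ 2 * ‖riemannZeta (σ + t * I)‖ₑ ^ 2 := by gcongr
            _ = _ := by ring
    _ = _ := lintegral_add_right _ hm
    _ ≤ _ := add_le_add (h₁ T σ e hT he he' hσ hσ')
        (h₂ T σ e N hT he hN hσ _ _ (by linarith) (by linarith))
    _ = _ := by rw [← ENNReal.ofReal_add (by positivity) (by positivity)]; congr 1; ring

/-- The mollified zeta function on the critical line, restricted to a dyadic window. -/
def molWindow (T : ℝ) (N : ℕ) (u : ℝ) : ENNReal :=
  1 + (Icc (T / 2) (4 * T)).indicator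
    (fun u : ℝ => ‖riemannZeta ((1 / 2 : ℝ) + u * I) * molPoly N ((1 / 2 : ℝ) + u * I)‖ₑ) u

theorem continuous_zeta_mul_molPoly {σ : ℝ} (hσ : σ ≠ 1) (N : ℕ) :
    Continuous fun u : ℝ => riemannZeta (σ + u * I) * molPoly N (σ + u * I) :=
  (continuous_zeta_vertical hσ).mul ((differentiable_molPoly N).continuous.comp (by fun_prop))

theorem measurable_molWindow (T : ℝ) (N : ℕ) : Measurable (molWindow T N) :=
  measurable_const.add ((continuous_zeta_mul_molPoly (by norm_num) N).enorm.measurable.indicator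
    measurableSet_Icc)

theorem exists_enorm_molPoly_left_le : ∃ K > 0, ∀ (T t y : ℝ) (N : ℕ) (p q : ℂ), 1 ≤ T →
    (N : ℝ) ^ 2 ≤ T → 3 * T / 4 ≤ t → t ≤ 3 * T → p = (1 / 2 : ℝ) + (t + y : ℝ) * I → 1 ≤ ‖q‖ →
    ‖p - 1 - q‖ ≤ 1 + |y| →
    ‖(riemannZeta₁ p * molPoly N p - (p - 1)) / q‖ₑ * ENNReal.ofReal (Real.exp (-y ^ 2 / 2)) ≤
      ENNReal.ofReal K * molWindow T N (t + y) := by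
  obtain ⟨C, hC, hz⟩ := exists_norm_riemannZeta₁_le
  refine ⟨2 * (Real.exp 2) + (C * 15 ^ 4 * 4 * ((5 : ℕ).factorial * Real.exp 2)
    + 15 * (Real.exp 2)), by positivity, fun T t y N p q hT hN ht1 ht2 hp hq hpq => ?_⟩
  have hq0 : 0 < ‖q‖ := by linarith
  have hp1 : p ≠ 1 := fun h => by
    rw [hp] at h
    have := congrArg Complex.re h
    norm_num at this
  have hexp : Real.exp (-y ^ 2 / 2) ≤ Real.exp (-y ^ 2 / 4) := by
    apply Real.exp_le_exp.2; nlinarith [sq_nonneg y]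
  have hr1 : ‖p - 1‖ / ‖q‖ ≤ 2 * (1 + |y|) := by
    rw [div_le_iff₀ hq0]
    have h1 : ‖p - 1‖ ≤ ‖p - 1 - q‖ + ‖q‖ := by
      simpa using norm_add_le (p - 1 - q) q
    nlinarith [abs_nonneg y]
  have he1 : (1 + |y|) * Real.exp (-y ^ 2 / 4) ≤ Real.exp 2 := by
    simpa using one_add_abs_pow_mul_exp_le 1 y
  have he5 := one_add_abs_pow_mul_exp_le 5 y
  have hre : p.re = 1 / 2 := by rw [hp]; simp
  have hfac : riemannZeta₁ p * molPoly N p - (p - 1) =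
      (p - 1) * (riemannZeta p * molPoly N p - 1) := by
    rw [riemannZeta₁_eq hp1]; ring
  by_cases hy : |y| ≤ T / 4
  · have hmem : t + y ∈ Icc (T / 2) (4 * T) := by
      have := abs_le.1 hy
      constructor <;> linarith
    have hw : molWindow T N (t + y) = ENNReal.ofReal (1 + ‖riemannZeta p * molPoly N p‖) := by
      rw [molWindow, indicator_of_mem hmem, ENNReal.ofReal_add (by norm_num) (by positivity),
        ofReal_norm, hp, ENNReal.ofReal_one]
    rw [hw, ← ofReal_norm, ← ENNReal.ofReal_mul (by positivity), ← ENNReal.ofReal_mul (by positivity)]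
    apply ENNReal.ofReal_le_ofReal
    rw [hfac, norm_div, norm_mul, mul_div_right_comm]
    have h2 : ‖riemannZeta p * molPoly N p - 1‖ ≤ 1 + ‖riemannZeta p * molPoly N p‖ := by
      have := norm_sub_le (riemannZeta p * molPoly N p) 1
      rw [norm_one] at this; linarith
    calc _ ≤ (2 * (1 + |y|)) * (1 + ‖riemannZeta p * molPoly N p‖) * Real.exp (-y ^ 2 / 4) := by
          gcongr
      _ = 2 * ((1 + |y|) * Real.exp (-y ^ 2 / 4)) * (1 + ‖riemannZeta p * molPoly N p‖) := by ring
      _ ≤ 2 * (Real.exp 2) * (1 + ‖riemannZeta p * molPoly N p‖) := by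
          gcongr
      _ ≤ _ := by
          gcongr
          linarith [show 0 ≤ C * 15 ^ 4 * 4 * ((5 : ℕ).factorial * Real.exp 2)
            + 15 * (Real.exp 2) by positivity]
  · push Not at hy
    have hNT : (N : ℝ) ≤ T := by
      rcases Nat.eq_zero_or_pos N with rfl | h0
      · simp; linarith
      · have : (1 : ℝ) ≤ N := by exact_mod_cast h0
        nlinarith
    have hpn : ‖p‖ ≤ 1 / 2 + 13 * |y| := by
      rw [hp]
      refine (norm_add_le _ _).trans ?_
      rw [norm_mul, Complex.norm_I, mul_one, Complex.norm_real, Complex.norm_real, Real.norm_eq_abs,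
        Real.norm_eq_abs]
      have h1 : |t + y| ≤ |t| + |y| := abs_add_le t y
      rw [abs_of_nonneg (show 0 ≤ t by linarith)] at h1
      rw [abs_of_pos (by norm_num : (0:ℝ) < 1 / 2)]
      linarith
    have hnum : ‖riemannZeta₁ p * molPoly N p - (p - 1)‖ ≤
        C * (15 * (1 + |y|)) ^ 4 * (4 * (1 + |y|)) + 15 * (1 + |y|) := by
      refine (norm_sub_le _ _).trans (add_le_add ?_ ?_)
      · rw [norm_mul]
        gcongr
        · refine (hz p (by rw [hre]; norm_num)).trans ?_
          gcongr
          linarith [abs_nonneg y]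
        · exact (norm_molPoly_le N (by rw [hre]; norm_num)).trans (by linarith)
      · have := norm_sub_le p 1
        rw [norm_one] at this
        linarith [abs_nonneg y]
    have hone : (1 : ENNReal) ≤ molWindow T N (t + y) := le_self_add
    calc _ ≤ ENNReal.ofReal (2 * (Real.exp 2) + (C * 15 ^ 4 * 4 * ((5 : ℕ).factorial * Real.exp 2)
          + 15 * (Real.exp 2))) * 1 := by
          rw [mul_one, ← ofReal_norm, ← ENNReal.ofReal_mul (by positivity)]
          apply ENNReal.ofReal_le_ofReal
          calc _ ≤ (C * (15 * (1 + |y|)) ^ 4 * (4 * (1 + |y|)) + 15 * (1 + |y|)) *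
                Real.exp (-y ^ 2 / 4) := by
                rw [norm_div]
                gcongr
                exact (div_le_self (norm_nonneg _) hq).trans hnum
            _ = C * 15 ^ 4 * 4 * ((1 + |y|) ^ 5 * Real.exp (-y ^ 2 / 4)) +
                15 * ((1 + |y|) * Real.exp (-y ^ 2 / 4)) := by ring
            _ ≤ C * 15 ^ 4 * 4 * ((5 : ℕ).factorial * Real.exp 2)
                + 15 * (Real.exp 2) := by
                gcongr
            _ ≤ _ := by linarith [Real.exp_pos 2]
      _ ≤ _ := by gcongr

theorem enorm_molPoly_right_le {y : ℝ} {N : ℕ} {p q : ℂ} (hp : p.re = 2) (hq : 1 ≤ ‖q‖)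
    (hpq : ‖p - 1 - q‖ ≤ 2 + |y|) :
    ‖(riemannZeta₁ p * molPoly N p - (p - 1)) / q‖ * Real.exp (-y ^ 2 / 2) ≤
      24 * Real.exp 2 / (N + 1) := by
  have hq0 : 0 < ‖q‖ := by linarith
  have hp1 : p ≠ 1 := fun h => by rw [h] at hp; norm_num at hp
  have hexp : Real.exp (-y ^ 2 / 2) ≤ Real.exp (-y ^ 2 / 4) := by
    apply Real.exp_le_exp.2; nlinarith [sq_nonneg y]
  have hr1 : ‖p - 1‖ / ‖q‖ ≤ 3 * (1 + |y|) := by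
    rw [div_le_iff₀ hq0]
    have h1 : ‖p - 1‖ ≤ ‖p - 1 - q‖ + ‖q‖ := by
      simpa using norm_add_le (p - 1 - q) q
    nlinarith [abs_nonneg y]
  have he1 : (1 + |y|) * Real.exp (-y ^ 2 / 4) ≤ Real.exp 2 := by
    simpa using one_add_abs_pow_mul_exp_le 1 y
  have hfac : riemannZeta₁ p * molPoly N p - (p - 1) =
      (p - 1) * (riemannZeta p * molPoly N p - 1) := by
    rw [riemannZeta₁_eq hp1]; ring
  rw [hfac, norm_div, norm_mul, mul_div_right_comm]
  calc _ ≤ (3 * (1 + |y|)) * (8 / (N + 1)) * Real.exp (-y ^ 2 / 4) := by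
        gcongr; exact norm_zeta_mul_molPoly_sub_one_le hp
    _ = 24 / (N + 1) * ((1 + |y|) * Real.exp (-y ^ 2 / 4)) := by ring
    _ ≤ 24 / (N + 1) * (Real.exp 2) := by gcongr
    _ = _ := by ring

theorem exists_enorm_zeta_mul_molPoly_sub_one_le : ∃ K > 0, ∀ (T η σ t : ℝ) (N : ℕ), 2 ≤ T →
    0 < η → η ≤ 1 / 8 → 1 ≤ N → (N : ℝ) ^ 2 ≤ T → 1 / 2 + η ≤ σ → σ ≤ 3 / 2 → 3 * T / 4 ≤ t →
    t ≤ 3 * T →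
    ‖riemannZeta (σ + t * I) * molPoly N (σ + t * I) - 1‖ₑ ≤
      ENNReal.ofReal (K * η⁻¹ * (N : ℝ) ^ (-η / 2)) *
        ∫⁻ y, molWindow T N (t + y) ∂(ProbabilityTheory.gaussianReal 0 1) := by
  obtain ⟨C, hC, hz⟩ := exists_norm_riemannZeta₁_le
  obtain ⟨K₁, hK₁, hleft⟩ := exists_enorm_molPoly_left_le
  refine ⟨2 * Real.exp 3 * (24 * Real.exp 2) + Real.exp 3 * K₁, by positivity, ?_⟩
  intro T η σ t N hT hη hη' hN hNT hσ hσ' ht ht'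
  set s : ℂ := σ + t * I with hs
  have hN0 : (0 : ℝ) < N := by exact_mod_cast hN
  have hN1 : (1 : ℝ) ≤ N := by exact_mod_cast hN
  have hlogN : 0 ≤ Real.log N := Real.log_nonneg hN1
  have hsre : s.re = σ := by simp [hs]
  have hsim : s.im = t := by simp [hs]
  have hs1 : 1 ≤ ‖s - 1‖ := by
    have := Complex.abs_im_le_norm (s - 1)
    rw [sub_im, hsim, one_im, sub_zero] at this
    linarith [le_abs_self t]
  have hsne : s - 1 ≠ 0 := by
    intro h; rw [h, norm_zero] at hs1; linarith
  set f : ℂ → ℂ := fun w => (riemannZeta₁ (s + w) * molPoly N (s + w) - (s + w - 1)) / (s - 1) *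
    Complex.exp (w * (Real.log N / 2 : ℝ)) with hf
  have hnexp : ∀ w : ℂ, ‖Complex.exp (w * (Real.log N / 2 : ℝ))‖ = (N : ℝ) ^ (w.re / 2) := by
    intro w
    rw [Complex.norm_exp, Complex.re_mul_ofReal, Real.rpow_def_of_pos hN0]
    congr 1; ring
  have hf0 : f 0 = riemannZeta s * molPoly N s - 1 := by
    simp only [hf, add_zero, zero_mul, Complex.exp_zero, mul_one]
    rw [riemannZeta₁_eq (sub_ne_zero.1 hsne)]
    field_simp
  have hdiff : Differentiable ℂ f := by
    have h1 := differentiable_riemannZeta₁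
    have h2 := differentiable_molPoly N
    simp only [hf]
    fun_prop
  have hgrow : ∀ z : ℂ, -(σ - 1 / 2) ≤ z.re → z.re ≤ 2 - σ → ‖f z‖ * Real.exp (-z.im ^ 2) ≤
      (C * (4 + ‖s‖) ^ 4 * N + (4 + ‖s‖)) * (N : ℝ) ^ (1 : ℝ) * ((4 : ℕ).factorial * Real.exp 2) := by
    intro z h1 h2
    have he4 := one_add_abs_pow_mul_exp_le 4 z.im
    have hzn : ‖z‖ ≤ 2 + |z.im| := by
      refine (Complex.norm_le_abs_re_add_abs_im z).trans ?_
      have : |z.re| ≤ 2 := abs_le.2 ⟨by linarith, by linarith⟩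
      linarith
    have hsz : 1 + ‖s + z‖ ≤ (4 + ‖s‖) * (1 + |z.im|) := by
      have := norm_add_le s z
      nlinarith [abs_nonneg z.im, norm_nonneg s]
    have hp1 : (1 : ℝ) ≤ (1 + |z.im|) := by linarith [abs_nonneg z.im]
    have hnum : ‖riemannZeta₁ (s + z) * molPoly N (s + z) - (s + z - 1)‖ ≤
        (C * (4 + ‖s‖) ^ 4 * N + (4 + ‖s‖)) * (1 + |z.im|) ^ 4 := by
      refine (norm_sub_le _ _).trans ?_
      rw [add_mul]
      refine add_le_add ?_ ?_
      · rw [norm_mul]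
        calc _ ≤ C * ((4 + ‖s‖) * (1 + |z.im|)) ^ 4 * N := by
              gcongr
              · exact (hz _ (by rw [add_re, hsre]; linarith)).trans (by gcongr)
              · exact norm_molPoly_le N (by rw [add_re, hsre]; linarith)
          _ = _ := by ring
      · have h3 := norm_sub_le (s + z) 1
        rw [norm_one] at h3
        calc _ ≤ (4 + ‖s‖) * (1 + |z.im|) := by linarith
          _ ≤ _ := by gcongr; exact le_self_pow₀ hp1 (by norm_num)
    have hexp : Real.exp (-z.im ^ 2) ≤ Real.exp (-z.im ^ 2 / 4) := by
      apply Real.exp_le_exp.2; nlinarith [sq_nonneg z.im]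
    calc ‖f z‖ * Real.exp (-z.im ^ 2)
        ≤ ((C * (4 + ‖s‖) ^ 4 * N + (4 + ‖s‖)) * (1 + |z.im|) ^ 4) * (N : ℝ) ^ (1 : ℝ) *
          Real.exp (-z.im ^ 2 / 4) := by
          simp only [hf]
          rw [norm_mul, norm_div, hnexp]
          gcongr
          · exact (div_le_self (norm_nonneg _) hs1).trans hnum
          · linarith
      _ = (C * (4 + ‖s‖) ^ 4 * N + (4 + ‖s‖)) * (N : ℝ) ^ (1 : ℝ) *
          ((1 + |z.im|) ^ 4 * Real.exp (-z.im ^ 2 / 4)) := by ring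
      _ ≤ _ := by gcongr
  have hSC := enorm_zero_le_lintegral_strip (f := f) (a := 2 - σ) (b := σ - 1 / 2) (by linarith)
    (by linarith) (fun z _ _ => hdiff z) hgrow
  rw [hf0] at hSC
  refine hSC.trans ?_
  have hone : ∀ u, (1 : ENNReal) ≤ molWindow T N u := fun u => le_self_add
  have hR : ∀ y : ℝ, ‖f ((2 - σ : ℝ) + y * I)‖ₑ * ENNReal.ofReal (Real.exp (-y ^ 2 / 2)) ≤
      ENNReal.ofReal (24 * Real.exp 2 * (N : ℝ) ^ (-η / 2)) * molWindow T N (t + y) := by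
    intro y
    refine le_trans ?_ (le_mul_of_one_le_right (by positivity) (hone _))
    rw [← ofReal_norm, ← ENNReal.ofReal_mul (by positivity)]
    apply ENNReal.ofReal_le_ofReal
    have hre : (s + ((2 - σ : ℝ) + y * I)).re = 2 := by simp [hs]
    have h1 := enorm_molPoly_right_le (y := y) (N := N) hre hs1 (by
      have : s + ((2 - σ : ℝ) + y * I) - 1 - (s - 1) = (2 - σ : ℝ) + y * I := by ring
      rw [this]
      refine (norm_add_le _ _).trans ?_
      rw [norm_mul, Complex.norm_I, mul_one, Complex.norm_real, Complex.norm_real, Real.norm_eq_abs,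
        Real.norm_eq_abs, abs_of_pos (by linarith)]
      linarith)
    simp only [hf]
    rw [norm_mul, hnexp, mul_right_comm]
    calc _ ≤ 24 * Real.exp 2 / (N + 1) * (N : ℝ) ^ ((3 / 4 : ℝ)) := by
          gcongr ?_ * ?_
          refine Real.rpow_le_rpow_of_exponent_le hN1 ?_
          simp; linarith
      _ ≤ 24 * Real.exp 2 / N * (N : ℝ) ^ ((3 / 4 : ℝ)) := by gcongr; linarith
      _ = 24 * Real.exp 2 * (N : ℝ) ^ (-(1 / 4) : ℝ) := by
          rw [div_mul_eq_mul_div, mul_div_assoc, ← Real.rpow_sub_one hN0.ne']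
          norm_num
      _ ≤ _ := by
          gcongr
          linarith
  have hL : ∀ y : ℝ, ‖f (-(σ - 1 / 2 : ℝ) + y * I)‖ₑ * ENNReal.ofReal (Real.exp (-y ^ 2 / 2)) ≤
      ENNReal.ofReal (K₁ * (N : ℝ) ^ (-η / 2)) * molWindow T N (t + y) := by
    intro y
    have hp : s + (-(σ - 1 / 2 : ℝ) + y * I) = (1 / 2 : ℝ) + (t + y : ℝ) * I := by
      rw [hs]; push_cast; ring
    have h1 := hleft T t y N _ (s - 1) (by linarith) hNT ht ht' hp hs1 (by
      have : s + (-(σ - 1 / 2 : ℝ) + y * I) - 1 - (s - 1) = (-(σ - 1 / 2) : ℝ) + y * I := by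
        push_cast; ring
      rw [this]
      refine (norm_add_le _ _).trans ?_
      rw [norm_mul, Complex.norm_I, mul_one, Complex.norm_real, Complex.norm_real, Real.norm_eq_abs,
        Real.norm_eq_abs, abs_neg, abs_of_pos (by linarith)]
      linarith)
    have h2 : ‖Complex.exp ((-(σ - 1 / 2 : ℝ) + y * I) * (Real.log N / 2 : ℝ))‖ₑ ≤
        ENNReal.ofReal ((N : ℝ) ^ (-η / 2)) := by
      rw [← ofReal_norm, hnexp]
      apply ENNReal.ofReal_le_ofReal
      apply Real.rpow_le_rpow_of_exponent_le hN1
      simp; linarith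
    simp only [hf]
    rw [enorm_mul, mul_right_comm, ENNReal.ofReal_mul hK₁.le, mul_right_comm (ENNReal.ofReal K₁)]
    exact mul_le_mul' h1 h2
  have hm : Measurable fun y => molWindow T N (t + y) :=
    (measurable_molWindow T N).comp (measurable_const_add t)
  have hIR := lintegral_mono (μ := ProbabilityTheory.gaussianReal 0 1) hR
  have hIL := lintegral_mono (μ := ProbabilityTheory.gaussianReal 0 1) hL
  rw [lintegral_const_mul _ hm] at hIR hIL
  have hηi : 1 ≤ η⁻¹ := (one_le_inv₀ hη).2 (by linarith)
  have hca : Real.exp ((2 - σ) ^ 2) / (2 - σ) ≤ 2 * Real.exp 3 * η⁻¹ := by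
    calc _ ≤ Real.exp 3 / (1 / 2) := by
          gcongr
          · nlinarith
          · linarith
      _ = 2 * Real.exp 3 * 1 := by ring
      _ ≤ _ := by gcongr
  have hcb : Real.exp ((σ - 1 / 2) ^ 2) / (σ - 1 / 2) ≤ Real.exp 3 * η⁻¹ := by
    rw [← div_eq_mul_inv]
    gcongr
    · nlinarith
    · linarith
  push_cast at hIR hIL ⊢
  calc _ ≤ ENNReal.ofReal (2 * Real.exp 3 * η⁻¹) * (ENNReal.ofReal (24 * Real.exp 2 * (N : ℝ) ^ (-η / 2)) *
          ∫⁻ y, molWindow T N (t + y) ∂(ProbabilityTheory.gaussianReal 0 1)) +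
        ENNReal.ofReal (Real.exp 3 * η⁻¹) * (ENNReal.ofReal (K₁ * (N : ℝ) ^ (-η / 2)) *
          ∫⁻ y, molWindow T N (t + y) ∂(ProbabilityTheory.gaussianReal 0 1)) := by
        gcongr
    _ = _ := by
        rw [← mul_assoc, ← mul_assoc, ← add_mul, ← ENNReal.ofReal_mul (by positivity),
          ← ENNReal.ofReal_mul (by positivity), ← ENNReal.ofReal_add (by positivity) (by positivity)]
        congr 2; ring

theorem exists_lintegral_zeta_mul_molPoly_sub_one_sq_le : ∃ C > 0, ∀ (T η σ : ℝ) (N : ℕ), 2 ≤ T →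
    0 < η → η ≤ 1 / 8 → 1 ≤ N → (N : ℝ) ^ 2 ≤ T → 1 / 2 + η ≤ σ → σ ≤ 3 / 2 →
    ∫⁻ t in Icc (3 * T / 4) (3 * T), ‖riemannZeta (σ + t * I) * molPoly N (σ + t * I) - 1‖ₑ ^ 2 ≤
      ENNReal.ofReal (C * (T * (9 + Real.log T) ^ 4 * (η⁻¹ ^ 2 * (N : ℝ) ^ (-η)))) := by
  obtain ⟨K, hK, hpt⟩ := exists_enorm_zeta_mul_molPoly_sub_one_le
  obtain ⟨C, hC, hm⟩ := exists_lintegral_zeta_mul_molPoly_sq_le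
  refine ⟨K ^ 2 * (2 ^ 2 * (3 + C)), by positivity, fun T η σ N hT hη hη' hN hNT hσ hσ' => ?_⟩
  have hlog : 0 < Real.log T := Real.log_pos (by linarith)
  have hN0 : (0 : ℝ) < N := by exact_mod_cast hN
  have hB : ∀ y, ∫⁻ u in Icc (3 * T / 4 + y) (3 * T + y), molWindow T N u ^ 2 ≤
      2 ^ 2 * (ENNReal.ofReal (3 * T) + ENNReal.ofReal (C * (T * (9 + Real.log T) ^ 4))) := by
    intro y
    refine lintegral_add_pow_le measurable_const 2 ?_ ?_
    · simp only [one_pow, lintegral_one, Measure.restrict_apply_univ, Real.volume_Icc]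
      apply ENNReal.ofReal_le_ofReal; linarith
    · have h1 := hm T (1 / 2) 0 N hT le_rfl (by norm_num) hNT (by norm_num) (by norm_num)
      rw [mul_zero, Real.rpow_zero, mul_one] at h1
      refine le_trans ?_ h1
      rw [← lintegral_indicator measurableSet_Icc (fun t : ℝ =>
        ‖riemannZeta ((1 / 2 : ℝ) + t * I) * molPoly N ((1 / 2 : ℝ) + t * I)‖ₑ ^ 2)]
      refine (setLIntegral_le_lintegral _ _).trans (lintegral_mono fun u => ?_)
      by_cases hu : u ∈ Icc (T / 2) (4 * T)
      · rw [indicator_of_mem hu, indicator_of_mem hu]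
      · rw [indicator_of_notMem hu]; simp
  have h2 := setLIntegral_lintegral_pow_le (ν := ProbabilityTheory.gaussianReal 0 1)
    (measurable_molWindow T N) (k := 2) (by norm_num) hB
  calc _ ≤ ∫⁻ t in Icc (3 * T / 4) (3 * T), (ENNReal.ofReal (K * η⁻¹ * (N : ℝ) ^ (-η / 2)) *
        ∫⁻ y, molWindow T N (t + y) ∂(ProbabilityTheory.gaussianReal 0 1)) ^ 2 :=
        setLIntegral_mono' measurableSet_Icc fun t ht => by
          gcongr; exact hpt T η σ t N hT hη hη' hN hNT hσ hσ' ht.1 ht.2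
    _ ≤ _ := lintegral_const_mul_pow_le ENNReal.ofReal_ne_top 2 h2
    _ = ENNReal.ofReal ((K * η⁻¹ * (N : ℝ) ^ (-η / 2)) ^ 2 *
          (2 ^ 2 * (3 * T + C * (T * (9 + Real.log T) ^ 4)))) := by
        rw [← ENNReal.ofReal_add (by positivity) (by positivity), ← ENNReal.ofReal_pow (by positivity),
          ENNReal.ofReal_mul (by positivity), ENNReal.ofReal_mul (by positivity)]
        norm_num
    _ ≤ _ := by
        apply ENNReal.ofReal_le_ofReal
        have h4 : ((N : ℝ) ^ (-η / 2)) ^ 2 = (N : ℝ) ^ (-η) := by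
          rw [← Real.rpow_natCast, ← Real.rpow_mul hN0.le]; congr 1; push_cast; ring
        have h5 : T ≤ T * (9 + Real.log T) ^ 4 :=
          le_mul_of_one_le_right (by linarith) (one_le_pow₀ (by linarith))
        calc _ = K ^ 2 * (η⁻¹ ^ 2 * (N : ℝ) ^ (-η)) * (2 ^ 2 * (3 * T + C * (T * (9 + Real.log T) ^ 4))) := by
              rw [mul_pow, mul_pow, h4]; ring
          _ ≤ K ^ 2 * (η⁻¹ ^ 2 * (N : ℝ) ^ (-η)) * (2 ^ 2 * (3 * (T * (9 + Real.log T) ^ 4) +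
              C * (T * (9 + Real.log T) ^ 4))) := by gcongr
          _ = _ := by ring

theorem enorm_mul_two_pi_le_lintegral_circle {g : ℂ → ℂ} {c : ℂ} {R r : ℝ} (hr : 0 < r) (hrR : r < R)
    (hg : DifferentiableOn ℂ g (Metric.ball c R)) :
    ‖g c‖ₑ * ENNReal.ofReal (2 * π) ≤ ∫⁻ θ in Ioo (-π) π, ‖g (circleMap c r θ)‖ₑ := by
  have h1 : DiffContOnCl ℂ g (Metric.ball c |r|) := by
    rw [abs_of_pos hr]
    refine ⟨hg.mono (Metric.ball_subset_ball hrR.le), ?_⟩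
    rw [closure_ball _ hr.ne']
    exact hg.continuousOn.mono (Metric.closedBall_subset_ball hrR)
  have h2 := h1.circleAverage
  rw [Real.circleAverage_eq_integral_add (-π), intervalIntegral.integral_comp_add_right
    (fun θ => g (circleMap c r θ)), show (0 : ℝ) + -π = -π by ring,
    show 2 * π + -π = π by ring] at h2
  have hpi := Real.pi_pos
  have h3 : ‖∫ θ in (-π)..π, g (circleMap c r θ)‖ₑ = ‖g c‖ₑ * ENNReal.ofReal (2 * π) := by
    rw [← h2, enorm_smul, ← ofReal_norm ((2 * π)⁻¹ : ℝ), Real.norm_of_nonneg (by positivity),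
      mul_right_comm, ← ENNReal.ofReal_mul (by positivity), inv_mul_cancel₀ (by positivity),
      ENNReal.ofReal_one, one_mul]
  rw [← h3, intervalIntegral.integral_of_le (by linarith), integral_Ioc_eq_integral_Ioo]
  exact enorm_integral_le_lintegral_enorm _

theorem enorm_mul_area_le_lintegral_ball {g : ℂ → ℂ} (hm : Measurable g) {c : ℂ} {R : ℝ} (hR : 0 < R)
    (hg : DifferentiableOn ℂ g (Metric.ball c R)) :
    ‖g c‖ₑ * ENNReal.ofReal (π * R ^ 2) ≤ ∫⁻ z in Metric.ball c R, ‖g z‖ₑ := by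
  set F : ℂ → ENNReal := fun z => (Metric.ball c R).indicator (fun z => ‖g z‖ₑ) (c + z) with hF
  have hFm : Measurable F :=
    (hm.enorm.indicator measurableSet_ball).comp (measurable_const_add c)
  have h1 : ∫⁻ z in Metric.ball c R, ‖g z‖ₑ = ∫⁻ z, F z := by
    rw [← lintegral_indicator measurableSet_ball, hF, lintegral_add_left_eq_self]
  have hpol : ∀ p : ℝ × ℝ, c + Complex.polarCoord.symm p = circleMap c p.1 p.2 := by
    intro p
    rw [Complex.polarCoord_symm_apply, circleMap, Complex.exp_mul_I]
    push_cast; ring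
  have hpm : Measurable fun p : ℝ × ℝ => ENNReal.ofReal p.1 • F (Complex.polarCoord.symm p) := by
    have : Measurable fun p : ℝ × ℝ => Complex.polarCoord.symm p := by
      simp only [Complex.polarCoord_symm_apply]
      fun_prop
    exact (measurable_fst.ennreal_ofReal).smul (hFm.comp this)
  rw [h1, ← Complex.lintegral_comp_polarCoord_symm, polarCoord_target,
    Measure.volume_eq_prod, ← Measure.prod_restrict, lintegral_prod _ hpm.aemeasurable]
  have h2 : ∫⁻ r in Ioo 0 R, ENNReal.ofReal r * (‖g c‖ₑ * ENNReal.ofReal (2 * π)) =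
      ‖g c‖ₑ * ENNReal.ofReal (π * R ^ 2) := by
    rw [lintegral_mul_const _ (by fun_prop)]
    have h3 : ∫⁻ r in Ioo 0 R, ENNReal.ofReal r = ENNReal.ofReal (R ^ 2 / 2) := by
      rw [← ofReal_integral_eq_lintegral_ofReal]
      · rw [← integral_Ioc_eq_integral_Ioo, ← intervalIntegral.integral_of_le hR.le, integral_id]
        congr 1; ring
      · exact (continuous_id.integrableOn_Icc).mono_set Ioo_subset_Icc_self
      · filter_upwards [ae_restrict_mem measurableSet_Ioo] with r hr using hr.1.le
    rw [h3, mul_left_comm, ← ENNReal.ofReal_mul (by positivity)]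
    congr 2; ring
  rw [← h2]
  refine le_trans ?_ (lintegral_mono_set (s := Ioo 0 R) Ioo_subset_Ioi_self)
  refine setLIntegral_mono' measurableSet_Ioo fun r hr => ?_
  simp only [smul_eq_mul]
  rw [lintegral_const_mul' _ _ ENNReal.ofReal_ne_top]
  gcongr
  refine (enorm_mul_two_pi_le_lintegral_circle hr.1 hr.2 hg).trans (le_of_eq ?_)
  refine lintegral_congr fun θ => ?_
  simp only [hF]
  rw [hpol, indicator_of_mem]
  rw [Metric.mem_ball, dist_eq_norm, circleMap_sub_center, norm_circleMap_zero, abs_of_pos hr.1]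
  exact hr.2

theorem setLIntegral_ball_le_rect {G : ℂ → ENNReal} (hG : Measurable G) {c : ℂ} {R a b u v : ℝ}
    (ha : a ≤ c.re - R) (hb : c.re + R ≤ b) (hu : u ≤ c.im - R) (hv : c.im + R ≤ v) :
    ∫⁻ z in Metric.ball c R, G z ≤ ∫⁻ σ in Icc a b, ∫⁻ t in Icc u v, G (σ + t * I) := by
  have hm : Measurable fun p : ℝ × ℝ => G (p.1 + p.2 * I) := hG.comp (by fun_prop)
  rw [← lintegral_prod (μ := volume.restrict (Icc a b)) (ν := volume.restrict (Icc u v))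
    (fun p : ℝ × ℝ => G (p.1 + p.2 * I)) hm.aemeasurable, Measure.prod_restrict,
    ← Measure.volume_eq_prod]
  rw [← (Complex.volume_preserving_equiv_real_prod.symm).setLIntegral_comp_preimage
    measurableSet_ball hG]
  refine (lintegral_mono_set (t := Icc a b ×ˢ Icc u v) ?_).trans (le_of_eq ?_)
  · intro p hp
    rw [mem_preimage, Metric.mem_ball, dist_eq_norm] at hp
    have h1 := (Complex.abs_re_le_norm _).trans_lt hp
    have h2 := (Complex.abs_im_le_norm _).trans_lt hp
    simp only [Complex.measurableEquivRealProd_symm_apply, sub_re, sub_im] at h1 h2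
    rw [abs_lt] at h1 h2
    exact ⟨⟨by linarith, by linarith⟩, ⟨by linarith, by linarith⟩⟩
  · refine lintegral_congr fun p => ?_
    simp only [Complex.measurableEquivRealProd_symm_apply]
    congr 1
    apply Complex.ext <;> simp

/-- Sub-mean-value inequality for the square of a holomorphic function over a rectangle. -/
theorem enorm_sq_mul_area_le_lintegral_rect {f : ℂ → ℂ} (hm : Measurable f) {c : ℂ} {R a b u v : ℝ}
    (hR : 0 < R) (hf : DifferentiableOn ℂ f (Metric.ball c R))
    (ha : a ≤ c.re - R) (hb : c.re + R ≤ b) (hu : u ≤ c.im - R) (hv : c.im + R ≤ v) :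
    ‖f c‖ₑ ^ 2 * ENNReal.ofReal (π * R ^ 2) ≤
      ∫⁻ σ in Icc a b, ∫⁻ t in Icc u v, ‖f (σ + t * I)‖ₑ ^ 2 := by
  have h1 := enorm_mul_area_le_lintegral_ball (g := fun z => f z ^ 2) (hm.pow_const 2) hR (hf.pow 2)
  simp only [enorm_pow] at h1
  exact h1.trans (setLIntegral_ball_le_rect (hm.enorm.pow_const 2) ha hb hu hv)

/-- Jensen's bound for the number of zeros in a disc, counted with multiplicity. -/
theorem sum_mult_le_of_jensen {f : ℂ → ℂ} {c : ℂ} {r R M : ℝ} (hr : 0 < r) (hrR : r < R) (hM : 1 ≤ M)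
    (hf : AnalyticOnNhd ℂ f (Metric.closedBall c R)) (hc : f c ≠ 0)
    (hbound : ∀ z ∈ Metric.sphere c R, ‖f z‖ ≤ M) (F : Finset ℂ) (m : ℂ → ℕ)
    (hF : ∀ ρ ∈ F, ρ ∈ Metric.closedBall c r ∧ (m ρ : ℕ∞) ≤ analyticOrderAt f ρ) :
    ∑ ρ ∈ F, (m ρ : ℝ) ≤ Real.log (M / ‖f c‖) / Real.log (R / r) := by
  have hR : 0 < R := hr.trans hrR
  have hJ := AnalyticOnNhd.sum_divisor_le (f := f) (c := c) (r := r) (R := R) (M := M)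
    (by rwa [abs_of_pos hr]) (by rwa [abs_of_pos hr, abs_of_pos hR]) hM
    (by rwa [abs_of_pos hR]) hc (by rwa [abs_of_pos hR])
  rw [abs_of_pos hr] at hJ
  refine le_trans ?_ hJ
  have hsub : Metric.closedBall c r ⊆ Metric.closedBall c R := Metric.closedBall_subset_closedBall hrR.le
  have hf' : AnalyticOnNhd ℂ f (Metric.closedBall c r) := hf.mono hsub
  set D := MeromorphicOn.divisor f (Metric.closedBall c r) with hD
  have hfin : (Function.support D).Finite := D.finiteSupport (isCompact_closedBall c r)
  have hnn : ∀ z, 0 ≤ D z := fun z => (MeromorphicOn.AnalyticOnNhd.divisor_nonneg hf') z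
  have hle : ∀ ρ ∈ F, (m ρ : ℤ) ≤ D ρ := by
    intro ρ hρ
    obtain ⟨h1, h2⟩ := hF ρ hρ
    have hne : analyticOrderAt f ρ ≠ ⊤ := by
      refine hf'.analyticOrderAt_ne_top_of_isPreconnected
        (convex_closedBall c r).isPreconnected (x := c) (Metric.mem_closedBall_self hr.le) h1 ?_
      rw [(hf' c (Metric.mem_closedBall_self hr.le)).analyticOrderAt_eq_zero.2 hc]
      simp
    rw [hD, MeromorphicOn.AnalyticOnNhd.divisor_apply hf' h1]
    obtain ⟨n, hn⟩ := ENat.ne_top_iff_exists.1 hne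
    rw [← hn] at h2 ⊢
    have h3 : m ρ ≤ n := by exact_mod_cast h2
    simp
    exact_mod_cast h3
  have h1 : ∑ ρ ∈ F, (m ρ : ℤ) ≤ ∑ᶠ u, D u := by
    classical
    rw [finsum_eq_sum_of_support_subset (s := hfin.toFinset ∪ F) _ (by
      intro x hx; simp; exact Or.inl hx)]
    refine (Finset.sum_le_sum hle).trans ?_
    exact Finset.sum_le_sum_of_subset_of_nonneg Finset.subset_union_right fun z _ _ => hnn z
  exact_mod_cast h1

theorem analyticOnNhd_zeta : AnalyticOnNhd ℂ riemannZeta {1}ᶜ := by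
  intro s hs
  exact (DifferentiableOn.analyticAt (s := {1}ᶜ)
    (fun z hz => (differentiableAt_riemannZeta hz).differentiableWithinAt)
    (isOpen_compl_singleton.mem_nhds hs))

theorem analyticOrderAt_zeta_ne_top {ρ : ℂ} (hρ : ρ ≠ 1) : analyticOrderAt riemannZeta ρ ≠ ⊤ := by
  refine analyticOnNhd_zeta.analyticOrderAt_ne_top_of_isPreconnected (x := 2)
    (isConnected_compl_singleton_of_one_lt_rank (by simp) 1).isPreconnected (by norm_num) hρ ?_
  rw [(analyticOnNhd_zeta 2 (by norm_num)).analyticOrderAt_eq_zero.2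
    (riemannZeta_ne_zero_of_one_le_re (by norm_num))]
  simp

theorem analyticOrderAt_zeta_eq {ρ : ℂ} (hρ : ρ ≠ 1) :
    analyticOrderAt riemannZeta ρ = zetaMult ρ := by
  obtain ⟨n, hn⟩ := ENat.ne_top_iff_exists.1 (analyticOrderAt_zeta_ne_top hρ)
  have h := (analyticOrderAt_eq_nat_iff_iteratedDeriv_eq_zero (analyticOnNhd_zeta ρ hρ)).1 hn.symm
  rw [← hn]
  congr 1
  rw [zetaMult]
  refine le_antisymm ?_ (Nat.sInf_le h.2)
  refine le_csInf ⟨n, h.2⟩ fun k hk => ?_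
  by_contra hlt
  exact hk (h.1 k (not_le.1 hlt))

theorem iteratedDeriv_zeta_conj (n : ℕ) (s : ℂ) :
    iteratedDeriv n riemannZeta (conj s) = conj (iteratedDeriv n riemannZeta s) := by
  induction n generalizing s with
  | zero => simp [riemannZeta_conj]
  | succ n ih =>
    rw [iteratedDeriv_succ]
    have h : (conj ∘ (iteratedDeriv n riemannZeta) ∘ conj : ℂ → ℂ) = iteratedDeriv n riemannZeta := by
      funext z
      simp [ih]
    conv_lhs => rw [← h]
    rw [deriv_conj_conj]
    simp

theorem zetaMult_conj (ρ : ℂ) : zetaMult (conj ρ) = zetaMult ρ := by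
  simp [zetaMult, iteratedDeriv_zeta_conj]

theorem sin_pi_mul_ne_zero_of_strip {s : ℂ} (h0 : 0 < s.re) (h1 : s.re < 1) : Complex.sin (π * s) ≠ 0 := by
  rw [Complex.sin_ne_zero_iff]
  intro k hk
  have h2 : s = k := by
    have : (π : ℂ) * s = π * k := by rw [hk]; ring
    exact mul_left_cancel₀ pi_ne_zero_complex this
  rw [h2] at h0 h1
  simp at h0 h1
  have h3 : (k : ℤ) < 1 := by exact_mod_cast h1
  have h4 : (0 : ℤ) < k := by exact_mod_cast h0
  omega

theorem chi_ne_zero {s : ℂ} (h0 : 0 < s.re) (h1 : s.re < 1) : chi s ≠ 0 := by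
  intro h
  have := chi_mul_chi_one_sub (sin_pi_mul_ne_zero_of_strip h0 h1)
  rw [h, zero_mul] at this
  exact zero_ne_one this

theorem analyticAt_chi {s : ℂ} (h1 : s.re < 1) : AnalyticAt ℂ chi s := by
  refine DifferentiableOn.analyticAt (s := {z : ℂ | z.re < 1})
    (fun z hz => (differentiableAt_chi hz).differentiableWithinAt)
    ((isOpen_lt Complex.continuous_re continuous_const).mem_nhds h1)

theorem zetaMult_one_sub {ρ : ℂ} (h0 : 0 < ρ.re) (h1 : ρ.re < 1) :
    zetaMult (1 - ρ) = zetaMult ρ := by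
  have hρ0 : ρ ≠ 0 := by rintro rfl; simp at h0
  have hρ1 : ρ ≠ 1 := by rintro rfl; simp at h1
  have hρ' : 1 - ρ ≠ 1 := by simpa using hρ0
  have heq : riemannZeta =ᶠ[nhds ρ] chi * (riemannZeta ∘ fun s => 1 - s) := by
    filter_upwards [isOpen_compl_singleton.mem_nhds (show ρ ∈ ({0}ᶜ : Set ℂ) from hρ0),
      (isOpen_lt Complex.continuous_re continuous_const).mem_nhds h1] with s hs hs1
    exact zeta_eq_chi_mul hs hs1
  have hg : AnalyticAt ℂ (fun s : ℂ => 1 - s) ρ := by fun_prop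
  have hz : AnalyticAt ℂ riemannZeta (1 - ρ) := analyticOnNhd_zeta _ hρ'
  have h := analyticOrderAt_congr heq
  rw [analyticOrderAt_mul (analyticAt_chi h1) (hz.comp_of_eq hg rfl),
    (analyticAt_chi h1).analyticOrderAt_eq_zero.2 (chi_ne_zero h0 h1), zero_add,
    analyticOrderAt_comp_of_deriv_ne_zero hg (by simp),
    analyticOrderAt_zeta_eq hρ1, analyticOrderAt_zeta_eq hρ'] at h
  exact_mod_cast h.symm

theorem isNontrivialZero_one_sub_conj {ρ : ℂ} (h : IsNontrivialZero ρ) :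
    IsNontrivialZero (1 - conj ρ) := by
  obtain ⟨hz, h0, h1⟩ := h
  have hs0 : conj ρ ≠ 0 := by
    intro h; rw [map_eq_zero] at h; rw [h] at h0; simp at h0
  refine ⟨?_, by simpa using h1, by simpa using h0⟩
  have h2 := zeta_eq_chi_mul hs0 (by simpa using h1)
  rw [riemannZeta_conj, hz, map_zero] at h2
  exact (mul_eq_zero.1 h2.symm).resolve_left (chi_ne_zero (by simpa using h0) (by simpa using h1))

theorem zetaMult_one_sub_conj {ρ : ℂ} (h : IsNontrivialZero ρ) :
    zetaMult (1 - conj ρ) = zetaMult ρ := by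
  rw [zetaMult_one_sub (by simpa using h.2.1) (by simpa using h.2.2), zetaMult_conj]

theorem finite_zeros (a b : ℝ) : {ρ : ℂ | IsNontrivialZero ρ ∧ a < ρ.im ∧ ρ.im ≤ b}.Finite := by
  refine ((isCompact_Icc (a := (0 : ℝ)) (b := 1)).reProdIm (isCompact_Icc (a := a) (b := b))
    |>.inter_riemannZetaZeros_finite).subset ?_
  rintro ρ ⟨⟨hz, h0, h1⟩, ha, hb⟩
  exact ⟨⟨⟨h0.le, h1.le⟩, ⟨ha.le, hb⟩⟩, hz⟩

/-- The nontrivial zeros of zeta with ordinate in `(a, b]`. -/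
def zeroFinset (a b : ℝ) : Finset ℂ := (finite_zeros a b).toFinset

theorem mem_zeroFinset {a b : ℝ} {ρ : ℂ} :
    ρ ∈ zeroFinset a b ↔ IsNontrivialZero ρ ∧ a < ρ.im ∧ ρ.im ≤ b := by
  simp [zeroFinset]

theorem tsum_zeros_eq (T : ℝ) (w : ℂ → ℝ) :
    ∑' ρ : {ρ : ℂ // IsNontrivialZero ρ ∧ 0 < ρ.im ∧ ρ.im ≤ T}, w ρ.1 =
      ∑ ρ ∈ zeroFinset 0 T, w ρ := by
  rw [← Finset.tsum_subtype]
  refine (Equiv.subtypeEquivRight fun ρ => ?_).tsum_eq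
    (fun ρ : {ρ : ℂ // ρ ∈ zeroFinset 0 T} => w ρ.1)
  rw [mem_zeroFinset]

theorem sum_zeroFinset_add {a b c : ℝ} (hab : a ≤ b) (hbc : b ≤ c) (w : ℂ → ℝ) :
    ∑ ρ ∈ zeroFinset a c, w ρ = ∑ ρ ∈ zeroFinset a b, w ρ + ∑ ρ ∈ zeroFinset b c, w ρ := by
  classical
  rw [← Finset.sum_union]
  · congr 1
    ext ρ
    simp only [Finset.mem_union, mem_zeroFinset]
    constructor
    · rintro ⟨h1, h2, h3⟩
      rcases le_or_gt ρ.im b with h | h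
      · exact Or.inl ⟨h1, h2, h⟩
      · exact Or.inr ⟨h1, h, h3⟩
    · rintro (⟨h1, h2, h3⟩ | ⟨h1, h2, h3⟩)
      · exact ⟨h1, h2, h3.trans hbc⟩
      · exact ⟨h1, hab.trans_lt h2, h3⟩
  · rw [Finset.disjoint_left]
    intro ρ h1 h2
    rw [mem_zeroFinset] at h1 h2
    linarith [h1.2.2, h2.2.1]

/-- The contribution of the zeros to the left of the critical line equals that of the zeros to the
right of it, while the zeros on the line do not contribute at all. -/
theorem sum_zeros_eq_two_mul (a b : ℝ) :
    ∑ ρ ∈ zeroFinset a b, (zetaMult ρ : ℝ) * ‖riemannZeta (1/2 + ρ.im * I)‖ ^ 2 =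
      2 * ∑ ρ ∈ (zeroFinset a b).filter (fun ρ => 1/2 < ρ.re),
        (zetaMult ρ : ℝ) * ‖riemannZeta (1/2 + ρ.im * I)‖ ^ 2 := by
  set w : ℂ → ℝ := fun ρ => (zetaMult ρ : ℝ) * ‖riemannZeta (1/2 + ρ.im * I)‖ ^ 2 with hw
  have hinv : ∀ ρ : ℂ, 1 - conj (1 - conj ρ) = ρ := fun ρ => by simp
  have h1 : ∑ ρ ∈ (zeroFinset a b).filter (fun ρ => ¬ 1/2 < ρ.re), w ρ =
      ∑ ρ ∈ (zeroFinset a b).filter (fun ρ => 1/2 < ρ.re), w ρ := by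
    have h2 : ∑ ρ ∈ (zeroFinset a b).filter (fun ρ => ¬ 1/2 < ρ.re), w ρ =
        ∑ ρ ∈ (zeroFinset a b).filter (fun ρ => ρ.re < 1/2), w ρ := by
      symm
      refine Finset.sum_subset (fun ρ hρ => ?_) fun ρ hρ hn => ?_
      · rw [Finset.mem_filter] at hρ ⊢
        exact ⟨hρ.1, by linarith [hρ.2]⟩
      · rw [Finset.mem_filter] at hρ hn
        have h3 : ρ.re = 1/2 := by
          by_contra h
          exact hn ⟨hρ.1, lt_of_le_of_ne (not_lt.1 hρ.2) h⟩
        have h4 : (1/2 + ρ.im * I : ℂ) = ρ := by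
          apply Complex.ext <;> simp [h3]
        simp only [hw]
        rw [h4, (mem_zeroFinset.1 hρ.1).1.1]
        simp
    rw [h2]
    refine Finset.sum_nbij' (fun ρ => 1 - conj ρ) (fun ρ => 1 - conj ρ) ?_ ?_ ?_ ?_ ?_
    · intro ρ hρ
      rw [Finset.mem_filter, mem_zeroFinset] at hρ ⊢
      refine ⟨⟨isNontrivialZero_one_sub_conj hρ.1.1, by simpa using hρ.1.2⟩, ?_⟩
      simp; linarith [hρ.2]
    · intro ρ hρ
      rw [Finset.mem_filter, mem_zeroFinset] at hρ ⊢
      refine ⟨⟨isNontrivialZero_one_sub_conj hρ.1.1, by simpa using hρ.1.2⟩, ?_⟩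
      simp; linarith [hρ.2]
    · intro ρ _; exact hinv ρ
    · intro ρ _; exact hinv ρ
    · intro ρ hρ
      rw [Finset.mem_filter, mem_zeroFinset] at hρ
      simp only [hw]
      rw [zetaMult_one_sub_conj hρ.1.1]
      simp
  rw [← Finset.sum_filter_add_sum_filter_not _ (fun ρ : ℂ => 1/2 < ρ.re), h1]
  ring

theorem measurable_zeta : Measurable riemannZeta :=
  measurable_of_continuousOn_compl_singleton 1 fun _ hz =>
    (differentiableAt_riemannZeta hz).continuousAt.continuousWithinAt

theorem norm_zeta_two_ge {s : ℂ} (hs : s.re = 2) : 1 / 30 ≤ ‖riemannZeta s‖ := by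
  have h1 := norm_zeta_mul_molPoly_sub_one_le (N := 15) hs
  have h2 : ‖molPoly 15 s‖ ≤ 15 := by exact_mod_cast norm_molPoly_le 15 (by linarith)
  have h3 : (1 : ℝ) ≤ ‖riemannZeta s * molPoly 15 s‖ + ‖riemannZeta s * molPoly 15 s - 1‖ := by
    have := norm_sub_le (riemannZeta s * molPoly 15 s) (riemannZeta s * molPoly 15 s - 1)
    simpa using this
  rw [norm_mul] at h3
  have h4 : ‖riemannZeta s‖ * ‖molPoly 15 s‖ ≤ ‖riemannZeta s‖ * 15 := by gcongr
  norm_num at h1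
  linarith

/-- The number of zeros near height `t` is `O(log t)`. -/
theorem exists_sum_mult_le_log : ∃ C : ℝ, 0 < C ∧ ∀ t : ℝ, 4 ≤ t → ∀ F : Finset ℂ,
    (∀ ρ ∈ F, IsNontrivialZero ρ ∧ 1/2 < ρ.re ∧ |ρ.im - t| ≤ 1) →
      ∑ ρ ∈ F, (zetaMult ρ : ℝ) ≤ C * Real.log t := by
  obtain ⟨C, hC, hb⟩ := exists_norm_riemannZeta₁_le
  have hlog : 0 < Real.log (1.9 / 1.81) := Real.log_pos (by norm_num)
  refine ⟨(|Real.log ((C + 1) * 81 * 30)| + 4) / Real.log (1.9 / 1.81), by positivity, ?_⟩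
  intro t ht F hF
  have hlt : 1 ≤ Real.log t := by
    rw [Real.le_log_iff_exp_le (by linarith)]
    linarith [Real.exp_one_lt_d9]
  set c : ℂ := 2 + t * I with hc
  have hcre : c.re = 2 := by simp [hc]
  have hcim : c.im = t := by simp [hc]
  have hball : ∀ z ∈ Metric.closedBall c 1.9, 0.1 ≤ z.re ∧ z.re ≤ 4 ∧ t - 1.9 ≤ z.im ∧ z.im ≤ t + 1.9 := by
    intro z hz
    rw [Metric.mem_closedBall, dist_eq_norm] at hz
    have h1 := abs_le.1 ((Complex.abs_re_le_norm _).trans hz)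
    have h2 := abs_le.1 ((Complex.abs_im_le_norm _).trans hz)
    rw [sub_re, hcre] at h1
    rw [sub_im, hcim] at h2
    exact ⟨by linarith, by linarith, by linarith, by linarith⟩
  have hne : ∀ z ∈ Metric.closedBall c 1.9, z ≠ 1 := by
    rintro z hz rfl
    have := (hball _ hz).2.2.1
    simp at this
    linarith
  have hζc := norm_zeta_two_ge hcre
  have hJ := sum_mult_le_of_jensen (f := riemannZeta) (c := c) (r := 1.81) (R := 1.9)
    (M := (C + 1) * (3 * t) ^ 4) (by norm_num) (by norm_num) ?_
    (fun z hz => analyticOnNhd_zeta z (hne z hz)) ?_ ?_ F zetaMult ?_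
  · refine hJ.trans ?_
    rw [div_mul_eq_mul_div]
    gcongr
    have h1 : (C + 1) * (3 * t) ^ 4 / ‖riemannZeta c‖ ≤ ((C + 1) * 81 * 30) * t ^ 4 := by
      rw [div_le_iff₀ (by linarith)]
      have : (C + 1) * (3 * t) ^ 4 = ((C + 1) * 81 * 30) * t ^ 4 * (1 / 30) := by ring
      rw [this]
      gcongr
    refine (Real.log_le_log (by positivity) h1).trans ?_
    rw [Real.log_mul (by positivity) (by positivity), Real.log_pow]
    have h2 := (le_abs_self (Real.log ((C + 1) * 81 * 30))).trans
      (le_mul_of_one_le_right (abs_nonneg _) hlt)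
    push_cast
    linarith
  · have : (1 : ℝ) ≤ (3 * t) ^ 4 := one_le_pow₀ (by linarith)
    nlinarith
  · intro h; rw [h] at hζc; norm_num at hζc
  · intro z hz
    have hz' := Metric.sphere_subset_closedBall hz
    obtain ⟨h1, h2, h3, h4⟩ := hball z hz'
    have h5 := hb z (by linarith)
    rw [riemannZeta₁_eq (hne z hz'), norm_mul] at h5
    have h6 : 1 ≤ ‖z - 1‖ := by
      have := Complex.abs_im_le_norm (z - 1)
      rw [sub_im, one_im, sub_zero] at this
      exact le_trans (by linarith) ((le_abs_self _).trans this)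
    have h7 : ‖z‖ ≤ 3 * t - 1 := by
      refine (Complex.norm_le_abs_re_add_abs_im z).trans ?_
      rw [abs_of_nonneg (by linarith), abs_of_nonneg (by linarith)]
      linarith
    calc ‖riemannZeta z‖ ≤ ‖z - 1‖ * ‖riemannZeta z‖ := le_mul_of_one_le_left (norm_nonneg _) h6
      _ ≤ _ := h5
      _ ≤ (C + 1) * (3 * t) ^ 4 := by
        gcongr
        · linarith
        · linarith
  · intro ρ hρ
    obtain ⟨⟨hz, h0, h1⟩, h2, h3⟩ := hF ρ hρ
    constructor
    · rw [Metric.mem_closedBall, dist_eq_norm, Complex.norm_def]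
      refine Real.sqrt_le_iff.2 ⟨by norm_num, ?_⟩
      rw [Complex.normSq_apply, sub_re, sub_im, hcre, hcim]
      have h4 : (ρ.im - t) ^ 2 ≤ 1 := by
        rw [← sq_abs]; exact pow_le_one₀ (abs_nonneg _) h3
      nlinarith
    · rw [analyticOrderAt_zeta_eq]
      rintro rfl; simp at h1

theorem enorm_sq_le_of_mul_area_le {x : ℂ} {r y : ℝ} (hr : 0 < r)
    (h : ‖x‖ₑ ^ 2 * ENNReal.ofReal (π * r ^ 2) ≤ ENNReal.ofReal (y * r ^ 2)) (hy : 0 ≤ y) :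
    ‖x‖ ^ 2 ≤ y / 3 := by
  have hpi := Real.pi_gt_three
  rw [← ofReal_norm, ← ENNReal.ofReal_pow (norm_nonneg _),
    ← ENNReal.ofReal_mul (by positivity), ENNReal.ofReal_le_ofReal_iff (by positivity)] at h
  have h2 : 0 < r ^ 2 := by positivity
  have h3 : ‖x‖ ^ 2 * π ≤ y := by
    by_contra hlt
    nlinarith
  nlinarith [sq_nonneg ‖x‖]

/-- If the mollified zeta function is close to `1` in mean square to the right of the critical
line and not too large near it, then there are few zeros nearby. -/
theorem sum_mult_le_of_lintegral_le {N : ℕ} {η t M : ℝ} (hη : 0 < η) (hη' : η ≤ 1 / 20) (ht : 4 ≤ t)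
    (hM : 1 ≤ M)
    (h2 : ∫⁻ σ in Icc (1/2 + η) (3/2), ∫⁻ v in Icc (t - 1) (t + 1),
      ‖riemannZeta (σ + v * I) * molPoly N (σ + v * I) - 1‖ₑ ^ 2 ≤ ENNReal.ofReal (η ^ 2 / 4))
    (h1 : ∫⁻ σ in Icc (1/2 - η) (1/2 + 9 * η), ∫⁻ v in Icc (t - 1) (t + 1),
      ‖riemannZeta (σ + v * I) * molPoly N (σ + v * I)‖ₑ ^ 2 ≤ ENNReal.ofReal (M ^ 2 * η ^ 2 / 4))
    (F : Finset ℂ) (hF : ∀ ρ ∈ F, IsNontrivialZero ρ ∧ 1/2 < ρ.re ∧ |ρ.im - t| ≤ η / 10) :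
    ∑ ρ ∈ F, (zetaMult ρ : ℝ) ≤ Real.log (2 * M) / Real.log (45 / 41) := by
  set f : ℂ → ℂ := fun s => riemannZeta s * molPoly N s with hf
  have hfm : Measurable f := measurable_zeta.mul (differentiable_molPoly N).continuous.measurable
  have hfa : AnalyticOnNhd ℂ f {1}ᶜ := fun z hz =>
    (analyticOnNhd_zeta z hz).mul ((differentiable_molPoly N).analyticAt z)
  have hfd : ∀ (z : ℂ) (r : ℝ), r ≤ 1 → 3 ≤ z.im → DifferentiableOn ℂ f (Metric.ball z r) := by
    intro z r hr hz w hw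
    refine (hfa w ?_).differentiableAt.differentiableWithinAt
    rintro rfl
    rw [Metric.mem_ball, dist_eq_norm] at hw
    have := (Complex.abs_im_le_norm _).trans_lt hw
    rw [sub_im, one_im, zero_sub, abs_neg] at this
    linarith [le_abs_self z.im]
  have key2 : ∀ z : ℂ, 1/2 + 2 * η ≤ z.re → z.re + η ≤ 3/2 → |z.im - t| ≤ η / 10 →
      ‖f z - 1‖ ^ 2 ≤ 1 / 12 := by
    intro z hz1 hz2 hz3
    have h4 := abs_le.1 hz3
    have h3 := enorm_sq_mul_area_le_lintegral_rect (f := fun s => f s - 1) (c := z) (R := η)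
      (a := 1/2 + η) (b := 3/2) (u := t - 1) (v := t + 1) (hfm.sub_const 1) hη
      ((hfd z η (by linarith) (by linarith)).sub_const 1) (by linarith) (by linarith)
      (by linarith) (by linarith)
    have := enorm_sq_le_of_mul_area_le (y := 1 / 4) hη
      (h3.trans (h2.trans (le_of_eq (by congr 1; ring)))) (by norm_num)
    linarith
  set c : ℂ := 1/2 + 4 * η + t * I with hc
  have hcre : c.re = 1/2 + 4 * η := by simp [hc]
  have hcim : c.im = t := by simp [hc]
  have hfc : 1 / 2 ≤ ‖f c‖ := by
    have h3 := key2 c (by linarith) (by linarith) (by rw [hcim]; simp; positivity)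
    have h4 : ‖f c - 1‖ ≤ 1 / 2 := by
      refine le_of_sq_le_sq (h3.trans (by norm_num)) (by norm_num)
    have h5 := norm_sub_le (f c) (f c - 1)
    rw [sub_sub_cancel, norm_one] at h5
    linarith
  have hJ := sum_mult_le_of_jensen (f := f) (c := c) (r := 4.1 * η) (R := 4.5 * η) (M := M)
    (by positivity) (by linarith) hM ?_ ?_ ?_ F zetaMult ?_
  · refine hJ.trans ?_
    rw [show 4.5 * η / (4.1 * η) = 45 / 41 by field_simp; norm_num]
    have h3 : 0 < Real.log (45 / 41) := Real.log_pos (by norm_num)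
    gcongr
    rw [div_le_iff₀ (by linarith)]
    nlinarith
  · intro z hz
    refine hfa z ?_
    rintro rfl
    rw [Metric.mem_closedBall, dist_eq_norm] at hz
    have := (Complex.abs_im_le_norm _).trans hz
    rw [sub_im, one_im, zero_sub, abs_neg, hcim] at this
    linarith [le_abs_self t]
  · intro h; rw [h] at hfc; norm_num at hfc
  · intro z hz
    rw [mem_sphere_iff_norm] at hz
    have h3 := abs_le.1 ((Complex.abs_re_le_norm _).trans hz.le)
    have h4 := abs_le.1 ((Complex.abs_im_le_norm _).trans hz.le)
    rw [sub_re, hcre] at h3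
    rw [sub_im, hcim] at h4
    have h5 := enorm_sq_mul_area_le_lintegral_rect (f := f) (c := z) (R := η / 2)
      (a := 1/2 - η) (b := 1/2 + 9 * η) (u := t - 1) (v := t + 1) hfm (by positivity)
      (hfd z (η / 2) (by linarith) (by linarith)) (by linarith) (by linarith)
      (by linarith) (by linarith)
    have := enorm_sq_le_of_mul_area_le (y := M ^ 2) (r := η / 2) (by positivity)
      (h5.trans (h1.trans (le_of_eq (by congr 1; ring)))) (by positivity)
    refine le_of_sq_le_sq (this.trans ?_) (by linarith)
    nlinarith
  · intro ρ hρ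
    obtain ⟨⟨hz, h0, h1'⟩, h3, h4⟩ := hF ρ hρ
    have hρ1 : ρ ≠ 1 := by rintro rfl; simp at h1'
    constructor
    · have h5 : ρ.re < 1/2 + 2 * η := by
        by_contra hge
        have := key2 ρ (not_lt.1 hge) (by linarith) h4
        simp only [hf, hz, zero_mul, zero_sub, norm_neg, norm_one] at this
        norm_num at this
      rw [Metric.mem_closedBall, dist_eq_norm, Complex.norm_def]
      refine Real.sqrt_le_iff.2 ⟨by positivity, ?_⟩
      rw [Complex.normSq_apply, sub_re, sub_im, hcre, hcim]
      have h6 : (ρ.im - t) ^ 2 ≤ (η / 10) ^ 2 := by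
        rw [← sq_abs]; exact pow_le_pow_left₀ (abs_nonneg _) h4 2
      nlinarith
    · rw [hf, show (fun s => riemannZeta s * molPoly N s) = riemannZeta * molPoly N from rfl,
        analyticOrderAt_mul (analyticOnNhd_zeta ρ hρ1) ((differentiable_molPoly N).analyticAt ρ),
        analyticOrderAt_zeta_eq hρ1]
      exact le_self_add

theorem measurableSet_window : MeasurableSet {p : ℝ × ℝ | p.1 - 1 ≤ p.2 ∧ p.2 ≤ p.1 + 1} :=
  (measurableSet_le (measurable_fst.sub_const 1) measurable_snd).inter
    (measurableSet_le measurable_snd (measurable_fst.add_const 1))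

theorem lintegral_lintegral_window_le {Q : ℝ → ENNReal} (hQ : Measurable Q) (a b : ℝ) :
    ∫⁻ t in Icc a b, ∫⁻ v in Icc (t - 1) (t + 1), Q v ≤ 2 * ∫⁻ v in Icc (a - 1) (b + 1), Q v := by
  have h1 : ∀ t, ∫⁻ v in Icc (t - 1) (t + 1), Q v =
      ∫⁻ v, {p : ℝ × ℝ | p.1 - 1 ≤ p.2 ∧ p.2 ≤ p.1 + 1}.indicator (fun p => Q p.2) (t, v) := by
    intro t
    rw [← lintegral_indicator measurableSet_Icc]
    rfl
  simp_rw [h1]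
  rw [lintegral_lintegral_swap (f := fun t v => {p : ℝ × ℝ | p.1 - 1 ≤ p.2 ∧ p.2 ≤ p.1 + 1}.indicator
    (fun p => Q p.2) (t, v))
    (((hQ.comp measurable_snd).indicator measurableSet_window).aemeasurable)]
  rw [← lintegral_indicator measurableSet_Icc, ← lintegral_const_mul' _ _ (by simp)]
  refine lintegral_mono fun v => ?_
  by_cases hv : v ∈ Icc (a - 1) (b + 1)
  · rw [indicator_of_mem hv]
    calc _ ≤ ∫⁻ t in Icc a b, (Icc (v - 1) (v + 1)).indicator (fun _ => Q v) t := by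
          refine lintegral_mono fun t => ?_
          by_cases h : t - 1 ≤ v ∧ v ≤ t + 1
          · rw [indicator_of_mem (show (t, v) ∈ {p : ℝ × ℝ | p.1 - 1 ≤ p.2 ∧ p.2 ≤ p.1 + 1} from h),
              indicator_of_mem (show t ∈ Icc (v - 1) (v + 1) from ⟨by linarith, by linarith⟩)]
          · rw [indicator_of_notMem
              (show (t, v) ∉ {p : ℝ × ℝ | p.1 - 1 ≤ p.2 ∧ p.2 ≤ p.1 + 1} from h)]
            exact zero_le
      _ ≤ ∫⁻ t, (Icc (v - 1) (v + 1)).indicator (fun _ => Q v) t := setLIntegral_le_lintegral _ _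
      _ = 2 * Q v := by
          rw [lintegral_indicator measurableSet_Icc, setLIntegral_const, Real.volume_Icc,
            show v + 1 - (v - 1) = 2 by ring, mul_comm]
          simp
  · rw [indicator_of_notMem hv, mul_zero, nonpos_iff_eq_zero]
    rw [setLIntegral_congr_fun (g := fun _ => 0) measurableSet_Icc]
    · simp
    · intro t ht
      beta_reduce
      rw [indicator_of_notMem]
      rintro ⟨h2, h3⟩
      simp only at h2 h3
      exact hv ⟨by linarith [ht.1], by linarith [ht.2]⟩

theorem lintegral_swap_rect {G : ℂ → ENNReal} (hG : Measurable G) (s s' : Set ℝ) :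
    ∫⁻ σ in s, ∫⁻ v in s', G (σ + v * I) = ∫⁻ v in s', ∫⁻ σ in s, G (σ + v * I) :=
  lintegral_lintegral_swap (hG.comp (show Measurable fun p : ℝ × ℝ => (p.1 + p.2 * I : ℂ)
    by fun_prop)).aemeasurable

theorem measurable_lintegral_horizontal {G : ℂ → ENNReal} (hG : Measurable G) (s : Set ℝ) :
    Measurable fun v : ℝ => ∫⁻ σ in s, G (σ + v * I) :=
  Measurable.lintegral_prod_right' (f := fun p : ℝ × ℝ => G (p.2 + p.1 * I))
    (hG.comp (by fun_prop))

theorem measurable_lintegral_vertical {G : ℂ → ENNReal} (hG : Measurable G) (s : Set ℝ) :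
    Measurable fun σ : ℝ => ∫⁻ v in s, G (σ + v * I) :=
  Measurable.lintegral_prod_right' (f := fun p : ℝ × ℝ => G (p.1 + p.2 * I))
    (hG.comp (by fun_prop))

theorem lintegral_window_rect_le {G : ℂ → ENNReal} (hG : Measurable G) {a b p q : ℝ} {B : ENNReal}
    (hB : ∀ σ ∈ Icc p q, ∫⁻ v in Icc (a - 1) (b + 1), G (σ + v * I) ≤ B) :
    ∫⁻ t in Icc a b, ∫⁻ σ in Icc p q, ∫⁻ v in Icc (t - 1) (t + 1), G (σ + v * I) ≤
      2 * (B * ENNReal.ofReal (q - p)) := by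
  simp_rw [lintegral_swap_rect hG]
  refine (lintegral_lintegral_window_le (measurable_lintegral_horizontal hG _) a b).trans ?_
  rw [← lintegral_swap_rect hG]
  gcongr
  refine (setLIntegral_mono' measurableSet_Icc hB).trans ?_
  rw [setLIntegral_const, Real.volume_Icc]

theorem measurable_window {G : ℂ → ENNReal} (hG : Measurable G) (p q : ℝ) :
    Measurable fun t : ℝ => ∫⁻ σ in Icc p q, ∫⁻ v in Icc (t - 1) (t + 1), G (σ + v * I) := by
  simp_rw [lintegral_swap_rect hG]
  have h : ∀ t : ℝ, ∫⁻ v in Icc (t - 1) (t + 1), ∫⁻ σ in Icc p q, G (σ + v * I) =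
      ∫⁻ v, {p : ℝ × ℝ | p.1 - 1 ≤ p.2 ∧ p.2 ≤ p.1 + 1}.indicator
        (fun x => ∫⁻ σ in Icc p q, G (σ + x.2 * I)) (t, v) := by
    intro t
    rw [← lintegral_indicator measurableSet_Icc]
    rfl
  simp_rw [h]
  refine Measurable.lintegral_prod_right'
    (f := {p : ℝ × ℝ | p.1 - 1 ≤ p.2 ∧ p.2 ≤ p.1 + 1}.indicator
        (fun x => ∫⁻ σ in Icc p q, G (σ + x.2 * I))) ?_
  exact ((measurable_lintegral_horizontal hG _).comp measurable_snd).indicator measurableSet_window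

/-- The sum of `‖ζ(1/2 + iγ)‖²` over a set of zeros is dominated by an integral of `‖ζ‖²` weighted
by the number of zeros nearby. -/
theorem sum_mul_normSq_le_lintegral (F : Finset ℂ) (m : ℂ → ℕ) {δ a b : ℝ} (hδ : 0 < δ)
    (hδ' : δ ≤ 1 / 4) (hF : ∀ ρ ∈ F, a + δ ≤ ρ.im ∧ ρ.im + δ ≤ b) :
    ENNReal.ofReal (∑ ρ ∈ F, (m ρ : ℝ) * ‖riemannZeta (1/2 + ρ.im * I)‖ ^ 2) *
        ENNReal.ofReal (π * δ ^ 2) ≤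
      ∫⁻ σ in Icc (1/2 - δ) (1/2 + δ), ∫⁻ t in Icc a b,
        ENNReal.ofReal (∑ ρ ∈ F with |ρ.im - t| ≤ δ, (m ρ : ℝ)) *
          ‖riemannZeta (σ + t * I)‖ₑ ^ 2 := by
  change _ ≤ ∫⁻ σ in Icc (1/2 - δ) (1/2 + δ), ∫⁻ t in Icc a b,
        ENNReal.ofReal (∑ ρ ∈ F with |ρ.im - t| ≤ δ, (m ρ : ℝ)) *
          (fun s => ‖riemannZeta s‖ₑ ^ 2) ((σ : ℂ) + t * I)
  set G : ℂ → ENNReal := fun s => ‖riemannZeta s‖ₑ ^ 2 with hG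
  have hGm : Measurable G := measurable_zeta.enorm.pow_const 2
  have h1 : ∀ ρ ∈ F, G (1/2 + ρ.im * I) * ENNReal.ofReal (π * δ ^ 2) ≤
      ∫⁻ σ in Icc (1/2 - δ) (1/2 + δ), ∫⁻ t in Icc (ρ.im - δ) (ρ.im + δ), G (σ + t * I) := by
    intro ρ hρ
    refine enorm_sq_mul_area_le_lintegral_rect measurable_zeta hδ ?_ (by simp) (by simp) (by simp)
      (by simp)
    intro z hz
    refine (differentiableAt_riemannZeta ?_).differentiableWithinAt
    rintro rfl
    rw [Metric.mem_ball, dist_eq_norm] at hz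
    have := (Complex.abs_re_le_norm _).trans_lt hz
    norm_num at this
    linarith
  have h2 : ∀ t : ℝ, ENNReal.ofReal (∑ ρ ∈ F with |ρ.im - t| ≤ δ, (m ρ : ℝ)) =
      ∑ ρ ∈ F, (Icc (ρ.im - δ) (ρ.im + δ)).indicator (fun _ => (m ρ : ENNReal)) t := by
    intro t
    rw [Finset.sum_filter, ENNReal.ofReal_sum_of_nonneg (fun ρ _ => by split_ifs <;> positivity)]
    refine Finset.sum_congr rfl fun ρ _ => ?_
    by_cases h : |ρ.im - t| ≤ δ
    · have h' := abs_le.1 h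
      rw [if_pos h, indicator_of_mem (show t ∈ Icc (ρ.im - δ) (ρ.im + δ) from
        ⟨by linarith, by linarith⟩), ENNReal.ofReal_natCast]
    · rw [if_neg h, indicator_of_notMem, ENNReal.ofReal_zero]
      exact fun h3 => h (abs_le.2 ⟨by linarith [h3.2], by linarith [h3.1]⟩)
  have h3 : ∀ σ : ℝ, ∫⁻ t in Icc a b, ENNReal.ofReal (∑ ρ ∈ F with |ρ.im - t| ≤ δ, (m ρ : ℝ)) *
      G (σ + t * I) = ∑ ρ ∈ F, (m ρ : ENNReal) *
        ∫⁻ t in Icc (ρ.im - δ) (ρ.im + δ), G (σ + t * I) := by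
    intro σ
    have hGσ : Measurable fun t : ℝ => G (σ + t * I) := hGm.comp (by fun_prop)
    simp_rw [h2, Finset.sum_mul]
    rw [lintegral_finsetSum F (f := fun ρ t => (Icc (ρ.im - δ) (ρ.im + δ)).indicator
      (fun _ => (m ρ : ENNReal)) t * G (σ + t * I)) (fun ρ _ =>
      (measurable_const.indicator measurableSet_Icc).mul hGσ)]
    refine Finset.sum_congr rfl fun ρ hρ => ?_
    have h4 : ∀ t : ℝ, (Icc (ρ.im - δ) (ρ.im + δ)).indicator (fun _ => (m ρ : ENNReal)) t *
        G (σ + t * I) = (Icc (ρ.im - δ) (ρ.im + δ)).indicator (fun t => (m ρ : ENNReal) *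
          G (σ + t * I)) t := by
      intro t
      by_cases h : t ∈ Icc (ρ.im - δ) (ρ.im + δ)
      · rw [indicator_of_mem h, indicator_of_mem h]
      · rw [indicator_of_notMem h, indicator_of_notMem h, zero_mul]
    simp_rw [h4]
    rw [lintegral_indicator measurableSet_Icc, Measure.restrict_restrict measurableSet_Icc,
      inter_eq_left.2 (Icc_subset_Icc (by linarith [(hF ρ hρ).1]) (by linarith [(hF ρ hρ).2])),
      lintegral_const_mul _ hGσ]
  simp_rw [h3]
  rw [lintegral_finsetSum _ (fun ρ _ => (measurable_lintegral_vertical hGm _).const_mul _),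
    ENNReal.ofReal_sum_of_nonneg (fun ρ _ => by positivity), Finset.sum_mul]
  refine Finset.sum_le_sum fun ρ hρ => ?_
  rw [lintegral_const_mul _ (measurable_lintegral_vertical hGm _), ENNReal.ofReal_mul (by positivity),
    ENNReal.ofReal_natCast, mul_assoc, ENNReal.ofReal_pow (norm_nonneg _), ofReal_norm]
  gcongr
  exact h1 ρ hρ

theorem exp_natCast_mul_log {x : ℝ} (hx : 0 < x) (k : ℕ) : Real.exp (k * Real.log x) = x ^ k := by
  rw [Real.exp_nat_mul, Real.exp_log hx]

theorem nine_add_pow_four_le {L : ℝ} (hL : 1 ≤ L) : (9 + L) ^ 4 ≤ 10 ^ 4 * L ^ 4 := by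
  rw [← mul_pow]
  gcongr
  linarith

theorem floor_sqrt_rpow_le {T L η : ℝ} (hT : 8 ≤ T) (hL : L = Real.log T) (hL1 : 1 ≤ L)
    (hη : η = 40 * Real.log L / L) (hη0 : 0 < η) (hη1 : η ≤ 1 / 20) :
    ((⌊√T⌋₊ : ℕ) : ℝ) ^ (-η) ≤ 2 * (L ^ 20)⁻¹ := by
  have hL0 : 0 < L := by linarith
  have hs : 2 ≤ √T := by
    rw [Real.le_sqrt (by norm_num) (by linarith)]; linarith
  have h1 : √T / 2 ≤ (⌊√T⌋₊ : ℕ) := by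
    have := Nat.lt_floor_add_one √T
    linarith
  have hT0 : 0 < T := by linarith
  calc ((⌊√T⌋₊ : ℕ) : ℝ) ^ (-η) ≤ (√T / 2) ^ (-η) :=
        Real.rpow_le_rpow_of_nonpos (by positivity) h1 (by linarith)
    _ = 2 ^ η * (√T) ^ (-η) := by
        rw [Real.div_rpow (by positivity) (by norm_num), Real.rpow_neg (by norm_num : (0:ℝ) ≤ 2),
          div_inv_eq_mul, mul_comm]
    _ ≤ 2 * (L ^ 20)⁻¹ := by
        gcongr
        · calc (2 : ℝ) ^ η ≤ 2 ^ (1 : ℝ) := by gcongr <;> linarith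
            _ = 2 := Real.rpow_one 2
        · rw [Real.sqrt_eq_rpow, ← Real.rpow_mul hT0.le, Real.rpow_def_of_pos hT0, ← hL,
            ← exp_natCast_mul_log hL0, ← Real.exp_neg]
          apply le_of_eq
          congr 1
          rw [hη]
          field_simp
          push_cast
          ring

theorem rpow_four_mul_eq {T L η : ℝ} (hT : 8 ≤ T) (hL : L = Real.log T) (hL1 : 1 ≤ L)
    (hη : η = 40 * Real.log L / L) : T ^ (4 * η) = L ^ 160 := by
  have hL0 : 0 < L := by linarith
  rw [Real.rpow_def_of_pos (by linarith), ← hL, ← exp_natCast_mul_log hL0]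
  congr 1
  rw [hη]
  field_simp
  push_cast
  ring

theorem exists_lintegral_window_sub_one_le : ∃ C > 0, ∀ T L η : ℝ, 8 ≤ T → L = Real.log T → 1 ≤ L →
    η = 40 * Real.log L / L → L⁻¹ ≤ η → η ≤ 1 / 20 →
    ∫⁻ t in Icc (T - 1) (2 * T + 1), ∫⁻ σ in Icc (1/2 + η) (3/2), ∫⁻ v in Icc (t - 1) (t + 1),
      ‖riemannZeta (σ + v * I) * molPoly ⌊√T⌋₊ (σ + v * I) - 1‖ₑ ^ 2 ≤
        ENNReal.ofReal (C * (T * (L ^ 14)⁻¹)) := by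
  obtain ⟨C, hC, hb⟩ := exists_lintegral_zeta_mul_molPoly_sub_one_sq_le
  refine ⟨2 * (C * (10 ^ 4 * 2)), by positivity, fun T L η hT hL hL1 hη hη0 hη1 => ?_⟩
  have hL0 : 0 < L := by linarith
  have hη0' : 0 < η := lt_of_lt_of_le (by positivity) hη0
  set N := ⌊√T⌋₊ with hN
  have hs : 2 ≤ √T := by
    rw [Real.le_sqrt (by norm_num) (by linarith)]; linarith
  have hN1 : 1 ≤ N := by
    rw [hN, Nat.one_le_floor_iff]; linarith
  have hN2 : (N : ℝ) ^ 2 ≤ T := by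
    have h1 : (N : ℝ) ≤ √T := Nat.floor_le (by positivity)
    calc (N : ℝ) ^ 2 ≤ √T ^ 2 := by gcongr
      _ = T := Real.sq_sqrt (by linarith)
  have hNη := floor_sqrt_rpow_le hT hL hL1 hη hη0' hη1
  rw [← hN] at hNη
  have hηi : η⁻¹ ≤ L := inv_le_of_inv_le₀ hL0 hη0
  have hm : Measurable fun s : ℂ => ‖riemannZeta s * molPoly N s - 1‖ₑ ^ 2 :=
    (((measurable_zeta.mul (differentiable_molPoly N).continuous.measurable).sub_const 1).enorm).pow_const 2
  refine (lintegral_window_rect_le hm (B := ENNReal.ofReal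
    (C * (T * (9 + Real.log T) ^ 4 * (η⁻¹ ^ 2 * (N : ℝ) ^ (-η))))) ?_).trans ?_
  · intro σ hσ
    refine (lintegral_mono_set (Icc_subset_Icc ?_ ?_)).trans
      (hb T η σ N (by linarith) hη0' (by linarith) hN1 hN2 hσ.1 hσ.2) <;> linarith
  · rw [← ENNReal.ofReal_mul (by positivity), show (2 : ENNReal) = ENNReal.ofReal 2 by simp,
      ← ENNReal.ofReal_mul (by norm_num)]
    apply ENNReal.ofReal_le_ofReal
    rw [← hL]
    have h1 : C * (T * (9 + L) ^ 4 * (η⁻¹ ^ 2 * (N : ℝ) ^ (-η))) ≤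
        C * (T * (10 ^ 4 * L ^ 4) * (L ^ 2 * (2 * (L ^ 20)⁻¹))) := by
      have := nine_add_pow_four_le hL1
      gcongr
    have h2 : C * (T * (10 ^ 4 * L ^ 4) * (L ^ 2 * (2 * (L ^ 20)⁻¹))) =
        C * (10 ^ 4 * 2) * (T * (L ^ 14)⁻¹) := by
      field_simp
    rw [h2] at h1
    have h3 : 0 ≤ C * (T * (9 + L) ^ 4 * (η⁻¹ ^ 2 * (N : ℝ) ^ (-η))) := by positivity
    nlinarith

theorem exists_lintegral_window_le : ∃ C > 0, ∀ T L η : ℝ, 8 ≤ T → L = Real.log T → 1 ≤ L →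
    η = 40 * Real.log L / L → L⁻¹ ≤ η → η ≤ 1 / 80 →
    ∫⁻ t in Icc (T - 1) (2 * T + 1), ∫⁻ σ in Icc (1/2 - η) (1/2 + 9 * η),
      ∫⁻ v in Icc (t - 1) (t + 1),
        ‖riemannZeta (σ + v * I) * molPoly ⌊√T⌋₊ (σ + v * I)‖ₑ ^ 2 ≤
          ENNReal.ofReal (C * (T * L ^ 164)) := by
  obtain ⟨C, hC, hb⟩ := exists_lintegral_zeta_mul_molPoly_sq_le
  refine ⟨2 * (C * 10 ^ 4), by positivity, fun T L η hT hL hL1 hη hη0 hη1 => ?_⟩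
  have hL0 : 0 < L := by linarith
  have hη0' : 0 < η := lt_of_lt_of_le (by positivity) hη0
  set N := ⌊√T⌋₊ with hN
  have hN2 : (N : ℝ) ^ 2 ≤ T := by
    have h1 : (N : ℝ) ≤ √T := Nat.floor_le (by positivity)
    calc (N : ℝ) ^ 2 ≤ √T ^ 2 := by gcongr
      _ = T := Real.sq_sqrt (by linarith)
  have hm : Measurable fun s : ℂ => ‖riemannZeta s * molPoly N s‖ₑ ^ 2 :=
    ((measurable_zeta.mul (differentiable_molPoly N).continuous.measurable).enorm).pow_const 2
  refine (lintegral_window_rect_le hm (B := ENNReal.ofReal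
    (C * (T * (9 + Real.log T) ^ 4 * T ^ (4 * η)))) ?_).trans ?_
  · intro σ hσ
    refine (lintegral_mono_set (Icc_subset_Icc ?_ ?_)).trans
      (hb T σ η N (by linarith) hη0'.le (by linarith) hN2 hσ.1 (by linarith [hσ.2])) <;> linarith
  · rw [← ENNReal.ofReal_mul (by positivity), show (2 : ENNReal) = ENNReal.ofReal 2 by simp,
      ← ENNReal.ofReal_mul (by norm_num)]
    apply ENNReal.ofReal_le_ofReal
    rw [rpow_four_mul_eq hT hL hL1 hη, ← hL]
    have h1 : C * (T * (9 + L) ^ 4 * L ^ 160) ≤ C * (T * (10 ^ 4 * L ^ 4) * L ^ 160) := by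
      have := nine_add_pow_four_le hL1
      gcongr
    have h2 : C * (T * (10 ^ 4 * L ^ 4) * L ^ 160) = C * 10 ^ 4 * (T * L ^ 164) := by ring
    rw [h2] at h1
    have h3 : 0 ≤ C * (T * (9 + L) ^ 4 * L ^ 160) := by positivity
    nlinarith

theorem ofReal_mul_enorm_sq_le {n a b lam : ℝ} {Φ : ENNReal} (hlam : 0 < lam) (ha : n ≤ a)
    (hb : Φ < 1 → n ≤ b) (z : ℂ) :
    ENNReal.ofReal n * ‖z‖ₑ ^ 2 ≤ ENNReal.ofReal b * ‖z‖ₑ ^ 2 +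
      ENNReal.ofReal a * (ENNReal.ofReal lam⁻¹ * ‖z‖ₑ ^ 4 + ENNReal.ofReal lam * Φ) := by
  rcases lt_or_ge Φ 1 with h | h
  · refine le_trans ?_ le_self_add
    gcongr
    exact hb h
  · refine le_trans ?_ le_add_self
    gcongr
    calc ‖z‖ₑ ^ 2 ≤ ENNReal.ofReal lam⁻¹ * ‖z‖ₑ ^ 4 + ENNReal.ofReal lam * 1 := by
          rw [← ofReal_norm, ← ENNReal.ofReal_pow (norm_nonneg _), ← ENNReal.ofReal_pow (norm_nonneg _),
            ← ENNReal.ofReal_mul (by positivity), mul_one, ← ENNReal.ofReal_add (by positivity) hlam.le]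
          apply ENNReal.ofReal_le_ofReal
          have h1 : lam⁻¹ * ‖z‖ ^ 4 + lam - ‖z‖ ^ 2 =
              lam⁻¹ * ((‖z‖ ^ 2 - lam / 2) ^ 2 + 3 / 4 * lam ^ 2) := by
            field_simp; ring
          have : 0 ≤ lam⁻¹ * ((‖z‖ ^ 2 - lam / 2) ^ 2 + 3 / 4 * lam ^ 2) := by positivity
          linarith
      _ ≤ _ := by gcongr

theorem le_ofReal_of_mul_le_one {x : ENNReal} {y : ℝ} (hy : 0 < y)
    (h : x * ENNReal.ofReal y⁻¹ ≤ 1) : x ≤ ENNReal.ofReal y := by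
  calc x = x * ENNReal.ofReal y⁻¹ * ENNReal.ofReal y := by
        rw [mul_assoc, ← ENNReal.ofReal_mul (by positivity), inv_mul_cancel₀ hy.ne']; simp
    _ ≤ 1 * ENNReal.ofReal y := by gcongr
    _ = _ := one_mul _

theorem exists_lintegral_zeta_sq_near_le : ∃ C > 0, ∀ T σ : ℝ, 4 ≤ T → 1 / 4 ≤ σ → σ < 1 →
    1 / 2 - 2 / Real.log T ≤ σ →
    ∫⁻ t in Icc (T / 2) (4 * T), ‖riemannZeta (σ + t * I)‖ₑ ^ 2 ≤
      ENNReal.ofReal (C * T * Real.log T) := by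
  obtain ⟨C, hC, hb⟩ := exists_integral_normSq_zeta_near_le
  refine ⟨C, hC, fun T σ hT h1 h2 h3 => ?_⟩
  have h4 := hb T σ hT h1 h2 h3
  rw [intervalIntegral.integral_of_le (by linarith), ← integral_Icc_eq_integral_Ioc] at h4
  refine le_trans (le_of_eq ?_) (ENNReal.ofReal_le_ofReal h4)
  rw [ofReal_integral_eq_lintegral_ofReal]
  · refine lintegral_congr fun t => ?_
    rw [ENNReal.ofReal_pow (norm_nonneg _), ofReal_norm]
  · exact ((continuous_zeta_vertical h2.ne).norm.pow 2).integrableOn_Icc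
  · exact ae_of_all _ fun t => by positivity

/-- The contribution of the zeros in a dyadic block. -/
theorem exists_sum_zeros_dyadic_le : ∃ C > 0, ∀ T : ℝ, 8 ≤ T → 1 ≤ Real.log (Real.log T) →
    3200 * Real.log (Real.log T) ≤ Real.log T →
    ∑ ρ ∈ zeroFinset T (2 * T), (zetaMult ρ : ℝ) * ‖riemannZeta (1/2 + ρ.im * I)‖ ^ 2 ≤
      C * (T * Real.log T ^ 2 * Real.log (Real.log T)) := by
  obtain ⟨C₁, hC₁, hn⟩ := exists_sum_mult_le_log
  obtain ⟨C₂, hC₂, hz2⟩ := exists_lintegral_zeta_sq_near_le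
  obtain ⟨C₄, hC₄, hz4⟩ := exists_lintegral_zeta_pow_four_near_le
  obtain ⟨C₅, hC₅, hw2⟩ := exists_lintegral_window_sub_one_le
  obtain ⟨C₆, hC₆, hw1⟩ := exists_lintegral_window_le
  set κ := 91 / Real.log (45 / 41) with hκ
  have hlog45 : 0 < Real.log (45 / 41) := Real.log_pos (by norm_num)
  have hκ0 : 0 < κ := by positivity
  set D := κ * C₂ + 2 * C₁ * (C₄ * (10 ^ 4 * 81) + 4 * (C₅ + C₆)) with hD
  refine ⟨4 * D, by positivity, fun T hT hℓ hLℓ => ?_⟩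
  set L := Real.log T with hL
  set ℓ := Real.log L with hℓ'
  have hL1 : 3200 ≤ L := by linarith
  have hL0 : 0 < L := by linarith
  have hT0 : 0 < T := by linarith
  set η := 40 * ℓ / L with hη
  have hη1 : η ≤ 1 / 80 := by rw [hη, div_le_iff₀ hL0]; linarith
  have hη0 : 10 * L⁻¹ ≤ η := by
    rw [hη, ← div_eq_mul_inv]; gcongr; linarith
  have hLi : 0 < L⁻¹ := by positivity
  have hηp : 0 < η := by linarith
  set δ := L⁻¹ with hδ
  have hδ1 : δ ≤ 1 / 8 := by rw [hδ, inv_le_comm₀ hL0 (by norm_num)]; linarith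
  set N := ⌊√T⌋₊ with hN
  set F := (zeroFinset T (2 * T)).filter (fun ρ => 1/2 < ρ.re) with hF
  have hFmem : ∀ ρ ∈ F, IsNontrivialZero ρ ∧ 1/2 < ρ.re ∧ T < ρ.im ∧ ρ.im ≤ 2 * T := by
    intro ρ hρ
    rw [hF, Finset.mem_filter, mem_zeroFinset] at hρ
    exact ⟨hρ.1.1, hρ.2, hρ.1.2⟩
  set M := L ^ 90 with hM
  have hM1 : 1 ≤ M := one_le_pow₀ (by linarith)
  set Φ2 : ℝ → ENNReal := fun t => ∫⁻ σ in Icc (1/2 + η) (3/2), ∫⁻ v in Icc (t - 1) (t + 1),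
      ‖riemannZeta (σ + v * I) * molPoly N (σ + v * I) - 1‖ₑ ^ 2 with hΦ2
  set Φ1 : ℝ → ENNReal := fun t => ∫⁻ σ in Icc (1/2 - η) (1/2 + 9 * η),
      ∫⁻ v in Icc (t - 1) (t + 1), ‖riemannZeta (σ + v * I) * molPoly N (σ + v * I)‖ₑ ^ 2 with hΦ1
  have hmf : Measurable fun s : ℂ => riemannZeta s * molPoly N s :=
    measurable_zeta.mul (differentiable_molPoly N).continuous.measurable
  have hΦ2m : Measurable Φ2 := measurable_window ((hmf.sub_const 1).enorm.pow_const 2) _ _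
  have hΦ1m : Measurable Φ1 := measurable_window (hmf.enorm.pow_const 2) _ _
  set Φ : ℝ → ENNReal := fun t => Φ2 t * ENNReal.ofReal (η ^ 2 / 4)⁻¹ +
    Φ1 t * ENNReal.ofReal (M ^ 2 * η ^ 2 / 4)⁻¹ with hΦ
  have hΦm : Measurable Φ := (hΦ2m.mul_const _).add (hΦ1m.mul_const _)
  set n : ℝ → ℝ := fun t => ∑ ρ ∈ F with |ρ.im - t| ≤ δ, (zetaMult ρ : ℝ) with hnd
  have hna : ∀ t ∈ Icc (T - 1) (2 * T + 1), n t ≤ 2 * C₁ * L := by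
    intro t ht
    refine (hn t (by linarith [ht.1]) _ ?_).trans ?_
    · intro ρ hρ
      rw [Finset.mem_filter] at hρ
      obtain ⟨h1, h2, -⟩ := hFmem ρ hρ.1
      exact ⟨h1, h2, hρ.2.trans (by linarith)⟩
    · have : Real.log t ≤ 2 * L := by
        rw [hL, show (2 : ℝ) * Real.log T = Real.log (T ^ 2) by rw [Real.log_pow]; norm_num]
        apply Real.log_le_log (by linarith [ht.1])
        nlinarith [ht.2]
      nlinarith
  have hnb : ∀ t ∈ Icc (T - 1) (2 * T + 1), Φ t < 1 → n t ≤ κ * ℓ := by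
    intro t ht hlt
    have h2 : Φ2 t ≤ ENNReal.ofReal (η ^ 2 / 4) :=
      le_ofReal_of_mul_le_one (by positivity) (le_self_add.trans hlt.le)
    have h1 : Φ1 t ≤ ENNReal.ofReal (M ^ 2 * η ^ 2 / 4) :=
      le_ofReal_of_mul_le_one (by positivity) (le_add_self.trans hlt.le)
    refine (sum_mult_le_of_lintegral_le hηp (by linarith) (by linarith [ht.1]) hM1 h2 h1 _ ?_).trans ?_
    · intro ρ hρ
      rw [Finset.mem_filter] at hρ
      obtain ⟨h1, h2, -⟩ := hFmem ρ hρ.1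
      exact ⟨h1, h2, hρ.2.trans (by linarith)⟩
    · rw [hκ, div_mul_eq_mul_div]
      gcongr
      rw [hM, Real.log_mul (by norm_num) (by positivity), Real.log_pow, ← hℓ']
      have := Real.log_two_lt_d9
      push_cast
      linarith
  have hW : ∫⁻ t in Icc (T - 1) (2 * T + 1), Φ t ≤ ENNReal.ofReal (4 * (C₅ + C₆) * (T * (L ^ 12)⁻¹)) := by
    simp only [hΦ]
    rw [lintegral_add_left (hΦ2m.mul_const _), lintegral_mul_const _ hΦ2m, lintegral_mul_const _ hΦ1m]
    have e2 := hw2 T L η hT hL (by linarith) hη (by linarith) (by linarith)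
    have e1 := hw1 T L η hT hL (by linarith) hη (by linarith) hη1
    refine (add_le_add (mul_le_mul_left e2 _) (mul_le_mul_left e1 _)).trans ?_
    rw [← ENNReal.ofReal_mul (by positivity), ← ENNReal.ofReal_mul (by positivity),
      ← ENNReal.ofReal_add (by positivity) (by positivity)]
    apply ENNReal.ofReal_le_ofReal
    have hηi : (η ^ 2 / 4)⁻¹ ≤ 4 * L ^ 2 := by
      rw [inv_div, div_le_iff₀ (by positivity)]
      have h1 : L⁻¹ ≤ η := by linarith
      have h2 : 1 ≤ L * η := by
        calc (1 : ℝ) = L * L⁻¹ := by field_simp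
          _ ≤ _ := by gcongr
      nlinarith
    have hηi' : (M ^ 2 * η ^ 2 / 4)⁻¹ ≤ (L ^ 180)⁻¹ * (4 * L ^ 2) := by
      rw [mul_div_assoc, mul_inv, hM, ← pow_mul]
      gcongr
    calc _ ≤ C₅ * (T * (L ^ 14)⁻¹) * (4 * L ^ 2) + C₆ * (T * L ^ 164) * ((L ^ 180)⁻¹ * (4 * L ^ 2)) := by
          gcongr
      _ = 4 * C₅ * (T * (L ^ 12)⁻¹) + 4 * C₆ * (T * (L ^ 14)⁻¹) := by
          field_simp
      _ ≤ 4 * C₅ * (T * (L ^ 12)⁻¹) + 4 * C₆ * (T * (L ^ 12)⁻¹) := by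
          gcongr
          · linarith
          · norm_num
      _ = _ := by ring
  have hinner : ∀ σ ∈ Icc (1/2 - δ) (1/2 + δ), ∫⁻ t in Icc (T - 1) (2 * T + 1),
      ENNReal.ofReal (n t) * ‖riemannZeta (σ + t * I)‖ₑ ^ 2 ≤ ENNReal.ofReal (D * (T * L * ℓ)) := by
    intro σ hσ
    have hσ1 : σ ≠ 1 := by have := hσ.2; intro h; linarith
    have hζm : Measurable fun t : ℝ => ‖riemannZeta (σ + t * I)‖ₑ :=
      (continuous_zeta_vertical hσ1).measurable.enorm
    have hsub : Icc (T - 1) (2 * T + 1) ⊆ Icc (T / 2) (4 * T) :=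
      Icc_subset_Icc (by linarith) (by linarith)
    have a2 : ∫⁻ t in Icc (T - 1) (2 * T + 1), ‖riemannZeta (σ + t * I)‖ₑ ^ 2 ≤
        ENNReal.ofReal (C₂ * T * L) := by
      refine (lintegral_mono_set hsub).trans
        (hz2 T σ (by linarith) (by linarith [hσ.1]) (by linarith [hσ.2]) ?_)
      rw [← hL, div_eq_mul_inv 2 L, ← hδ]; linarith [hσ.1]
    have a4 : ∫⁻ t in Icc (T - 1) (2 * T + 1), ‖riemannZeta (σ + t * I)‖ₑ ^ 4 ≤
        ENNReal.ofReal (C₄ * (10 ^ 4 * 81) * (T * L ^ 4)) := by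
      refine (lintegral_mono_set hsub).trans
        ((hz4 T σ δ (by linarith) hLi.le (by linarith) hσ.1 (by linarith [hσ.2])).trans ?_)
      apply ENNReal.ofReal_le_ofReal
      have h1 := nine_add_pow_four_le (show 1 ≤ L by linarith)
      have h2 : T ^ (4 * δ) ≤ 81 := by
        rw [Real.rpow_def_of_pos hT0, ← hL, hδ, show L * (4 * L⁻¹) = (4 : ℕ) * (1 : ℝ) by
          field_simp; norm_num, Real.exp_nat_mul]
        calc Real.exp 1 ^ 4 ≤ 3 ^ 4 := by gcongr; linarith [Real.exp_one_lt_d9]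
          _ = 81 := by norm_num
      rw [← hL]
      calc C₄ * (T * (9 + L) ^ 4 * T ^ (4 * δ)) ≤ C₄ * (T * (10 ^ 4 * L ^ 4) * 81) := by gcongr
        _ = _ := by ring
    have hpt : ∀ t ∈ Icc (T - 1) (2 * T + 1),
        ENNReal.ofReal (n t) * ‖riemannZeta (σ + t * I)‖ₑ ^ 2 ≤
          ENNReal.ofReal (κ * ℓ) * ‖riemannZeta (σ + t * I)‖ₑ ^ 2 + ENNReal.ofReal (2 * C₁ * L) *
            (ENNReal.ofReal (L ^ 6)⁻¹ * ‖riemannZeta (σ + t * I)‖ₑ ^ 4 + ENNReal.ofReal (L ^ 6) * Φ t) :=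
      fun t ht => ofReal_mul_enorm_sq_le (by positivity) (hna t ht) (hnb t ht) _
    refine (setLIntegral_mono' measurableSet_Icc hpt).trans ?_
    rw [lintegral_add_left ((hζm.pow_const 2).const_mul _), lintegral_const_mul _ (hζm.pow_const 2),
      lintegral_const_mul' _ _ ENNReal.ofReal_ne_top,
      lintegral_add_left ((hζm.pow_const 4).const_mul _), lintegral_const_mul _ (hζm.pow_const 4),
      lintegral_const_mul _ hΦm]
    calc _ ≤ ENNReal.ofReal (κ * ℓ) * ENNReal.ofReal (C₂ * T * L) + ENNReal.ofReal (2 * C₁ * L) *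
            (ENNReal.ofReal (L ^ 6)⁻¹ * ENNReal.ofReal (C₄ * (10 ^ 4 * 81) * (T * L ^ 4)) +
              ENNReal.ofReal (L ^ 6) * ENNReal.ofReal (4 * (C₅ + C₆) * (T * (L ^ 12)⁻¹))) := by
          gcongr
      _ = ENNReal.ofReal (κ * ℓ * (C₂ * T * L) + 2 * C₁ * L * ((L ^ 6)⁻¹ *
            (C₄ * (10 ^ 4 * 81) * (T * L ^ 4)) + L ^ 6 * (4 * (C₅ + C₆) * (T * (L ^ 12)⁻¹)))) := by
          rw [← ENNReal.ofReal_mul (by positivity), ← ENNReal.ofReal_mul (by positivity),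
            ← ENNReal.ofReal_mul (by positivity), ← ENNReal.ofReal_add (by positivity) (by positivity),
            ← ENNReal.ofReal_mul (by positivity), ← ENNReal.ofReal_add (by positivity) (by positivity)]
      _ ≤ _ := by
          apply ENNReal.ofReal_le_ofReal
          have e1 : (L ^ 6)⁻¹ * (C₄ * (10 ^ 4 * 81) * (T * L ^ 4)) +
              L ^ 6 * (4 * (C₅ + C₆) * (T * (L ^ 12)⁻¹)) =
              C₄ * (10 ^ 4 * 81) * T * (L ^ 2)⁻¹ + 4 * (C₅ + C₆) * T * (L ^ 6)⁻¹ := by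
            field_simp
          have i2 : (L ^ 2)⁻¹ ≤ 1 := inv_le_one_of_one_le₀ (one_le_pow₀ (by linarith))
          have i6 : (L ^ 6)⁻¹ ≤ 1 := inv_le_one_of_one_le₀ (one_le_pow₀ (by linarith))
          rw [e1]
          calc _ ≤ κ * ℓ * (C₂ * T * L) + 2 * C₁ * L * (C₄ * (10 ^ 4 * 81) * T * 1 +
                4 * (C₅ + C₆) * T * 1) := by gcongr
            _ = κ * C₂ * (T * L * ℓ) + 2 * C₁ * (C₄ * (10 ^ 4 * 81) + 4 * (C₅ + C₆)) * (T * L * 1) := by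
                ring
            _ ≤ κ * C₂ * (T * L * ℓ) + 2 * C₁ * (C₄ * (10 ^ 4 * 81) + 4 * (C₅ + C₆)) * (T * L * ℓ) := by
                gcongr
            _ = _ := by rw [hD]; ring
  have hmain := sum_mul_normSq_le_lintegral F zetaMult (δ := δ) (a := T - 1) (b := 2 * T + 1) hLi
    (by linarith) (by
    intro ρ hρ
    obtain ⟨-, -, h3, h4⟩ := hFmem ρ hρ
    exact ⟨by linarith, by linarith⟩)
  have hmain2 := hmain.trans (setLIntegral_mono' measurableSet_Icc hinner)
  rw [setLIntegral_const, Real.volume_Icc, ← ENNReal.ofReal_mul (by positivity),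
    ← ENNReal.ofReal_mul (by positivity), ENNReal.ofReal_le_ofReal_iff (by
      have : 0 ≤ 1 / 2 + δ - (1 / 2 - δ) := by linarith
      positivity)] at hmain2
  rw [sum_zeros_eq_two_mul]
  set X := ∑ ρ ∈ F, (zetaMult ρ : ℝ) * ‖riemannZeta (1/2 + ρ.im * I)‖ ^ 2 with hX
  have hX0 : 0 ≤ X := Finset.sum_nonneg fun ρ _ => by positivity
  have hpi := Real.pi_gt_three
  have h5 : X * δ ≤ 2 * (D * (T * L * ℓ)) := by
    have h6 : X * (π * δ ^ 2) = (X * δ * π) * δ := by ring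
    have h7 : D * (T * L * ℓ) * (1 / 2 + δ - (1 / 2 - δ)) = 2 * (D * (T * L * ℓ)) * δ := by ring
    rw [h6, h7] at hmain2
    have h8 := le_of_mul_le_mul_right hmain2 hLi
    have h9 : 0 ≤ X * δ := by positivity
    nlinarith
  have h6 : X = X * δ * L := by rw [hδ]; field_simp
  have h7 : X * δ * L ≤ 2 * (D * (T * L * ℓ)) * L := by gcongr
  calc 2 * X ≤ 2 * (2 * (D * (T * L * ℓ)) * L) := by linarith
    _ = 4 * D * (T * L ^ 2 * ℓ) := by ring

lemma eventually_loglog_bounds :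
    ∀ᶠ T : ℝ in atTop, 8 ≤ T ∧ 1 ≤ Real.log (Real.log T) ∧
      3200 * Real.log (Real.log T) ≤ Real.log T := by
  have h1 : Tendsto (fun T : ℝ => Real.log (Real.log T)) atTop atTop :=
    Real.tendsto_log_atTop.comp Real.tendsto_log_atTop
  have h2 : ∀ᶠ x : ℝ in atTop, 3200 * Real.log x ≤ x := by
    have h := Real.isLittleO_log_id_atTop.bound (show (0 : ℝ) < 1 / 3200 by norm_num)
    filter_upwards [h, eventually_ge_atTop 1] with x hx hx1
    rw [Real.norm_of_nonneg (Real.log_nonneg hx1), id, Real.norm_of_nonneg (by linarith)] at hx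
    linarith
  filter_upwards [eventually_ge_atTop 8, h1.eventually_ge_atTop 1,
    Real.tendsto_log_atTop.eventually h2] with T a b c
  exact ⟨a, b, c⟩

lemma zeroFinset_subset {a b b' : ℝ} (h : b ≤ b') : zeroFinset a b ⊆ zeroFinset a b' := by
  intro ρ hρ
  rw [mem_zeroFinset] at hρ ⊢
  exact ⟨hρ.1, hρ.2.1, hρ.2.2.trans h⟩

lemma log_sq_mul_loglog_mono {x y : ℝ} (hx : 3 ≤ x) (hxy : x ≤ y) :
    Real.log x ^ 2 * Real.log (Real.log x) ≤ Real.log y ^ 2 * Real.log (Real.log y) := by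
  have h1 : 1 ≤ Real.log x := by
    rw [Real.le_log_iff_exp_le (by linarith)]
    linarith [Real.exp_one_lt_d9]
  have h2 : Real.log x ≤ Real.log y := Real.log_le_log (by linarith) hxy
  have h3 : 0 ≤ Real.log (Real.log x) := Real.log_nonneg h1
  have h4 : Real.log (Real.log x) ≤ Real.log (Real.log y) := Real.log_le_log (by linarith) h2
  gcongr

/-- The second moment over zeros up to height `T` is at most a constant times
`T log² T log log T`, up to an additive constant. -/
lemma exists_sum_zeros_le : ∃ A C : ℝ, 0 < A ∧ 0 < C ∧ ∀ T, 3 ≤ T →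
    ∑ ρ ∈ zeroFinset 0 T, (zetaMult ρ : ℝ) * ‖riemannZeta (1/2 + ρ.im * I)‖ ^ 2 ≤
      A + C * (T * (Real.log T ^ 2 * Real.log (Real.log T))) := by
  obtain ⟨C, hC, h⟩ := exists_sum_zeros_dyadic_le
  obtain ⟨T₀, hT₀⟩ := eventually_atTop.1 eventually_loglog_bounds
  set T₁ := max T₀ 3 with hT₁
  set F : ℝ → ℝ := fun T => ∑ ρ ∈ zeroFinset 0 T,
    (zetaMult ρ : ℝ) * ‖riemannZeta (1/2 + ρ.im * I)‖ ^ 2 with hF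
  have hF0 : ∀ T, 0 ≤ F T := fun T => Finset.sum_nonneg fun ρ _ => by positivity
  have h3 : 3 ≤ T₁ := le_max_right _ _
  have key : ∀ n : ℕ, ∀ T, 3 ≤ T → T ≤ 2 ^ (n + 1) * T₁ →
      F T ≤ F (2 * T₁) + 1 + 2 * C * (T * (Real.log T ^ 2 * Real.log (Real.log T))) := by
    have hnn : ∀ T : ℝ, 3 ≤ T → 0 ≤ T * (Real.log T ^ 2 * Real.log (Real.log T)) := by
      intro T hT
      have : 0 ≤ Real.log (Real.log T) := by
        apply Real.log_nonneg
        rw [Real.le_log_iff_exp_le (by linarith)]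
        linarith [Real.exp_one_lt_d9]
      positivity
    have base : ∀ T, 3 ≤ T → T ≤ 2 * T₁ →
        F T ≤ F (2 * T₁) + 1 + 2 * C * (T * (Real.log T ^ 2 * Real.log (Real.log T))) := by
      intro T hT hT2
      have h1 : F T ≤ F (2 * T₁) :=
        Finset.sum_le_sum_of_subset_of_nonneg (zeroFinset_subset hT2) fun ρ _ _ => by positivity
      have := mul_nonneg hC.le (hnn T hT)
      linarith
    intro n
    induction n with
    | zero => intro T hT hT2; exact base T hT (by simpa using hT2)
    | succ n ih =>
      intro T hT hT2
      rcases le_total T (2 * T₁) with hle | hle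
      · exact base T hT hle
      have hh : 3 ≤ T / 2 := by linarith
      have e1 := ih (T / 2) hh (by rw [pow_succ] at hT2; linarith)
      obtain ⟨b1, b2, b3⟩ := hT₀ (T / 2) ((le_max_left T₀ 3).trans (by rw [← hT₁]; linarith))
      have e2 := h (T / 2) b1 b2 b3
      have e3 : F T = F (T / 2) + ∑ ρ ∈ zeroFinset (T / 2) (2 * (T / 2)),
          (zetaMult ρ : ℝ) * ‖riemannZeta (1/2 + ρ.im * I)‖ ^ 2 := by
        rw [show 2 * (T / 2) = T by ring]
        exact sum_zeroFinset_add (by linarith) (by linarith) _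
      have e4 := log_sq_mul_loglog_mono hh (show T / 2 ≤ T by linarith)
      have e5 : T / 2 * (Real.log (T / 2) ^ 2 * Real.log (Real.log (T / 2))) ≤
          T / 2 * (Real.log T ^ 2 * Real.log (Real.log T)) := by gcongr
      have e6 := hnn T hT
      rw [mul_assoc (T / 2)] at e2
      nlinarith
  refine ⟨F (2 * T₁) + 1, 2 * C, by linarith [hF0 (2 * T₁)], by positivity, fun T hT => ?_⟩
  obtain ⟨n, hn⟩ := pow_unbounded_of_one_lt T (show (1 : ℝ) < 2 by norm_num)
  refine key n T hT (hn.le.trans ?_)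
  rw [pow_succ, mul_assoc]
  have : (0 : ℝ) < 2 ^ n := by positivity
  nlinarith

theorem exists_tsum_zeros_le (ε : ℝ) (hε : 0 < ε) : ∃ K : ℝ, ∀ T : ℝ, 3 ≤ T →
    (∑' ρ : {ρ : ℂ // IsNontrivialZero ρ ∧ 0 < ρ.im ∧ ρ.im ≤ T},
        (zetaMult ρ.1 : ℝ) * ‖riemannZeta (1/2 + ρ.1.im * I)‖ ^ 2) ≤
      K * T * (Real.log T) ^ 2 * (Real.log (Real.log T)) ^ (3/2 + ε : ℝ) := by
  obtain ⟨A, C, hA, hC, h⟩ := exists_sum_zeros_le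
  have l3 : 1 < Real.log 3 := by
    rw [Real.lt_log_iff_exp_lt (by norm_num)]
    linarith [Real.exp_one_lt_d9]
  set c := Real.log (Real.log 3) with hc
  have hc0 : 0 < c := Real.log_pos l3
  set e : ℝ := 3 / 2 + ε with he
  refine ⟨A / c ^ e + C / c ^ (e - 1), fun T hT => ?_⟩
  rw [tsum_zeros_eq T fun ρ => (zetaMult ρ : ℝ) * ‖riemannZeta (1/2 + ρ.im * I)‖ ^ 2]
  refine (h T hT).trans ?_
  have l1 : Real.log 3 ≤ Real.log T := Real.log_le_log (by norm_num) hT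
  have l2 : c ≤ Real.log (Real.log T) := Real.log_le_log (by linarith) l1
  set L := Real.log T
  set ℓ := Real.log L
  have hℓ : 0 < ℓ := by linarith
  have p1 : c ^ e ≤ ℓ ^ e := Real.rpow_le_rpow hc0.le l2 (by positivity)
  have p2 : c ^ (e - 1) ≤ ℓ ^ (e - 1) := Real.rpow_le_rpow hc0.le l2 (by rw [he]; linarith)
  have q1 : 0 < c ^ e := Real.rpow_pos_of_pos hc0 _
  have q2 : 0 < c ^ (e - 1) := Real.rpow_pos_of_pos hc0 _
  have p3 : ℓ ^ e = ℓ ^ (e - 1) * ℓ := by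
    rw [Real.rpow_sub_one hℓ.ne']; field_simp
  have r1 : A ≤ A / c ^ e * (T * L ^ 2 * ℓ ^ e) := by
    have : 1 ≤ T * L ^ 2 := by nlinarith
    calc A = A / c ^ e * (1 * c ^ e) := by field_simp
      _ ≤ _ := by gcongr
  have r2 : C * (T * (L ^ 2 * ℓ)) ≤ C / c ^ (e - 1) * (T * L ^ 2 * ℓ ^ e) := by
    calc C * (T * (L ^ 2 * ℓ)) = C / c ^ (e - 1) * (T * L ^ 2 * (c ^ (e - 1) * ℓ)) := by field_simp
      _ ≤ _ := by rw [p3]; gcongr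
  linarith

/-- An analytic function on an open set factors through its zeros in a finite set. -/
lemma exists_eq_prod_mul {f : ℂ → ℂ} {U : Set ℂ} (hUo : IsOpen U) (hf : AnalyticOnNhd ℂ f U)
    (m : ℂ → ℕ) (P : Finset ℂ) (hP : ∀ ρ ∈ P, ρ ∈ U → analyticOrderAt f ρ = m ρ) :
    ∃ g : ℂ → ℂ, AnalyticOnNhd ℂ g U ∧ (∀ s ∈ U, f s = (∏ ρ ∈ P, (s - ρ) ^ m ρ) * g s) ∧
      ∀ ρ ∈ P, ρ ∈ U → g ρ ≠ 0 := by
  classical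
  induction P using Finset.induction_on with
  | empty => exact ⟨f, hf, by simp, by simp⟩
  | insert ρ P hρ ih =>
    obtain ⟨g, hg, hfg, hne⟩ := ih fun r hr => hP r (Finset.mem_insert_of_mem hr)
    have hpow : ∀ s : ℂ, AnalyticAt ℂ (fun s => (s - ρ) ^ m ρ) s := fun s => by fun_prop
    have hquot : ∀ s ∈ U, s ≠ ρ → AnalyticAt ℂ (fun s => g s / (s - ρ) ^ m ρ) s := fun s hs hsρ =>
      (hg s hs).div (hpow s) (pow_ne_zero _ (sub_ne_zero.2 hsρ))
    by_cases hU : ρ ∈ U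
    · have hQ : AnalyticAt ℂ (fun s => ∏ r ∈ P, (s - r) ^ m r) ρ := by fun_prop
      have hQ0 : (∏ r ∈ P, (ρ - r) ^ m r) ≠ 0 := by
        refine Finset.prod_ne_zero_iff.2 fun r hr => pow_ne_zero _ (sub_ne_zero.2 ?_)
        rintro rfl
        exact hρ hr
      have hord : analyticOrderAt g ρ = m ρ := by
        have h1 := hP ρ (Finset.mem_insert_self _ _) hU
        have h2 : f =ᶠ[nhds ρ] (fun s => ∏ r ∈ P, (s - r) ^ m r) * g := by
          filter_upwards [hUo.mem_nhds hU] with s hs using hfg s hs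
        rw [analyticOrderAt_congr h2, analyticOrderAt_mul hQ (hg ρ hU),
          hQ.analyticOrderAt_eq_zero.2 hQ0, zero_add] at h1
        exact h1
      obtain ⟨g₀, hg₀, hg₀0, hg₀e⟩ := (hg ρ hU).analyticOrderAt_eq_natCast.1 hord
      refine ⟨Function.update (fun s => g s / (s - ρ) ^ m ρ) ρ (g₀ ρ), ?_, ?_, ?_⟩
      · intro s hs
        by_cases hsρ : s = ρ
        · subst hsρ
          refine hg₀.congr ?_
          filter_upwards [hg₀e] with z hz
          by_cases hzs : z = s
          · subst hzs; simp
          · have := pow_ne_zero (m s) (sub_ne_zero.2 hzs)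
            rw [Function.update_of_ne hzs, hz, smul_eq_mul]
            field_simp
        · refine (hquot s hs hsρ).congr ?_
          filter_upwards [isOpen_ne.mem_nhds hsρ] with z hz
          rw [Function.update_of_ne hz]
      · intro s hs
        rw [Finset.prod_insert hρ]
        by_cases hsρ : s = ρ
        · subst hsρ
          rw [hfg s hs, Function.update_self]
          have := hg₀e.self_of_nhds
          rw [this, smul_eq_mul]
          ring
        · have := pow_ne_zero (m ρ) (sub_ne_zero.2 hsρ)
          rw [Function.update_of_ne hsρ, hfg s hs]
          field_simp
      · intro r hr hrU
        by_cases hrρ : r = ρ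
        · subst hrρ; rwa [Function.update_self]
        · rw [Function.update_of_ne hrρ]
          exact div_ne_zero (hne r (Finset.mem_of_mem_insert_of_ne hr hrρ) hrU)
            (pow_ne_zero _ (sub_ne_zero.2 hrρ))
    · have hs' : ∀ s ∈ U, s ≠ ρ := fun s hs h => hU (h ▸ hs)
      refine ⟨fun s => g s / (s - ρ) ^ m ρ, fun s hs => hquot s hs (hs' s hs), fun s hs => ?_,
        fun r hr hrU => ?_⟩
      · have := pow_ne_zero (m ρ) (sub_ne_zero.2 (hs' s hs))
        rw [Finset.prod_insert hρ, hfg s hs]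
        field_simp
      · refine div_ne_zero (hne r (Finset.mem_of_mem_insert_of_ne hr (hs' r hrU)) hrU)
          (pow_ne_zero _ (sub_ne_zero.2 (hs' r hrU)))

/-- A nonvanishing analytic function on a ball is an exponential. -/
lemma exists_exp_eq_of_ball {g : ℂ → ℂ} {c : ℂ} {r : ℝ} (hr : 0 < r)
    (hg : AnalyticOnNhd ℂ g (Metric.ball c r)) (hne : ∀ s ∈ Metric.ball c r, g s ≠ 0) :
    ∃ G : ℂ → ℂ, DifferentiableOn ℂ G (Metric.ball c r) ∧
      ∀ s ∈ Metric.ball c r, g s = Complex.exp (G s) := by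
  have hd : DifferentiableOn ℂ (fun s => deriv g s / g s) (Metric.ball c r) :=
    fun s hs => ((hg s hs).deriv.differentiableAt.div (hg s hs).differentiableAt
      (hne s hs)).differentiableWithinAt
  obtain ⟨F, hF⟩ := hd.isExactOn_ball
  have hc := Metric.mem_ball_self (x := c) hr
  refine ⟨fun s => F s - F c + Complex.log (g c), fun s hs =>
    (((hF s hs).differentiableAt.sub_const _).add_const _).differentiableWithinAt, fun s hs => ?_⟩
  have hconst : ∀ z ∈ Metric.ball c r, HasDerivAt (fun z => g z * Complex.exp (-F z)) 0 z := by
    intro z hz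
    have h1 := (hg z hz).differentiableAt.hasDerivAt.mul (hF z hz).neg.cexp
    refine h1.congr_deriv ?_
    have := hne z hz
    simp only [Pi.neg_apply]
    field_simp
    ring
  have h2 : g s * Complex.exp (-F s) = g c * Complex.exp (-F c) := by
    refine (convex_ball c r).is_const_of_fderivWithin_eq_zero (𝕜 := ℂ)
      (fun z hz => (hconst z hz).differentiableAt.differentiableWithinAt) (fun z hz => ?_) hs hc
    rw [fderivWithin_of_isOpen Metric.isOpen_ball hz]
    have := (hconst z hz).hasFDerivAt.fderiv
    rw [this]; simp
  rw [Complex.exp_add, Complex.exp_sub, Complex.exp_log (hne c hc)]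
  rw [Complex.exp_neg, Complex.exp_neg] at h2
  have e1 := Complex.exp_ne_zero (F s)
  have e2 := Complex.exp_ne_zero (F c)
  field_simp at h2 ⊢
  linear_combination h2

/-- Two continuous logarithms of the same function on a connected set differ by a constant. -/
lemma sub_eq_sub_of_exp_eq {X : Type*} [TopologicalSpace X] {s : Set X} (hs : IsPreconnected s)
    {u v : X → ℂ} (hu : ContinuousOn u s) (hv : ContinuousOn v s)
    (h : ∀ x ∈ s, Complex.exp (u x) = Complex.exp (v x)) {x y : X} (hx : x ∈ s) (hy : y ∈ s) :
    u x - v x = u y - v y := by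
  have h2π : (2 * π * I : ℂ) ≠ 0 := Complex.two_pi_I_ne_zero
  have hk : ∀ x ∈ s, ∃ n : ℤ, u x - v x = n * (2 * π * I) := by
    intro x hx
    obtain ⟨n, hn⟩ := Complex.exp_eq_exp_iff_exists_int.1 (h x hx)
    exact ⟨n, by rw [hn]; ring⟩
  have hmaps : MapsTo (fun x => (u x - v x) / (2 * π * I)) s (range ((↑) : ℤ → ℂ)) := by
    intro x hx
    obtain ⟨n, hn⟩ := hk x hx
    exact ⟨n, by beta_reduce; rw [hn]; field_simp⟩
  have hdisc : IsDiscrete (range ((↑) : ℤ → ℂ)) := by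
    rw [isDiscrete_iff_discreteTopology]
    exact Complex.isClosedEmbedding_intCast.isEmbedding.toHomeomorph.discreteTopology
  have := hs.constant_of_mapsTo hdisc ((hu.sub hv).div_const _) hmaps hx hy
  field_simp at this
  exact this

lemma zeta_mem_slitPlane {s : ℂ} (hs : s.re = 2) : riemannZeta s ∈ Complex.slitPlane := by
  have h1 : ‖riemannZeta s - 1‖ < 1 := by
    have a0 : HasSum (LSeries.term (fun n => (ArithmeticFunction.zeta n : ℂ)) s) (riemannZeta s) :=
      ArithmeticFunction.LSeriesHasSum_zeta (by rw [hs]; norm_num)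
    have a1 := a0.sub (hasSum_ite_eq (1 : ℕ) (1 : ℂ))
    have a2 := hasSum_zeta_two.sub (hasSum_ite_eq (1 : ℕ) (1 : ℝ))
    have a3 := a1.norm_le_of_bounded a2 fun n => by
      rcases Nat.eq_zero_or_pos n with rfl | hn
      · simp
      · by_cases hn1 : n = 1
        · subst hn1; simp [LSeries.term]
        · rw [if_neg hn1, if_neg hn1, sub_zero, sub_zero, LSeries.norm_term_eq, if_neg hn.ne', hs]
          simp [hn.ne']
    nlinarith [Real.pi_lt_d2, Real.pi_pos]
  have h2 := Complex.abs_re_le_norm (riemannZeta s - 1)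
  left
  have := abs_lt.1 (h2.trans_lt h1)
  simp at this
  linarith [this.1]

/-- The value of `S` in terms of an arbitrary logarithm of `ζ` along the horizontal segment. -/
lemma pi_mul_S_eq {S : ℝ → ℝ} (hS : IsS S) {T : ℝ} (hT : 0 < T) {L : ℝ → ℂ}
    (hL : ContinuousOn L (Icc (1/2) 2))
    (hexp : ∀ σ ∈ Icc (1/2 : ℝ) 2, Complex.exp (L σ) = riemannZeta (σ + T * I)) :
    π * S T = (Complex.log (riemannZeta (2 + T * I)) + L (1/2) - L 2).im := by
  obtain ⟨θ, hθ, hθ0, h1, h2, hST⟩ := hS.1 T hT fun σ a b => by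
    rw [← hexp σ ⟨a, b⟩]; exact Complex.exp_ne_zero _
  have hre : ∀ u : ℝ, (2 + u * T * I : ℂ).re = 2 := fun u => by simp
  have e1 : θ 1 - Complex.log (riemannZeta (2 + (1 : ℝ) * T * I)) =
      θ 0 - Complex.log (riemannZeta (2 + (0 : ℝ) * T * I)) := by
    refine sub_eq_sub_of_exp_eq (s := Icc (0 : ℝ) 1)
      (v := fun u : ℝ => Complex.log (riemannZeta (2 + u * T * I))) isPreconnected_Icc
      (hθ.mono (Icc_subset_Icc le_rfl (by norm_num))) ?_ ?_ ⟨by norm_num, le_rfl⟩ ⟨le_rfl, by norm_num⟩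
    · intro u _
      refine ContinuousAt.continuousWithinAt ?_
      have hne : (2 + u * T * I : ℂ) ≠ 1 := fun h => by
        have := congrArg Complex.re h
        rw [hre] at this
        norm_num at this
      exact ContinuousAt.clog ((differentiableAt_riemannZeta hne).continuousAt.comp
        (f := fun u : ℝ => (2 + u * T * I : ℂ)) (by fun_prop)) (zeta_mem_slitPlane (hre u))
    · intro u hu
      rw [h1 u hu, Complex.exp_log (Complex.slitPlane_ne_zero (zeta_mem_slitPlane (hre u)))]
  have e2 : θ 2 - L (2 - 3/2 * (2 - 1)) = θ 1 - L (2 - 3/2 * (1 - 1)) := by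
    refine sub_eq_sub_of_exp_eq (s := Icc (1 : ℝ) 2) (v := fun u : ℝ => L (2 - 3/2 * (u - 1)))
      isPreconnected_Icc (hθ.mono (Icc_subset_Icc (by norm_num) le_rfl)) ?_ ?_
      ⟨by norm_num, le_rfl⟩ ⟨le_rfl, by norm_num⟩
    · refine hL.comp (by fun_prop) fun u hu => ⟨?_, ?_⟩ <;> linarith [hu.1, hu.2]
    · intro u hu
      rw [h2 u hu, hexp _ ⟨by linarith [hu.2], by linarith [hu.1]⟩]
      push_cast
      rfl
  have e3 : θ 2 = Complex.log (riemannZeta (2 + T * I)) + L (1/2) - L 2 := by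
    norm_num at e1 e2
    rw [hθ0] at e1
    linear_combination e2 + e1
  rw [hST, ← e3]
  field_simp

lemma arg_add_arg_neg_conj {z : ℂ} (hz : z.im ≠ 0) :
    Complex.arg z + Complex.arg (-conj z) = 2 * π * (if 0 < z.im then 1 else 0) - π := by
  have hne : Complex.arg z ≠ π := fun h => hz (Complex.arg_eq_pi_iff.1 h).2
  rcases lt_or_gt_of_ne hz with h | h
  · rw [if_neg (not_lt.2 h.le), Complex.arg_neg_eq_arg_sub_pi_of_im_pos (by simpa using h),
      Complex.arg_conj, if_neg hne]
    ring
  · rw [if_pos h, Complex.arg_neg_eq_arg_add_pi_of_im_neg (by simpa using h),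
      Complex.arg_conj, if_neg hne]
    ring

/-- The zeros are symmetric about the critical line. -/
lemma sum_zeros_reflect {M : Type*} [AddCommMonoid M] (a b : ℝ) (f : ℕ → ℂ → M) :
    ∑ ρ ∈ zeroFinset a b, f (zetaMult ρ) (1 - conj ρ) = ∑ ρ ∈ zeroFinset a b, f (zetaMult ρ) ρ := by
  have hmem : ∀ ρ ∈ zeroFinset a b, 1 - conj ρ ∈ zeroFinset a b := by
    intro ρ hρ
    rw [mem_zeroFinset] at hρ ⊢
    exact ⟨isNontrivialZero_one_sub_conj hρ.1, by simpa using hρ.2.1, by simpa using hρ.2.2⟩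
  refine Finset.sum_nbij' (fun ρ => 1 - conj ρ) (fun ρ => 1 - conj ρ) hmem hmem (by simp) (by simp) ?_
  intro ρ hρ
  rw [zetaMult_one_sub_conj (mem_zeroFinset.1 hρ).1]

/-- The arguments of the linear factors on the critical line count the zeros below. -/
lemma sum_zeros_mul_arg {a b t : ℝ} (htb : t ≤ b)
    (ht : ∀ ρ ∈ zeroFinset a b, ρ.im ≠ t) :
    ∑ ρ ∈ zeroFinset a b, (zetaMult ρ : ℝ) * Complex.arg (1/2 + t * I - ρ) =
      π * ∑ ρ ∈ zeroFinset a t, (zetaMult ρ : ℝ) - π / 2 * ∑ ρ ∈ zeroFinset a b, (zetaMult ρ : ℝ) := by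
  have h1 := sum_zeros_reflect a b fun n ρ => (n : ℝ) * Complex.arg (1/2 + t * I - ρ)
  have h2 : ∑ ρ ∈ zeroFinset a b, (zetaMult ρ : ℝ) * Complex.arg (1/2 + t * I - ρ) +
      ∑ ρ ∈ zeroFinset a b, (zetaMult ρ : ℝ) * Complex.arg (1/2 + t * I - (1 - conj ρ)) =
      ∑ ρ ∈ zeroFinset a b, (2 * π * (if ρ.im ≤ t then (zetaMult ρ : ℝ) else 0) -
        π * (zetaMult ρ : ℝ)) := by
    rw [← Finset.sum_add_distrib]
    refine Finset.sum_congr rfl fun ρ hρ => ?_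
    have h3 : (1/2 + t * I - ρ : ℂ).im = t - ρ.im := by simp
    have h4 : (1/2 + t * I - (1 - conj ρ) : ℂ) = -conj (1/2 + t * I - ρ) := by
      simp only [map_sub, map_add, map_mul, Complex.conj_I, Complex.conj_ofReal, map_div₀, map_one,
        map_ofNat]
      ring
    rw [← mul_add, h4, arg_add_arg_neg_conj (by rw [h3]; exact sub_ne_zero.2 (ht ρ hρ).symm), h3]
    rcases lt_or_gt_of_ne (ht ρ hρ) with h | h
    · rw [if_pos (by linarith), if_pos h.le]; ring
    · rw [if_neg (by linarith), if_neg (by linarith)]; ring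
  have h5 : ∑ ρ ∈ zeroFinset a b, (if ρ.im ≤ t then (zetaMult ρ : ℝ) else 0) =
      ∑ ρ ∈ zeroFinset a t, (zetaMult ρ : ℝ) := by
    rw [← Finset.sum_filter]
    congr 1
    ext ρ
    rw [Finset.mem_filter, mem_zeroFinset, mem_zeroFinset]
    constructor
    · rintro ⟨⟨h, h', -⟩, h''⟩; exact ⟨h, h', h''⟩
    · rintro ⟨h, h', h''⟩; exact ⟨⟨h, h', h''.trans htb⟩, h''⟩
  rw [h1, Finset.sum_sub_distrib, ← Finset.mul_sum, ← Finset.mul_sum, h5] at h2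
  linarith

/-- The derivative of the Riemann–Siegel theta function. -/
def thetaDeriv (t : ℝ) : ℝ := -(1/2) * (deriv chi (1/2 + t * I) / chi (1/2 + t * I)).re

/-- The number of zeros up to height `t`, counted with multiplicity. -/
def zeroCount (t : ℝ) : ℝ := ∑ ρ ∈ zeroFinset 0 t, (zetaMult ρ : ℝ)

lemma half_add_mul_I_re (t : ℝ) : (1/2 + t * I : ℂ).re = 1/2 := by simp

lemma chi_half_ne_zero (t : ℝ) : chi (1/2 + t * I) ≠ 0 :=
  chi_ne_zero (by rw [half_add_mul_I_re]; norm_num) (by rw [half_add_mul_I_re]; norm_num)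

lemma hasDerivAt_half_line (t : ℝ) : HasDerivAt (fun t : ℝ => (1/2 + t * I : ℂ)) I t := by
  simpa using ((Complex.ofRealCLM.hasDerivAt (x := t)).mul_const I).const_add (1/2)

lemma hasDerivAt_chi_half (t : ℝ) : HasDerivAt (fun t : ℝ => chi (1/2 + t * I))
    (deriv chi (1/2 + t * I) * I) t :=
  (differentiableAt_chi (by rw [half_add_mul_I_re]; norm_num)).hasDerivAt.comp t
    (hasDerivAt_half_line t)

lemma continuous_thetaDeriv : Continuous thetaDeriv := by
  rw [continuous_iff_continuousAt]
  intro t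
  have hre : (1/2 + t * I : ℂ).re < 1 := by rw [half_add_mul_I_re]; norm_num
  have h1 : ContinuousAt (fun t : ℝ => (1/2 + t * I : ℂ)) t := by fun_prop
  have h2 : ContinuousAt (fun s => deriv chi s / chi s) (1/2 + t * I) :=
    (analyticAt_chi hre).deriv.continuousAt.div (analyticAt_chi hre).continuousAt (chi_half_ne_zero t)
  exact (Complex.continuous_re.continuousAt.comp (h2.comp (f := fun t : ℝ => (1/2 + t * I : ℂ)) h1)).const_mul _

/-- On the critical line `χ'/χ` is real. -/
lemma deriv_chi_div_chi_half (t : ℝ) :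
    deriv chi (1/2 + t * I) / chi (1/2 + t * I) = -2 * (thetaDeriv t : ℂ) := by
  have hd := hasDerivAt_chi_half t
  set c := chi (1/2 + t * I) with hc
  set d := deriv chi (1/2 + t * I) with hdd
  have h1 : HasDerivAt (fun t : ℝ => chi (1/2 + t * I) * conj (chi (1/2 + t * I)))
      (d * I * conj c + c * conj (d * I)) t := hd.mul hd.star
  have h2 : (fun t : ℝ => chi (1/2 + t * I) * conj (chi (1/2 + t * I))) = fun _ => 1 := by
    ext t
    rw [Complex.mul_conj, Complex.normSq_eq_norm_sq, norm_chi_half]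
    simp
  rw [h2] at h1
  have h3 := h1.unique (hasDerivAt_const t (1 : ℂ))
  have h4 : c * conj c = 1 := congrFun h2 t
  have hcne : c ≠ 0 := chi_half_ne_zero t
  have h5 : conj (d / c) = d / c := by
    have hcc : conj c ≠ 0 := by simpa using hcne
    rw [map_div₀, div_eq_div_iff hcc hcne]
    rw [map_mul, Complex.conj_I] at h3
    have : I * (d * conj c - conj d * c) = 0 := by linear_combination h3
    have := (mul_eq_zero.1 this).resolve_left Complex.I_ne_zero
    linear_combination -this
  have h6 := Complex.conj_eq_iff_re.1 h5
  rw [thetaDeriv, ← hc, ← hdd, ← h6]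
  push_cast
  simp only [Complex.ofReal_re]
  ring

/-- `χ(1/2 + it) = e^{-2iθ(t)}` up to a constant. -/
lemma chi_half_mul_exp (t : ℝ) :
    chi (1/2 + t * I) * Complex.exp (2 * I * ((∫ u in (1:ℝ)..t, thetaDeriv u : ℝ) : ℂ)) =
      chi (1/2 + I) := by
  have hd : ∀ t : ℝ, HasDerivAt (fun t : ℝ => chi (1/2 + t * I) *
      Complex.exp (2 * I * ((∫ u in (1:ℝ)..t, thetaDeriv u : ℝ) : ℂ))) 0 t := by
    intro t
    have h1 : HasDerivAt (fun t : ℝ => ∫ u in (1:ℝ)..t, thetaDeriv u) (thetaDeriv t) t :=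
      intervalIntegral.integral_hasDerivAt_right (continuous_thetaDeriv.intervalIntegrable _ _)
        (continuous_thetaDeriv.stronglyMeasurableAtFilter _ _) continuous_thetaDeriv.continuousAt
    have h2 := (hasDerivAt_chi_half t).mul (h1.ofReal_comp.const_mul (2 * I)).cexp
    refine h2.congr_deriv ?_
    have h3 := deriv_chi_div_chi_half t
    rw [div_eq_iff (chi_half_ne_zero t)] at h3
    rw [h3]
    ring
  have := is_const_of_deriv_eq_zero (fun t => (hd t).differentiableAt) (fun t => (hd t).deriv) t 1
  simpa using this

/-- Local logarithm of `ζ` with its nearby zeros removed. -/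
lemma exists_local_log {t₀ : ℝ} (ht₀ : 1 ≤ t₀) : ∃ G : ℂ → ℂ,
    DifferentiableOn ℂ G (Metric.ball (5/4 + t₀ * I) 1) ∧
    ∀ s ∈ Metric.ball (5/4 + t₀ * I : ℂ) 1, riemannZeta s =
      (∏ ρ ∈ zeroFinset (t₀ - 1) (t₀ + 1), (s - ρ) ^ zetaMult ρ) * Complex.exp (G s) := by
  set B := Metric.ball (5/4 + t₀ * I : ℂ) 1 with hB
  have hBre : ∀ s ∈ B, 1/4 < s.re ∧ |s.im - t₀| < 1 := by
    intro s hs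
    rw [hB, Metric.mem_ball, dist_eq_norm] at hs
    have h1 := (Complex.abs_re_le_norm _).trans_lt hs
    have h2 := (Complex.abs_im_le_norm _).trans_lt hs
    simp at h1 h2
    norm_num at h1
    exact ⟨by linarith [(abs_lt.1 h1).1], h2⟩
  have hB1 : ∀ s ∈ B, s ≠ 1 := by
    rintro s hs rfl
    have := (hBre _ hs).2
    simp at this
    rw [abs_of_pos (by linarith)] at this
    linarith
  have hζ : AnalyticOnNhd ℂ riemannZeta B := fun s hs => analyticOnNhd_zeta s (hB1 s hs)
  obtain ⟨g, hg, hfg, hne⟩ := exists_eq_prod_mul Metric.isOpen_ball hζ zetaMult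
    (zeroFinset (t₀ - 1) (t₀ + 1)) fun ρ _ hρ => analyticOrderAt_zeta_eq (hB1 ρ hρ)
  have hne' : ∀ s ∈ B, g s ≠ 0 := by
    intro s hs hgs
    have h0 : riemannZeta s = 0 := by rw [hfg s hs, hgs, mul_zero]
    obtain ⟨h1, h2⟩ := hBre s hs
    have h3 : s.re < 1 := by
      by_contra h
      exact riemannZeta_ne_zero_of_one_le_re (not_lt.1 h) h0
    rw [abs_lt] at h2
    exact hne s (mem_zeroFinset.2 ⟨⟨h0, by linarith, h3⟩, by linarith, by linarith⟩) hs hgs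
  obtain ⟨G, hG, hGe⟩ := exists_exp_eq_of_ball one_pos hg hne'
  exact ⟨G, hG, fun s hs => by rw [hfg s hs, hGe s hs]⟩

/-- Reflection of the linear factors about the critical line. -/
lemma conj_prod_zeros (a b t : ℝ) :
    conj (∏ ρ ∈ zeroFinset a b, (1/2 + t * I - ρ) ^ zetaMult ρ) =
      (∏ ρ ∈ zeroFinset a b, (-1) ^ zetaMult ρ) *
        ∏ ρ ∈ zeroFinset a b, (1/2 + t * I - ρ) ^ zetaMult ρ := by
  have h1 : ∏ ρ ∈ zeroFinset a b, (1/2 + t * I - (1 - conj ρ)) ^ zetaMult ρ =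
      ∏ ρ ∈ zeroFinset a b, (1/2 + t * I - ρ) ^ zetaMult ρ :=
    sum_zeros_reflect (M := Additive ℂ) a b fun n ρ => Additive.ofMul ((1/2 + t * I - ρ) ^ n)
  conv_rhs => rw [← h1]
  rw [map_prod, ← Finset.prod_mul_distrib]
  refine Finset.prod_congr rfl fun ρ _ => ?_
  rw [map_pow, ← mul_pow]
  congr 1
  simp only [map_sub, map_add, map_mul, Complex.conj_I, Complex.conj_ofReal, map_div₀, map_one,
    map_ofNat]
  ring

lemma mem_ball_of_near {t₀ σ t : ℝ} (hσ : σ ∈ Icc (1/2 : ℝ) 2) (ht : |t - t₀| < 1/4) :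
    (σ + t * I : ℂ) ∈ Metric.ball (5/4 + t₀ * I : ℂ) 1 := by
  rw [Metric.mem_ball, dist_eq_norm]
  have h : ((σ + t * I : ℂ) - (5/4 + t₀ * I)) = ((σ - 5/4 : ℝ) : ℂ) + ((t - t₀ : ℝ) : ℂ) * I := by
    push_cast; ring
  rw [h]
  have h2 : ‖((σ - 5/4 : ℝ) : ℂ) + ((t - t₀ : ℝ) : ℂ) * I‖ ^ 2 = (σ - 5/4) ^ 2 + (t - t₀) ^ 2 := by
    rw [← Complex.normSq_eq_norm_sq, Complex.normSq_add_mul_I]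
  rw [abs_lt] at ht
  have h3 : (σ - 5/4) ^ 2 ≤ (3/4) ^ 2 := by nlinarith [hσ.1, hσ.2]
  have h4 : (t - t₀) ^ 2 ≤ (1/4) ^ 2 := by nlinarith
  nlinarith [norm_nonneg (((σ - 5/4 : ℝ) : ℂ) + ((t - t₀ : ℝ) : ℂ) * I)]

lemma continuous_integral_thetaDeriv : Continuous fun t : ℝ => ∫ u in (1:ℝ)..t, thetaDeriv u :=
  intervalIntegral.continuous_primitive (fun a b => continuous_thetaDeriv.intervalIntegrable a b) 1

/-- The imaginary part of the zero-free logarithm on the critical line is `-θ` up to a constant. -/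
lemma im_add_theta_eq {t₀ δ : ℝ} (hδ0 : 0 < δ) (hδ : δ ≤ 1/4)
    (hgood : ∀ ρ ∈ zeroFinset (t₀ - 1) (t₀ + 1), ∀ t, |t - t₀| < δ → t ≠ t₀ → ρ.im ≠ t) {G : ℂ → ℂ}
    (hG : DifferentiableOn ℂ G (Metric.ball (5/4 + t₀ * I) 1))
    (hζ : ∀ s ∈ Metric.ball (5/4 + t₀ * I : ℂ) 1, riemannZeta s =
      (∏ ρ ∈ zeroFinset (t₀ - 1) (t₀ + 1), (s - ρ) ^ zetaMult ρ) * Complex.exp (G s))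
    {t : ℝ} (ht : |t - t₀| < δ) :
    (G (1/2 + t * I)).im + ∫ u in (1:ℝ)..t, thetaDeriv u =
      (G (1/2 + t₀ * I)).im + ∫ u in (1:ℝ)..t₀, thetaDeriv u := by
  set V : ℝ → ℝ := fun t => (G (1/2 + t * I)).im + ∫ u in (1:ℝ)..t, thetaDeriv u with hV
  set E : ℝ → ℂ := fun t => Complex.exp (2 * I * (V t : ℂ)) with hE
  have hmem : ∀ t : ℝ, |t - t₀| < δ → (1/2 + t * I : ℂ) ∈ Metric.ball (5/4 + t₀ * I : ℂ) 1 := by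
    intro t ht
    have := mem_ball_of_near (t₀ := t₀) (σ := 1/2) ⟨le_rfl, by norm_num⟩ (ht.trans_le hδ)
    simpa using this
  have hVc : ∀ t : ℝ, |t - t₀| < δ → ContinuousAt V t := by
    intro t ht
    have h1 : ContinuousAt G (1/2 + t * I) :=
      (hG.differentiableAt (Metric.isOpen_ball.mem_nhds (hmem t ht))).continuousAt
    have h2 : ContinuousAt (fun t : ℝ => (1/2 + t * I : ℂ)) t := by fun_prop
    exact (Complex.continuous_im.continuousAt.comp
      (h1.comp (f := fun t : ℝ => (1/2 + t * I : ℂ)) h2)).add continuous_integral_thetaDeriv.continuousAt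
  have hEc : ∀ t : ℝ, |t - t₀| < δ → ContinuousAt E t := by
    intro t ht
    exact (continuousAt_const.mul (Complex.continuous_ofReal.continuousAt.comp (hVc t ht))).cexp
  set ε : ℂ := ∏ ρ ∈ zeroFinset (t₀ - 1) (t₀ + 1), (-1) ^ zetaMult ρ with hε
  have hpunct : ∀ t : ℝ, |t - t₀| < δ → t ≠ t₀ → E t = ε * chi (1/2 + I) := by
    intro t ht htne
    have e1 := hζ _ (hmem t ht)
    have e2 : riemannZeta (1/2 + t * I) = chi (1/2 + t * I) * conj (riemannZeta (1/2 + t * I)) := by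
      rw [← riemannZeta_conj]
      have h1 : conj (1/2 + t * I : ℂ) = 1 - (1/2 + t * I) := by
        simp only [map_add, map_mul, Complex.conj_I, Complex.conj_ofReal, map_div₀, map_one,
          map_ofNat]
        ring
      rw [h1]
      refine zeta_eq_chi_mul (fun h => ?_) (by rw [half_add_mul_I_re]; norm_num)
      have := congrArg Complex.re h
      rw [half_add_mul_I_re] at this
      norm_num at this
    set Q := ∏ ρ ∈ zeroFinset (t₀ - 1) (t₀ + 1), (1/2 + t * I - ρ) ^ zetaMult ρ with hQ
    have hQ0 : Q ≠ 0 := by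
      refine Finset.prod_ne_zero_iff.2 fun ρ hρ => pow_ne_zero _ fun h => hgood ρ hρ t ht htne ?_
      rw [← sub_eq_zero.1 h]; simp
    rw [e1, map_mul, conj_prod_zeros, ← hQ, ← Complex.exp_conj, ← hε] at e2
    set x := G (1/2 + t * I) with hx
    have e3 : Complex.exp x = chi (1/2 + t * I) * ε * Complex.exp (conj x) := by
      apply mul_left_cancel₀ hQ0
      linear_combination e2
    have e4 : Complex.exp (2 * I * (x.im : ℂ)) = ε * chi (1/2 + t * I) := by
      have : (2 * I * (x.im : ℂ)) = x - conj x := by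
        rw [Complex.sub_conj]; push_cast; ring
      rw [this, Complex.exp_sub, e3]
      field_simp
    have e5 := chi_half_mul_exp t
    simp only [hE, hV]
    rw [Complex.ofReal_add, mul_add, Complex.exp_add, e4, ← e5]
    ring
  have hat : E t₀ = ε * chi (1/2 + I) := by
    have h1 : Tendsto E (nhdsWithin t₀ {t₀}ᶜ) (nhds (E t₀)) :=
      (hEc t₀ (by simpa using hδ0)).tendsto.mono_left nhdsWithin_le_nhds
    refine tendsto_nhds_unique h1 (tendsto_const_nhds.congr' ?_)
    have h2 : ∀ᶠ t in nhds t₀, |t - t₀| < δ := Metric.ball_mem_nhds t₀ hδ0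
    filter_upwards [h2.filter_mono nhdsWithin_le_nhds, self_mem_nhdsWithin] with t a b
    exact (hpunct t a b).symm
  have hall : ∀ t : ℝ, |t - t₀| < δ → E t = ε * chi (1/2 + I) := by
    intro t ht
    by_cases h : t = t₀
    · rw [h, hat]
    · exact hpunct t ht h
  have hpre : IsPreconnected (Metric.ball t₀ δ) := (convex_ball t₀ δ).isPreconnected
  have hfin := sub_eq_sub_of_exp_eq hpre (u := fun t => 2 * I * (V t : ℂ))
    (v := fun _ => 2 * I * (V t₀ : ℂ)) (fun t ht => (continuousAt_const.mul
      (Complex.continuous_ofReal.continuousAt.comp (hVc t ht))).continuousWithinAt) continuousOn_const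
    (fun t ht => (hall t ht).trans hat.symm) (x := t) (y := t₀) ht (Metric.mem_ball_self hδ0)
  have h2I : (2 * I : ℂ) ≠ 0 := by simp
  have h3 : (V t : ℂ) = V t₀ := by
    apply mul_left_cancel₀ h2I
    linear_combination hfin
  exact_mod_cast h3

/-- A punctured neighbourhood of `t₀` free of ordinates of zeros. -/
lemma exists_punctured_interval (t₀ : ℝ) : ∃ δ, 0 < δ ∧ δ ≤ 1/4 ∧
    ∀ ρ ∈ zeroFinset (t₀ - 1) (t₀ + 1), ∀ t, |t - t₀| < δ → t ≠ t₀ → ρ.im ≠ t := by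
  have h : ∀ᶠ t in nhds t₀, ∀ ρ ∈ zeroFinset (t₀ - 1) (t₀ + 1), t ≠ t₀ → ρ.im ≠ t := by
    rw [eventually_all_finset]
    intro ρ _
    by_cases hρ : ρ.im = t₀
    · filter_upwards with t ht
      rw [hρ]; exact ht.symm
    · filter_upwards [isOpen_ne.mem_nhds (Ne.symm hρ)] with t ht _
      exact ht.symm
  obtain ⟨δ, hδ, hb⟩ := Metric.eventually_nhds_iff.1 h
  exact ⟨min δ (1/4), lt_min hδ (by norm_num), min_le_right _ _,
    fun ρ hρ t ht => hb (lt_of_lt_of_le ht (min_le_left _ _)) ρ hρ⟩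

/-- The principal logarithms of the linear factors add up to a logarithm of their product. -/
lemma exp_sum_mul_log {P : Finset ℂ} (m : ℂ → ℕ) {s : ℂ} (hs : ∀ ρ ∈ P, s ≠ ρ) :
    Complex.exp (∑ ρ ∈ P, (m ρ : ℂ) * Complex.log (s - ρ)) = ∏ ρ ∈ P, (s - ρ) ^ m ρ := by
  rw [Complex.exp_sum]
  refine Finset.prod_congr rfl fun ρ hρ => ?_
  rw [Complex.exp_nat_mul, Complex.exp_log (sub_ne_zero.2 (hs ρ hρ))]

/-- Local form of the Riemann–von Mangoldt formula, off the ordinates of zeros. -/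
lemma exists_pi_mul_S_sub_zeroCount_eq {S : ℝ → ℝ} (hS : IsS S) {t₀ δ : ℝ} (ht₀ : 1 ≤ t₀) (hδ0 : 0 < δ)
    (hδ : δ ≤ 1/4)
    (hgood : ∀ ρ ∈ zeroFinset (t₀ - 1) (t₀ + 1), ∀ t, |t - t₀| < δ → t ≠ t₀ → ρ.im ≠ t) :
    ∃ c : ℝ, ∀ t, |t - t₀| < δ → t ≠ t₀ →
      π * (S t - zeroCount t) + ∫ u in (1:ℝ)..t, thetaDeriv u = c := by
  obtain ⟨G, hG, hζ⟩ := exists_local_log ht₀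
  set P := zeroFinset (t₀ - 1) (t₀ + 1) with hP
  have hPre : ∀ ρ ∈ P, ρ.re < 1 := fun ρ hρ => (mem_zeroFinset.1 hρ).1.2.2
  set Λ : ℂ → ℂ := fun s => ∑ ρ ∈ P, (zetaMult ρ : ℂ) * Complex.log (s - ρ) with hΛ
  have hGc : ∀ (σ t : ℝ), σ ∈ Icc (1/2 : ℝ) 2 → |t - t₀| < δ → ContinuousAt G (σ + t * I) :=
    fun σ t hσ ht => (hG.differentiableAt (Metric.isOpen_ball.mem_nhds
      (mem_ball_of_near hσ (ht.trans_le hδ)))).continuousAt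
  have hΛc : ∀ s : ℂ, (∀ ρ ∈ P, s - ρ ∈ Complex.slitPlane) → ContinuousAt Λ s := by
    intro s hs
    exact tendsto_finsetSum _ fun ρ hρ =>
      ((continuousAt_id.sub_const ρ).clog (hs ρ hρ)).const_mul _
  set κ : ℝ → ℂ := fun t => Complex.log (riemannZeta (2 + t * I)) - (Λ (2 + t * I) + G (2 + t * I))
    with hκ
  have h2re : ∀ t : ℝ, (2 + t * I : ℂ).re = 2 := fun t => by simp
  have hconst : ∀ t, |t - t₀| < δ → κ t = κ t₀ := by
    intro t ht
    have hslit : ∀ t : ℝ, ∀ ρ ∈ P, (2 + t * I : ℂ) - ρ ∈ Complex.slitPlane := by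
      intro t ρ hρ
      left
      rw [Complex.sub_re, h2re]
      linarith [hPre ρ hρ]
    refine sub_eq_sub_of_exp_eq (s := Metric.ball t₀ δ) (convex_ball t₀ δ).isPreconnected
      (u := fun t : ℝ => Complex.log (riemannZeta (2 + t * I)))
      (v := fun t : ℝ => Λ (2 + t * I) + G (2 + t * I)) ?_ ?_ ?_ ht (Metric.mem_ball_self hδ0)
    · intro u _
      refine ContinuousAt.continuousWithinAt ?_
      have hne : (2 + u * I : ℂ) ≠ 1 := fun h => by
        have := congrArg Complex.re h
        rw [h2re] at this
        norm_num at this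
      exact ContinuousAt.clog ((differentiableAt_riemannZeta hne).continuousAt.comp
        (f := fun u : ℝ => (2 + u * I : ℂ)) (by fun_prop)) (zeta_mem_slitPlane (h2re u))
    · intro u hu
      refine ContinuousAt.continuousWithinAt ?_
      have h1 : ContinuousAt (fun t : ℝ => (2 + t * I : ℂ)) u := by fun_prop
      have h2 := hGc 2 u ⟨by norm_num, le_rfl⟩ hu
      rw [Complex.ofReal_ofNat] at h2
      exact ContinuousAt.comp (f := fun t : ℝ => (2 + t * I : ℂ)) (g := fun s => Λ s + G s)
        ((hΛc _ (hslit u)).add h2) h1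
    · intro u hu
      have h1 : (2 + u * I : ℂ) ∈ Metric.ball (5/4 + t₀ * I : ℂ) 1 := by
        have := mem_ball_of_near (t₀ := t₀) (σ := 2) ⟨by norm_num, le_rfl⟩
          (lt_of_lt_of_le (Metric.mem_ball.1 hu) hδ)
        rwa [Complex.ofReal_ofNat] at this
      rw [Complex.exp_log (Complex.slitPlane_ne_zero (zeta_mem_slitPlane (h2re u))),
        Complex.exp_add, exp_sum_mul_log, hζ _ h1]
      exact fun ρ hρ => sub_ne_zero.1 (Complex.slitPlane_ne_zero (hslit u ρ hρ))
  refine ⟨(κ t₀).im - π / 2 * ∑ ρ ∈ P, (zetaMult ρ : ℝ) - π * zeroCount (t₀ - 1) +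
    ((G (1/2 + t₀ * I)).im + ∫ u in (1:ℝ)..t₀, thetaDeriv u), fun t ht htne => ?_⟩
  have hne : ∀ ρ ∈ P, ρ.im ≠ t := fun ρ hρ => hgood ρ hρ t ht htne
  have hslit : ∀ (σ : ℝ), ∀ ρ ∈ P, (σ + t * I : ℂ) - ρ ∈ Complex.slitPlane := by
    intro σ ρ hρ
    right
    simpa [sub_eq_zero] using (hne ρ hρ).symm
  have hS1 := pi_mul_S_eq hS (T := t) (by rw [abs_lt] at ht; linarith)
    (L := fun σ => Λ (σ + t * I) + G (σ + t * I)) (by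
      intro σ hσ
      refine ContinuousAt.continuousWithinAt ?_
      have h1 : ContinuousAt (fun σ : ℝ => (σ + t * I : ℂ)) σ := by fun_prop
      exact ContinuousAt.comp (f := fun σ : ℝ => (σ + t * I : ℂ)) (g := fun s => Λ s + G s)
        ((hΛc _ (hslit σ)).add (hGc σ t hσ ht)) h1) (by
      intro σ hσ
      rw [Complex.exp_add, exp_sum_mul_log, hζ _ (mem_ball_of_near hσ (ht.trans_le hδ))]
      exact fun ρ hρ => sub_ne_zero.1 (Complex.slitPlane_ne_zero (hslit σ ρ hρ)))
  have hΛim : (Λ (1/2 + t * I)).im =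
      π * ∑ ρ ∈ zeroFinset (t₀ - 1) t, (zetaMult ρ : ℝ) - π / 2 * ∑ ρ ∈ P, (zetaMult ρ : ℝ) := by
    rw [← sum_zeros_mul_arg (by rw [abs_lt] at ht; linarith) hne, hΛ, Complex.im_sum]
    refine Finset.sum_congr rfl fun ρ _ => ?_
    rw [← Complex.ofReal_natCast, Complex.im_ofReal_mul, Complex.log_im]
  have hN : zeroCount t = zeroCount (t₀ - 1) + ∑ ρ ∈ zeroFinset (t₀ - 1) t, (zetaMult ρ : ℝ) :=
    sum_zeroFinset_add (by linarith) (by rw [abs_lt] at ht; linarith) _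
  have hV := im_add_theta_eq hδ0 hδ hgood hG hζ ht
  have hκt := congrArg Complex.im (hconst t ht)
  rw [← hV, ← hκt, mul_sub, hS1, hN]
  have e1 : (((1/2 : ℝ) : ℂ) + t * I) = 1/2 + t * I := by push_cast; rfl
  have e2 : (((2 : ℝ) : ℂ) + t * I) = 2 + t * I := by push_cast; rfl
  simp only [hκ, e1, e2, Complex.sub_im, Complex.add_im, hΛim]
  ring

/-- The Riemann–von Mangoldt formula `N(t) = θ(t)/π + S(t) + const`. -/
theorem pi_mul_S_sub_zeroCount_add {S : ℝ → ℝ} (hS : IsS S) {T : ℝ} (hT : 1 ≤ T) :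
    π * (S T - zeroCount T) + ∫ u in (1:ℝ)..T, thetaDeriv u = π * (S 1 - zeroCount 1) := by
  set E : ℝ → ℝ := fun t => π * (S t - zeroCount t) + ∫ u in (1:ℝ)..t, thetaDeriv u with hE
  have hloc : ∀ t₀, 1 ≤ t₀ → ∀ᶠ t in nhds t₀, E t = E t₀ := by
    intro t₀ ht₀
    obtain ⟨δ, hδ0, hδ, hgood⟩ := exists_punctured_interval t₀
    obtain ⟨c, hc⟩ := exists_pi_mul_S_sub_zeroCount_eq hS ht₀ hδ0 hδ hgood
    have hnear : ∀ᶠ t in nhds t₀, |t - t₀| < δ := Metric.ball_mem_nhds t₀ hδ0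
    have hat : E t₀ = c := by
      have h1 : Tendsto E (nhdsWithin t₀ (Ioi t₀)) (nhds (E t₀)) := by
        refine (Tendsto.const_mul _ ((hS.2 t₀ (by linarith)).sub ?_)).add
          (continuous_integral_thetaDeriv.tendsto t₀ |>.mono_left nhdsWithin_le_nhds)
        refine tendsto_const_nhds.congr' ?_
        filter_upwards [hnear.filter_mono nhdsWithin_le_nhds, self_mem_nhdsWithin] with t ht htgt
        have htgt : t₀ < t := htgt
        rw [zeroCount, zeroCount]
        congr 1
        ext ρ
        rw [mem_zeroFinset, mem_zeroFinset]
        refine and_congr_right fun hρ => and_congr_right fun hρ0 => ⟨fun h => h.trans htgt.le, fun h => ?_⟩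
        by_contra hlt
        push Not at hlt
        rw [abs_lt] at ht
        exact hgood ρ (mem_zeroFinset.2 ⟨hρ, by linarith, by linarith⟩) ρ.im
          (by rw [abs_lt]; constructor <;> linarith) hlt.ne' rfl
      refine tendsto_nhds_unique h1 (tendsto_const_nhds.congr' ?_)
      filter_upwards [hnear.filter_mono nhdsWithin_le_nhds, self_mem_nhdsWithin] with t ht htgt
      exact (hc t ht (ne_of_gt htgt)).symm
    filter_upwards [hnear] with t ht
    by_cases h : t = t₀
    · rw [h]
    · rw [hat]; exact hc t ht h
  have hder : ∀ t₀, 1 ≤ t₀ → HasDerivAt E 0 t₀ := fun t₀ ht₀ =>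
    (hasDerivAt_const t₀ (E t₀)).congr_of_eventuallyEq (hloc t₀ ht₀)
  have := constant_of_has_deriv_right_zero (f := E) (a := 1) (b := T)
    (fun t ht => (hder t ht.1).continuousAt.continuousWithinAt)
    (fun t ht => (hder t ht.1).hasDerivWithinAt) T ⟨hT, le_rfl⟩
  simpa [hE] using this

lemma zeroCount_sub_eq {t T : ℝ} (ht : 1 ≤ t) (htT : t ≤ T) : zeroCount t - zeroCount 1 =
    ∑ ρ ∈ zeroFinset 1 T, (Ici ρ.im).indicator (fun _ => (zetaMult ρ : ℝ)) t := by
  have h1 : zeroCount t = zeroCount 1 + ∑ ρ ∈ zeroFinset 1 t, (zetaMult ρ : ℝ) :=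
    sum_zeroFinset_add zero_le_one ht _
  have h2 : zeroFinset 1 t = (zeroFinset 1 T).filter fun ρ => ρ.im ≤ t := by
    ext ρ
    rw [Finset.mem_filter, mem_zeroFinset, mem_zeroFinset]
    constructor
    · rintro ⟨h, h', h''⟩; exact ⟨⟨h, h', h''.trans htT⟩, h''⟩
    · rintro ⟨⟨h, h', -⟩, h''⟩; exact ⟨h, h', h''⟩
  rw [h1, add_sub_cancel_left, h2, Finset.sum_filter]
  rfl

/-- Abel summation over the zeros. -/
lemma sum_zeros_eq_sub_integral {f f' : ℝ → ℝ} (hf : ∀ t, HasDerivAt f (f' t) t) (hf' : Continuous f')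
    {T : ℝ} (hT : 1 ≤ T) :
    IntervalIntegrable (fun t => (zeroCount t - zeroCount 1) * f' t) volume 1 T ∧
    ∑ ρ ∈ zeroFinset 1 T, (zetaMult ρ : ℝ) * f ρ.im =
      f T * (zeroCount T - zeroCount 1) - ∫ t in (1:ℝ)..T, (zeroCount t - zeroCount 1) * f' t := by
  have hcongr : ∀ t ∈ Ioc 1 T, (∑ ρ ∈ zeroFinset 1 T,
      (Ici ρ.im).indicator (fun t => (zetaMult ρ : ℝ) * f' t) t) = (zeroCount t - zeroCount 1) * f' t := by
    intro t ht
    rw [zeroCount_sub_eq ht.1.le ht.2, Finset.sum_mul]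
    refine Finset.sum_congr rfl fun ρ _ => ?_
    by_cases h : t ∈ Ici ρ.im
    · rw [indicator_of_mem h, indicator_of_mem h]
    · rw [indicator_of_notMem h, indicator_of_notMem h, zero_mul]
  have hintegral : ∀ ρ ∈ zeroFinset 1 T,
      IntegrableOn ((Ici ρ.im).indicator (fun t => (zetaMult ρ : ℝ) * f' t)) (Ioc 1 T) := fun ρ _ =>
    Integrable.indicator (((hf'.const_mul _).integrableOn_Icc).mono_set Ioc_subset_Icc_self)
      measurableSet_Ici
  refine ⟨?_, ?_⟩
  · rw [intervalIntegrable_iff_integrableOn_Ioc_of_le hT]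
    exact IntegrableOn.congr_fun (integrable_finsetSum _ hintegral) hcongr measurableSet_Ioc
  · have h1 : ∫ t in (1:ℝ)..T, (zeroCount t - zeroCount 1) * f' t =
        ∑ ρ ∈ zeroFinset 1 T, (zetaMult ρ : ℝ) * (f T - f ρ.im) := by
      rw [intervalIntegral.integral_of_le hT, ← setIntegral_congr_fun measurableSet_Ioc hcongr,
        integral_finsetSum _ hintegral]
      refine Finset.sum_congr rfl fun ρ hρ => ?_
      obtain ⟨-, h1, h2⟩ := mem_zeroFinset.1 hρ
      have h3 : Ioc 1 T ∩ Ici ρ.im = Icc ρ.im T := by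
        ext t
        simp only [mem_inter_iff, mem_Ioc, mem_Ici, mem_Icc]
        constructor
        · rintro ⟨⟨-, a⟩, b⟩; exact ⟨b, a⟩
        · rintro ⟨a, b⟩; exact ⟨⟨by linarith, b⟩, a⟩
      rw [setIntegral_indicator measurableSet_Ici, h3, integral_Icc_eq_integral_Ioc,
        integral_const_mul, ← intervalIntegral.integral_of_le h2,
        intervalIntegral.integral_eq_sub_of_hasDerivAt (fun t _ => hf t) (hf'.intervalIntegrable _ _)]
    have h2 : zeroCount T - zeroCount 1 = ∑ ρ ∈ zeroFinset 1 T, (zetaMult ρ : ℝ) := by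
      rw [zeroCount, sum_zeroFinset_add zero_le_one hT, zeroCount]; ring
    rw [h1, h2, Finset.mul_sum, ← Finset.sum_sub_distrib]
    exact Finset.sum_congr rfl fun ρ _ => by ring

/-- The sum over zeros minus the Stieltjes integral against `S` is an integral against `θ'`. -/
lemma sum_zeros_sub_stieltjes {S : ℝ → ℝ} (hS : IsS S) {f f' : ℝ → ℝ}
    (hf : ∀ t, HasDerivAt f (f' t) t) (hf' : Continuous f') {T : ℝ} (hT : 1 ≤ T) :
    ∑ ρ ∈ zeroFinset 1 T, (zetaMult ρ : ℝ) * f ρ.im -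
      (f T * S T - f 1 * S 1 - ∫ t in (1:ℝ)..T, S t * f' t) =
        1 / π * ∫ t in (1:ℝ)..T, thetaDeriv t * f t := by
  obtain ⟨hi, hsum⟩ := sum_zeros_eq_sub_integral hf hf' hT
  set Θ : ℝ → ℝ := fun t => ∫ u in (1:ℝ)..t, thetaDeriv u with hΘ
  have hSeq : ∀ t, 1 ≤ t → S t = (zeroCount t - zeroCount 1) - 1 / π * Θ t + S 1 := by
    intro t ht
    have h := pi_mul_S_sub_zeroCount_add hS ht
    have hpi := Real.pi_pos
    simp only [hΘ]
    field_simp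
    linear_combination h
  have hΘd : ∀ t, HasDerivAt Θ (thetaDeriv t) t := fun t =>
    intervalIntegral.integral_hasDerivAt_right (continuous_thetaDeriv.intervalIntegrable _ _)
      (continuous_thetaDeriv.stronglyMeasurableAtFilter _ _) continuous_thetaDeriv.continuousAt
  have hΘc : Continuous Θ := continuous_integral_thetaDeriv
  have hparts : ∫ t in (1:ℝ)..T, Θ t * f' t = Θ T * f T - Θ 1 * f 1 - ∫ t in (1:ℝ)..T, thetaDeriv t * f t :=
    intervalIntegral.integral_mul_deriv_eq_deriv_mul (fun t _ => hΘd t) (fun t _ => hf t)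
      (continuous_thetaDeriv.intervalIntegrable _ _) (hf'.intervalIntegrable _ _)
  have hSint : ∫ t in (1:ℝ)..T, S t * f' t = (∫ t in (1:ℝ)..T, (zeroCount t - zeroCount 1) * f' t) -
      1 / π * (∫ t in (1:ℝ)..T, Θ t * f' t) + S 1 * (f T - f 1) := by
    have hi₂ : IntervalIntegrable (fun t => 1 / π * (Θ t * f' t)) volume 1 T :=
      (continuous_const.mul (hΘc.mul hf')).intervalIntegrable _ _
    have hi₃ : IntervalIntegrable (fun t => S 1 * f' t) volume 1 T :=
      (continuous_const.mul hf').intervalIntegrable _ _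
    rw [← intervalIntegral.integral_eq_sub_of_hasDerivAt (fun t _ => hf t) (hf'.intervalIntegrable 1 T),
      ← intervalIntegral.integral_const_mul, ← intervalIntegral.integral_const_mul,
      ← intervalIntegral.integral_sub hi hi₂, ← intervalIntegral.integral_add (hi.sub hi₂) hi₃]
    refine intervalIntegral.integral_congr fun t ht => ?_
    rw [uIcc_of_le hT] at ht
    rw [hSeq t ht.1]
    ring
  have hΘ1 : Θ 1 = 0 := by simp [hΘ]
  rw [hsum, hSint, hparts, hSeq T hT, hΘ1]
  ring

/-- The square of the modulus of zeta on the critical line is continuously differentiable. -/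
lemma exists_hasDerivAt_normSq_zeta_half :
    ∃ f' : ℝ → ℝ, Continuous f' ∧
      ∀ t : ℝ, HasDerivAt (fun t : ℝ => ‖riemannZeta (1/2 + t * I)‖ ^ 2) (f' t) t := by
  have hne (t : ℝ) : (1/2 + t * I : ℂ) ≠ 1 := fun h => by
    have := congrArg Complex.re h
    norm_num at this
  have hline : Continuous fun t : ℝ => (1/2 + t * I : ℂ) := by fun_prop
  have hd (t : ℝ) : HasDerivAt (fun t : ℝ => riemannZeta (1/2 + t * I))
      (deriv riemannZeta (1/2 + t * I) * I) t := by
    have h1 : HasDerivAt riemannZeta (deriv riemannZeta (1/2 + t * I)) (1/2 + t * I) :=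
      (differentiableAt_riemannZeta (hne t)).hasDerivAt
    exact h1.comp t (hasDerivAt_half_line t)
  have hc0 : Continuous fun t : ℝ => riemannZeta (1/2 + t * I) :=
    continuous_iff_continuousAt.2 fun t => (hd t).continuousAt
  have hc1 : Continuous fun t : ℝ => deriv riemannZeta (1/2 + t * I) :=
    continuous_iff_continuousAt.2 fun t =>
      ContinuousAt.comp (f := fun t : ℝ => (1/2 + t * I : ℂ))
        (analyticOnNhd_zeta _ (hne t)).deriv.continuousAt hline.continuousAt
  refine ⟨fun t => 2 * inner ℝ (riemannZeta (1/2 + t * I)) (deriv riemannZeta (1/2 + t * I) * I),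
    ?_, fun t => (hd t).norm_sq⟩
  exact continuous_const.mul (hc0.inner (hc1.mul continuous_const))

lemma abs_integral_log_mul_sub_le {f : ℝ → ℝ} (hf : Continuous f) {C : ℝ}
    (hF : ∀ T : ℝ, 1 ≤ T → |(∫ t in (1:ℝ)..T, f t) - T * Real.log T| ≤ C * T) {T : ℝ} (hT : 1 ≤ T) :
    |(∫ t in (1:ℝ)..T, Real.log t * f t) - T * Real.log T ^ 2| ≤
      (C + 1) * (T * Real.log T) + C * T := by
  set F : ℝ → ℝ := fun t => ∫ u in (1:ℝ)..t, f u with hFdef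
  have hFd (t : ℝ) : HasDerivAt F (f t) t :=
    intervalIntegral.integral_hasDerivAt_right (hf.intervalIntegrable _ _)
      (hf.stronglyMeasurableAtFilter _ _) hf.continuousAt
  have hC : 0 ≤ C := by
    have := (abs_nonneg _).trans (hF 1 le_rfl)
    linarith
  have hmem : ∀ t ∈ uIcc 1 T, t ≠ 0 := by
    intro t ht
    rw [uIcc_of_le hT] at ht
    linarith [ht.1]
  have hparts : ∫ t in (1:ℝ)..T, Real.log t * f t =
      Real.log T * F T - Real.log 1 * F 1 - ∫ t in (1:ℝ)..T, t⁻¹ * F t :=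
    intervalIntegral.integral_mul_deriv_eq_deriv_mul
      (fun t ht => Real.hasDerivAt_log (hmem t ht)) (fun t _ => hFd t)
      (ContinuousOn.intervalIntegrable (continuousOn_inv₀.mono hmem)) (hf.intervalIntegrable _ _)
  have hbound : |∫ t in (1:ℝ)..T, t⁻¹ * F t| ≤ (Real.log T + C) * |T - 1| := by
    rw [← Real.norm_eq_abs]
    refine intervalIntegral.norm_integral_le_of_norm_le_const fun t ht => ?_
    rw [uIoc_of_le hT] at ht
    have ht0 : 0 < t := by linarith [ht.1]
    have h1 := abs_le.1 (hF t ht.1.le)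
    have h2 : Real.log t ≤ Real.log T := Real.log_le_log ht0 ht.2
    have h3 : 0 ≤ Real.log t := Real.log_nonneg ht.1.le
    rw [Real.norm_eq_abs, abs_mul, abs_inv, abs_of_pos ht0, inv_mul_le_iff₀ ht0, abs_le]
    change -_ ≤ ∫ u in (1:ℝ)..t, f u ∧ ∫ u in (1:ℝ)..t, f u ≤ _
    constructor <;> nlinarith
  rw [abs_of_nonneg (sub_nonneg.2 hT)] at hbound
  have hlog : 0 ≤ Real.log T := Real.log_nonneg hT
  have h1 : |Real.log T * (F T - T * Real.log T)| ≤ Real.log T * (C * T) := by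
    rw [abs_mul, abs_of_nonneg hlog]
    exact mul_le_mul_of_nonneg_left (hF T hT) hlog
  rw [hparts, Real.log_one, abs_le]
  rw [abs_le] at h1 hbound
  constructor <;> nlinarith

lemma abs_thetaDeriv_sub_le {C t : ℝ}
    (h : ‖deriv chi (1/2 + t * I) / chi (1/2 + t * I) + Real.log t‖ ≤ C) :
    |thetaDeriv t - 1/2 * Real.log t| ≤ C / 2 := by
  have h1 := (Complex.abs_re_le_norm _).trans h
  rw [Complex.add_re, Complex.ofReal_re] at h1
  rw [thetaDeriv]
  rw [abs_le] at h1 ⊢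
  constructor <;> linarith

/-- The mean square of zeta on the critical line with respect to the measure `θ'(t) dt`. -/
lemma exists_integral_thetaDeriv_mul_normSq_zeta_sub_le :
    ∃ K : ℝ, ∀ T : ℝ, 3 ≤ T →
      |1 / π * (∫ t in (1:ℝ)..T, thetaDeriv t * ‖riemannZeta (1/2 + t * I)‖ ^ 2) -
        T / (2 * π) * Real.log T ^ 2| ≤ K * T * Real.log T := by
  obtain ⟨C, hC, hF⟩ := exists_integral_normSq_zeta_sub_le
  obtain ⟨D, hD, hchi⟩ := exists_norm_logDeriv_chi_add_log_le
  refine ⟨(2 * C + 1) / 2 + D / 2 * (1 + C), fun T hT => ?_⟩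
  have hT1 : (1:ℝ) ≤ T := by linarith
  have hlog : 1 ≤ Real.log T := by
    rw [Real.le_log_iff_exp_le (by linarith)]
    linarith [Real.exp_one_lt_d9]
  obtain ⟨f', -, hf'⟩ := exists_hasDerivAt_normSq_zeta_half
  set f : ℝ → ℝ := fun t => ‖riemannZeta (1/2 + t * I)‖ ^ 2 with hfdef
  have hf : Continuous f := continuous_iff_continuousAt.2 fun t => (hf' t).continuousAt
  have hlogc : ContinuousOn Real.log (uIcc 1 T) := by
    refine Real.continuousOn_log.mono fun t ht => ?_
    rw [uIcc_of_le hT1] at ht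
    exact (by linarith [ht.1] : t ≠ 0)
  have hmain := abs_integral_log_mul_sub_le hf hF hT1
  have herr : |(∫ t in (1:ℝ)..T, thetaDeriv t * f t) -
      1/2 * ∫ t in (1:ℝ)..T, Real.log t * f t| ≤ D / 2 * ∫ t in (1:ℝ)..T, f t := by
    have hi₁ : IntervalIntegrable (fun t => thetaDeriv t * f t) volume 1 T :=
      (continuous_thetaDeriv.mul hf).intervalIntegrable _ _
    have hi₂ : IntervalIntegrable (fun t => 1/2 * (Real.log t * f t)) volume 1 T :=
      ContinuousOn.intervalIntegrable (continuousOn_const.mul (hlogc.mul hf.continuousOn))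
    rw [← intervalIntegral.integral_const_mul, ← intervalIntegral.integral_const_mul,
      ← intervalIntegral.integral_sub hi₁ hi₂, ← Real.norm_eq_abs]
    refine intervalIntegral.norm_integral_le_of_norm_le hT1 (ae_of_all _ fun t ht => ?_)
      ((continuous_const.mul hf).intervalIntegrable _ _)
    have h1 := abs_thetaDeriv_sub_le (hchi t ht.1.le)
    have h2 : 0 ≤ f t := sq_nonneg _
    rw [show thetaDeriv t * f t - 1/2 * (Real.log t * f t) =
      (thetaDeriv t - 1/2 * Real.log t) * f t by ring, norm_mul, Real.norm_of_nonneg h2]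
    exact mul_le_mul_of_nonneg_right h1 h2
  have hpi : 1 / π ≤ 1 := by
    rw [div_le_one Real.pi_pos]
    linarith [Real.pi_gt_three]
  have hpi0 : 0 ≤ 1 / π := by positivity
  have hrw : 1 / π * (∫ t in (1:ℝ)..T, thetaDeriv t * f t) - T / (2 * π) * Real.log T ^ 2 =
      1 / π * ((∫ t in (1:ℝ)..T, thetaDeriv t * f t) - 1/2 * (T * Real.log T ^ 2)) := by
    field_simp
  rw [hrw, abs_mul, abs_of_nonneg hpi0]
  refine (mul_le_of_le_one_left (abs_nonneg _) hpi).trans ?_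
  have hFT := (abs_le.1 (hF T hT1)).2
  have hFT' : ∫ t in (1:ℝ)..T, f t ≤ T * Real.log T + C * T := by linarith
  have h4 : T ≤ T * Real.log T := le_mul_of_one_le_right (by linarith) hlog
  have h5 : C * T ≤ C * (T * Real.log T) := mul_le_mul_of_nonneg_left h4 hC.le
  have h6 : D / 2 * ∫ t in (1:ℝ)..T, f t ≤ D / 2 * ((1 + C) * (T * Real.log T)) :=
    mul_le_mul_of_nonneg_left (by linarith) (by positivity)
  rw [abs_le] at hmain herr ⊢
  constructor <;> linarith [hmain.1, hmain.2, herr.1, herr.2]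

/-- The sum of `|ζ(1/2 + iγ)|²` over zeros up to `T` is `(T / 2π) log² T`, up to the Stieltjes
integral of `|ζ|²` against `S` and an error `O(T log T)`. -/
lemma exists_tsum_zeros_sub_le {S : ℝ → ℝ} (hS : IsS S) {Z : ℝ → ℝ} (hZd : Differentiable ℝ Z)
    (hZsq : ∀ t : ℝ, ((Z t : ℂ)) ^ 2 * chi (1/2 + t * I) = (riemannZeta (1/2 + t * I)) ^ 2) :
    ∃ K : ℝ, ∀ T : ℝ, 3 ≤ T →
        |(∑' ρ : {ρ : ℂ // IsNontrivialZero ρ ∧ 0 < ρ.im ∧ ρ.im ≤ T},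
              (zetaMult ρ.1 : ℝ) * ‖riemannZeta (1/2 + ρ.1.im * I)‖ ^ 2)
            - T / (2 * π) * (Real.log T) ^ 2
            - (‖riemannZeta (1/2 + T * I)‖ ^ 2 * S T - ‖riemannZeta (1/2 + I)‖ ^ 2 * S 1
                - 2 * ∫ t in (1:ℝ)..T, S t * Z t * deriv Z t)| ≤ K * T * Real.log T := by
  obtain ⟨K, hK⟩ := exists_integral_thetaDeriv_mul_normSq_zeta_sub_le
  obtain ⟨f', hf'c, hf'⟩ := exists_hasDerivAt_normSq_zeta_half
  have hZ : (fun t : ℝ => ‖riemannZeta (1/2 + t * I)‖ ^ 2) = fun t => Z t ^ 2 := by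
    funext t
    rw [← norm_pow, ← hZsq t, norm_mul, norm_chi_half, mul_one, norm_pow, Complex.norm_real,
      Real.norm_eq_abs, sq_abs]
  have hf'Z (t : ℝ) : f' t = 2 * (Z t * deriv Z t) := by
    have h1 := hf' t
    rw [hZ] at h1
    refine h1.unique (((hZd t).hasDerivAt.fun_pow 2).congr_deriv ?_)
    ring
  set w : ℂ → ℝ := fun ρ => (zetaMult ρ : ℝ) * ‖riemannZeta (1/2 + ρ.im * I)‖ ^ 2 with hw
  set A : ℝ := ∑ ρ ∈ zeroFinset 0 1, w ρ with hA
  refine ⟨K + |A|, fun T hT => ?_⟩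
  have hT1 : (1:ℝ) ≤ T := by linarith
  have hlog : 1 ≤ Real.log T := by
    rw [Real.le_log_iff_exp_le (by linarith)]
    linarith [Real.exp_one_lt_d9]
  have hst := sum_zeros_sub_stieltjes hS hf' hf'c hT1
  have hintegral : ∫ t in (1:ℝ)..T, S t * f' t = 2 * ∫ t in (1:ℝ)..T, S t * Z t * deriv Z t := by
    rw [← intervalIntegral.integral_const_mul]
    refine intervalIntegral.integral_congr fun t _ => ?_
    simp only [hf'Z]
    ring
  rw [hintegral] at hst
  simp only [Complex.ofReal_one, one_mul] at hst
  have hsplit := tsum_zeros_eq T w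
  rw [sum_zeroFinset_add zero_le_one hT1] at hsplit
  rw [show (∑' ρ : {ρ : ℂ // IsNontrivialZero ρ ∧ 0 < ρ.im ∧ ρ.im ≤ T},
    (zetaMult ρ.1 : ℝ) * ‖riemannZeta (1/2 + ρ.1.im * I)‖ ^ 2) = A + ∑ ρ ∈ zeroFinset 1 T, w ρ
    from hsplit]
  have hTl : 1 ≤ T * Real.log T := by nlinarith
  have hAl : |A| ≤ |A| * (T * Real.log T) := le_mul_of_one_le_right (abs_nonneg _) hTl
  have hKT := hK T hT
  rw [← hst] at hKT
  calc _ = |A + (∑ ρ ∈ zeroFinset 1 T, w ρ - (‖riemannZeta (1/2 + T * I)‖ ^ 2 * S T -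
          ‖riemannZeta (1/2 + I)‖ ^ 2 * S 1 - 2 * ∫ t in (1:ℝ)..T, S t * Z t * deriv Z t) -
          T / (2 * π) * Real.log T ^ 2)| := by congr 1; ring
    _ ≤ |A| + K * T * Real.log T := (abs_add_le _ _).trans (by gcongr)
    _ ≤ (K + |A|) * T * Real.log T := by linarith

theorem statement18 (S : ℝ → ℝ) (hS : IsS S)
    (Z : ℝ → ℝ) (hZd : Differentiable ℝ Z)
    (hZsq : ∀ t : ℝ, ((Z t : ℂ)) ^ 2 * chi (1/2 + t * I) = (riemannZeta (1/2 + t * I)) ^ 2)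
    : (∃ K : ℝ, ∀ T : ℝ, 3 ≤ T →
        |(∑' ρ : {ρ : ℂ // IsNontrivialZero ρ ∧ 0 < ρ.im ∧ ρ.im ≤ T},
              (zetaMult ρ.1 : ℝ) * ‖riemannZeta (1/2 + ρ.1.im * I)‖ ^ 2)
            - T / (2 * π) * (Real.log T) ^ 2
            - (‖riemannZeta (1/2 + T * I)‖ ^ 2 * S T - ‖riemannZeta (1/2 + I)‖ ^ 2 * S 1
                - 2 * ∫ t in (1:ℝ)..T, S t * Z t * deriv Z t)| ≤ K * T * Real.log T) ∧
      (∀ ε : ℝ, 0 < ε → ∃ K : ℝ, ∀ T : ℝ, 3 ≤ T →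
        (∑' ρ : {ρ : ℂ // IsNontrivialZero ρ ∧ 0 < ρ.im ∧ ρ.im ≤ T},
            (zetaMult ρ.1 : ℝ) * ‖riemannZeta (1/2 + ρ.1.im * I)‖ ^ 2) ≤
          K * T * (Real.log T) ^ 2 * (Real.log (Real.log T)) ^ (3/2 + ε : ℝ)) :=
  ⟨exists_tsum_zeros_sub_le hS hZd hZsq, fun ε hε => exists_tsum_zeros_le ε hε⟩
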